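/- (Maynard–Tao) For every integer m ≥ 2 there exists an integer k = k(m) such that the following holds: if g_1 x + h_1, …, g_k x + h_k is an admissible k-tuple of linear forms, then for infinitely many positive integers n there are at least m primes among g_1 n + h_1, …, g_k n + h_k. -/

import Mathlib

open scoped Classical

/-- A `k`-tuple of linear forms `gᵢ x + hᵢ` is *admissible* if for every prime `p`,
the number of residue classes `n mod p` for which `∏ᵢ (gᵢ n + hᵢ) ≡ 0 (mod p)`
is strictly less than `p`. -/
def AdmissibleTuple {k : ℕ} (g : Fin k → ℕ) (h : Fin k → ℤ) : Prop :=
  ∀ p : ℕ, p.Prime →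
    ((Finset.range p).filter
      (fun n : ℕ => (∏ i, ((g i : ℤ) * n + h i)) % (p : ℤ) = 0)).card < p

namespace MT
open MeasureTheory Filter Topology
open scoped SchwartzMap FourierTransform ContDiff

lemma fourier_rep (W : ℝ → ℝ) (hW : ContDiff ℝ ∞ W) (hc : HasCompactSupport W) :
    ∃ h : 𝓢(ℝ, ℂ), ∀ u : ℝ, (W u : ℂ) = ∫ t : ℝ, h t * Complex.exp (-(Complex.I * t * u)) := by
  have hpi : (2 * Real.pi) ≠ 0 := by positivity
  let V : ℝ → ℂ := fun x => ((W (2 * Real.pi * x) : ℝ) : ℂ)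
  have hV : ContDiff ℝ ∞ V := Complex.ofRealCLM.contDiff.comp (hW.comp (by fun_prop))
  have hVc : HasCompactSupport V := by
    have h1 : HasCompactSupport (fun x => W (2 * Real.pi * x)) :=
      hc.comp_homeomorph (Homeomorph.mulLeft₀ (2 * Real.pi) hpi)
    exact h1.comp_left (g := fun x : ℝ => (x : ℂ)) (by simp)
  let S : 𝓢(ℝ, ℂ) := hVc.toSchwartzMap hV
  refine ⟨𝓕⁻ S, fun u => ?_⟩
  have h1 : 𝓕 (𝓕⁻ S) = S := FourierTransform.fourier_fourierInv_eq S
  have h2 : (𝓕 (𝓕⁻ S)) (u / (2 * Real.pi)) = S (u / (2 * Real.pi)) := by rw [h1]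
  have h3 : S (u / (2 * Real.pi)) = (W u : ℂ) := by
    change ((W (2 * Real.pi * (u / (2 * Real.pi))) : ℝ) : ℂ) = _
    congr 2; field_simp
  rw [h3] at h2
  rw [← h2]
  rw [SchwartzMap.fourier_coe, Real.fourier_real_eq_integral_exp_smul]
  refine integral_congr_ae (Eventually.of_forall fun t => ?_)
  simp only [smul_eq_mul]
  rw [mul_comm]
  congr 2
  push_cast
  field_simp

lemma schwartz_decay (h : 𝓢(ℝ, ℂ)) (j A : ℕ) :
    ∃ C : ℝ, 0 < C ∧ ∀ t : ℝ, (1 + |t|) ^ A * ‖iteratedDeriv j h t‖ ≤ C := by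
  refine ⟨2 ^ A * ((Finset.Iic (A, j)).sup fun m => SchwartzMap.seminorm ℝ m.1 m.2) h + 1, ?_, ?_⟩
  · positivity
  · intro t
    have := SchwartzMap.one_add_le_sup_seminorm_apply (𝕜 := ℝ) (m := (A, j)) (le_refl A) (le_refl j) h t
    rw [norm_iteratedFDeriv_eq_norm_iteratedDeriv, Real.norm_eq_abs] at this
    linarith

lemma schwartz_integrable_poly (h : 𝓢(ℝ, ℂ)) (A : ℕ) :
    Integrable (fun t : ℝ => (1 + |t|) ^ A * ‖h t‖) := by
  obtain ⟨C, hC, hb⟩ := schwartz_decay h 0 (A + 2)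
  refine ((integrable_inv_one_add_sq).const_mul C).mono' ?_ ?_
  · exact (by fun_prop : Continuous fun t : ℝ => (1 + |t|) ^ A * ‖h t‖).aestronglyMeasurable
  · refine Eventually.of_forall fun t => ?_
    have := hb t
    simp only [iteratedDeriv_zero] at this
    rw [Real.norm_of_nonneg (by positivity), ← div_eq_mul_inv, le_div_iff₀ (by positivity)]
    refine le_trans ?_ this
    have h1 : (1 + t ^ 2) ≤ (1 + |t|) ^ 2 := by
      have := abs_nonneg t
      nlinarith [sq_abs t]
    calc (1 + |t|) ^ A * ‖h t‖ * (1 + t ^ 2) ≤ (1 + |t|) ^ A * ‖h t‖ * (1 + |t|) ^ 2 := by gcongr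
      _ = _ := by ring

/-- integration by parts, tower form -/
lemma ibp_tower (K : ℕ) : ∀ (g : ℕ → ℝ → ℂ) (C : ℝ), 0 ≤ C →
    (∀ j t, HasDerivAt (g j) (g (j + 1) t) t) →
    (∀ j ≤ K, ∀ t, ‖g j t‖ ≤ C / (1 + t ^ 2)) → ∀ x : ℝ, 0 < x →
    ‖∫ t : ℝ, g 0 t * Complex.exp (Complex.I * t * x)‖ ≤ Real.pi * C / x ^ K := by
  have hintg : ∀ (f : ℝ → ℂ) (C : ℝ), Continuous f → (∀ t, ‖f t‖ ≤ C / (1 + t ^ 2)) →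
      Integrable f := by
    intro f C hf hb
    refine ((integrable_inv_one_add_sq).const_mul C).mono' hf.aestronglyMeasurable ?_
    exact Eventually.of_forall fun t => by rw [← div_eq_mul_inv]; exact hb t
  have hexp : ∀ (t x : ℝ), ‖Complex.exp (Complex.I * t * x)‖ = 1 := by
    intro t x
    rw [show Complex.I * (t : ℂ) * x = ((t * x : ℝ) : ℂ) * Complex.I by push_cast; ring]
    exact Complex.norm_exp_ofReal_mul_I _
  induction K with
  | zero =>
    intro g C hC hd hb x hx
    have hb0 := hb 0 le_rfl
    calc ‖∫ t : ℝ, g 0 t * Complex.exp (Complex.I * t * x)‖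
        ≤ ∫ t : ℝ, C * (1 + t ^ 2)⁻¹ := by
          refine norm_integral_le_of_norm_le ((integrable_inv_one_add_sq).const_mul C) ?_
          refine Eventually.of_forall fun t => ?_
          rw [norm_mul, hexp, mul_one, ← div_eq_mul_inv]
          exact hb0 t
      _ = _ := by rw [integral_const_mul, integral_univ_inv_one_add_sq]; ring
  | succ K ih =>
    intro g C hC hd hb x hx
    have hcont : ∀ j, Continuous (g j) := fun j =>
      continuous_iff_continuousAt.2 fun t => (hd j t).continuousAt
    have ih' := ih (fun j => g (j + 1)) C hC (fun j t => hd (j + 1) t)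
      (fun j hj t => hb (j + 1) (by omega) t) x hx
    have hxc : (Complex.I * (x : ℂ)) ≠ 0 := by
      simp [hx.ne']
    let E : ℝ → ℂ := fun t => Complex.exp (Complex.I * t * x) / (Complex.I * x)
    have hE : ∀ t : ℝ, HasDerivAt E (Complex.exp (Complex.I * t * x)) t := by
      intro t
      have h1 : HasDerivAt (fun t : ℝ => Complex.I * (t : ℂ) * x) (Complex.I * x) t := by
        have := (((hasDerivAt_id t).ofReal_comp).const_mul Complex.I).mul_const (x : ℂ)
        simpa using this
      have h2 := (h1.cexp).div_const (Complex.I * x)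
      rw [mul_div_assoc, div_self hxc, mul_one] at h2
      exact h2
    have hEn : ∀ t, ‖E t‖ = 1 / x := by
      intro t
      simp only [E, norm_div, hexp, norm_mul, Complex.norm_I, one_mul, Complex.norm_real,
        Real.norm_of_nonneg hx.le]
    have hEc : Continuous E := continuous_iff_continuousAt.2 fun t => (hE t).continuousAt
    have hec : Continuous (fun t : ℝ => Complex.exp (Complex.I * t * x)) := by fun_prop
    have key := integral_mul_deriv_eq_deriv_mul_of_integrable (u := g 0) (v := E) (u' := g 1)
      (v' := fun t : ℝ => Complex.exp (Complex.I * t * x)) (fun t _ => hd 0 t) (fun t _ => hE t)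
      (hintg _ C ((hcont 0).mul hec) (fun t => by
        simp only [Pi.mul_apply, norm_mul, hexp, mul_one]; exact hb 0 (by omega) t))
      (hintg _ (C / x) ((hcont 1).mul hEc) (fun t => by
        simp only [Pi.mul_apply, norm_mul, hEn]
        have := hb 1 (by omega) t
        calc ‖g 1 t‖ * (1 / x) ≤ C / (1 + t ^ 2) * (1 / x) := by gcongr
          _ = _ := by ring))
      (hintg _ (C / x) ((hcont 0).mul hEc) (fun t => by
        simp only [Pi.mul_apply, norm_mul, hEn]
        have := hb 0 (by omega) t
        calc ‖g 0 t‖ * (1 / x) ≤ C / (1 + t ^ 2) * (1 / x) := by gcongr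
          _ = _ := by ring))
    rw [key, norm_neg]
    have : ∫ t : ℝ, g 1 t * E t = (∫ t : ℝ, g 1 t * Complex.exp (Complex.I * t * x)) / (Complex.I * x) := by
      rw [← integral_div]
      refine integral_congr_ae (Eventually.of_forall fun t => ?_)
      simp only [E]; ring
    rw [this, norm_div, norm_mul, Complex.norm_I, one_mul, Complex.norm_real, Real.norm_of_nonneg hx.le]
    rw [pow_succ, ← div_div]
    gcongr

end MT

namespace MT
open Finset

lemma periodic_sum_bound (f : ℕ → ℂ) (q : ℕ) (hq : 0 < q) (hp : Function.Periodic f q)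
    (h0 : ∑ n ∈ range q, f n = 0) (h1 : ∀ n, ‖f n‖ ≤ 1) (a b : ℕ) :
    ‖∑ n ∈ Ico a b, f n‖ ≤ ((2 * q : ℕ) : ℝ) := by
  have hF : Function.Periodic (fun n => ∑ i ∈ range n, f i) q := by
    intro n
    induction n with
    | zero => simpa using h0
    | succ n ih =>
      have ih' : ∑ i ∈ range (n + q), f i = ∑ i ∈ range n, f i := ih
      show ∑ i ∈ range (n + 1 + q), f i = ∑ i ∈ range (n + 1), f i
      rw [show n + 1 + q = (n + q) + 1 by ring, sum_range_succ, ih', sum_range_succ, hp n]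
  have hb : ∀ n, ‖∑ i ∈ range n, f i‖ ≤ q := by
    intro n
    rw [← hF.map_mod_nat n]
    calc _ ≤ ∑ i ∈ range (n % q), ‖f i‖ := norm_sum_le _ _
      _ ≤ ∑ i ∈ range (n % q), 1 := sum_le_sum fun i _ => h1 i
      _ = (n % q : ℕ) := by simp
      _ ≤ q := by exact_mod_cast (Nat.mod_lt _ hq).le
  rcases le_total a b with hab | hab
  · rw [sum_Ico_eq_sub _ hab]
    calc _ ≤ ‖∑ i ∈ range b, f i‖ + ‖∑ i ∈ range a, f i‖ := norm_sub_le _ _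
      _ ≤ q + q := add_le_add (hb _) (hb _)
      _ = _ := by push_cast; ring
  · rw [Ico_eq_empty_of_le hab]; simp

lemma abel_id (f φ : ℕ → ℂ) (a b : ℕ) (hab : a ≤ b) :
    ∑ n ∈ Ico a b, f n * φ n = (∑ n ∈ Ico a b, f n) * φ b
      - ∑ n ∈ Ico a b, (∑ i ∈ Ico a (n+1), f i) * (φ (n+1) - φ n) := by
  induction b, hab using Nat.le_induction with
  | base => simp
  | succ b hab ih =>
    rw [sum_Ico_succ_top hab, ih, sum_Ico_succ_top hab, sum_Ico_succ_top hab, sum_Ico_succ_top hab]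
    ring

lemma abel_bound (f φ : ℕ → ℂ) (B : ℝ) (hB : ∀ a b, ‖∑ n ∈ Ico a b, f n‖ ≤ B) (a b : ℕ)
    (hab : a ≤ b) :
    ‖∑ n ∈ Ico a b, f n * φ n‖ ≤ B * (‖φ b‖ + ∑ n ∈ Ico a b, ‖φ (n+1) - φ n‖) := by
  rw [abel_id f φ a b hab]
  calc _ ≤ ‖(∑ n ∈ Ico a b, f n) * φ b‖
      + ‖∑ n ∈ Ico a b, (∑ i ∈ Ico a (n+1), f i) * (φ (n+1) - φ n)‖ := norm_sub_le _ _
    _ ≤ B * ‖φ b‖ + ∑ n ∈ Ico a b, B * ‖φ (n+1) - φ n‖ := by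
        gcongr
        · rw [norm_mul]; gcongr; exact hB _ _
        · refine (norm_sum_le _ _).trans (sum_le_sum fun n _ => ?_)
          rw [norm_mul]; gcongr; exact hB _ _
    _ = _ := by rw [mul_add, mul_sum]

/-- Abel summation with a differentiable weight whose derivative is dominated. -/
lemma abel_deriv (f : ℕ → ℂ) (φ φ' : ℝ → ℂ) (g g' : ℝ → ℝ) (B : ℝ)
    (hB : ∀ a b, ‖∑ n ∈ Ico a b, f n‖ ≤ B) (a b : ℕ) (hab : a ≤ b)
    (hφ : ∀ x : ℝ, (a : ℝ) ≤ x → HasDerivAt φ (φ' x) x)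
    (hg : ∀ x : ℝ, (a : ℝ) ≤ x → HasDerivAt g (g' x) x)
    (hle : ∀ x : ℝ, (a : ℝ) ≤ x → x ≤ b → ‖φ' x‖ ≤ - g' x) :
    ‖∑ n ∈ Ico a b, f n * φ n‖ ≤ B * (‖φ b‖ + (g a - g b)) := by
  have hB0 : 0 ≤ B := (norm_nonneg _).trans (hB 0 0)
  have key : ∀ n ∈ Ico a b, ‖φ ((n+1 : ℕ) : ℝ) - φ n‖ ≤ g n - g ((n+1 : ℕ) : ℝ) := by
    intro n hn
    rw [mem_Ico] at hn
    have han : (a : ℝ) ≤ n := by exact_mod_cast hn.1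
    have hnb : ((n + 1 : ℕ) : ℝ) ≤ b := by exact_mod_cast hn.2
    have := image_norm_le_of_norm_deriv_right_le_deriv_boundary' (a := (n : ℝ)) (b := ((n + 1 : ℕ) : ℝ))
      (f := fun x => φ x - φ n) (f' := φ') (B := fun x => g n - g x) (B' := fun x => - g' x)
      (fun x hx => ((hφ x (han.trans hx.1)).sub_const _).continuousAt.continuousWithinAt)
      (fun x hx => ((hφ x (han.trans hx.1)).sub_const _).hasDerivWithinAt)
      (by simp) 
      (fun x hx => (((hg x (han.trans hx.1)).const_sub _)).continuousAt.continuousWithinAt)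
      (fun x hx => (((hg x (han.trans hx.1)).const_sub _)).hasDerivWithinAt)
      (fun x hx => hle x (han.trans hx.1) (hx.2.le.trans hnb))
      (x := ((n + 1 : ℕ) : ℝ)) ⟨by push_cast; linarith, le_rfl⟩
    simpa using this
  refine (abel_bound f (fun n => φ n) B hB a b hab).trans ?_
  gcongr
  calc _ ≤ ∑ n ∈ Ico a b, (g n - g ((n+1 : ℕ) : ℝ)) := by
        refine sum_le_sum fun n hn => key n hn
    _ = _ := by
        have := sum_Ico_sub (fun n : ℕ => g n) hab
        rw [← neg_inj, ← sum_neg_distrib]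
        simp only [neg_sub]
        exact_mod_cast this

lemma log_pow_le_sqrt (j : ℕ) (x : ℝ) (hx : 1 ≤ x) :
    (Real.log x)^j ≤ 2^j * j.factorial * x ^ (1/2 : ℝ) := by
  have hl := Real.log_nonneg hx
  have h := Real.pow_div_factorial_le_exp (Real.log x / 2) (by positivity) j
  rw [div_le_iff₀ (by positivity), div_pow, div_le_iff₀ (by positivity)] at h
  rw [Real.rpow_def_of_pos (by linarith), mul_one_div]
  linarith


open LSeries in
lemma logMul_iter (f : ℕ → ℂ) (j n : ℕ) :
    (logMul^[j] f) n = ((Real.log n : ℝ) : ℂ)^j * f n := by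
  induction j with
  | zero => simp
  | succ j ih =>
    rw [Function.iterate_succ_apply']
    rw [logMul, ih, pow_succ, ← Complex.natCast_log]; ring

lemma abscissa_le_one (f : ℕ → ℂ) (h1 : ∀ n, ‖f n‖ ≤ 1) : LSeries.abscissaOfAbsConv f ≤ 1 :=
  LSeries.abscissaOfAbsConv_le_of_le_const ⟨1, fun n _ => h1 n⟩

lemma summable_logMul (f : ℕ → ℂ) (h1 : ∀ n, ‖f n‖ ≤ 1) (j : ℕ) (s : ℂ) (hs : 1 < s.re) :
    LSeriesSummable (LSeries.logMul^[j] f) s := by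
  apply LSeriesSummable_of_abscissaOfAbsConv_lt_re
  rw [LSeries.absicssaOfAbsConv_logPowMul]
  exact (abscissa_le_one f h1).trans_lt (by exact_mod_cast hs)

lemma harmonic_le (M : ℕ) (hM : 1 ≤ M) : ∑ n ∈ Ico 1 M, (1 : ℝ) / n ≤ 1 + Real.log M := by
  have h := harmonic_le_one_add_log M
  refine le_trans ?_ h
  rw [harmonic_eq_sum_Icc]
  push_cast
  simp only [one_div]
  apply sum_le_sum_of_subset_of_nonneg
  · intro x hx; simp at hx ⊢; omega
  · intros; positivity

lemma cpow_log_deriv (j : ℕ) (s : ℂ) (x : ℝ) (hx : 0 < x) :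
    HasDerivAt (fun x : ℝ => ((Real.log x : ℝ) : ℂ)^j * (x : ℂ)^(-s))
      ((j : ℂ) * ((Real.log x : ℝ) : ℂ)^(j-1) * ((x⁻¹ : ℝ) : ℂ) * (x : ℂ)^(-s)
        + ((Real.log x : ℝ) : ℂ)^j * (-s * (x : ℂ)^(-s-1))) x := by
  have h1 : HasDerivAt (fun x : ℝ => ((Real.log x : ℝ) : ℂ)) ((x⁻¹ : ℝ) : ℂ) x :=
    (Real.hasDerivAt_log hx.ne').ofReal_comp
  have h2 : HasDerivAt (fun x : ℝ => (x : ℂ)^(-s)) (-s * (x : ℂ)^(-s-1)) x := by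
    by_cases hs : s = 0
    · subst hs; simpa using hasDerivAt_const x (1 : ℂ)
    exact hasDerivAt_ofReal_cpow_const hx.ne' (by simpa using hs)
  exact (h1.pow j).mul h2

lemma tail_bound (f : ℕ → ℂ) (j : ℕ) (B : ℝ) (hB : ∀ a b, ‖∑ n ∈ Ico a b, f n‖ ≤ B) (s : ℂ)
    (hs : 1 ≤ s.re) (a b : ℕ) (ha : 1 ≤ a) (hab : a ≤ b) :
    ‖∑ n ∈ Ico a b, f n * (((Real.log n : ℝ) : ℂ)^j * ((n : ℝ) : ℂ)^(-s))‖ ≤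
      B * (5 * 2^j * j.factorial * ‖s‖ * (a : ℝ)^(-(1/2) : ℝ)) := by
  have hB0 : 0 ≤ B := (norm_nonneg _).trans (hB 0 0)
  have hs1 : 1 ≤ ‖s‖ := hs.trans (Complex.re_le_norm s)
  set c : ℝ := 2^j * j.factorial with hc
  have hc0 : 0 < c := by positivity
  have ha' : (1 : ℝ) ≤ a := by exact_mod_cast ha
  have key := abel_deriv f (fun x : ℝ => ((Real.log x : ℝ) : ℂ)^j * (x : ℂ)^(-s)) _
    (fun x => 4 * c * ‖s‖ * x^(-(1/2) : ℝ)) (fun x => 4 * c * ‖s‖ * (-(1/2) * x^(-(1/2) - 1 : ℝ))) B hB a b hab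
    (fun x hx => cpow_log_deriv j s x (by linarith))
    (fun x hx => by
      exact (Real.hasDerivAt_rpow_const (Or.inl (by linarith))).const_mul _)
    (fun x hx _ => by
      have hx1 : 1 ≤ x := by linarith
      have hx0 : 0 < x := by linarith
      have hl := Real.log_nonneg hx1
      have e1 : ‖(x : ℂ)^(-s)‖ ≤ x^(-1 : ℝ) := by
        rw [Complex.norm_cpow_eq_rpow_re_of_pos hx0]
        exact Real.rpow_le_rpow_of_exponent_le hx1 (by simp; linarith)
      have e2 : ‖(x : ℂ)^(-s-1)‖ ≤ x^(-2 : ℝ) := by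
        rw [Complex.norm_cpow_eq_rpow_re_of_pos hx0]
        exact Real.rpow_le_rpow_of_exponent_le hx1 (by simp; linarith)
      have e3 := log_pow_le_sqrt j x hx1
      have e4 : (j : ℝ) * (Real.log x)^(j-1) ≤ c * x^(1/2 : ℝ) := by
        rcases Nat.eq_zero_or_pos j with h | h
        · subst h; simp; positivity
        · obtain ⟨i, rfl⟩ : ∃ i, j = i + 1 := ⟨j-1, by omega⟩
          have := log_pow_le_sqrt i x hx1
          simp only [Nat.add_sub_cancel]
          rw [hc, Nat.factorial_succ, pow_succ]
          push_cast at *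
          have h2 : (0 : ℝ) ≤ (i+1) * (2^i * i.factorial * x^(1/2 : ℝ)) := by positivity
          nlinarith [mul_le_mul_of_nonneg_left this (show (0 : ℝ) ≤ (i : ℝ) + 1 by positivity)]
      refine (norm_add_le _ _).trans ?_
      simp only [norm_mul, norm_neg, norm_pow, Complex.norm_real, Complex.norm_natCast, Real.norm_eq_abs,
        abs_of_nonneg hl, abs_inv, abs_of_pos hx0]
      have e5 : x^(-(1/2) - 1 : ℝ) = x^(1/2 : ℝ) * x^(-2 : ℝ) := by
        rw [← Real.rpow_add hx0]; norm_num
      have e6 : x^(-2 : ℝ) = x⁻¹ * x^(-1 : ℝ) := by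
        rw [← Real.rpow_neg_one, ← Real.rpow_add hx0]; norm_num
      have p1 : (0:ℝ) < x^(1/2 : ℝ) := by positivity
      have p2 : (0:ℝ) < x^(-2 : ℝ) := by positivity
      calc (j : ℝ) * Real.log x^(j-1) * x⁻¹ * ‖(x : ℂ)^(-s)‖ + Real.log x^j * (‖s‖ * ‖(x : ℂ)^(-s-1)‖)
          ≤ (c * x^(1/2 : ℝ)) * x⁻¹ * x^(-1 : ℝ) + (c * x^(1/2 : ℝ)) * (‖s‖ * x^(-2 : ℝ)) := by
            gcongr
        _ = (c * x^(1/2 : ℝ)) * x^(-2 : ℝ) * (1 + ‖s‖) := by rw [e6]; ring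
        _ ≤ (c * x^(1/2 : ℝ)) * x^(-2 : ℝ) * (‖s‖ + ‖s‖) := by gcongr
        _ = _ := by rw [e5]; ring)
  refine key.trans ?_
  gcongr
  have hb' : (a : ℝ) ≤ b := by exact_mod_cast hab
  have hb1 : (1 : ℝ) ≤ b := ha'.trans hb'
  have hb0 : (0 : ℝ) < b := by linarith
  have e1 : ‖((b : ℝ) : ℂ)^(-s)‖ ≤ (b : ℝ)^(-1 : ℝ) := by
    rw [Complex.norm_cpow_eq_rpow_re_of_pos hb0]
    exact Real.rpow_le_rpow_of_exponent_le hb1 (by simp; linarith)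
  have e2 : ‖((Real.log b : ℝ) : ℂ)^j * ((b : ℝ) : ℂ)^(-s)‖ ≤ c * (b : ℝ)^(-(1/2) : ℝ) := by
    rw [norm_mul, norm_pow, Complex.norm_real, Real.norm_eq_abs, abs_of_nonneg (Real.log_nonneg hb1)]
    calc _ ≤ (c * (b:ℝ)^(1/2 : ℝ)) * (b : ℝ)^(-1 : ℝ) := by
          gcongr; exact log_pow_le_sqrt j b hb1
      _ = _ := by rw [mul_assoc, ← Real.rpow_add hb0]; norm_num
  have p0 : (0:ℝ) ≤ (b : ℝ)^(-(1/2) : ℝ) := by positivity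
  have p1 : (b : ℝ)^(-(1/2) : ℝ) ≤ (a : ℝ)^(-(1/2) : ℝ) :=
    Real.rpow_le_rpow_of_nonpos (by linarith) hb' (by norm_num)
  have p2 : c ≤ c * ‖s‖ := le_mul_of_one_le_right hc0.le hs1
  calc _ ≤ c * (b : ℝ)^(-(1/2) : ℝ) + (4 * c * ‖s‖ * (a : ℝ)^(-(1/2) : ℝ) - 4 * c * ‖s‖ * (b : ℝ)^(-(1/2) : ℝ)) := by
        gcongr
    _ ≤ 4 * c * ‖s‖ * (a : ℝ)^(-(1/2) : ℝ) := by
        nlinarith [mul_le_mul_of_nonneg_right p2 p0, mul_nonneg (mul_nonneg hc0.le (norm_nonneg s)) p0]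
    _ ≤ _ := by
        rw [hc]
        have : 0 ≤ 2^j * (j.factorial : ℝ) * ‖s‖ * (a : ℝ)^(-(1/2) : ℝ) := by positivity
        nlinarith

/-- Upper bound for `L`-series derivatives. -/
lemma L_upper (f : ℕ → ℂ) (j B : ℕ) (hB1 : 1 ≤ B) (h1 : ∀ n, ‖f n‖ ≤ 1)
    (hB : ∀ a b, ‖∑ n ∈ Ico a b, f n‖ ≤ B) (s : ℂ) (hs : 1 < s.re) :
    ‖LSeries (LSeries.logMul^[j] f) s‖ ≤
      (2 * Real.log B)^j * (1 + 2 * Real.log B) + 5 * 2^j * j.factorial * ‖s‖ := by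
  have hsum := (summable_logMul f h1 j s hs).LSeriesHasSum
  have ht := HasSum.tendsto_sum_nat hsum
  refine le_of_tendsto ht.norm ?_
  filter_upwards [Filter.eventually_ge_atTop (B^2)] with K hK
  have hBB : 1 ≤ B^2 := Nat.one_le_pow _ _ hB1
  have hterm : ∀ n, 1 ≤ n → LSeries.term (LSeries.logMul^[j] f) s n
      = f n * (((Real.log n : ℝ) : ℂ)^j * ((n : ℝ) : ℂ)^(-s)) := by
    intro n hn
    rw [LSeries.term_of_ne_zero (by omega), logMul_iter, Complex.cpow_neg, div_eq_mul_inv]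
    push_cast; ring
  rw [range_eq_Ico, ← sum_Ico_consecutive _ (Nat.zero_le 1) (hBB.trans hK)]
  rw [← sum_Ico_consecutive _ hBB hK]
  have h00 : ∑ i ∈ Ico 0 1, LSeries.term (LSeries.logMul^[j] f) s i = 0 := by simp
  rw [h00, zero_add]
  have hl : Real.log ((B^2 : ℕ) : ℝ) = 2 * Real.log B := by push_cast; rw [Real.log_pow]; norm_num
  have hlB : 0 ≤ Real.log B := Real.log_natCast_nonneg B
  refine (norm_add_le _ _).trans (add_le_add ?_ ?_)
  · calc _ ≤ ∑ n ∈ Ico 1 (B^2), (2 * Real.log B)^j * (1 / (n : ℝ)) := by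
          refine (norm_sum_le _ _).trans (sum_le_sum fun n hn => ?_)
          rw [mem_Ico] at hn
          have hn0 : (0 : ℝ) < n := by exact_mod_cast hn.1
          have hn1 : (1 : ℝ) ≤ n := by exact_mod_cast hn.1
          rw [hterm n hn.1, norm_mul, norm_mul, norm_pow, Complex.norm_real, Real.norm_eq_abs,
            abs_of_nonneg (Real.log_natCast_nonneg n), Complex.norm_cpow_eq_rpow_re_of_pos hn0]
          have e1 : (n : ℝ)^(-s).re ≤ 1 / n := by
            rw [one_div, ← Real.rpow_neg_one]
            exact Real.rpow_le_rpow_of_exponent_le hn1 (by simp; linarith)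
          have e2 : Real.log n ≤ 2 * Real.log B := by
            rw [← hl]; exact Real.log_le_log hn0 (by exact_mod_cast hn.2.le)
          have e0 := Real.log_natCast_nonneg n
          calc _ ≤ 1 * ((2 * Real.log B)^j * (1 / (n : ℝ))) := by gcongr; exact h1 n
            _ = _ := one_mul _
      _ ≤ _ := by
          rw [← mul_sum]
          gcongr
          rw [← hl]
          exact harmonic_le _ hBB
  · rw [sum_congr rfl (fun n hn => hterm n (hBB.trans (mem_Ico.mp hn).1))]
    refine (tail_bound f j B hB s hs.le (B^2) K hBB hK).trans (le_of_eq ?_)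
    have hB0 : (0 : ℝ) < B := by exact_mod_cast hB1
    have : ((B^2 : ℕ) : ℝ)^(-(1/2) : ℝ) = (B : ℝ)⁻¹ := by
      push_cast
      rw [← Real.rpow_natCast, ← Real.rpow_mul hB0.le, ← Real.rpow_neg_one]; norm_num
    rw [this]
    field_simp

lemma char_interval {r : ℕ} [NeZero r] (χ : DirichletCharacter ℂ r) (hχ : χ ≠ 1) (a b : ℕ) :
    ‖∑ n ∈ Ico a b, χ (n : ZMod r)‖ ≤ ((2 * r : ℕ) : ℝ) := by
  refine periodic_sum_bound (fun n => χ (n : ZMod r)) r (NeZero.pos r) ?_ ?_ ?_ a b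
  · intro n; simp
  · have := MulChar.sum_eq_zero_of_ne_one hχ
    rw [← this]
    refine sum_bij (fun n _ => (n : ZMod r)) (by simp) ?_ ?_ (by simp)
    · intro a ha b hb h
      rw [ZMod.natCast_eq_natCast_iff'] at h
      rwa [Nat.mod_eq_of_lt (mem_range.mp ha), Nat.mod_eq_of_lt (mem_range.mp hb)] at h
    · intro b _
      exact ⟨b.val, mem_range.mpr (ZMod.val_lt b), by simp⟩
  · intro n; exact DirichletCharacter.norm_le_one χ _

lemma char_zero_of_not_coprime {r : ℕ} (χ : DirichletCharacter ℂ r) (n : ℕ) (h : ¬ n.Coprime r) :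
    χ (n : ZMod r) = 0 :=
  MulChar.map_nonunit _ (by rwa [ZMod.isUnit_iff_coprime])

lemma changeLevel_nat {r q : ℕ} (χ : DirichletCharacter ℂ r) (h : r ∣ q) (n : ℕ) (hn : n.Coprime q) :
    (χ.changeLevel h) (n : ZMod q) = χ (n : ZMod r) := by
  have := DirichletCharacter.changeLevel_eq_cast_of_dvd' χ h (a := n) (Nat.isCoprime_iff_coprime.mpr hn)
  simpa using this

/-- Product of two distinct primitive characters is a nonprincipal character. -/
lemma prod_char {r r' : ℕ} [NeZero r] [NeZero r'] (χ : DirichletCharacter ℂ r)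
    (χ' : DirichletCharacter ℂ r') (hp : χ.IsPrimitive) (hp' : χ'.IsPrimitive)
    (hne : (⟨r, χ⟩ : Σ r, DirichletCharacter ℂ r) ≠ ⟨r', χ'⟩) :
    ∃ ψ : DirichletCharacter ℂ (r * r'), ψ ≠ 1 ∧
      ∀ n : ℕ, ψ (n : ZMod (r * r')) = χ (n : ZMod r) * (starRingEnd ℂ) (χ' (n : ZMod r')) := by
  refine ⟨χ.changeLevel (dvd_mul_right r r') * (χ'.changeLevel (dvd_mul_left r' r))⁻¹, ?_, ?_⟩
  · intro h
    rw [mul_inv_eq_one] at h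
    have hc := congrArg DirichletCharacter.conductor h
    rw [DirichletCharacter.conductor_changeLevel, DirichletCharacter.conductor_changeLevel] at hc
    have hr : r = r' := by rw [← hp, ← hp']; exact hc
    subst hr
    exact hne (by rw [DirichletCharacter.changeLevel_injective _ h])
  · intro n
    rw [MulChar.mul_apply, ← MulChar.star_apply']
    by_cases hn : n.Coprime (r * r')
    · rw [changeLevel_nat _ _ _ hn, changeLevel_nat _ _ _ hn]; rfl
    · rw [char_zero_of_not_coprime _ _ hn, zero_mul]
      rw [Nat.coprime_mul_iff_right, not_and_or] at hn
      rcases hn with hn | hn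
      · rw [char_zero_of_not_coprime _ _ hn, zero_mul]
      · rw [char_zero_of_not_coprime χ' _ hn, map_zero, mul_zero]

lemma prod_char_interval {r r' : ℕ} [NeZero r] [NeZero r'] (χ : DirichletCharacter ℂ r)
    (χ' : DirichletCharacter ℂ r') (hp : χ.IsPrimitive) (hp' : χ'.IsPrimitive)
    (hne : (⟨r, χ⟩ : Σ r, DirichletCharacter ℂ r) ≠ ⟨r', χ'⟩) (a b : ℕ) :
    ‖∑ n ∈ Ico a b, χ (n : ZMod r) * (starRingEnd ℂ) (χ' (n : ZMod r'))‖ ≤ ((2 * (r * r') : ℕ) : ℝ) := by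
  obtain ⟨ψ, h1, h2⟩ := prod_char χ χ' hp hp' hne
  simp only [← h2]
  exact char_interval ψ h1 a b

end MT

namespace MT
open Finset Filter Topology

lemma cpow_diff (s : ℂ) (hs : 1 ≤ s.re) (a x : ℝ) (ha : 1 ≤ a) (hax : a ≤ x) :
    ‖(a : ℂ)^(-s) - (x : ℂ)^(-s)‖ ≤ ‖s‖ * (a⁻¹ - x⁻¹) := by
  have hs0 : s ≠ 0 := by rintro rfl; norm_num at hs
  have := image_norm_le_of_norm_deriv_right_le_deriv_boundary' (a := a) (b := x)
      (f := fun x : ℝ => (x : ℂ)^(-s) - (a : ℂ)^(-s)) (f' := fun x : ℝ => -s * (x : ℂ)^(-s-1))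
      (B := fun x => ‖s‖ * (a⁻¹ - x⁻¹)) (B' := fun x => ‖s‖ * (-(-(x^2)⁻¹)))
      (fun y hy => ((hasDerivAt_ofReal_cpow_const (by linarith [hy.1]) (by simpa using hs0)).sub_const _).continuousAt.continuousWithinAt)
      (fun y hy => ((hasDerivAt_ofReal_cpow_const (by linarith [hy.1]) (by simpa using hs0)).sub_const _).hasDerivWithinAt)
      (by simp)
      (fun y hy => (((hasDerivAt_inv (by linarith [hy.1])).const_sub _).const_mul _).continuousAt.continuousWithinAt)
      (fun y hy => (((hasDerivAt_inv (by linarith [hy.1])).const_sub _).const_mul _).hasDerivWithinAt)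
      (fun y hy => by
        have hy1 : 1 ≤ y := by linarith [hy.1]
        rw [norm_mul, norm_neg, neg_neg]
        gcongr
        rw [Complex.norm_cpow_eq_rpow_re_of_pos (by linarith)]
        calc y^(-s-1).re ≤ y^(-2 : ℝ) := Real.rpow_le_rpow_of_exponent_le hy1 (by simp; linarith)
          _ = _ := by rw [Real.rpow_neg (by linarith)]; norm_num)
      (x := x) ⟨hax, le_rfl⟩
  rw [norm_sub_rev]; exact this

lemma zeta_step (s : ℂ) (hs : 1 < s.re) (n : ℕ) (hn : 1 ≤ n) :
    ‖((n : ℝ) : ℂ)^(-s) - ((((n + 1 : ℕ) : ℝ) : ℂ)^(1-s)/(1-s) - ((n : ℝ) : ℂ)^(1-s)/(1-s))‖ ≤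
      ‖s‖ * ((n : ℝ)⁻¹ - ((n + 1 : ℕ) : ℝ)⁻¹) := by
  have hs1 : 1 - s ≠ 0 := by
    intro h; have := congrArg Complex.re h; simp at this; linarith
  have hn1 : (1 : ℝ) ≤ n := by exact_mod_cast hn
  have hs0 : s ≠ 0 := by rintro rfl; norm_num at hs
  have hd : ∀ y : ℝ, (n : ℝ) ≤ y → HasDerivAt (fun x : ℝ => ((n : ℝ) : ℂ)^(-s) * (((x : ℝ) : ℂ) - (n : ℝ))
        - ((x : ℂ)^(1-s)/(1-s) - ((n : ℝ) : ℂ)^(1-s)/(1-s)))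
      (((n : ℝ) : ℂ)^(-s) * 1 - (((1 - s) * (y : ℂ)^(1-s-1))/(1-s))) y := by
    intro y hy
    have h1 : HasDerivAt (fun x : ℝ => (x : ℂ)^(1-s)) ((1 - s) * (y : ℂ)^(1-s-1)) y :=
      hasDerivAt_ofReal_cpow_const (by linarith) hs1
    exact ((Complex.ofRealCLM.hasDerivAt.sub_const _).const_mul _).sub ((h1.div_const _).sub_const _)
  have := norm_image_sub_le_of_norm_deriv_le_segment' (a := (n : ℝ)) (b := ((n + 1 : ℕ) : ℝ))
    (f := fun x : ℝ => ((n : ℝ) : ℂ)^(-s) * (((x : ℝ) : ℂ) - (n : ℝ))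
        - ((x : ℂ)^(1-s)/(1-s) - ((n : ℝ) : ℂ)^(1-s)/(1-s)))
    (C := ‖s‖ * ((n : ℝ)⁻¹ - ((n + 1 : ℕ) : ℝ)⁻¹))
    (fun y hy => (hd y hy.1).hasDerivWithinAt)
    (fun y hy => by
      rw [mul_div_cancel_left₀ _ hs1, mul_one, show 1 - s - 1 = -s by ring]
      refine (cpow_diff s hs.le n y hn1 hy.1).trans ?_
      have h3 : (0 : ℝ) < y := by linarith [hy.1]
      gcongr
      exact hy.2.le) ((n + 1 : ℕ) : ℝ) ⟨by push_cast; linarith, le_rfl⟩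
  convert this using 1
  · congr 1
    push_cast; ring
  · push_cast; ring

lemma zeta_sub (s : ℂ) (hs : 1 < s.re) : ‖LSeries 1 s - 1 / (s - 1)‖ ≤ ‖s‖ := by
  have hsum := (LSeriesSummable_one_iff.mpr hs).LSeriesHasSum
  have ht := HasSum.tendsto_sum_nat hsum
  have hphi : Tendsto (fun K : ℕ => ((K : ℝ) : ℂ)^(1-s)/(1-s)) atTop (𝓝 (0 / (1 - s))) := by
    refine Tendsto.div_const ?_ _
    rw [tendsto_zero_iff_norm_tendsto_zero]
    have : Tendsto (fun K : ℕ => (K : ℝ)^(-(s.re - 1))) atTop (𝓝 0) :=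
      (tendsto_rpow_neg_atTop (by linarith)).comp tendsto_natCast_atTop_atTop
    refine this.congr' ?_
    filter_upwards [eventually_ge_atTop 1] with K hK
    rw [Complex.norm_cpow_eq_rpow_re_of_pos (by exact_mod_cast hK)]
    simp
  have ht2 := ((ht.sub hphi).add_const (1 / (1 - s))).norm
  have heq : LSeries 1 s - 0 / (1 - s) + 1 / (1 - s) = LSeries 1 s - 1 / (s - 1) := by
    rw [show s - 1 = -(1 - s) by ring, div_neg]; ring
  rw [heq] at ht2
  refine le_of_tendsto ht2 ?_
  filter_upwards [eventually_ge_atTop 1] with K hK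
  have hterm : ∀ n ∈ Ico 1 K, LSeries.term 1 s n = ((n : ℝ) : ℂ)^(-s) := by
    intro n hn
    rw [mem_Ico] at hn
    rw [LSeries.term_of_ne_zero (by omega), Complex.cpow_neg]; simp
  have e1 : ∑ n ∈ range K, LSeries.term 1 s n = ∑ n ∈ Ico 1 K, ((n : ℝ) : ℂ)^(-s) := by
    rw [range_eq_Ico, ← sum_Ico_consecutive _ (Nat.zero_le 1) hK, sum_congr rfl hterm]; simp
  have e2 := sum_Ico_sub (fun n : ℕ => ((n : ℝ) : ℂ)^(1-s)/(1-s)) hK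
  have e3 := sum_Ico_sub (fun n : ℕ => (n : ℝ)⁻¹) hK
  simp only [Nat.cast_one, Complex.ofReal_one, Complex.one_cpow, inv_one] at e2 e3
  have e4 : ∑ n ∈ range K, LSeries.term 1 s n - ((K : ℝ) : ℂ)^(1-s)/(1-s) + 1 / (1 - s)
      = ∑ n ∈ Ico 1 K, (((n : ℝ) : ℂ)^(-s) - ((((n + 1 : ℕ) : ℝ) : ℂ)^(1-s)/(1-s) - ((n : ℝ) : ℂ)^(1-s)/(1-s))) := by
    rw [e1, sum_sub_distrib, e2]; ring
  rw [e4]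
  calc _ ≤ ∑ n ∈ Ico 1 K, ‖s‖ * ((n : ℝ)⁻¹ - ((n + 1 : ℕ) : ℝ)⁻¹) :=
        (norm_sum_le _ _).trans (sum_le_sum fun n hn => zeta_step s hs n (mem_Ico.mp hn).1)
    _ = ‖s‖ * (1 - (K : ℝ)⁻¹) := by
        rw [← mul_sum, ← neg_sub, ← e3, ← sum_neg_distrib]; simp
    _ ≤ ‖s‖ * 1 := by gcongr; simp
    _ = _ := mul_one _

lemma norm_L_le (f : ℕ → ℂ) (h1 : ∀ n, ‖f n‖ ≤ 1) (s : ℂ) (hs : 1 < s.re) (hs2 : s.re ≤ 2) :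
    ‖LSeries f s‖ ≤ 3 / (s.re - 1) := by
  have hf : LSeriesSummable f s := summable_logMul f h1 0 s hs
  have hσ : 1 < (s.re : ℂ).re := by simpa using hs
  have h1s := LSeriesSummable_one_iff.mpr hσ
  have hz := zeta_sub (s.re : ℂ) hσ
  have hle : ∀ n, ‖LSeries.term f s n‖ ≤ ‖LSeries.term 1 (s.re : ℂ) n‖ := by
    intro n
    refine (LSeries.norm_term_le s (g := 1) (by simpa using h1 n)).trans (le_of_eq ?_)
    rw [LSeries.norm_term_eq, LSeries.norm_term_eq]; simp
  have hre : ∀ n, LSeries.term 1 (s.re : ℂ) n = ((‖LSeries.term 1 (s.re : ℂ) n‖ : ℝ) : ℂ) := by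
    intro n
    rw [LSeries.norm_term_eq]
    rcases Nat.eq_zero_or_pos n with h | h
    · subst h; simp
    · rw [LSeries.term_of_ne_zero (by omega), if_neg (by omega)]
      push_cast
      rw [Complex.ofReal_cpow (by positivity)]
      simp
  have hL : LSeries 1 (s.re : ℂ) = ((∑' n, ‖LSeries.term 1 (s.re : ℂ) n‖ : ℝ) : ℂ) := by
    rw [LSeries, Complex.ofReal_tsum]; exact tsum_congr hre
  have hn : ‖LSeries 1 (s.re : ℂ)‖ = ∑' n, ‖LSeries.term 1 (s.re : ℂ) n‖ := by
    rw [hL, Complex.norm_real, Real.norm_of_nonneg (tsum_nonneg fun _ => norm_nonneg _)]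
  calc ‖LSeries f s‖ ≤ ∑' n, ‖LSeries.term f s n‖ := norm_tsum_le_tsum_norm hf.norm
    _ ≤ ∑' n, ‖LSeries.term 1 (s.re : ℂ) n‖ := Summable.tsum_le_tsum hle hf.norm h1s.norm
    _ = ‖LSeries 1 (s.re : ℂ)‖ := hn.symm
    _ ≤ ‖LSeries 1 (s.re : ℂ) - 1 / ((s.re : ℂ) - 1)‖ + ‖1 / ((s.re : ℂ) - 1)‖ := by
        have := norm_add_le (LSeries 1 (s.re : ℂ) - 1 / ((s.re : ℂ) - 1)) (1 / ((s.re : ℂ) - 1))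
        rwa [sub_add_cancel] at this
    _ ≤ 2 + 1 / (s.re - 1) := by
        gcongr
        · refine hz.trans ?_
          rw [Complex.norm_real, Real.norm_of_nonneg (by linarith)]; exact hs2
        · rw [← Complex.ofReal_one, ← Complex.ofReal_sub, ← Complex.ofReal_div, Complex.norm_real,
            Real.norm_of_nonneg (by apply div_nonneg; norm_num; linarith)]
    _ ≤ _ := by
        have : 0 < s.re - 1 := by linarith
        rw [add_div' _ _ _ this.ne', div_le_div_iff_of_pos_right this]; linarith

lemma L_lower_trivial {r : ℕ} (χ : DirichletCharacter ℂ r) (s : ℂ) (hs : 1 < s.re) (hs2 : s.re ≤ 2) :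
    (s.re - 1) / 3 ≤ ‖LSeries (fun n => χ n) s‖ := by
  have h := DirichletCharacter.LSeries.mul_mu_eq_one χ hs
  have h2 := norm_L_le ((fun n : ℕ => χ n) * fun n : ℕ => ((ArithmeticFunction.moebius n : ℤ) : ℂ)) (fun n => by
    rw [Pi.mul_apply, norm_mul]
    have a1 := DirichletCharacter.norm_le_one χ (n : ZMod r)
    have a2 : ‖((ArithmeticFunction.moebius n : ℤ) : ℂ)‖ ≤ 1 := by
      rw [Complex.norm_intCast]; exact_mod_cast ArithmeticFunction.abs_moebius_le_one
    nlinarith [norm_nonneg (χ (n : ZMod r)), norm_nonneg ((ArithmeticFunction.moebius n : ℤ) : ℂ)]) s hs hs2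
  have h3 := congrArg norm h
  rw [norm_mul, norm_one] at h3
  have h4 : 0 < s.re - 1 := by linarith
  have h5 : 1 ≤ ‖LSeries (fun n => χ n) s‖ * (3 / (s.re - 1)) := by
    calc (1 : ℝ) = _ := h3.symm
      _ ≤ _ := by gcongr
  rw [mul_div_assoc', le_div_iff₀ h4] at h5
  linarith

/-- packaged upper bound with `ℓ` -/
lemma L_up (f : ℕ → ℂ) (B : ℕ) (hB1 : 1 ≤ B) (h1 : ∀ n, ‖f n‖ ≤ 1)
    (hB : ∀ a b, ‖∑ n ∈ Ico a b, f n‖ ≤ B) (l : ℝ) (hl : 1 + Real.log B ≤ l) (j : ℕ)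
    (s : ℂ) (hs : 1 < s.re) :
    ‖LSeries (LSeries.logMul^[j] f) s‖ ≤ 7 * 2^j * j.factorial * ‖s‖ * l^(j+1) := by
  refine (L_upper f j B hB1 h1 hB s hs).trans ?_
  have hlB : 0 ≤ Real.log B := Real.log_natCast_nonneg B
  have hl1 : 1 ≤ l := by linarith
  have hs1 : 1 ≤ ‖s‖ := hs.le.trans (Complex.re_le_norm s)
  have hf1 : (1 : ℝ) ≤ j.factorial := by exact_mod_cast Nat.factorial_pos j
  have e1 : (2 * Real.log B)^j * (1 + 2 * Real.log B) ≤ (2 * l)^j * (2 * l) := by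
    gcongr <;> linarith
  have e2 : (2 * l)^j * (2 * l) ≤ 2 * (2^j * j.factorial * ‖s‖ * l^(j+1)) := by
    have : (2 * l)^j * (2 * l) = 2 * (2^j * 1 * 1 * l^(j+1)) := by ring
    rw [this]; gcongr
  have e3 : 5 * 2^j * j.factorial * ‖s‖ ≤ 5 * (2^j * j.factorial * ‖s‖ * l^(j+1)) := by
    have : 5 * 2^j * (j.factorial : ℝ) * ‖s‖ = 5 * (2^j * j.factorial * ‖s‖ * 1) := by ring
    rw [this]; gcongr; exact one_le_pow₀ hl1
  linarith

lemma L_char_up {r : ℕ} [NeZero r] (χ : DirichletCharacter ℂ r) (hχ : χ ≠ 1) (l : ℝ)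
    (hl : 1 + Real.log (2 * r : ℕ) ≤ l) (j : ℕ) (s : ℂ) (hs : 1 < s.re) :
    ‖LSeries (LSeries.logMul^[j] (fun n => χ n)) s‖ ≤ 7 * 2^j * j.factorial * ‖s‖ * l^(j+1) :=
  L_up _ (2 * r) (by have := NeZero.pos r; omega) (fun n => DirichletCharacter.norm_le_one χ _)
    (char_interval χ hχ) l hl j s hs

lemma L_char0_up {r : ℕ} [NeZero r] (l : ℝ)
    (hl : 1 + Real.log (2 * r : ℕ) ≤ l) (s : ℂ) (hs : 1 < s.re) :
    ‖LSeries (fun n => (1 : DirichletCharacter ℂ r) n) s‖ ≤ 1 / ‖s - 1‖ + ‖s‖ + 7 * ‖s‖ * l := by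
  set χ := (1 : DirichletCharacter ℂ r)
  set S := ∑ n ∈ range r, χ n
  have hr : 0 < r := NeZero.pos r
  have hr0 : (r : ℂ) ≠ 0 := by exact_mod_cast hr.ne'
  have hv : ∀ n : ℕ, χ n = if n.Coprime r then 1 else 0 := by
    intro n
    split_ifs with h
    · exact MulChar.one_apply ((ZMod.isUnit_iff_coprime n r).mpr h)
    · exact char_zero_of_not_coprime _ _ h
  set m := (range r).filter (fun n => n.Coprime r)
  have hS : S = (m.card : ℂ) := by
    simp only [S, hv, sum_ite, sum_const_zero, add_zero, sum_const, nsmul_eq_mul, mul_one]; rfl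
  set c : ℝ := m.card / r
  have hc0 : 0 ≤ c := by positivity
  have hc1 : c ≤ 1 := by
    rw [div_le_one (by exact_mod_cast hr)]
    exact_mod_cast (card_filter_le _ _).trans (by simp)
  have hcS : (c : ℂ) = S / r := by rw [hS]; simp [c]
  have hb : ∀ n : ℕ, ‖χ n - (c : ℂ)‖ ≤ 1 := by
    intro n; rw [hv]
    split_ifs
    · rw [← Complex.ofReal_one, ← Complex.ofReal_sub, Complex.norm_real, Real.norm_of_nonneg] <;> linarith
    · rw [zero_sub, norm_neg, Complex.norm_real, Real.norm_of_nonneg hc0]; exact hc1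
  have hper := periodic_sum_bound (fun n : ℕ => χ n - (c : ℂ)) r hr (by intro n; simp)
    (by rw [sum_sub_distrib]; simp only [sum_const, card_range, nsmul_eq_mul, hcS]
        rw [mul_div_cancel₀ _ hr0, sub_self]) hb
  have hup := L_up (fun n : ℕ => χ n - (c : ℂ)) (2 * r) (by omega) hb hper l hl 0 s hs
  simp only [Function.iterate_zero, id] at hup
  have hχs : LSeriesSummable (fun n : ℕ => χ n) s := DirichletCharacter.LSeriesSummable_of_one_lt_re χ hs
  have h1s := LSeriesSummable_one_iff.mpr hs
  have hsub : LSeries (fun n : ℕ => χ n - (c : ℂ)) s = LSeries (fun n : ℕ => χ n) s - c * LSeries 1 s := by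
    rw [← LSeries_smul, ← LSeries_sub hχs (h1s.smul _)]
    congr 1; ext n; simp
  rw [hsub] at hup
  have hz : ‖LSeries 1 s‖ ≤ 1 / ‖s - 1‖ + ‖s‖ := by
    have := norm_add_le (LSeries 1 s - 1 / (s - 1)) (1 / (s - 1))
    rw [sub_add_cancel] at this
    have h2 := zeta_sub s hs
    rw [norm_div, norm_one] at this
    linarith
  have := norm_add_le (LSeries (fun n : ℕ => χ n) s - c * LSeries 1 s) (c * LSeries 1 s)
  rw [sub_add_cancel, norm_mul, Complex.norm_real, Real.norm_of_nonneg hc0] at this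
  have h3 : c * ‖LSeries 1 s‖ ≤ 1 / ‖s - 1‖ + ‖s‖ := by
    calc _ ≤ 1 * ‖LSeries 1 s‖ := by gcongr
      _ ≤ _ := by rw [one_mul]; exact hz
  simp at hup
  linarith

lemma L_diff (f : ℕ → ℂ) (h1 : ∀ n, ‖f n‖ ≤ 1) (R C : ℝ)
    (hC : ∀ s : ℂ, 1 < s.re → ‖s‖ ≤ R → ‖LSeries (LSeries.logMul f) s‖ ≤ C)
    (s s' : ℂ) (hs : 1 < s.re) (hs' : 1 < s'.re) (hR : ‖s‖ ≤ R) (hR' : ‖s'‖ ≤ R) :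
    ‖LSeries f s - LSeries f s'‖ ≤ C * ‖s - s'‖ := by
  have hconv : Convex ℝ ({z : ℂ | 1 < z.re} ∩ Metric.closedBall 0 R) :=
    (convex_halfSpace_re_gt 1).inter (convex_closedBall _ _)
  refine hconv.norm_image_sub_le_of_norm_hasDerivWithin_le (f := LSeries f)
    (f' := fun z => -LSeries (LSeries.logMul f) z) (fun z hz => ?_) (fun z hz => ?_) ⟨hs', by simpa using hR'⟩
    ⟨hs, by simpa using hR⟩
  · exact (LSeries_hasDerivAt ((abscissa_le_one f h1).trans_lt (by exact_mod_cast hz.1))).hasDerivWithinAt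
  · rw [norm_neg]; exact hC z hz.1 (by simpa using hz.2)

end MT

namespace MT
open Finset Filter Topology

lemma norm_line (x y : ℝ) (hx : 0 < x) (hx1 : x ≤ 1) : ‖(1 : ℂ) + x + Complex.I * y‖ ≤ 2 * (1 + |y|) := by
  calc _ ≤ ‖(1 : ℂ)‖ + ‖(x : ℂ)‖ + ‖Complex.I * y‖ := norm_add₃_le
    _ = 1 + x + |y| := by simp [abs_of_pos hx]
    _ ≤ _ := by linarith [abs_nonneg y]

lemma lower_core {r : ℕ} [NeZero r] (χ : DirichletCharacter ℂ r) (hχ : χ ≠ 1) (l : ℝ)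
    (hl : 1 + Real.log (2 * r : ℕ) ≤ l) (y M : ℝ) (hM1 : 1 ≤ M)
    (hM : ∀ x : ℝ, 0 < x → x ≤ 1 →
      ‖LSeries (fun n => (χ^2 : DirichletCharacter ℂ r) n) (1 + x + 2 * Complex.I * y)‖ ≤ M * (1 + |y|))
    (x : ℝ) (hx : 0 < x) (hx1 : x ≤ 1) :
    28 / (27 * 56^4 * M * (1 + |y|)^4 * l^6) ≤ ‖LSeries (fun n => χ n) (1 + x + Complex.I * y)‖ := by
  have hl1 : 1 ≤ l := by linarith [Real.log_natCast_nonneg (2 * r)]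
  set τ := 1 + |y| with hτ
  have hτ1 : 1 ≤ τ := by rw [hτ]; linarith [abs_nonneg y]
  set x0 := 1 / (27 * 56^4 * M * τ^5 * l^8) with hx0
  have hx0p : 0 < x0 := by positivity
  have hx01 : x0 ≤ 1 := by
    rw [hx0, div_le_one (by positivity)]
    have a1 : 1 ≤ τ^5 := one_le_pow₀ hτ1
    have a2 : 1 ≤ l^8 := one_le_pow₀ hl1
    have a3 : 1 ≤ M * τ^5 := one_le_mul_of_one_le_of_one_le hM1 a1
    have a4 : 1 ≤ M * τ^5 * l^8 := one_le_mul_of_one_le_of_one_le a3 a2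
    nlinarith
  have htarget : 28 / (27 * 56^4 * M * τ^4 * l^6) = 28 * x0 * τ * l^2 := by
    rw [hx0]; field_simp
  rw [htarget]
  have big : ∀ z : ℝ, x0 ≤ z → z ≤ 1 → 56 * x0 * τ * l^2 ≤ ‖LSeries (fun n => χ n) (1 + z + Complex.I * y)‖ := by
    intro z hz hz1
    have hz0 : 0 < z := by linarith
    have h := DirichletCharacter.norm_LSeries_product_ge_one χ hz0 y
    rw [norm_mul, norm_mul, norm_pow, norm_pow] at h
    have h0 := norm_L_le (fun n : ℕ => (1 : DirichletCharacter ℂ r) n) (fun n => DirichletCharacter.norm_le_one _ _)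
      (1 + z) (by simp; linarith) (by simp; linarith)
    simp only [Complex.add_re, Complex.one_re, Complex.ofReal_re, add_sub_cancel_left] at h0
    have h2 := hM z hz0 hz1
    have hpos : 0 ≤ ‖LSeries (fun n => χ n) (1 + z + Complex.I * y)‖ := norm_nonneg _
    set N := ‖LSeries (fun n => χ n) (1 + z + Complex.I * y)‖
    have h3 : 1 ≤ (3 / z)^3 * N^4 * (M * τ) := by
      refine le_trans h ?_
      gcongr
    have h4 : z^3 ≤ 27 * M * τ * N^4 := by
      have : (3 / z)^3 * N^4 * (M * τ) = (27 * M * τ * N^4) / z^3 := by field_simp; norm_num; ring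
      rw [this, le_div_iff₀ (by positivity)] at h3
      linarith
    have h5 : (56 * x0 * τ * l^2)^4 ≤ N^4 := by
      have e : (56 * x0 * τ * l^2)^4 * (27 * M * τ) = x0^3 * (27 * 56^4 * M * τ^5 * l^8 * x0) := by ring
      have e2 : 27 * 56^4 * M * τ^5 * l^8 * x0 = 1 := by rw [hx0]; field_simp
      rw [e2, mul_one] at e
      have e3 : x0^3 ≤ z^3 := by gcongr
      have : (56 * x0 * τ * l^2)^4 * (27 * M * τ) ≤ N^4 * (27 * M * τ) := by rw [e]; linarith
      exact le_of_mul_le_mul_right this (by positivity)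
    exact le_of_pow_le_pow_left₀ (by norm_num) hpos h5
  rcases le_total x0 x with h | h
  · have := big x h hx1
    have p : 0 ≤ 28 * x0 * τ * l^2 := by positivity
    linarith
  · have h1 := big x0 le_rfl hx01
    have h2 := L_diff (fun n : ℕ => χ n) (fun n => DirichletCharacter.norm_le_one χ _) (2 * τ) (28 * τ * l^2)
      (fun s hs hsR => by
        refine (L_char_up χ hχ l hl 1 s hs).trans ?_
        simp only [pow_one, Nat.factorial_one, Nat.cast_one]
        have : 7 * 2 * 1 * ‖s‖ * l^2 ≤ 7 * 2 * 1 * (2 * τ) * l^2 := by gcongr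
        norm_num at this ⊢
        linarith)
      (1 + x0 + Complex.I * y) (1 + x + Complex.I * y) (by simp; linarith) (by simp; linarith)
      (norm_line x0 y hx0p hx01) (norm_line x y hx hx1)
    have h3 : ‖((1 : ℂ) + x0 + Complex.I * y) - (1 + x + Complex.I * y)‖ ≤ x0 := by
      have : ((1 : ℂ) + x0 + Complex.I * y) - (1 + x + Complex.I * y) = ((x0 - x : ℝ) : ℂ) := by push_cast; ring
      rw [this, Complex.norm_real, Real.norm_of_nonneg (by linarith)]; linarith
    have h4 := norm_sub_norm_le (LSeries (fun n => χ n) (1 + x0 + Complex.I * y)) (LSeries (fun n => χ n) (1 + x + Complex.I * y))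
    have h5 : 28 * τ * l^2 * ‖((1 : ℂ) + x0 + Complex.I * y) - (1 + x + Complex.I * y)‖ ≤ 28 * τ * l^2 * x0 := by gcongr
    linarith

lemma L_one_diff {r : ℕ} [NeZero r] (χ : DirichletCharacter ℂ r) (hχ : χ ≠ 1) (l : ℝ)
    (hl : 1 + Real.log (2 * r : ℕ) ≤ l) (s : ℂ) (hs : 1 < s.re) (R : ℝ) (hR : ‖s‖ ≤ R) (hR2 : 2 ≤ R) :
    ‖LSeries (fun n => χ n) s - DirichletCharacter.LFunction χ 1‖ ≤ 14 * R * l^2 * ‖s - 1‖ := by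
  have hl1 : 1 ≤ l := by linarith [Real.log_natCast_nonneg (2 * r)]
  have hu : Tendsto (fun n : ℕ => (1 : ℂ) + ((1 / ((n : ℝ) + 1) : ℝ) : ℂ)) atTop (𝓝 (1 + ((0 : ℝ) : ℂ))) :=
    ((Complex.continuous_ofReal.tendsto 0).comp tendsto_one_div_add_atTop_nhds_zero_nat).const_add 1
  simp only [Complex.ofReal_zero, add_zero] at hu
  have hL : Tendsto (fun n : ℕ => DirichletCharacter.LFunction χ ((1 : ℂ) + ((1 / ((n : ℝ) + 1) : ℝ) : ℂ))) atTop
      (𝓝 (DirichletCharacter.LFunction χ 1)) :=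
    ((DirichletCharacter.differentiable_LFunction hχ).continuous.tendsto 1).comp hu
  have t1 := (hL.const_sub (LSeries (fun n => χ n) s)).norm
  have t2 := ((hu.const_sub s).norm).const_mul (14 * R * l^2)
  refine le_of_tendsto_of_tendsto t1 t2 ?_
  filter_upwards with n
  have hp : 0 < 1 / ((n : ℝ) + 1) := by positivity
  have hp1 : 1 / ((n : ℝ) + 1) ≤ 1 := by rw [div_le_one (by positivity)]; linarith [Nat.cast_nonneg (α := ℝ) n]
  have hre : 1 < ((1 : ℂ) + ((1 / ((n : ℝ) + 1) : ℝ) : ℂ)).re := by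
    rw [Complex.add_re, Complex.one_re, Complex.ofReal_re]; linarith
  rw [DirichletCharacter.LFunction_eq_LSeries χ hre]
  refine L_diff (fun n : ℕ => χ n) (fun n => DirichletCharacter.norm_le_one χ _) R (14 * R * l^2)
      (fun s hs hsR => by
        refine (L_char_up χ hχ l hl 1 s hs).trans ?_
        simp only [pow_one, Nat.factorial_one, Nat.cast_one]
        have : 7 * 2 * 1 * ‖s‖ * l^2 ≤ 7 * 2 * 1 * R * l^2 := by gcongr
        norm_num at this ⊢
        linarith) _ _ hs hre hR ?_
  calc _ ≤ ‖(1 : ℂ)‖ + ‖((1 / ((n : ℝ) + 1) : ℝ) : ℂ)‖ := norm_add_le _ _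
    _ = 1 + 1 / ((n : ℝ) + 1) := by rw [Complex.norm_real, Real.norm_of_nonneg hp.le]; simp
    _ ≤ R := by linarith

/-- Lower bound, with an assumption on `L(1,χ)` for quadratic characters. -/
lemma L_lower {r : ℕ} [NeZero r] (χ : DirichletCharacter ℂ r) (hχ : χ ≠ 1) (l c : ℝ)
    (hl : 1 + Real.log (2 * r : ℕ) ≤ l) (hc : 0 < c) (hc1 : c ≤ 1)
    (hgood : χ^2 = 1 → c / l^3 ≤ ‖DirichletCharacter.LFunction χ 1‖)
    (x y : ℝ) (hx : 0 < x) (hx1 : x ≤ 1) :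
    c / (10^15 * (1 + |y|)^4 * l^12) ≤ ‖LSeries (fun n => χ n) (1 + x + Complex.I * y)‖ := by
  have hl1 : 1 ≤ l := by linarith [Real.log_natCast_nonneg (2 * r)]
  set τ := 1 + |y| with hτ
  have hτ1 : 1 ≤ τ := by rw [hτ]; linarith [abs_nonneg y]
  have hn2 : ∀ z : ℝ, 0 < z → z ≤ 1 → ‖(1 : ℂ) + z + 2 * Complex.I * y‖ ≤ 2 * τ := by
    intro z hz hz1
    calc _ ≤ ‖(1 : ℂ)‖ + ‖(z : ℂ)‖ + ‖2 * Complex.I * y‖ := norm_add₃_le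
      _ = 1 + z + 2 * |y| := by simp [abs_of_pos hz]
      _ ≤ _ := by rw [hτ]; linarith [abs_nonneg y]
  by_cases h2 : χ^2 = 1
  · set y0 := c / (200 * l^5) with hy0
    have hy0p : 0 < y0 := by positivity
    have hy01 : y0 ≤ 1 := by
      rw [hy0, div_le_one (by positivity)]
      have : 1 ≤ l^5 := one_le_pow₀ hl1
      linarith
    rcases le_total y0 |y| with hy | hy
    · have := lower_core χ hχ l hl y (200 / c * 17 * l^6) (by
          have : 1 ≤ l^6 := one_le_pow₀ hl1
          have h3 : 1 ≤ 200 / c := by rw [le_div_iff₀ hc]; linarith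
          have := one_le_mul_of_one_le_of_one_le h3 this
          nlinarith) (fun z hz hz1 => by
          rw [h2]
          refine (L_char0_up l hl _ (by simp; linarith)).trans ?_
          have a1 := hn2 z hz hz1
          have a2 : y0 ≤ ‖(1 : ℂ) + z + 2 * Complex.I * y - 1‖ := by
            have := Complex.abs_im_le_norm ((1 : ℂ) + z + 2 * Complex.I * y - 1)
            simp at this
            linarith [abs_nonneg y, abs_mul 2 y, abs_two (α := ℝ)]
          have a3 : 1 / ‖(1 : ℂ) + z + 2 * Complex.I * y - 1‖ ≤ 200 / c * l^5 := by
            refine (one_div_le_one_div_of_le hy0p a2).trans (le_of_eq ?_)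
            rw [hy0]; field_simp
          have h3 : 1 ≤ 200 / c := by rw [le_div_iff₀ hc]; linarith
          have h5 : l^5 ≤ l^6 := pow_le_pow_right₀ hl1 (by norm_num)
          have h6 : l ≤ l^6 := le_self_pow₀ hl1 (by norm_num)
          have h7 : 1 ≤ l^6 := one_le_pow₀ hl1
          have k1 : 200 / c * l^5 ≤ 200 / c * l^6 * τ := by
            calc _ ≤ 200 / c * l^6 * 1 := by rw [mul_one]; gcongr
              _ ≤ _ := by gcongr
          have k2 : 1 * 1 * τ ≤ 200 / c * l^6 * τ := by gcongr
          have k3 : 1 * l * τ ≤ 200 / c * l^6 * τ := by gcongr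
          have k4 : 7 * ‖(1 : ℂ) + z + 2 * Complex.I * y‖ * l ≤ 7 * (2 * τ) * l := by gcongr
          linarith) x hx hx1
      refine le_trans ?_ this
      rw [div_le_div_iff₀ (by positivity) (by positivity)]
      have e : c * (27 * 56^4 * (200 / c * 17 * l^6) * τ^4 * l^6) = (27 * 56^4 * 200 * 17) * (τ^4 * l^12) := by
        field_simp
      rw [e]
      have : 0 ≤ τ^4 * l^12 := by positivity
      nlinarith
    · have hτ2 : τ ≤ 2 := by rw [hτ]; linarith
      have hpw : 1 ≤ τ^4 := one_le_pow₀ hτ1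
      rcases le_total y0 x with hxx | hxx
      · have := L_lower_trivial χ (1 + x + Complex.I * y) (by simp; linarith) (by simp; linarith)
        simp at this
        refine le_trans ?_ this
        have e1 : c / (10^15 * τ^4 * l^12) ≤ y0 / 3 := by
          rw [hy0, div_div]
          apply div_le_div_of_nonneg_left hc.le (by positivity)
          have h5 : l^5 ≤ l^12 := pow_le_pow_right₀ hl1 (by norm_num)
          have : 1 * l^5 ≤ τ^4 * l^12 := by gcongr
          nlinarith [pow_nonneg (zero_le_one.trans hl1) 5]
        linarith
      · have h3 := L_one_diff χ hχ l hl (1 + x + Complex.I * y) (by simp; linarith) 4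
          ((norm_line x y hx hx1).trans (by linarith)) (by norm_num)
        have h4 : ‖(1 : ℂ) + x + Complex.I * y - 1‖ ≤ 2 * y0 := by
          have : (1 : ℂ) + x + Complex.I * y - 1 = x + Complex.I * y := by ring
          rw [this]
          calc _ ≤ ‖(x : ℂ)‖ + ‖Complex.I * y‖ := norm_add_le _ _
            _ = x + |y| := by simp [abs_of_pos hx]
            _ ≤ _ := by linarith
        have h5 := hgood h2
        have h6 := norm_sub_norm_le (DirichletCharacter.LFunction χ 1) (LSeries (fun n => χ n) (1 + x + Complex.I * y))
        rw [norm_sub_rev] at h6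
        have h7 : 14 * 4 * l^2 * ‖(1 : ℂ) + x + Complex.I * y - 1‖ ≤ 14 * 4 * l^2 * (2 * y0) := by gcongr
        have h8 : 14 * 4 * l^2 * (2 * y0) = 0.56 * (c / l^3) := by
          rw [hy0]; field_simp; norm_num
        have h9 : c / (10^15 * τ^4 * l^12) ≤ 0.44 * (c / l^3) := by
          rw [mul_div_assoc', div_le_div_iff₀ (by positivity) (by positivity)]
          have h5 : l^3 ≤ l^12 := pow_le_pow_right₀ hl1 (by norm_num)
          have : 1 * l^3 ≤ τ^4 * l^12 := by gcongr
          have p : 0 < l^3 := by positivity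
          nlinarith [mul_le_mul_of_nonneg_left this hc.le, mul_pos hc p]
        linarith
  · have := lower_core χ hχ l hl y (14 * l) (by linarith) (fun z hz hz1 => by
        have := L_char_up (χ^2) h2 l hl 0 (1 + z + 2 * Complex.I * y) (by simp; linarith)
        simp only [Function.iterate_zero, id] at this
        refine this.trans ?_
        norm_num
        calc 7 * ‖(1 : ℂ) + z + 2 * Complex.I * y‖ * l ≤ 7 * (2 * τ) * l := by gcongr; exact hn2 z hz hz1
          _ = _ := by ring) x hx hx1
    refine le_trans ?_ this
    rw [div_le_div_iff₀ (by positivity) (by positivity)]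
    have h7 : l^7 ≤ l^12 := pow_le_pow_right₀ hl1 (by norm_num)
    have e : c * (27 * 56^4 * (14 * l) * τ^4 * l^6) = c * ((27 * 56^4 * 14) * (τ^4 * l^7)) := by ring
    rw [e]
    have e2 : τ^4 * l^7 ≤ τ^4 * l^12 := by gcongr
    have e3 : 0 ≤ τ^4 * l^7 := by positivity
    nlinarith

end MT

namespace MT
open Finset Filter Topology

lemma real_char_vals {r : ℕ} [NeZero r] (χ : DirichletCharacter ℂ r) (h2 : χ^2 = 1) (a : ZMod r) :
    χ a = 0 ∨ χ a = 1 ∨ χ a = -1 := by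
  by_cases ha : IsUnit a
  · right
    have h := congrArg (fun ψ : DirichletCharacter ℂ r => ψ a) h2
    simp only [MulChar.pow_apply' _ (two_ne_zero), MulChar.one_apply ha] at h
    have h3 : (χ a - 1) * (χ a + 1) = 0 := by linear_combination h
    rcases mul_eq_zero.mp h3 with h | h
    · left; linear_combination h
    · right; linear_combination h
  · left; exact MulChar.map_nonunit _ ha

lemma euler_factor (a b : ℂ) (ha : a = 0 ∨ a = 1 ∨ a = -1) (hb : b = 0 ∨ b = 1 ∨ b = -1)
    (x : ℝ) (hx : 0 < x) (hx1 : x < 1) :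
    1 ≤ ‖(1 - x : ℂ)⁻¹ * (1 - a * x)⁻¹ * (1 - b * x)⁻¹ * (1 - a * b * x)⁻¹‖ := by
  have key : ∀ A B : ℝ, (A = 0 ∨ A = 1 ∨ A = -1) → (B = 0 ∨ B = 1 ∨ B = -1) →
      1 ≤ ‖((1 - x)⁻¹ * (1 - A * x)⁻¹ * (1 - B * x)⁻¹ * (1 - A * B * x)⁻¹ : ℝ)‖ := by
    intro A B hA hB
    have p1 : ∀ t : ℝ, -1 ≤ t → t ≤ 1 → 0 < 1 - t * x := by intro t h1 h2; nlinarith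
    have q1 : 0 < 1 - x := by linarith
    have hA1 : -1 ≤ A ∧ A ≤ 1 := by rcases hA with h | h | h <;> subst h <;> norm_num
    have hB1 : -1 ≤ B ∧ B ≤ 1 := by rcases hB with h | h | h <;> subst h <;> norm_num
    have hAB1 : -1 ≤ A * B ∧ A * B ≤ 1 := by
      rcases hA with h | h | h <;> rcases hB with h' | h' | h' <;> subst h <;> subst h' <;> norm_num
    have q2 := p1 A hA1.1 hA1.2
    have q3 := p1 B hB1.1 hB1.2
    have q4 := p1 (A * B) hAB1.1 hAB1.2
    rw [Real.norm_of_nonneg (by positivity), ← mul_inv, ← mul_inv, ← mul_inv]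
    refine (one_le_inv₀ (by positivity)).mpr ?_
    have s1 : x^2 ≤ 1 := by nlinarith
    have s2 : 0 ≤ 1 - x^2 := by linarith
    have t1 : (1 - x)^2 ≤ 1 := by nlinarith
    have t2 : (1 - x^2)^2 ≤ 1 := by nlinarith [sq_nonneg x]
    rcases hA with h | h | h <;> rcases hB with h' | h' | h' <;> subst h <;> subst h' <;> nlinarith [sq_nonneg x]
  have lift : ∀ a : ℂ, (a = 0 ∨ a = 1 ∨ a = -1) → ∃ A : ℝ, (A : ℂ) = a ∧ (A = 0 ∨ A = 1 ∨ A = -1) := by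
    intro a ha
    rcases ha with h | h | h
    · exact ⟨0, by simp [h], by simp⟩
    · exact ⟨1, by simp [h], by simp⟩
    · exact ⟨-1, by simp [h], by simp⟩
  obtain ⟨A, rfl, hA⟩ := lift a ha
  obtain ⟨B, rfl, hB⟩ := lift b hb
  have := key A B hA hB
  rw [← Complex.norm_real] at this
  push_cast at this
  exact this

lemma euler_four {r r' : ℕ} [NeZero r] [NeZero r'] (χ : DirichletCharacter ℂ r)
    (χ' : DirichletCharacter ℂ r') (h2 : χ^2 = 1) (h2' : χ'^2 = 1)
    (ψ : DirichletCharacter ℂ (r * r'))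
    (hψ : ∀ n : ℕ, ψ (n : ZMod (r * r')) = χ (n : ZMod r) * (starRingEnd ℂ) (χ' (n : ZMod r')))
    (δ : ℝ) (hδ : 0 < δ) :
    1 ≤ ‖LSeries (fun n => (1 : DirichletCharacter ℂ 1) n) (1 + δ)‖ * ‖LSeries (fun n => χ n) (1 + δ)‖ *
      ‖LSeries (fun n => χ' n) (1 + δ)‖ * ‖LSeries (fun n => ψ n) (1 + δ)‖ := by
  have hs : 1 < ((1 : ℂ) + δ).re := by simp; linarith
  have H := (((DirichletCharacter.LSeries_eulerProduct_hasProd (1 : DirichletCharacter ℂ 1) hs).mul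
    (DirichletCharacter.LSeries_eulerProduct_hasProd χ hs)).mul
    (DirichletCharacter.LSeries_eulerProduct_hasProd χ' hs)).mul
    (DirichletCharacter.LSeries_eulerProduct_hasProd ψ hs)
  rw [← norm_mul, ← norm_mul, ← norm_mul]
  refine ge_of_tendsto (Tendsto.norm H) ?_
  filter_upwards with S
  rw [norm_prod]
  refine Finset.one_le_prod fun p _ => ?_
  have hp : (0 : ℝ) < (p : ℕ) := by exact_mod_cast p.2.pos
  have hp1 : (1 : ℝ) < (p : ℕ) := by exact_mod_cast p.2.one_lt
  have hx : (((p : ℕ) : ℂ))^(-((1 : ℂ) + δ)) = ((((p : ℕ) : ℝ)^(-(1 + δ)) : ℝ) : ℂ) := by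
    rw [Complex.ofReal_cpow hp.le]; push_cast; rfl
  rw [hx]
  have h1 : (1 : DirichletCharacter ℂ 1) ((p : ℕ) : ZMod 1) = 1 :=
    MulChar.one_apply (isUnit_of_subsingleton _)
  have hv := real_char_vals χ h2 ((p : ℕ) : ZMod r)
  have hv' := real_char_vals χ' h2' ((p : ℕ) : ZMod r')
  have hconj : (starRingEnd ℂ) (χ' ((p : ℕ) : ZMod r')) = χ' ((p : ℕ) : ZMod r') := by
    rcases hv' with h | h | h <;> rw [h] <;> simp
  rw [hψ, hconj, h1, one_mul]
  exact euler_factor _ _ hv hv' _ (by positivity) (Real.rpow_lt_one_of_one_lt_of_neg hp1 (by linarith))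

lemma repulsion {r r' : ℕ} [NeZero r] [NeZero r'] (χ : DirichletCharacter ℂ r)
    (χ' : DirichletCharacter ℂ r') (hp : χ.IsPrimitive) (hp' : χ'.IsPrimitive)
    (hne : (⟨r, χ⟩ : Σ r, DirichletCharacter ℂ r) ≠ ⟨r', χ'⟩)
    (h1 : χ ≠ 1) (h1' : χ' ≠ 1) (h2 : χ^2 = 1) (h2' : χ'^2 = 1) (l : ℝ)
    (hl : 1 + Real.log (2 * (r * r') : ℕ) ≤ l)
    (hb : ‖DirichletCharacter.LFunction χ 1‖ ≤ 1 / (4816 * l^3))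
    (hb' : ‖DirichletCharacter.LFunction χ' 1‖ ≤ 1 / (4816 * l^3)) : False := by
  obtain ⟨ψ, hψ1, hψ⟩ := prod_char χ χ' hp hp' hne
  have hr := NeZero.pos r
  have hr' := NeZero.pos r'
  have hlr : 1 + Real.log (2 * r : ℕ) ≤ l := by
    refine le_trans ?_ hl
    gcongr
    exact Nat.le_mul_of_pos_right _ hr'
  have hlr' : 1 + Real.log (2 * r' : ℕ) ≤ l := by
    refine le_trans ?_ hl
    gcongr
    exact Nat.le_mul_of_pos_left _ hr
  have hl1 : 1 ≤ l := by linarith [Real.log_natCast_nonneg (2 * r)]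
  set δ := 1 / (134848 * l^5) with hδ
  have hδ0 : 0 < δ := by positivity
  have hδ1 : δ ≤ 1 := by
    rw [hδ, div_le_one (by positivity)]
    have : 1 ≤ l^5 := one_le_pow₀ hl1
    linarith
  have hs : 1 < ((1 : ℂ) + δ).re := by simp; linarith
  have hs2 : ((1 : ℂ) + δ).re ≤ 2 := by simp; linarith
  have hn : ‖(1 : ℂ) + δ‖ ≤ 2 := by
    have : (1 : ℂ) + δ = ((1 + δ : ℝ) : ℂ) := by push_cast; rfl
    rw [this, Complex.norm_real, Real.norm_of_nonneg (by linarith)]; linarith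
  have E := euler_four χ χ' h2 h2' ψ hψ δ hδ0
  have a0 := norm_L_le (fun n : ℕ => (1 : DirichletCharacter ℂ 1) n) (fun n => DirichletCharacter.norm_le_one _ _) _ hs hs2
  have a3 := L_char_up ψ hψ1 l hl 0 _ hs
  simp only [Function.iterate_zero, id] at a3
  have a3' : ‖LSeries (fun n => ψ n) (1 + δ)‖ ≤ 14 * l := by
    refine a3.trans ?_
    norm_num
    have : 7 * ‖(1 : ℂ) + δ‖ * l ≤ 7 * 2 * l := by gcongr
    linarith
  simp only [Complex.add_re, Complex.one_re, Complex.ofReal_re, add_sub_cancel_left] at a0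
  have hε : 1 / (4816 * l^3) = 28 * l^2 * δ := by rw [hδ]; field_simp; norm_num
  have hd : ‖(1 : ℂ) + δ - 1‖ = δ := by
    rw [add_sub_cancel_left, Complex.norm_real, Real.norm_of_nonneg hδ0.le]
  have a1 : ‖LSeries (fun n => χ n) (1 + δ)‖ ≤ 56 * l^2 * δ := by
    have := L_one_diff χ h1 l hlr _ hs 2 hn le_rfl
    rw [hd] at this
    have h4 := norm_sub_norm_le (LSeries (fun n => χ n) (1 + δ)) (DirichletCharacter.LFunction χ 1)
    linarith
  have a2 : ‖LSeries (fun n => χ' n) (1 + δ)‖ ≤ 56 * l^2 * δ := by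
    have := L_one_diff χ' h1' l hlr' _ hs 2 hn le_rfl
    rw [hd] at this
    have h4 := norm_sub_norm_le (LSeries (fun n => χ' n) (1 + δ)) (DirichletCharacter.LFunction χ' 1)
    linarith
  have : (1 : ℝ) ≤ (3 / δ) * (56 * l^2 * δ) * (56 * l^2 * δ) * (14 * l) := by
    refine E.trans ?_
    gcongr
  have e : (3 / δ) * (56 * l^2 * δ) * (56 * l^2 * δ) * (14 * l) = 131712 * (l^5 * δ) := by field_simp; norm_num
  rw [e, hδ] at this
  have e2 : l^5 * (1 / (134848 * l^5)) = 1 / 134848 := by field_simp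
  rw [e2] at this
  norm_num at this

/-- `Q` has no exceptional character. -/
def GoodQ (Q : ℕ) : Prop :=
  ∀ (r : ℕ) (_ : NeZero r), r ≤ Q → ∀ χ : DirichletCharacter ℂ r, χ.IsPrimitive → χ ≠ 1 → χ^2 = 1 →
    (1 / 10^6) / (1 + Real.log (2 * Q : ℕ))^3 ≤ ‖DirichletCharacter.LFunction χ 1‖

lemma exists_good (Q0 : ℕ) : ∃ Q, Q0 ≤ Q ∧ GoodQ Q := by
  by_contra hcon
  push Not at hcon
  have hbad : ∀ Q, ∃ X : Σ r, DirichletCharacter ℂ r, Q0 + 1 ≤ Q → (X.1 ≠ 0 ∧ X.1 ≤ Q ∧ X.2.IsPrimitive ∧ X.2 ≠ 1 ∧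
      X.2^2 = 1 ∧ ∀ _ : NeZero X.1, ‖DirichletCharacter.LFunction X.2 1‖ < (1 / 10^6) / (1 + Real.log (2 * Q : ℕ))^3) := by
    intro Q
    by_cases hQ : Q0 + 1 ≤ Q
    · have := hcon Q (by omega)
      unfold GoodQ at this
      push Not at this
      obtain ⟨r, hr, hrQ, χ, a, b, c, d⟩ := this
      exact ⟨⟨r, χ⟩, fun _ => ⟨hr.out, hrQ, a, b, c, fun _ => d⟩⟩
    · exact ⟨⟨1, 1⟩, fun h => absurd h hQ⟩
  choose X hX using hbad
  have hstep : ∀ Q, Q0 + 1 ≤ Q → X (Q + 1) = X Q := by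
    intro Q hQ
    by_contra hne
    obtain ⟨a0, a1, a2, a3, a4, a5⟩ := hX (Q + 1) (by omega)
    obtain ⟨b0, b1, b2, b3, b4, b5⟩ := hX Q hQ
    haveI : NeZero (X (Q + 1)).1 := ⟨a0⟩
    haveI : NeZero (X Q).1 := ⟨b0⟩
    have c1 := a5 inferInstance
    have c2 := b5 inferInstance
    set L := 1 + Real.log (2 * (Q + 1) : ℕ) with hL
    have hl2 : 0 ≤ Real.log (2 * (Q + 1) : ℕ) := Real.log_natCast_nonneg _
    have hL1 : 1 ≤ L := by linarith
    have hl0 : 0 ≤ Real.log (2 * Q : ℕ) := Real.log_natCast_nonneg _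
    have hLQ : L ≤ 2 * (1 + Real.log (2 * Q : ℕ)) := by
      have : Real.log (2 * (Q + 1) : ℕ) ≤ Real.log 2 + Real.log (2 * Q : ℕ) := by
        rw [← Real.log_mul (by norm_num) (by norm_cast; omega)]
        apply Real.log_le_log (by norm_cast; omega)
        norm_cast; omega
      have h2 : Real.log 2 ≤ 1 := by linarith [Real.log_two_lt_d9]
      linarith
    refine repulsion (X (Q + 1)).2 (X Q).2 a2 b2 hne a3 b3 a4 b4 (2 * L) ?_ ?_ ?_
    · have : Real.log (2 * ((X (Q + 1)).1 * (X Q).1) : ℕ) ≤ Real.log (2 * (Q + 1) : ℕ) + Real.log (2 * (Q + 1) : ℕ) := by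
        rw [← Real.log_mul (by norm_cast) (by norm_cast)]
        apply Real.log_le_log
        · have := Nat.pos_of_ne_zero a0; have := Nat.pos_of_ne_zero b0; norm_cast; positivity
        · norm_cast
          have : (X (Q + 1)).1 * (X Q).1 ≤ (Q + 1) * (Q + 1) := Nat.mul_le_mul a1 (by omega)
          nlinarith
      linarith
    · refine c1.le.trans ?_
      rw [div_div]
      apply one_div_le_one_div_of_le (by positivity)
      have : 0 < L^3 := by positivity
      nlinarith
    · refine c2.le.trans ?_
      rw [div_div]
      apply one_div_le_one_div_of_le (by positivity)
      have : L^3 ≤ (2 * (1 + Real.log (2 * Q : ℕ)))^3 := by gcongr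
      have : 0 < L^3 := by positivity
      nlinarith
  have hconst : ∀ Q, Q0 + 1 ≤ Q → X Q = X (Q0 + 1) := by
    intro Q hQ
    induction Q, hQ using Nat.le_induction with
    | base => rfl
    | succ n hn ih => rw [hstep n hn, ih]
  obtain ⟨b0, b1, b2, b3, b4, b5⟩ := hX (Q0 + 1) le_rfl
  haveI : NeZero (X (Q0 + 1)).1 := ⟨b0⟩
  have hne := DirichletCharacter.LFunction_apply_one_ne_zero b3
  have hpos : 0 < ‖DirichletCharacter.LFunction (X (Q0 + 1)).2 1‖ := norm_pos_iff.mpr hne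
  have hlim : Tendsto (fun Q : ℕ => ((1 : ℝ) / 10^6) / (1 + Real.log (2 * Q : ℕ))^3) atTop (𝓝 0) := by
    apply Tendsto.div_atTop tendsto_const_nhds
    refine (tendsto_pow_atTop (by norm_num)).comp (tendsto_atTop_add_const_left _ _ ?_)
    refine Real.tendsto_log_atTop.comp (tendsto_natCast_atTop_atTop.comp ?_)
    exact tendsto_id.const_mul_atTop' (by norm_num)
  obtain ⟨Q, hQ1, hQ2⟩ := ((hlim.eventually (gt_mem_nhds hpos)).and (eventually_ge_atTop (Q0 + 1))).exists
  have h3 := hX Q hQ2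
  rw [hconst Q hQ2] at h3
  have := h3.2.2.2.2.2 inferInstance
  linarith

end MT

namespace MT
open Finset Filter Topology

/-- Leibniz product of towers. -/
noncomputable def LP (u v : ℕ → ℝ → ℂ) (j : ℕ) (t : ℝ) : ℂ :=
  ∑ ij ∈ antidiagonal j, (j.choose ij.1 : ℂ) * (u ij.1 t * v ij.2 t)

lemma LP_deriv (u v : ℕ → ℝ → ℂ) (hu : ∀ j t, HasDerivAt (u j) (u (j+1) t) t)
    (hv : ∀ j t, HasDerivAt (v j) (v (j+1) t) t) (j : ℕ) (t : ℝ) :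
    HasDerivAt (LP u v j) (LP u v (j+1) t) t := by
  have h1 : LP u v (j+1) t = ∑ ij ∈ antidiagonal j, (j.choose ij.1 : ℂ) *
      (u (ij.1+1) t * v ij.2 t + u ij.1 t * v (ij.2+1) t) := by
    unfold LP
    rw [Finset.sum_antidiagonal_choose_succ_mul (fun a b => u a t * v b t) j]
    simp_rw [mul_add, Finset.sum_add_distrib]
    rw [add_comm]
    congr 1
    refine Finset.sum_congr rfl fun ij hij => ?_
    rw [← Nat.choose_symm_of_eq_add (HasAntidiagonal.mem_antidiagonal.mp hij).symm]
  rw [h1]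
  unfold LP
  have := HasDerivAt.fun_sum (u := antidiagonal j)
    (A := fun ij : ℕ × ℕ => fun t => (j.choose ij.1 : ℂ) * (u ij.1 t * v ij.2 t))
    (A' := fun ij => (j.choose ij.1 : ℂ) * (u (ij.1+1) t * v ij.2 t + u ij.1 t * v (ij.2+1) t))
    (x := t) (fun ij _ => ((hu ij.1 t).mul (hv ij.2 t)).const_mul _)
  exact this

lemma LP_rel (u v : ℕ → ℝ → ℂ) (hu : ∀ j t, HasDerivAt (u j) (u (j+1) t) t)
    (hv : ∀ j t, HasDerivAt (v j) (v (j+1) t) t) (c : ℂ)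
    (h0 : ∀ t, v 1 t = c * (u 0 t * v 0 t)) (j : ℕ) : ∀ t, v (j+1) t = c * LP u v j t := by
  induction j with
  | zero => intro t; simp [LP, h0 t]
  | succ j ih =>
    intro t
    have h1 := hv (j+1) t
    have h2 := (LP_deriv u v hu hv j t).const_mul c
    have h3 : v (j+1) = fun t => c * LP u v j t := funext ih
    rw [h3] at h1
    exact h1.unique h2

lemma quot_bound (K : ℕ) : ∃ C : ℝ, 0 < C ∧ ∀ (u v : ℕ → ℂ) (X : ℝ), 1 ≤ X →
    (∀ j ≤ K, v (j+1) = -Complex.I * ∑ ij ∈ antidiagonal j, (j.choose ij.1 : ℂ) * (u ij.1 * v ij.2)) →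
    (∀ j ≤ K+1, ‖v j‖ ≤ X) → 1 ≤ X * ‖v 0‖ → ∀ j ≤ K, ‖u j‖ ≤ C * X^(2*K+2) := by
  induction K with
  | zero =>
    refine ⟨1, one_pos, ?_⟩
    intro u v X hX h hv h0 j hj
    obtain rfl : j = 0 := by omega
    have h1 := h 0 le_rfl
    simp at h1
    have h2 := hv 1 le_rfl
    rw [h1] at h2
    simp at h2
    have : ‖u 0‖ * 1 ≤ ‖u 0‖ * (X * ‖v 0‖) := by gcongr
    simp
    nlinarith [norm_nonneg (u 0), norm_nonneg (v 0)]
  | succ K ih =>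
    obtain ⟨C, hC, hCb⟩ := ih
    set S : ℝ := ∑ ij ∈ antidiagonal K, ((K+1).choose ij.1 : ℝ) with hS
    have hS0 : 0 ≤ S := Finset.sum_nonneg fun _ _ => by positivity
    refine ⟨1 + S * C + C, by positivity, ?_⟩
    intro u v X hX h hv h0
    have hprev := hCb u v X hX (fun j hj => h j (by omega)) (fun j hj => hv j (by omega)) h0
    have hX0 : 0 < X := by linarith
    intro j hj
    by_cases hjK : j ≤ K
    · refine (hprev j hjK).trans ?_
      have : X^(2*K+2) ≤ X^(2*(K+1)+2) := pow_le_pow_right₀ hX (by omega)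
      have h5 : 0 ≤ X^(2*(K+1)+2) := by positivity
      nlinarith [mul_nonneg hS0 hC.le]
    · obtain rfl : j = K+1 := by omega
      have h1 := h (K+1) le_rfl
      rw [Finset.Nat.sum_antidiagonal_succ'] at h1
      simp only [Nat.choose_self, Nat.cast_one, one_mul] at h1
      set R : ℂ := ∑ p ∈ antidiagonal K, ((K+1).choose p.1 : ℂ) * (u p.1 * v (p.2+1)) with hR
      have hRb : ‖R‖ ≤ S * C * X^(2*K+3) := by
        rw [hR, hS, Finset.sum_mul, Finset.sum_mul]
        refine norm_sum_le_of_le _ fun p hp => ?_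
        have hp' := HasAntidiagonal.mem_antidiagonal.mp hp
        rw [norm_mul, norm_mul, Complex.norm_natCast]
        have a1 := hprev p.1 (by omega)
        have a2 := hv (p.2+1) (by omega)
        calc _ ≤ ((K+1).choose p.1 : ℝ) * ((C * X^(2*K+2)) * X) := by gcongr
          _ = _ := by ring
      have h2 : u (K+1) * v 0 = Complex.I * v (K+2) - R := by
        have : v (K+2) = -Complex.I * (u (K+1) * v 0 + R) := by
          rw [h1]
        rw [this]
        linear_combination (u (K+1) * v 0 + R) * Complex.I_mul_I
      have h3 : ‖u (K+1)‖ * ‖v 0‖ ≤ X + S * C * X^(2*K+3) := by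
        rw [← norm_mul, h2]
        refine (norm_sub_le _ _).trans ?_
        have := hv (K+2) (by omega)
        simp only [norm_mul, Complex.norm_I, one_mul]
        linarith
      have h4 : ‖u (K+1)‖ ≤ X * (X + S * C * X^(2*K+3)) := by
        calc ‖u (K+1)‖ = ‖u (K+1)‖ * 1 := by ring
          _ ≤ ‖u (K+1)‖ * (X * ‖v 0‖) := by gcongr
          _ = X * (‖u (K+1)‖ * ‖v 0‖) := by ring
          _ ≤ _ := by gcongr
      refine h4.trans ?_
      have e1 : X * (X + S * C * X^(2*K+3)) = X^2 + S * C * X^(2*(K+1)+2) := by ring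
      rw [e1]
      have e2 : X^2 ≤ X^(2*(K+1)+2) := pow_le_pow_right₀ hX (by omega)
      have h5 : 0 ≤ X^(2*(K+1)+2) := by positivity
      nlinarith [mul_nonneg hC.le h5]

/-- L-series tower on a vertical line. -/
noncomputable def TW (f : ℕ → ℂ) (δ : ℝ) (j : ℕ) (t : ℝ) : ℂ :=
  (-Complex.I)^j * LSeries (LSeries.logMul^[j] f) (1 + δ + Complex.I * t)

lemma absc_of (f : ℕ → ℂ) (hf : ∀ s : ℂ, 1 < s.re → LSeriesSummable f s) :
    LSeries.abscissaOfAbsConv f ≤ 1 := by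
  refine LSeries.abscissaOfAbsConv_le_of_forall_lt_LSeriesSummable fun y hy => ?_
  exact hf y (by simpa using hy)

lemma absc_iter (f : ℕ → ℂ) (j : ℕ) :
    LSeries.abscissaOfAbsConv (LSeries.logMul^[j] f) = LSeries.abscissaOfAbsConv f := by
  induction j with
  | zero => rfl
  | succ j ih => rw [Function.iterate_succ_apply', LSeries.abscissaOfAbsConv_logMul, ih]

lemma TW_deriv (f : ℕ → ℂ) (hf : ∀ s : ℂ, 1 < s.re → LSeriesSummable f s) (δ : ℝ) (hδ : 0 < δ)
    (j : ℕ) (t : ℝ) : HasDerivAt (TW f δ j) (TW f δ (j+1) t) t := by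
  have ha : LSeries.abscissaOfAbsConv (LSeries.logMul^[j] f) < ((1 + δ + Complex.I * t : ℂ).re : EReal) := by
    rw [absc_iter]
    refine lt_of_le_of_lt (absc_of f hf) ?_
    have : (1:ℝ) < (1 + δ + Complex.I * t : ℂ).re := by simp; exact hδ
    exact_mod_cast this
  have h1 := LSeries_hasDerivAt ha
  have h2 : HasDerivAt (fun t : ℝ => (1 + δ + Complex.I * t : ℂ)) (Complex.I) t := by
    have := ((Complex.ofRealCLM.hasDerivAt (x := t)).const_mul Complex.I).const_add (1 + δ : ℂ)
    simpa using this
  have h3 := (h1.comp t h2).const_mul ((-Complex.I)^j)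
  unfold TW
  convert! h3 using 1
  rw [Function.iterate_succ_apply']
  ring

/-- smooth cutoff supported in `[a,b]`, `a>0`. -/
structure Cut (w : ℝ → ℝ) (a b : ℝ) : Prop where
  smooth : ContDiff ℝ (⊤ : ℕ∞) w
  ha : 0 < a
  hab : a < b
  supp : ∀ x, w x ≠ 0 → a ≤ x ∧ x ≤ b

lemma cut_fourier (w : ℝ → ℝ) (a b : ℝ) (hw : Cut w a b) :
    ∃ h : SchwartzMap ℝ ℂ, ∀ x : ℝ, 0 < x →
      (w x : ℂ) = (x : ℂ)⁻¹ * ∫ t : ℝ, h t * Complex.exp (-(Complex.I * t * Real.log x)) := by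
  obtain ⟨h, hh⟩ := fourier_rep (fun u => Real.exp u * w (Real.exp u))
    (Real.contDiff_exp.mul (hw.smooth.comp Real.contDiff_exp))
    (HasCompactSupport.intro (isCompact_Icc (a := Real.log a) (b := Real.log b)) (by
      intro u hu
      by_contra hne
      have := hw.supp (Real.exp u) (by intro h0; simp [h0] at hne)
      apply hu
      refine ⟨?_, ?_⟩
      · rw [Real.log_le_iff_le_exp hw.ha]; exact this.1
      · rw [Real.le_log_iff_exp_le (hw.ha.trans hw.hab)]; exact this.2))
  refine ⟨h, fun x hx => ?_⟩
  rw [← hh (Real.log x), Real.exp_log hx]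
  have : (x : ℂ) ≠ 0 := by exact_mod_cast hx.ne'
  push_cast
  field_simp

/-- finite sum as a smooth integral of an L-series. -/
lemma smooth_integral (w : ℝ → ℝ) (a b : ℝ) (h : SchwartzMap ℝ ℂ) (hw : Cut w a b)
    (hh : ∀ x : ℝ, 0 < x →
      (w x : ℂ) = (x : ℂ)⁻¹ * ∫ t : ℝ, h t * Complex.exp (-(Complex.I * t * Real.log x)))
    (f : ℕ → ℂ) (hf : ∀ s : ℂ, 1 < s.re → LSeriesSummable f s) (δ : ℝ) (hδ : 0 < δ) (N : ℝ)
    (hN : 0 < N) (M : ℕ) (hM : b * N < M) :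
    ∑ n ∈ Ico 1 M, f n * (((n : ℝ) : ℂ)^(-δ : ℂ) * (w (n / N) : ℂ)) =
      N * ∫ t : ℝ, (h t * LSeries f (1 + δ + Complex.I * t)) *
        Complex.exp (Complex.I * t * Real.log N) := by
  set F : ℕ → ℝ → ℂ := fun n t => h t * LSeries.term f (1 + δ + Complex.I * t) n *
        Complex.exp (Complex.I * t * Real.log N) with hF
  have hre : ∀ t : ℝ, ((1 : ℂ) + δ + Complex.I * t).re = 1 + δ := by intro t; simp
  have hterm : ∀ (n : ℕ) (t : ℝ), LSeries.term f (1 + δ + Complex.I * t) n =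
      LSeries.term f (1 + δ) n * Complex.exp (-(Complex.I * t * Real.log n)) := by
    intro n t
    rcases Nat.eq_zero_or_pos n with rfl | hn
    · simp
    rw [LSeries.term_of_ne_zero hn.ne', LSeries.term_of_ne_zero hn.ne']
    have hn0 : (n : ℂ) ≠ 0 := by exact_mod_cast hn.ne'
    rw [Complex.cpow_add _ _ hn0, Complex.cpow_def_of_ne_zero hn0 (Complex.I * t), ← Complex.natCast_log,
      Complex.exp_neg]
    rw [div_mul_eq_div_div, div_eq_mul_inv (f n / _), mul_comm (Complex.ofReal _) (Complex.I * t)]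
  have hnormexp : ∀ x y : ℝ, ‖Complex.exp (Complex.I * x * y)‖ = 1 := by
    intro x y
    have : Complex.I * x * y = ((x * y : ℝ) : ℂ) * Complex.I := by push_cast; ring
    rw [this, Complex.norm_exp_ofReal_mul_I]
  have hnormexp' : ∀ x y : ℝ, ‖Complex.exp (-(Complex.I * x * y))‖ = 1 := by
    intro x y; rw [Complex.exp_neg, norm_inv, hnormexp, inv_one]
  have hnorm : ∀ n t, ‖F n t‖ = ‖LSeries.term f (1 + δ) n‖ * ‖h t‖ := by
    intro n t
    simp only [hF]
    rw [norm_mul, hnormexp, norm_mul, hterm, norm_mul, hnormexp']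
    ring
  have hcont : ∀ n, Continuous (F n) := by
    intro n
    simp only [hF, hterm]
    have := h.continuous
    fun_prop
  have hint0 : MeasureTheory.Integrable (fun t => ‖h t‖) := h.integrable.norm
  have hintg : ∀ n, MeasureTheory.Integrable (F n) := by
    intro n
    refine (hint0.const_mul ‖LSeries.term f (1 + δ) n‖).mono' (hcont n).aestronglyMeasurable ?_
    filter_upwards with t
    rw [hnorm]
  have hsum0 : Summable (fun n => ‖LSeries.term f (1 + δ) n‖) := by
    have := hf (1 + δ) (by simp; exact hδ)
    exact Summable.norm this
  have hsum : Summable (fun n => ∫ t, ‖F n t‖) := by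
    simp_rw [hnorm, MeasureTheory.integral_const_mul]
    exact hsum0.mul_right _
  have H := MeasureTheory.hasSum_integral_of_summable_integral_norm hintg hsum
  have hR : (∫ t : ℝ, ∑' n, F n t) = ∫ t : ℝ, (h t * LSeries f (1 + δ + Complex.I * t)) *
        Complex.exp (Complex.I * t * Real.log N) := by
    congr 1
    ext t
    simp only [hF, LSeries]
    rw [tsum_mul_right, tsum_mul_left]
  rw [hR] at H
  rw [← H.tsum_eq]
  have hval : ∀ n : ℕ, n ≠ 0 → (N : ℂ) * ∫ t, F n t = f n * (((n : ℝ) : ℂ)^(-δ : ℂ) * (w (n / N) : ℂ)) := by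
    intro n hn
    have hn0 : (n : ℂ) ≠ 0 := by exact_mod_cast hn
    have hn1 : (0 : ℝ) < n := by exact_mod_cast Nat.pos_of_ne_zero hn
    have hNC : (N : ℂ) ≠ 0 := by exact_mod_cast hN.ne'
    rw [hh _ (div_pos hn1 hN)]
    have e1 : ∀ t : ℝ, F n t = LSeries.term f (1 + δ) n *
        (h t * Complex.exp (-(Complex.I * t * Real.log (n / N)))) := by
      intro t
      simp only [hF]
      rw [hterm, Real.log_div hn1.ne' hN.ne']
      rw [Complex.ofReal_sub]
      rw [show -(Complex.I * t * (Complex.ofReal (Real.log n) - Complex.ofReal (Real.log N))) =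
        -(Complex.I * t * Complex.ofReal (Real.log n)) + Complex.I * t * Complex.ofReal (Real.log N) by ring,
        Complex.exp_add]
      ring
    simp_rw [e1]
    rw [MeasureTheory.integral_const_mul, LSeries.term_of_ne_zero hn, Complex.cpow_add _ _ hn0, Complex.cpow_one,
      Complex.cpow_neg]
    generalize (∫ t : ℝ, h t * Complex.exp (-(Complex.I * t * Real.log (n / N)))) = J
    push_cast
    have : (n : ℂ)^(δ : ℂ) ≠ 0 := by simp [Complex.cpow_eq_zero_iff, hn]
    field_simp
  rw [← tsum_mul_left, tsum_eq_sum (s := Ico 1 M)]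
  · refine Finset.sum_congr rfl fun n hn => ?_
    rw [hval n (by have := (Finset.mem_Ico.mp hn).1; omega)]
  · intro n hn
    rcases Nat.eq_zero_or_pos n with rfl | hn'
    · simp [hF]
    rw [hval n hn'.ne']
    have : w (n / N) = 0 := by
      by_contra hne
      have h2 := (hw.supp _ hne).2
      rw [div_le_iff₀ hN] at h2
      have : (n : ℝ) < M := lt_of_le_of_lt h2 hM
      have : n < M := by exact_mod_cast this
      exact hn (Finset.mem_Ico.mpr ⟨hn', this⟩)
    simp [this]

set_option maxHeartbeats 1600000 in
lemma psi_small (w : ℝ → ℝ) (a b : ℝ) (hw : Cut w a b) (K : ℕ) : ∃ (C : ℝ) (E : ℕ), 0 < C ∧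
    ∀ Q : ℕ, GoodQ Q → ∀ (r : ℕ) (_ : NeZero r), r ≤ Q → ∀ χ : DirichletCharacter ℂ r,
    χ.IsPrimitive → χ ≠ 1 → ∀ N : ℝ, 1 < N → ∀ M : ℕ, b * N < M →
    ‖∑ n ∈ Ico 1 M, (ArithmeticFunction.vonMangoldt n : ℂ) * χ n * (w (n / N) : ℂ)‖ ≤
      C * N * (1 + Real.log (2*Q : ℕ))^E / (Real.log N)^K := by
  obtain ⟨h, hh⟩ := cut_fourier w a b hw
  obtain ⟨C1, hC1, hq⟩ := quot_bound K
  set A : ℕ := 4*(2*K+2) + 2 with hA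
  choose C2 hC2 hdec using fun j => schwartz_decay h j A
  set Y0 : ℝ := 10^21 * (7 * 2^(K+1) * (K+1).factorial * 2) with hY0
  set C3 : ℝ := ∑ j ∈ range (K+1), ∑ ij ∈ antidiagonal j, (j.choose ij.1 : ℝ) * (C2 ij.1 * (C1 * Y0^(2*K+2)))
    with hC3
  have hY0p : 0 < Y0 := by positivity
  have hC3p : 0 ≤ C3 := Finset.sum_nonneg fun _ _ => Finset.sum_nonneg fun i _ => by
    have := hC2 i.1; positivity
  refine ⟨Real.pi * C3 + 1, (K+13)*(2*K+2), by positivity, ?_⟩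
  intro Q hQ r hr hrQ χ hprim hχ N hN M hM
  set l : ℝ := 1 + Real.log (2*Q : ℕ) with hl
  have hr0 : 0 < r := Nat.pos_of_ne_zero hr.out
  have hl1 : 1 ≤ l := by
    have : 0 ≤ Real.log (2*Q : ℕ) := Real.log_natCast_nonneg _
    linarith
  have hlr : 1 + Real.log (2*r : ℕ) ≤ l := by
    rw [hl]
    have : Real.log (2*r : ℕ) ≤ Real.log (2*Q : ℕ) := by
      apply Real.log_le_log
      · exact_mod_cast (by omega : 0 < 2 * r)
      · exact_mod_cast (by omega : 2*r ≤ 2*Q)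
    linarith
  have hlogN : 0 < Real.log N := Real.log_pos hN
  have hN0 : 0 < N := by linarith
  set f : ℕ → ℂ := fun n => χ n with hf
  set g : ℕ → ℂ := fun n => (ArithmeticFunction.vonMangoldt n : ℂ) * χ n with hg
  have hf1 : ∀ n, ‖f n‖ ≤ 1 := fun n => χ.norm_le_one _
  have hfs : ∀ s : ℂ, 1 < s.re → LSeriesSummable f s := fun s hs => by
    have := summable_logMul f hf1 0 s hs
    simpa using this
  have hgs : ∀ s : ℂ, 1 < s.re → LSeriesSummable g s := fun s hs => by
    have := DirichletCharacter.LSeriesSummable_twist_vonMangoldt χ hs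
    refine (LSeriesSummable_congr s fun {n} hn => ?_).mp this
    simp [hg, mul_comm]
  have hgL : ∀ s : ℂ, 1 < s.re → LSeries g s * LSeries f s = LSeries (LSeries.logMul f) s := fun s hs => by
    have h1 := DirichletCharacter.LSeries_twist_vonMangoldt_eq χ hs
    have h2 : LSeries g s = LSeries ((fun n : ℕ => χ n) * fun n : ℕ => (ArithmeticFunction.vonMangoldt n : ℂ)) s := by
      refine LSeries_congr (fun {n} hn => ?_) s
      simp [hg, mul_comm]
    have h3 : LSeries.abscissaOfAbsConv f < s.re :=
      lt_of_le_of_lt (absc_of f hfs) (by exact_mod_cast hs)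
    have h4 := LSeries_deriv h3
    have h5 := DirichletCharacter.LSeries_ne_zero_of_one_lt_re χ hs
    rw [h2, h1]
    simp only [hf] at h4 ⊢
    rw [h4]
    field_simp
  have main : ∀ δ : ℝ, 0 < δ → δ ≤ 1 →
      ‖∑ n ∈ Ico 1 M, g n * (((n : ℝ) : ℂ)^(-δ : ℂ) * (w (n / N) : ℂ))‖ ≤
      N * (Real.pi * (C3 * l^((K+13)*(2*K+2))) / (Real.log N)^K) := by
    intro δ hδ hδ1
    rw [smooth_integral w a b h hw hh g hgs δ hδ N hN0 M hM]
    rw [norm_mul, Complex.norm_real, Real.norm_of_nonneg hN0.le]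
    refine mul_le_mul_of_nonneg_left ?_ hN0.le
    set u := TW g δ with hu
    set v := TW f δ with hv
    have hu' := TW_deriv g hgs δ hδ
    have hv' := TW_deriv f hfs δ hδ
    have hre : ∀ t : ℝ, 1 < ((1 : ℂ) + δ + Complex.I * t).re := by intro t; simp; exact hδ
    have hrel : ∀ t, v 1 t = -Complex.I * (u 0 t * v 0 t) := by
      intro t
      simp only [hv, hu, TW, pow_one, pow_zero, one_mul, Function.iterate_one, Function.iterate_zero, id]
      rw [hgL _ (hre t)]
    have hrel' := LP_rel u v hu' hv' _ hrel
    set hj : ℕ → ℝ → ℂ := fun j t => iteratedDeriv j h t with hhj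
    have hhd : ∀ j t, HasDerivAt (hj j) (hj (j+1) t) t := by
      intro j t
      have hs : ContDiff ℝ (j+1 : ℕ) (h : ℝ → ℂ) := h.smooth _
      have : DifferentiableAt ℝ (iteratedDeriv j h) t :=
        (hs.differentiable_iteratedDeriv j (by exact_mod_cast Nat.lt_succ_self j)) t
      simp only [hhj, iteratedDeriv_succ]
      exact this.hasDerivAt
    have key := ibp_tower K (LP hj u) (C3 * l^((K+13)*(2*K+2))) (by positivity)
      (LP_deriv hj u hhd hu') ?_ (Real.log N) hlogN
    · have e : ∀ t, LP hj u 0 t = h t * LSeries g (1 + δ + Complex.I * t) := by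
        intro t; simp [LP, hhj, hu, TW]
      simp_rw [e] at key
      exact key
    · intro j hjK t
      set T : ℝ := 1 + |t| with hT
      have hT1 : 1 ≤ T := by rw [hT]; linarith [abs_nonneg t]
      set X : ℝ := Y0 * T^4 * l^(K+13) with hX
      have hX1 : 1 ≤ X := by
        have h1 : 1 ≤ T^4 := one_le_pow₀ hT1
        have h2 : 1 ≤ l^(K+13) := one_le_pow₀ hl1
        have h3 : 1 ≤ Y0 := by
          rw [hY0]
          have : (1:ℝ) ≤ 2^(K+1) := one_le_pow₀ (by norm_num)
          have : (1:ℝ) ≤ (K+1).factorial := by exact_mod_cast Nat.succ_le_of_lt (Nat.factorial_pos _)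
          nlinarith
        exact one_le_mul_of_one_le_of_one_le (one_le_mul_of_one_le_of_one_le h3 h1) h2
      have hs2 : ‖(1 : ℂ) + δ + Complex.I * t‖ ≤ 3 * T := by
        refine (norm_add_le _ _).trans ?_
        have h1 : ‖(1 : ℂ) + δ‖ ≤ 2 := by
          have : ((1 : ℂ) + δ) = ((1 + δ : ℝ) : ℂ) := by push_cast; ring
          rw [this, Complex.norm_real, Real.norm_of_nonneg (by linarith)]; linarith
        have h2 : ‖Complex.I * t‖ = |t| := by simp
        rw [h2, hT]; linarith [abs_nonneg t]
      have hvb : ∀ j ≤ K+1, ‖v j t‖ ≤ X := by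
        intro j hj
        have h1 := L_char_up χ hχ l hlr j _ (hre t)
        have h2 : ‖v j t‖ = ‖LSeries (LSeries.logMul^[j] f) (1 + δ + Complex.I * t)‖ := by
          simp [hv, TW]
        rw [h2]
        refine h1.trans ?_
        have e1 : (2:ℝ)^j ≤ 2^(K+1) := pow_le_pow_right₀ (by norm_num) hj
        have e2 : (j.factorial : ℝ) ≤ (K+1).factorial := by exact_mod_cast Nat.factorial_le hj
        have e3 : l^(j+1) ≤ l^(K+13) := pow_le_pow_right₀ hl1 (by omega)
        have e4 : T ≤ T^4 := le_self_pow₀ hT1 (by norm_num)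
        calc 7 * 2^j * j.factorial * ‖(1 : ℂ) + δ + Complex.I * t‖ * l^(j+1)
            ≤ 7 * 2^(K+1) * (K+1).factorial * (3 * T^4) * l^(K+13) := by gcongr; linarith
          _ ≤ X := by
            rw [hX, hY0]
            have : 0 ≤ (7 * 2^(K+1) * (K+1).factorial * T^4 * l^(K+13) : ℝ) := by positivity
            nlinarith
      have hv0 : 1 ≤ X * ‖v 0 t‖ := by
        have h1 := L_lower χ hχ l (1/10^6) hlr (by norm_num) (by norm_num)
          (fun h2 => hQ r hr hrQ χ hprim hχ h2) δ t hδ hδ1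
        have h2 : ‖v 0 t‖ = ‖LSeries f (1 + δ + Complex.I * t)‖ := by simp [hv, TW]
        rw [h2]
        refine le_trans ?_ (mul_le_mul_of_nonneg_left h1 (by positivity))
        have e3 : l^12 ≤ l^(K+13) := pow_le_pow_right₀ hl1 (by omega)
        have hp : 0 < (10^15 * T^4 * l^12 : ℝ) := by positivity
        rw [← mul_div_assoc, le_div_iff₀ hp, hX, hY0, one_mul]
        have f1 : (1:ℝ) ≤ 2^(K+1) := one_le_pow₀ (by norm_num)
        have f2 : (1:ℝ) ≤ (K+1).factorial := by exact_mod_cast Nat.succ_le_of_lt (Nat.factorial_pos _)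
        have f3 : (1:ℝ) ≤ 2^(K+1) * (K+1).factorial := one_le_mul_of_one_le_of_one_le f1 f2
        calc (10^15 * T^4 * l^12 : ℝ) ≤ 10^15 * T^4 * l^(K+13) * 1 := by rw [mul_one]; gcongr
          _ ≤ 10^15 * T^4 * l^(K+13) * (2^(K+1) * (K+1).factorial) := by gcongr
          _ ≤ _ := by
            have : 0 ≤ (10^15 * T^4 * l^(K+13) * (2^(K+1) * (K+1).factorial) : ℝ) := by positivity
            nlinarith
      have hub := hq (fun j => u j t) (fun j => v j t) X hX1
        (fun j _ => hrel' j t) hvb hv0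
      have hTA : (1 + t^2) * T^(4*(2*K+2)) ≤ T^A := by
        rw [hA, pow_add, mul_comm]
        gcongr
        rw [hT]; nlinarith [abs_nonneg t, sq_abs t]
      have h1t : (0:ℝ) < 1 + t^2 := by positivity
      rw [le_div_iff₀ h1t]
      have hterm : ∀ ij ∈ antidiagonal j, ‖(j.choose ij.1 : ℂ) * (hj ij.1 t * u ij.2 t)‖ * (1 + t^2) ≤
          (j.choose ij.1 : ℝ) * (C2 ij.1 * (C1 * Y0^(2*K+2))) * l^((K+13)*(2*K+2)) := by
        intro ij hij
        have hij' := HasAntidiagonal.mem_antidiagonal.mp hij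
        have b1 := hub ij.2 (by omega)
        have b2 := hdec ij.1 t
        rw [norm_mul, norm_mul, Complex.norm_natCast]
        calc (j.choose ij.1 : ℝ) * (‖hj ij.1 t‖ * ‖u ij.2 t‖) * (1 + t^2)
            ≤ (j.choose ij.1 : ℝ) * (‖hj ij.1 t‖ * (C1 * X^(2*K+2))) * (1 + t^2) := by gcongr
          _ = (j.choose ij.1 : ℝ) * ((((1 + t^2) * T^(4*(2*K+2))) * ‖hj ij.1 t‖) * (C1 * Y0^(2*K+2))) * l^((K+13)*(2*K+2)) := by
              rw [hX]; rw [mul_pow, mul_pow, ← pow_mul, ← pow_mul]; ring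
          _ ≤ (j.choose ij.1 : ℝ) * ((T^A * ‖hj ij.1 t‖) * (C1 * Y0^(2*K+2))) * l^((K+13)*(2*K+2)) := by gcongr
          _ ≤ (j.choose ij.1 : ℝ) * (C2 ij.1 * (C1 * Y0^(2*K+2))) * l^((K+13)*(2*K+2)) := by gcongr
      calc ‖LP hj u j t‖ * (1 + t^2) ≤ (∑ ij ∈ antidiagonal j, ‖(j.choose ij.1 : ℂ) * (hj ij.1 t * u ij.2 t)‖) * (1 + t^2) := by
            gcongr; exact norm_sum_le _ _
        _ ≤ ∑ ij ∈ antidiagonal j, (j.choose ij.1 : ℝ) * (C2 ij.1 * (C1 * Y0^(2*K+2))) * l^((K+13)*(2*K+2)) := by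
            rw [Finset.sum_mul]; exact Finset.sum_le_sum hterm
        _ = (∑ ij ∈ antidiagonal j, (j.choose ij.1 : ℝ) * (C2 ij.1 * (C1 * Y0^(2*K+2)))) * l^((K+13)*(2*K+2)) := by
            rw [Finset.sum_mul]
        _ ≤ C3 * l^((K+13)*(2*K+2)) := by
            gcongr
            rw [hC3]
            exact Finset.single_le_sum (f := fun j => ∑ ij ∈ antidiagonal j, (j.choose ij.1 : ℝ) * (C2 ij.1 * (C1 * Y0^(2*K+2))))
              (fun i _ => Finset.sum_nonneg fun i _ => by have := hC2 i.1; positivity) (Finset.mem_range.mpr (by omega))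
  have hlim : Tendsto (fun δ : ℝ => ‖∑ n ∈ Ico 1 M, g n * (((n : ℝ) : ℂ)^(-δ : ℂ) * (w (n / N) : ℂ))‖)
      (𝓝[>] 0) (𝓝 ‖∑ n ∈ Ico 1 M, g n * (w (n / N) : ℂ)‖) := by
    refine Tendsto.mono_left ?_ nhdsWithin_le_nhds
    refine Tendsto.norm (tendsto_finsetSum _ fun n hn => ?_)
    refine Tendsto.const_mul _ ?_
    have hn0 : ((n : ℝ) : ℂ) ≠ 0 := by
      have := (Finset.mem_Ico.mp hn).1
      exact_mod_cast (by omega : n ≠ 0)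
    have : Continuous fun δ : ℝ => ((n : ℝ) : ℂ)^(-δ : ℂ) := by
      refine Continuous.const_cpow (by fun_prop) (Or.inl hn0)
    have h2 := (this.tendsto 0).mul_const (w (n / N) : ℂ)
    simpa using h2
  have hfin : ‖∑ n ∈ Ico 1 M, g n * (w (n / N) : ℂ)‖ ≤ N * (Real.pi * (C3 * l^((K+13)*(2*K+2))) / (Real.log N)^K) := by
    refine le_of_tendsto hlim ?_
    have : Set.Ioc (0:ℝ) 1 ∈ 𝓝[>] (0:ℝ) := Ioc_mem_nhdsGT one_pos
    filter_upwards [this] with δ hδ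
    exact main δ hδ.1 hδ.2
  refine hfin.trans ?_
  rw [← mul_div_assoc]
  refine div_le_div_of_nonneg_right ?_ (by positivity)
  have : 0 ≤ N * l^((K+13)*(2*K+2)) := by positivity
  have e : (Real.pi * C3 + 1) * N * l^((K+13)*(2*K+2)) =
    N * (Real.pi * (C3 * l^((K+13)*(2*K+2)))) + N * l^((K+13)*(2*K+2)) := by ring
  rw [e]; linarith

end MT

namespace MT
open Finset Filter Topology

lemma sum_conv {α : Type*} [AddCommMonoid α] (G : ℕ × ℕ → α) (M : ℕ) :
    ∑ n ∈ Ico 1 M, ∑ x ∈ n.divisorsAntidiagonal, G x =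
      ∑ x ∈ (Ico 1 M ×ˢ Ico 1 M) with x.1 * x.2 < M, G x := by
  have hmap : ∀ x ∈ (Ico 1 M ×ˢ Ico 1 M).filter (fun x => x.1 * x.2 < M), x.1 * x.2 ∈ Ico 1 M := by
    intro x hx
    simp only [mem_filter, mem_product, mem_Ico] at hx ⊢
    exact ⟨Nat.mul_pos hx.1.1.1 hx.1.2.1, hx.2⟩
  rw [← Finset.sum_fiberwise_of_maps_to hmap]
  refine Finset.sum_congr rfl fun n hn => Finset.sum_congr ?_ fun _ _ => rfl
  ext x
  simp only [mem_filter, mem_product, mem_Ico, Nat.mem_divisorsAntidiagonal] at hn ⊢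
  constructor
  · rintro ⟨h1, h2⟩
    have h3 : 0 < x.1 := Nat.pos_of_ne_zero (by rintro h; rw [h] at h1; omega)
    have h4 : 0 < x.2 := Nat.pos_of_ne_zero (by rintro h; rw [h] at h1; omega)
    refine ⟨⟨⟨⟨h3, ?_⟩, ⟨h4, ?_⟩⟩, by omega⟩, h1⟩ <;> nlinarith
  · rintro ⟨_, h⟩
    exact ⟨h, by omega⟩

lemma tau_mul (d e : ℕ) : (d * e).divisors.card ≤ d.divisors.card * e.divisors.card := by
  rw [Nat.divisors_mul]; exact Finset.card_mul_le

lemma sum_conv_le (G : ℕ × ℕ → ℝ) (hG : ∀ x, 0 ≤ G x) (M : ℕ) :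
    ∑ n ∈ Ico 1 M, ∑ x ∈ n.divisorsAntidiagonal, G x ≤ ∑ d ∈ Ico 1 M, ∑ e ∈ Ico 1 M, G (d, e) := by
  rw [sum_conv, ← Finset.sum_product']
  exact Finset.sum_le_sum_of_subset_of_nonneg (Finset.filter_subset _ _) fun _ _ _ => hG _

lemma card_divAnti (n : ℕ) : (n.divisorsAntidiagonal.card) = n.divisors.card := by
  rw [← Nat.map_div_right_divisors, Finset.card_map]

lemma tau_sum (M : ℕ) (hM : 1 ≤ M) : ∑ n ∈ Ico 1 M, (n.divisors.card : ℝ) / n ≤ (1 + Real.log M)^2 := by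
  have h1 : ∀ n ∈ Ico 1 M, (n.divisors.card : ℝ) / n =
      ∑ x ∈ n.divisorsAntidiagonal, (1 / (x.1 : ℝ)) * (1 / (x.2 : ℝ)) := by
    intro n hn
    rw [Finset.sum_congr rfl (g := fun _ => 1 / (n : ℝ))]
    · rw [Finset.sum_const, card_divAnti]; simp [div_eq_mul_inv]
    · intro x hx
      have := (Nat.mem_divisorsAntidiagonal.mp hx).1
      rw [← this]; push_cast; rw [one_div_mul_one_div]
  rw [Finset.sum_congr rfl h1]
  refine (sum_conv_le (fun x => (1 / (x.1 : ℝ)) * (1 / (x.2 : ℝ))) (fun x => by positivity) M).trans ?_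
  simp only
  rw [← Finset.sum_mul_sum, sq]
  have := harmonic_le M hM
  have h0 : 0 ≤ ∑ n ∈ Ico 1 M, (1 : ℝ) / n := Finset.sum_nonneg fun _ _ => by positivity
  gcongr

lemma tau_sq_sum (M : ℕ) (hM : 1 ≤ M) :
    ∑ n ∈ Ico 1 M, (n.divisors.card : ℝ)^2 / n ≤ (1 + Real.log M)^4 := by
  have h1 : ∀ n ∈ Ico 1 M, (n.divisors.card : ℝ)^2 / n ≤
      ∑ x ∈ n.divisorsAntidiagonal, ((x.1.divisors.card : ℝ) / (x.1 : ℝ)) * ((x.2.divisors.card : ℝ) / (x.2 : ℝ)) := by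
    intro n hn
    have : (n.divisors.card : ℝ)^2 / n = ∑ x ∈ n.divisorsAntidiagonal, (n.divisors.card : ℝ) / n := by
      rw [Finset.sum_const, card_divAnti]; simp; ring
    rw [this]
    refine Finset.sum_le_sum fun x hx => ?_
    have := (Nat.mem_divisorsAntidiagonal.mp hx).1
    rw [← this, div_mul_div_comm]; push_cast
    gcongr
    exact_mod_cast tau_mul _ _
  refine (Finset.sum_le_sum h1).trans ?_
  refine (sum_conv_le (fun x => ((x.1.divisors.card : ℝ) / (x.1 : ℝ)) * ((x.2.divisors.card : ℝ) / (x.2 : ℝ)))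
    (fun x => by positivity) M).trans ?_
  simp only
  rw [← Finset.sum_mul_sum]
  have := tau_sum M hM
  have h0 : 0 ≤ ∑ n ∈ Ico 1 M, (n.divisors.card : ℝ) / n := Finset.sum_nonneg fun _ _ => by positivity
  calc _ ≤ (1 + Real.log M)^2 * (1 + Real.log M)^2 := by gcongr
    _ = _ := by ring

/-- family of primitive nonprincipal characters of conductor at most `R`. -/
def Fam (X : Finset (Σ r, DirichletCharacter ℂ r)) (R : ℕ) : Prop :=
  ∀ x ∈ X, x.1 ≠ 0 ∧ x.1 ≤ R ∧ x.2.IsPrimitive ∧ x.2 ≠ 1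

lemma Fam_card (X : Finset (Σ r, DirichletCharacter ℂ r)) (R : ℕ) (hX : Fam X R) : X.card ≤ R^2 := by
  have hmap : ∀ x ∈ X, x.1 ∈ Icc 1 R := fun x hx => by
    have := hX x hx
    exact Finset.mem_Icc.mpr ⟨Nat.pos_of_ne_zero this.1, this.2.1⟩
  rw [Finset.card_eq_sum_card_fiberwise hmap]
  have : ∀ r ∈ Icc 1 R, (X.filter (fun x => x.1 = r)).card ≤ R := by
    intro r hr
    rw [Finset.mem_Icc] at hr
    have : NeZero r := ⟨by omega⟩
    have hc := DirichletCharacter.card_eq_totient_of_hasEnoughRootsOfUnity ℂ r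
    have h1 : (X.filter (fun x => x.1 = r)).card ≤
        ((Finset.univ : Finset (DirichletCharacter ℂ r)).image (fun χ => (⟨r, χ⟩ : Σ r, DirichletCharacter ℂ r))).card := by
      apply Finset.card_le_card
      intro x hx
      rw [Finset.mem_filter] at hx
      obtain ⟨s, χ⟩ := x
      obtain rfl : s = r := hx.2
      exact Finset.mem_image.mpr ⟨χ, Finset.mem_univ _, rfl⟩
    refine h1.trans (Finset.card_image_le.trans ?_)
    rw [Finset.card_univ, ← Nat.card_eq_fintype_card, hc]
    exact (Nat.totient_le r).trans hr.2
  refine (Finset.sum_le_card_nsmul _ _ _ this).trans ?_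
  simp [sq]

lemma row_diag (a M : ℕ) (ha : 1 ≤ a) (hM : 1 ≤ M) (x : Σ r, DirichletCharacter ℂ r) :
    ‖∑ n ∈ Ico a M, x.2 (n : ZMod x.1) * (starRingEnd ℂ) (x.2 (n : ZMod x.1)) * ((1 / n : ℝ) : ℂ)‖ ≤ 1 + Real.log M := by
  refine le_trans ?_ (harmonic_le M hM)
  refine (norm_sum_le _ _).trans ?_
  refine le_trans (Finset.sum_le_sum (g := fun n : ℕ => (1 : ℝ) / n) fun n hn => ?_) ?_
  · rw [norm_mul, norm_mul, RCLike.norm_conj, Complex.norm_real, Real.norm_of_nonneg (by positivity)]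
    have := x.2.norm_le_one (n : ZMod x.1)
    have h2 : ‖x.2 (n : ZMod x.1)‖ * ‖x.2 (n : ZMod x.1)‖ ≤ 1 := by nlinarith [norm_nonneg (x.2 (n : ZMod x.1))]
    have h3 : (0:ℝ) ≤ 1 / n := by positivity
    nlinarith
  · exact Finset.sum_le_sum_of_subset_of_nonneg (Finset.Ico_subset_Ico_left ha) fun _ _ _ => by positivity

lemma row_off (a M : ℕ) (ha : 1 ≤ a) (haM : a ≤ M) (R : ℕ) (x y : Σ r, DirichletCharacter ℂ r)
    (hx : x.1 ≠ 0 ∧ x.1 ≤ R ∧ x.2.IsPrimitive ∧ x.2 ≠ 1) (hy : y.1 ≠ 0 ∧ y.1 ≤ R ∧ y.2.IsPrimitive ∧ y.2 ≠ 1)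
    (hne : x ≠ y) :
    ‖∑ n ∈ Ico a M, x.2 (n : ZMod x.1) * (starRingEnd ℂ) (y.2 (n : ZMod y.1)) * ((1 / n : ℝ) : ℂ)‖ ≤ 2 * R^2 / a := by
  have i1 : NeZero x.1 := ⟨hx.1⟩
  have i2 : NeZero y.1 := ⟨hy.1⟩
  have ha0 : (0:ℝ) < a := by exact_mod_cast ha
  have h := abel_deriv (fun n => x.2 (n : ZMod x.1) * (starRingEnd ℂ) (y.2 (n : ZMod y.1)))
    (fun t => ((1 / t : ℝ) : ℂ)) (fun t => ((-(t^2)⁻¹ : ℝ) : ℂ)) (fun t => 1 / t) (fun t => -(t^2)⁻¹)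
    _ (prod_char_interval x.2 y.2 hx.2.2.1 hy.2.2.1 hne) a M haM ?_ ?_ ?_
  · refine h.trans ?_
    have hM0 : (0:ℝ) < M := lt_of_lt_of_le ha0 (by exact_mod_cast haM)
    rw [Complex.norm_real, Real.norm_of_nonneg (by positivity)]
    have : (1:ℝ) / M + (1 / a - 1 / M) = 1 / a := by ring
    rw [this, mul_one_div]
    gcongr
    push_cast
    have b1 : (x.1 : ℝ) ≤ R := by exact_mod_cast hx.2.1
    have b2 : (y.1 : ℝ) ≤ R := by exact_mod_cast hy.2.1
    rw [sq]
    gcongr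
  · intro t ht
    have ht0 : t ≠ 0 := by linarith
    have := hasDerivAt_inv ht0
    simp only [one_div]
    exact this.ofReal_comp
  · intro t ht
    have ht0 : t ≠ 0 := by linarith
    simp only [one_div]
    exact hasDerivAt_inv ht0
  · intro t ht _
    rw [Complex.norm_real, norm_neg, neg_neg, Real.norm_of_nonneg (by positivity)]

lemma large_sieve (X : Finset (Σ r, DirichletCharacter ℂ r)) (R : ℕ) (hX : Fam X R) (a M : ℕ)
    (ha : 1 ≤ a) (haM : a ≤ M) (c : ℕ → ℂ) :
    ∑ x ∈ X, ‖∑ n ∈ Ico a M, c n * x.2 (n : ZMod x.1)‖^2 ≤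
      (1 + Real.log M + X.card * (2 * R^2 / a)) * ∑ n ∈ Ico a M, n * ‖c n‖^2 := by
  set D : ℝ := 1 + Real.log M + X.card * (2 * R^2 / a) with hD
  have hM1 : 1 ≤ M := ha.trans haM
  have hD0 : 0 ≤ D := by
    have : 0 ≤ Real.log M := Real.log_natCast_nonneg M
    positivity
  set S : (Σ r, DirichletCharacter ℂ r) → ℂ := fun x => ∑ n ∈ Ico a M, c n * x.2 (n : ZMod x.1) with hS
  set B : (Σ r, DirichletCharacter ℂ r) → (Σ r, DirichletCharacter ℂ r) → ℝ := fun x y =>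
    ‖∑ n ∈ Ico a M, x.2 (n : ZMod x.1) * (starRingEnd ℂ) (y.2 (n : ZMod y.1)) * ((1 / n : ℝ) : ℂ)‖ with hB
  have hrow : ∀ x ∈ X, ∑ y ∈ X, B x y ≤ D := by
    intro x hx
    rw [← Finset.add_sum_erase X _ hx]
    have h1 : B x x ≤ 1 + Real.log M := row_diag a M ha hM1 x
    have h2 : ∑ y ∈ X.erase x, B x y ≤ (X.erase x).card • (2 * R^2 / a : ℝ) := by
      refine Finset.sum_le_card_nsmul _ _ _ fun y hy => ?_
      rw [Finset.mem_erase] at hy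
      exact row_off a M ha haM R x y (hX x hx) (hX y hy.2) (Ne.symm hy.1)
    have h3 : ((X.erase x).card • (2 * R^2 / a : ℝ)) ≤ X.card * (2 * R^2 / a) := by
      rw [nsmul_eq_mul]
      have : ((X.erase x).card : ℝ) ≤ X.card := by exact_mod_cast Finset.card_le_card (Finset.erase_subset _ _)
      gcongr
    rw [hD]; linarith
  have hsymm : ∀ x y, B x y = B y x := by
    intro x y
    simp only [hB]
    rw [← RCLike.norm_conj]
    congr 1
    rw [map_sum]
    refine Finset.sum_congr rfl fun n _ => ?_
    simp only [map_mul, Complex.conj_conj, Complex.conj_ofReal]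
    ring
  set Z : ℝ := ∑ x ∈ X, ‖S x‖^2 with hZ
  set Y : ℝ := ∑ n ∈ Ico a M, n * ‖c n‖^2 with hY
  have hZ0 : 0 ≤ Z := Finset.sum_nonneg fun _ _ => by positivity
  have hY0 : 0 ≤ Y := Finset.sum_nonneg fun _ _ => by positivity
  set V : ℕ → ℂ := fun n => ∑ x ∈ X, (starRingEnd ℂ) (S x) * x.2 (n : ZMod x.1) with hV
  -- dual bound
  have hdual : ∑ n ∈ Ico a M, (1 / n : ℝ) * ‖V n‖^2 ≤ D * Z := by
    have e1 : ((∑ n ∈ Ico a M, (1 / n : ℝ) * ‖V n‖^2 : ℝ) : ℂ) =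
        ∑ x ∈ X, ∑ y ∈ X, (starRingEnd ℂ) (S x) * S y *
          ∑ n ∈ Ico a M, x.2 (n : ZMod x.1) * (starRingEnd ℂ) (y.2 (n : ZMod y.1)) * ((1 / n : ℝ) : ℂ) := by
      have : ∀ n ∈ Ico a M, (((1 / n : ℝ) * ‖V n‖^2 : ℝ) : ℂ) = ∑ x ∈ X, ∑ y ∈ X, (starRingEnd ℂ) (S x) * S y *
          (x.2 (n : ZMod x.1) * (starRingEnd ℂ) (y.2 (n : ZMod y.1)) * ((1 / n : ℝ) : ℂ)) := by
        intro n _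
        have : ((‖V n‖^2 : ℝ) : ℂ) = V n * (starRingEnd ℂ) (V n) := by
          rw [Complex.mul_conj, Complex.normSq_eq_norm_sq]
        rw [Complex.ofReal_mul, this]
        simp only [hV]
        rw [map_sum, Finset.sum_mul_sum, Finset.mul_sum]
        refine Finset.sum_congr rfl fun x _ => ?_
        rw [Finset.mul_sum]
        refine Finset.sum_congr rfl fun y _ => ?_
        simp only [map_mul, Complex.conj_conj]
        ring
      rw [Complex.ofReal_sum, Finset.sum_congr rfl this, Finset.sum_comm]
      refine Finset.sum_congr rfl fun x _ => ?_
      rw [Finset.sum_comm]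
      refine Finset.sum_congr rfl fun y _ => ?_
      exact (Finset.mul_sum _ _ _).symm
    have e2 : ∑ n ∈ Ico a M, (1 / n : ℝ) * ‖V n‖^2 ≤ ∑ x ∈ X, ∑ y ∈ X, ‖S x‖ * ‖S y‖ * B x y := by
      have h0 : 0 ≤ ∑ n ∈ Ico a M, (1 / n : ℝ) * ‖V n‖^2 := Finset.sum_nonneg fun _ _ => by positivity
      rw [← Real.norm_of_nonneg h0, ← Complex.norm_real, e1]
      refine (norm_sum_le _ _).trans (Finset.sum_le_sum fun x _ => (norm_sum_le _ _).trans (Finset.sum_le_sum fun y _ => ?_))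
      rw [norm_mul, norm_mul, RCLike.norm_conj]
    refine e2.trans ?_
    have e3 : ∑ x ∈ X, ∑ y ∈ X, ‖S x‖ * ‖S y‖ * B x y ≤
        ∑ x ∈ X, ∑ y ∈ X, (‖S x‖^2 * B x y / 2 + ‖S y‖^2 * B y x / 2) := by
      refine Finset.sum_le_sum fun x _ => Finset.sum_le_sum fun y _ => ?_
      rw [hsymm y x]
      have : 0 ≤ B x y := norm_nonneg _
      nlinarith [mul_nonneg this (sq_nonneg (‖S x‖ - ‖S y‖))]
    refine e3.trans ?_
    simp_rw [Finset.sum_add_distrib]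
    rw [Finset.sum_comm (f := fun x y => ‖S y‖^2 * B y x / 2), ← two_mul]
    rw [hZ, Finset.mul_sum, Finset.mul_sum]
    refine Finset.sum_le_sum fun x hx => ?_
    rw [← Finset.sum_div, ← Finset.mul_sum]
    have := hrow x hx
    have h4 : 0 ≤ ‖S x‖^2 := by positivity
    nlinarith
  have hZeq : (Z : ℂ) = ∑ n ∈ Ico a M, c n * V n := by
    simp only [hV, hZ]
    simp_rw [Finset.mul_sum]
    rw [Finset.sum_comm, Complex.ofReal_sum]
    refine Finset.sum_congr rfl fun x _ => ?_
    have : ((‖S x‖^2 : ℝ) : ℂ) = (starRingEnd ℂ) (S x) * S x := by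
      rw [mul_comm, Complex.mul_conj, Complex.normSq_eq_norm_sq]
    rw [this]
    conv_lhs => rw [hS]
    simp only
    rw [Finset.mul_sum]
    refine Finset.sum_congr rfl fun n _ => ?_
    ring
  have hCS : Z^2 ≤ Y * (D * Z) := by
    have h1 : Z ≤ ∑ n ∈ Ico a M, (Real.sqrt n * ‖c n‖) * (Real.sqrt (1 / n) * ‖V n‖) := by
      rw [← Real.norm_of_nonneg hZ0, ← Complex.norm_real, hZeq]
      refine (norm_sum_le _ _).trans (Finset.sum_le_sum fun n hn => ?_)
      have hn1 : (0:ℝ) < n := by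
        have := (Finset.mem_Ico.mp hn).1
        exact_mod_cast (by omega : 0 < n)
      have : Real.sqrt n * Real.sqrt (1 / n) = 1 := by
        rw [← Real.sqrt_mul hn1.le, mul_one_div_cancel hn1.ne', Real.sqrt_one]
      rw [norm_mul]
      calc ‖c n‖ * ‖V n‖ = (Real.sqrt n * Real.sqrt (1 / n)) * (‖c n‖ * ‖V n‖) := by rw [this, one_mul]
        _ ≤ _ := le_of_eq (by ring)
    have h2 := Finset.sum_mul_sq_le_sq_mul_sq (Ico a M) (fun n : ℕ => Real.sqrt n * ‖c n‖)
      (fun n : ℕ => Real.sqrt (1 / n) * ‖V n‖)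
    have h3 : ∑ n ∈ Ico a M, (Real.sqrt n * ‖c n‖)^2 = Y := by
      refine Finset.sum_congr rfl fun n _ => ?_
      rw [mul_pow, Real.sq_sqrt (by positivity)]
    have h4 : ∑ n ∈ Ico a M, (Real.sqrt (1 / n) * ‖V n‖)^2 = ∑ n ∈ Ico a M, (1 / n : ℝ) * ‖V n‖^2 := by
      refine Finset.sum_congr rfl fun n _ => ?_
      rw [mul_pow, Real.sq_sqrt (by positivity)]
    rw [h3, h4] at h2
    calc Z^2 ≤ _ := pow_le_pow_left₀ hZ0 h1 2
      _ ≤ _ := h2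
      _ ≤ _ := by gcongr
  rcases hZ0.eq_or_lt with h | h
  · rw [← h]; positivity
  · nlinarith

end MT

namespace MT
open Finset Filter Topology

/-- truncation of an arithmetic function. -/
noncomputable def cutA (f : ArithmeticFunction ℝ) (U : ℕ) : ArithmeticFunction ℝ :=
  ⟨fun n => if n < U then f n else 0, by simp⟩

lemma cutA_apply (f : ArithmeticFunction ℝ) (U n : ℕ) : cutA f U n = if n < U then f n else 0 := rfl

/-- real-valued Moebius. -/
noncomputable def muR : ArithmeticFunction ℝ := ((ArithmeticFunction.moebius : ArithmeticFunction ℤ) : ArithmeticFunction ℝ)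

/-- real-valued zeta. -/
noncomputable def zeR : ArithmeticFunction ℝ := ((ArithmeticFunction.zeta : ArithmeticFunction ℕ) : ArithmeticFunction ℝ)

lemma zeR_mul_muR : zeR * muR = 1 := by
  unfold zeR muR
  exact ArithmeticFunction.coe_zeta_mul_coe_moebius

lemma muR_abs (n : ℕ) : |muR n| ≤ 1 := by
  unfold muR
  rw [ArithmeticFunction.intCoe_apply]
  have := ArithmeticFunction.abs_moebius_le_one (n := n)
  exact_mod_cast this

lemma zeR_abs (n : ℕ) : |zeR n| ≤ 1 := by
  unfold zeR
  rw [ArithmeticFunction.natCoe_apply, ArithmeticFunction.zeta_apply]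
  split_ifs <;> simp

open ArithmeticFunction in
lemma vaughan (U : ℕ) : vonMangoldt = cutA vonMangoldt U + cutA muR U * log
    - (cutA vonMangoldt U * cutA muR U) * zeR
    + (vonMangoldt - cutA vonMangoldt U) * (1 - zeR * cutA muR U) := by
  have h : log = vonMangoldt * zeR := vonMangoldt_mul_zeta.symm
  rw [h]; ring

lemma subA_apply (f g : ArithmeticFunction ℝ) (n : ℕ) : (f - g) n = f n - g n := by
  have h : f = (f - g) + g := by ring
  have h2 := congrArg (fun F : ArithmeticFunction ℝ => F n) h
  simp only [ArithmeticFunction.add_apply] at h2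
  linarith

lemma bcoef_zero (U n : ℕ) (hn : n < U) : (1 - zeR * cutA muR U) n = 0 := by
  have h : (zeR * cutA muR U) n = (zeR * muR) n := by
    rw [ArithmeticFunction.mul_apply, ArithmeticFunction.mul_apply]
    refine Finset.sum_congr rfl fun x hx => ?_
    have := Nat.mem_divisorsAntidiagonal.mp hx
    have h2 : x.2 < U := lt_of_le_of_lt (Nat.le_of_dvd (Nat.pos_of_ne_zero this.2) ⟨x.1, by rw [← this.1]; ring⟩) hn
    rw [cutA_apply, if_pos h2]
  rw [subA_apply, h, zeR_mul_muR, sub_self]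

lemma bcoef_abs (U n : ℕ) (hU : 2 ≤ U) : |(1 - zeR * cutA muR U) n| ≤ n.divisors.card := by
  by_cases hn : n < U
  · rw [bcoef_zero U n hn]; simp
  · rw [subA_apply, ArithmeticFunction.one_apply_ne (by omega), zero_sub, abs_neg,
      ArithmeticFunction.mul_apply]
    refine (Finset.abs_sum_le_sum_abs _ _).trans ?_
    rw [← card_divAnti]
    refine (Finset.sum_le_card_nsmul _ _ 1 fun x _ => ?_).trans (by simp)
    rw [abs_mul, cutA_apply]
    have h1 := zeR_abs x.1
    have h2 : |if x.2 < U then muR x.2 else 0| ≤ 1 := by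
      split_ifs
      · exact muR_abs _
      · simp
    nlinarith [abs_nonneg (zeR x.1), abs_nonneg (if x.2 < U then muR x.2 else 0)]

lemma acoef_zero (U m : ℕ) (hm : U^2 ≤ m) : (cutA ArithmeticFunction.vonMangoldt U * cutA muR U) m = 0 := by
  rw [ArithmeticFunction.mul_apply]
  refine Finset.sum_eq_zero fun x hx => ?_
  have := Nat.mem_divisorsAntidiagonal.mp hx
  rw [cutA_apply, cutA_apply]
  by_cases h1 : x.1 < U
  · by_cases h2 : x.2 < U
    · exfalso
      have : x.1 * x.2 < U * U := by
        have : 0 < U := by omega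
        nlinarith
      nlinarith
    · simp [h2]
  · simp [h1]

lemma acoef_abs (U m : ℕ) : |(cutA ArithmeticFunction.vonMangoldt U * cutA muR U) m| ≤ Real.log m := by
  rw [ArithmeticFunction.mul_apply]
  refine (Finset.abs_sum_le_sum_abs _ _).trans ?_
  have h : Real.log m = ∑ x ∈ m.divisorsAntidiagonal, ArithmeticFunction.vonMangoldt x.1 := by
    rw [← ArithmeticFunction.vonMangoldt_sum, Nat.sum_divisorsAntidiagonal (fun i _ => ArithmeticFunction.vonMangoldt i)]
  rw [h]
  refine Finset.sum_le_sum fun x _ => ?_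
  rw [abs_mul, cutA_apply, cutA_apply]
  have hΛ : 0 ≤ ArithmeticFunction.vonMangoldt x.1 := ArithmeticFunction.vonMangoldt_nonneg
  have h2 : |if x.2 < U then muR x.2 else 0| ≤ 1 := by
    split_ifs
    · exact muR_abs _
    · simp
  have h1 : |if x.1 < U then ArithmeticFunction.vonMangoldt x.1 else 0| ≤ ArithmeticFunction.vonMangoldt x.1 := by
    split_ifs
    · rw [abs_of_nonneg hΛ]
    · simpa using hΛ
  calc _ ≤ ArithmeticFunction.vonMangoldt x.1 * 1 := by gcongr
    _ = _ := mul_one _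

lemma rect (w : ℝ → ℝ) (a b : ℝ) (hw : Cut w a b) (α β : ArithmeticFunction ℝ) {r : ℕ} (χ : DirichletCharacter ℂ r)
    (N : ℝ) (hN : 0 < N) (M : ℕ) (hM : b * N < M) :
    ∑ n ∈ Ico 1 M, ((α * β) n : ℂ) * χ n * (w (n / N) : ℂ) =
      ∑ m ∈ Ico 1 M, ∑ n ∈ Ico 1 M, ((α m : ℂ) * χ m) * (((β n : ℂ) * χ n) * (w (m * n / N) : ℂ)) := by
  have h1 : ∀ n ∈ Ico 1 M, ((α * β) n : ℂ) * χ n * (w (n / N) : ℂ) =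
      ∑ x ∈ n.divisorsAntidiagonal, ((α x.1 : ℂ) * χ x.1) * (((β x.2 : ℂ) * χ x.2) * (w (x.1 * x.2 / N) : ℂ)) := by
    intro n _
    rw [ArithmeticFunction.mul_apply, Complex.ofReal_sum, Finset.sum_mul, Finset.sum_mul]
    refine Finset.sum_congr rfl fun x hx => ?_
    have := (Nat.mem_divisorsAntidiagonal.mp hx).1
    rw [← this]
    push_cast
    rw [map_mul]
    ring
  rw [Finset.sum_congr rfl h1,
    sum_conv (fun x => ((α x.1 : ℂ) * χ x.1) * (((β x.2 : ℂ) * χ x.2) * (w (x.1 * x.2 / N) : ℂ))),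
    Finset.sum_filter_of_ne, Finset.sum_product]
  intro x _ hne
  by_contra hlt
  apply hne
  have : w (x.1 * x.2 / N) = 0 := by
    by_contra h
    have h2 := (hw.supp _ h).2
    rw [div_le_iff₀ hN] at h2
    have h3 : ((x.1 * x.2 : ℕ) : ℝ) < M := by push_cast; linarith
    exact hlt (by exact_mod_cast h3)
  rw [this]; simp

lemma cut_lip (w : ℝ → ℝ) (a b : ℝ) (hw : Cut w a b) :
    ∃ L : ℝ, 0 < L ∧ (∀ x, |w x| ≤ L) ∧ ∀ x y, |w x - w y| ≤ L * |x - y| := by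
  have hc : HasCompactSupport w := HasCompactSupport.intro (isCompact_Icc (a := a) (b := b)) (by
    intro x hx
    by_contra h
    exact hx (hw.supp x h))
  obtain ⟨K, hK⟩ := ContDiff.lipschitzWith_of_hasCompactSupport hc hw.smooth (by simp)
  obtain ⟨C, hC⟩ := hc.exists_bound_of_continuous hw.smooth.continuous
  have hC0 : 0 ≤ C := (norm_nonneg _).trans (hC 0)
  refine ⟨C + K + 1, by positivity, fun x => ?_, fun x y => ?_⟩
  · have := hC x
    rw [Real.norm_eq_abs] at this
    linarith [K.2]
  · have := hK.dist_le_mul x y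
    rw [Real.dist_eq, Real.dist_eq] at this
    nlinarith [abs_nonneg (x - y), K.2]

lemma inner1 (w : ℝ → ℝ) (L : ℝ) (hL : 0 < L) (hb : ∀ x, |w x| ≤ L) (hl : ∀ x y, |w x - w y| ≤ L * |x - y|)
    {r : ℕ} [NeZero r] (χ : DirichletCharacter ℂ r) (hχ : χ ≠ 1) (N κ : ℝ) (hN : 0 < N) (M : ℕ) (hM1 : 1 ≤ M)
    (hκ : M ≤ κ * N) (m : ℕ) (hm : 1 ≤ m) :
    ‖∑ n ∈ Ico 1 M, χ n * (w (m * n / N) : ℂ)‖ ≤ 2 * r * (L * (1 + κ) * m) := by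
  have h := abel_bound (fun n => χ n) (fun n => (w (m * n / N) : ℂ)) _ (char_interval χ hχ) 1 M hM1
  refine h.trans ?_
  push_cast
  refine mul_le_mul_of_nonneg_left ?_ (by positivity)
  have h1 : ‖(w (m * M / N) : ℂ)‖ ≤ L := by rw [Complex.norm_real]; exact hb _
  have hm1 : (1:ℝ) ≤ m := by exact_mod_cast hm
  have h2 : ∑ n ∈ Ico 1 M, ‖((w (m * (n + 1) / N) : ℂ)) - (w (m * n / N) : ℂ)‖ ≤ ∑ n ∈ Ico 1 M, L * (m / N) := by
    refine Finset.sum_le_sum fun n _ => ?_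
    rw [← Complex.ofReal_sub, Complex.norm_real]
    refine (hl _ _).trans (le_of_eq ?_)
    have : (m : ℝ) * (n + 1) / N - m * n / N = m / N := by ring
    rw [this, abs_of_nonneg (by positivity)]
  have h3 : ∑ n ∈ Ico 1 M, L * (m / N) ≤ L * κ * m := by
    rw [Finset.sum_const, Nat.card_Ico, nsmul_eq_mul]
    have : ((M - 1 : ℕ) : ℝ) ≤ M := by exact_mod_cast Nat.sub_le _ _
    calc ((M - 1 : ℕ) : ℝ) * (L * (m / N)) ≤ (κ * N) * (L * (m / N)) := by gcongr; linarith
      _ = L * κ * m := by field_simp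
  have h4 : L ≤ L * m := by nlinarith
  nlinarith

lemma inner2 (w : ℝ → ℝ) (L : ℝ) (hL : 0 < L) (hb : ∀ x, |w x| ≤ L) (hl : ∀ x y, |w x - w y| ≤ L * |x - y|)
    {r : ℕ} [NeZero r] (χ : DirichletCharacter ℂ r) (hχ : χ ≠ 1) (N κ : ℝ) (hN : 0 < N) (M : ℕ) (hM1 : 1 ≤ M)
    (hκ : M ≤ κ * N) (m : ℕ) (hm : 1 ≤ m) :
    ‖∑ n ∈ Ico 1 M, χ n * (((Real.log n : ℝ) : ℂ) * (w (m * n / N) : ℂ))‖ ≤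
      2 * r * (L * (2 + κ) * Real.log M * m) := by
  have h := abel_bound (fun n => χ n) (fun n => (((Real.log n : ℝ) : ℂ) * (w (m * n / N) : ℂ))) _
    (char_interval χ hχ) 1 M hM1
  refine h.trans ?_
  rw [show ((2 * r : ℕ) : ℝ) = 2 * r by push_cast; rfl]
  refine mul_le_mul_of_nonneg_left ?_ (by positivity)
  have hlM : 0 ≤ Real.log M := Real.log_natCast_nonneg M
  have h1 : ‖((Real.log M : ℝ) : ℂ) * (w (m * M / N) : ℂ)‖ ≤ L * Real.log M := by
    rw [norm_mul, Complex.norm_real, Complex.norm_real, Real.norm_of_nonneg hlM, mul_comm]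
    gcongr; exact hb _
  have hm1 : (1:ℝ) ≤ m := by exact_mod_cast hm
  have h2 : ∑ n ∈ Ico 1 M, ‖((Real.log ((n + 1 : ℕ) : ℝ) : ℝ) : ℂ) * (w (m * ((n + 1 : ℕ) : ℝ) / N) : ℂ) - ((Real.log n : ℝ) : ℂ) * (w (m * n / N) : ℂ)‖ ≤
      ∑ n ∈ Ico 1 M, (Real.log M * (L * (m / N)) + L * (Real.log ((n + 1 : ℕ) : ℝ) - Real.log (n : ℝ))) := by
    refine Finset.sum_le_sum fun n hn => ?_
    rw [Finset.mem_Ico] at hn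
    have e1 : ((n + 1 : ℕ) : ℝ) = n + 1 := by push_cast; rfl
    rw [← Complex.ofReal_mul, ← Complex.ofReal_mul, ← Complex.ofReal_sub, Complex.norm_real]
    have e2 : Real.log ((n + 1 : ℕ) : ℝ) * w (m * ((n + 1 : ℕ) : ℝ) / N) - Real.log n * w (m * n / N) =
        Real.log ((n + 1 : ℕ) : ℝ) * (w (m * ((n + 1 : ℕ) : ℝ) / N) - w (m * n / N)) +
        (Real.log ((n + 1 : ℕ) : ℝ) - Real.log n) * w (m * n / N) := by ring
    rw [e2]
    refine (norm_add_le _ _).trans ?_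
    rw [norm_mul, norm_mul]
    have n1 : (0:ℝ) < n := by exact_mod_cast hn.1
    have l1 : Real.log ((n + 1 : ℕ) : ℝ) ≤ Real.log M := by
      apply Real.log_le_log
      · positivity
      · exact_mod_cast hn.2
    have l2 : 0 ≤ Real.log ((n + 1 : ℕ) : ℝ) := Real.log_natCast_nonneg _
    have l3 : Real.log n ≤ Real.log ((n + 1 : ℕ) : ℝ) := by
      apply Real.log_le_log n1; push_cast; linarith
    have w1 := hl (m * ((n + 1 : ℕ) : ℝ) / N) (m * n / N)
    have : (m : ℝ) * ((n + 1 : ℕ) : ℝ) / N - m * n / N = m / N := by rw [e1]; ring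
    rw [this, abs_of_nonneg (by positivity : (0:ℝ) ≤ m / N)] at w1
    rw [Real.norm_of_nonneg l2, Real.norm_of_nonneg (sub_nonneg.mpr l3), Real.norm_eq_abs, Real.norm_eq_abs]
    have w2 := hb (m * n / N)
    have : 0 ≤ Real.log ((n + 1 : ℕ) : ℝ) - Real.log n := sub_nonneg.mpr l3
    calc _ ≤ Real.log M * (L * (m / N)) + (Real.log ((n + 1 : ℕ) : ℝ) - Real.log n) * L := by gcongr
      _ = _ := by ring
  have h3 : ∑ n ∈ Ico 1 M, (Real.log M * (L * (m / N)) + L * (Real.log ((n + 1 : ℕ) : ℝ) - Real.log (n : ℝ))) ≤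
      L * κ * Real.log M * m + L * Real.log M := by
    rw [Finset.sum_add_distrib, ← Finset.mul_sum _ _ L, Finset.sum_Ico_sub (fun n : ℕ => Real.log n) hM1,
      Finset.sum_const, Nat.card_Ico, nsmul_eq_mul]
    have : ((M - 1 : ℕ) : ℝ) ≤ M := by exact_mod_cast Nat.sub_le _ _
    have e : ((M - 1 : ℕ) : ℝ) * (Real.log M * (L * (m / N))) ≤ L * κ * Real.log M * m := by
      calc ((M - 1 : ℕ) : ℝ) * (Real.log M * (L * (m / N))) ≤ (κ * N) * (Real.log M * (L * (m / N))) := by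
            gcongr; linarith
        _ = _ := by field_simp
    simp only [Nat.cast_one, Real.log_one, sub_zero]
    linarith
  have h4 : L * Real.log M ≤ L * Real.log M * m := by
    have : 0 ≤ L * Real.log M := by positivity
    nlinarith
  calc _ ≤ L * Real.log M + (L * κ * Real.log M * m + L * Real.log M) := add_le_add h1 (h2.trans h3)
    _ ≤ _ := by nlinarith

lemma sum_cut (t : ℕ → ℂ) (U M : ℕ) (B : ℝ) (hB : 0 ≤ B) (h0 : ∀ m, U ≤ m → t m = 0)
    (h1 : ∀ m, 1 ≤ m → m < U → ‖t m‖ ≤ B) : ‖∑ m ∈ Ico 1 M, t m‖ ≤ U * B := by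
  have : ∑ m ∈ Ico 1 M, t m = ∑ m ∈ (Ico 1 M).filter (· < U), t m := by
    rw [Finset.sum_filter]
    refine Finset.sum_congr rfl fun m _ => ?_
    split_ifs with h
    · rfl
    · exact h0 m (by omega)
  rw [this]
  refine (norm_sum_le _ _).trans ((Finset.sum_le_card_nsmul _ _ B fun m hm => ?_).trans ?_)
  · rw [Finset.mem_filter, Finset.mem_Ico] at hm
    exact h1 m hm.1.1 hm.2
  · rw [nsmul_eq_mul]
    gcongr
    refine (Finset.card_le_card (t := range U) ?_).trans (by simp)
    intro m hm
    simp only [mem_filter, mem_range] at hm ⊢; exact hm.2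

end MT

namespace MT
open Finset Filter Topology

lemma typeI (w : ℝ → ℝ) (a b : ℝ) (hw : Cut w a b) (L : ℝ) (hL : 0 < L) (hb : ∀ x, |w x| ≤ L)
    (hl : ∀ x y, |w x - w y| ≤ L * |x - y|)
    {r : ℕ} [NeZero r] (χ : DirichletCharacter ℂ r) (hχ : χ ≠ 1) (R : ℕ) (hR : r ≤ R)
    (N κ : ℝ) (hN : 0 < N) (hκ0 : 0 ≤ κ) (M : ℕ) (hM1 : 1 ≤ M) (hM : b * N < M)
    (hκ : M ≤ κ * N) (U : ℕ) (hU : 2 ≤ U) (hUM : U^2 ≤ M) :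
    ‖∑ n ∈ Ico 1 M, (ArithmeticFunction.vonMangoldt n : ℂ) * χ n * (w (n / N) : ℂ)‖ ≤
      5 * (R * L * (2 + κ) * U^4 * Real.log M) +
    ‖∑ n ∈ Ico 1 M, ((((ArithmeticFunction.vonMangoldt - cutA ArithmeticFunction.vonMangoldt U) * (1 - zeR * cutA muR U)) n : ℝ) : ℂ)
      * χ n * (w (n / N) : ℂ)‖ := by
  have hr1 : 1 ≤ r := Nat.pos_of_ne_zero (NeZero.ne r)
  have hR1 : (1:ℝ) ≤ R := by exact_mod_cast hr1.trans hR
  have hrR : (r:ℝ) ≤ R := by exact_mod_cast hR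
  have hU1 : (1:ℝ) ≤ U := by exact_mod_cast (by omega : 1 ≤ U)
  have hlM : 0 ≤ Real.log M := Real.log_natCast_nonneg M
  have hUU : U ≤ U^2 := by nlinarith
  set W : ℝ := R * L * (2 + κ) * U^4 * Real.log M with hW
  have hchi : ∀ n : ℕ, ‖χ n‖ ≤ 1 := fun n => χ.norm_le_one _
  have hdec : ∑ n ∈ Ico 1 M, (ArithmeticFunction.vonMangoldt n : ℂ) * χ n * (w (n / N) : ℂ) =
      ∑ n ∈ Ico 1 M, ((cutA ArithmeticFunction.vonMangoldt U n : ℝ) : ℂ) * χ n * (w (n / N) : ℂ) +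
      ∑ n ∈ Ico 1 M, (((cutA muR U * ArithmeticFunction.log) n : ℝ) : ℂ) * χ n * (w (n / N) : ℂ) -
      ∑ n ∈ Ico 1 M, ((((cutA ArithmeticFunction.vonMangoldt U * cutA muR U) * zeR) n : ℝ) : ℂ) * χ n * (w (n / N) : ℂ) +
      ∑ n ∈ Ico 1 M, ((((ArithmeticFunction.vonMangoldt - cutA ArithmeticFunction.vonMangoldt U) * (1 - zeR * cutA muR U)) n : ℝ) : ℂ)
      * χ n * (w (n / N) : ℂ) := by
    rw [← Finset.sum_add_distrib, ← Finset.sum_sub_distrib, ← Finset.sum_add_distrib]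
    refine Finset.sum_congr rfl fun n _ => ?_
    have h := congrArg (fun F : ArithmeticFunction ℝ => F n) (vaughan U)
    simp only [ArithmeticFunction.add_apply, subA_apply] at h
    rw [h]
    push_cast
    ring
  have s1 : ‖∑ n ∈ Ico 1 M, ((cutA ArithmeticFunction.vonMangoldt U n : ℝ) : ℂ) * χ n * (w (n / N) : ℂ)‖ ≤ W := by
    refine (sum_cut _ U M (Real.log M * L) (by positivity) ?_ ?_).trans ?_
    · intro m hm
      rw [cutA_apply, if_neg (by omega)]; simp
    · intro m h1 h2
      rw [cutA_apply, if_pos h2, norm_mul, norm_mul, Complex.norm_real, Complex.norm_real,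
        Real.norm_of_nonneg ArithmeticFunction.vonMangoldt_nonneg, Real.norm_eq_abs]
      have l1 : ArithmeticFunction.vonMangoldt m ≤ Real.log M := by
        refine ArithmeticFunction.vonMangoldt_le_log.trans ?_
        apply Real.log_le_log (by exact_mod_cast h1)
        exact_mod_cast (by omega : m ≤ M)
      have := hb (m / N)
      calc _ ≤ Real.log M * 1 * L := by
            have := hchi m
            gcongr
        _ = _ := by ring
    · rw [hW]
      have e : (U:ℝ) ≤ U^4 := le_self_pow₀ hU1 (by norm_num)
      calc (U:ℝ) * (Real.log M * L) ≤ U^4 * (Real.log M * L) := by gcongr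
        _ = 1 * L * 1 * U^4 * Real.log M := by ring
        _ ≤ _ := by gcongr; linarith
  have s2 : ‖∑ n ∈ Ico 1 M, (((cutA muR U * ArithmeticFunction.log) n : ℝ) : ℂ) * χ n * (w (n / N) : ℂ)‖ ≤ 2 * W := by
    rw [rect w a b hw _ _ χ N hN M hM]
    refine (sum_cut _ U M (2 * R * (L * (2 + κ) * Real.log M * U)) (by positivity) ?_ ?_).trans ?_
    · intro m hm
      rw [cutA_apply, if_neg (by omega)]; simp
    · intro m h1 h2
      rw [← Finset.mul_sum, cutA_apply, if_pos h2, norm_mul, norm_mul, Complex.norm_real]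
      have i2 := inner2 w L hL hb hl χ hχ N κ hN M hM1 hκ m h1
      have i2' : ‖∑ n ∈ Ico 1 M, ((ArithmeticFunction.log n : ℝ) : ℂ) * χ n * (w (m * n / N) : ℂ)‖ ≤
          2 * R * (L * (2 + κ) * Real.log M * U) := by
        have e : ∑ n ∈ Ico 1 M, ((ArithmeticFunction.log n : ℝ) : ℂ) * χ n * (w (m * n / N) : ℂ) =
            ∑ n ∈ Ico 1 M, χ n * (((Real.log n : ℝ) : ℂ) * (w (m * n / N) : ℂ)) := by
          refine Finset.sum_congr rfl fun n _ => ?_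
          rw [ArithmeticFunction.log_apply]; ring
        rw [e]
        refine i2.trans ?_
        have : (m:ℝ) ≤ U := by exact_mod_cast h2.le
        gcongr
      have m1 : ‖muR m‖ * ‖χ m‖ ≤ 1 := by
        have := muR_abs m
        rw [← Real.norm_eq_abs] at this
        have h3 := hchi m
        nlinarith [norm_nonneg (muR m), norm_nonneg (χ m)]
      calc _ ≤ 1 * (2 * R * (L * (2 + κ) * Real.log M * U)) := by gcongr
        _ = _ := one_mul _
    · rw [hW]
      have e : (U:ℝ)^2 ≤ U^4 := pow_le_pow_right₀ hU1 (by norm_num)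
      calc (U:ℝ) * (2 * R * (L * (2 + κ) * Real.log M * U)) = 2 * (R * L * (2 + κ) * U^2 * Real.log M) := by ring
        _ ≤ _ := by gcongr
  have s3 : ‖∑ n ∈ Ico 1 M, ((((cutA ArithmeticFunction.vonMangoldt U * cutA muR U) * zeR) n : ℝ) : ℂ) * χ n * (w (n / N) : ℂ)‖ ≤ 2 * W := by
    rw [rect w a b hw _ _ χ N hN M hM]
    refine (sum_cut _ (U^2) M (Real.log M * (2 * R * (L * (1 + κ) * U^2))) (by positivity) ?_ ?_).trans ?_
    · intro m hm
      rw [acoef_zero U m hm]; simp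
    · intro m h1 h2
      rw [← Finset.mul_sum, norm_mul, norm_mul, Complex.norm_real]
      have i1 := inner1 w L hL hb hl χ hχ N κ hN M hM1 hκ m h1
      have i1' : ‖∑ n ∈ Ico 1 M, ((zeR n : ℝ) : ℂ) * χ n * (w (m * n / N) : ℂ)‖ ≤
          2 * R * (L * (1 + κ) * U^2) := by
        have e : ∑ n ∈ Ico 1 M, ((zeR n : ℝ) : ℂ) * χ n * (w (m * n / N) : ℂ) =
            ∑ n ∈ Ico 1 M, χ n * (w (m * n / N) : ℂ) := by
          refine Finset.sum_congr rfl fun n hn => ?_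
          have : n ≠ 0 := by have := (Finset.mem_Ico.mp hn).1; omega
          unfold zeR
          rw [ArithmeticFunction.natCoe_apply, ArithmeticFunction.zeta_apply_ne this]; simp
        rw [e]
        refine i1.trans ?_
        have : (m:ℝ) ≤ U^2 := by exact_mod_cast h2.le
        gcongr
      have m1 : ‖(cutA ArithmeticFunction.vonMangoldt U * cutA muR U) m‖ * ‖χ m‖ ≤ Real.log M := by
        have := acoef_abs U m
        rw [← Real.norm_eq_abs] at this
        have h3 := hchi m
        have l1 : Real.log m ≤ Real.log M := by
          apply Real.log_le_log (by exact_mod_cast h1)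
          exact_mod_cast (by omega : m ≤ M)
        calc _ ≤ Real.log M * 1 := by gcongr; exact this.trans l1
          _ = _ := mul_one _
      gcongr
    · rw [hW]
      push_cast
      calc (U:ℝ)^2 * (Real.log M * (2 * R * (L * (1 + κ) * U^2))) = 2 * (R * L * (1 + κ) * U^4 * Real.log M) := by ring
        _ ≤ _ := by gcongr; norm_num
  rw [hdec]
  refine (norm_add_le _ _).trans ?_
  gcongr
  refine (norm_sub_le _ _).trans ?_
  have := norm_add_le (∑ n ∈ Ico 1 M, ((cutA ArithmeticFunction.vonMangoldt U n : ℝ) : ℂ) * χ n * (w (n / N) : ℂ))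
    (∑ n ∈ Ico 1 M, (((cutA muR U * ArithmeticFunction.log) n : ℝ) : ℂ) * χ n * (w (n / N) : ℂ))
  linarith

lemma rect_restrict (α β : ArithmeticFunction ℝ) (U M : ℕ) (hU : 1 ≤ U) (hα : ∀ n, n < U → α n = 0) (hβ : ∀ n, n < U → β n = 0)
    (F G : ℕ → ℂ) (H : ℕ → ℕ → ℂ) :
    ∑ m ∈ Ico 1 M, ∑ n ∈ Ico 1 M, ((α m : ℂ) * F m) * (((β n : ℂ) * G n) * H m n) =
    ∑ m ∈ Ico U M, ∑ n ∈ Ico U M, ((α m : ℂ) * F m) * (((β n : ℂ) * G n) * H m n) := by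
  symm
  have h1 : ∀ m, ∑ n ∈ Ico U M, ((α m : ℂ) * F m) * (((β n : ℂ) * G n) * H m n) =
      ∑ n ∈ Ico 1 M, ((α m : ℂ) * F m) * (((β n : ℂ) * G n) * H m n) := by
    intro m
    refine Finset.sum_subset (Finset.Ico_subset_Ico_left hU) fun n hn hn' => ?_
    rw [Finset.mem_Ico] at hn hn'
    rw [hβ n (by omega)]; simp
  simp_rw [h1]
  refine Finset.sum_subset (Finset.Ico_subset_Ico_left hU) fun n hn hn' => ?_
  rw [Finset.mem_Ico] at hn hn'
  rw [hα n (by omega)]; simp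

lemma typeII (w : ℝ → ℝ) (a b : ℝ) (hw : Cut w a b) (h : SchwartzMap ℝ ℂ)
    (hh : ∀ x : ℝ, 0 < x →
      (w x : ℂ) = (x : ℂ)⁻¹ * ∫ t : ℝ, h t * Complex.exp (-(Complex.I * t * Real.log x)))
    (X : Finset (Σ r, DirichletCharacter ℂ r)) (R : ℕ) (hX : Fam X R)
    (N : ℝ) (hN : 0 < N) (M : ℕ) (hM : b * N < M) (U : ℕ) (hU : 2 ≤ U) (hUM : U ≤ M) (α β : ArithmeticFunction ℝ)
    (hα : ∀ n, n < U → α n = 0) (hβ : ∀ n, n < U → β n = 0)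
    (hα1 : ∀ n, |α n| ≤ Real.log n) (hβ1 : ∀ n, |β n| ≤ n.divisors.card) :
    ∑ x ∈ X, ‖∑ n ∈ Ico 1 M, (((α * β) n : ℝ) : ℂ) * x.2 (n : ZMod x.1) * (w (n / N) : ℂ)‖ ≤
      N * ((∫ t, ‖h t‖) * ((1 + Real.log M + X.card * (2 * R^2 / U)) * (1 + Real.log M)^4)) := by
  set D : ℝ := 1 + Real.log M + X.card * (2 * R^2 / U) with hD
  have hM1 : 1 ≤ M := by omega
  have hlM : 0 ≤ Real.log M := Real.log_natCast_nonneg M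
  have hD0 : 0 ≤ D := by positivity
  have hU0 : (0:ℝ) < U := by exact_mod_cast (by omega : 0 < U)
  set cA : ℝ → ℕ → ℂ := fun t m => (α m : ℂ) * ((m : ℂ)⁻¹ * Complex.exp (-(Complex.I * t * Real.log m))) with hcA
  set cB : ℝ → ℕ → ℂ := fun t m => (β m : ℂ) * ((m : ℂ)⁻¹ * Complex.exp (-(Complex.I * t * Real.log m))) with hcB
  have hnormexp : ∀ x y : ℝ, ‖Complex.exp (Complex.I * x * y)‖ = 1 := by
    intro x y
    have : Complex.I * x * y = ((x * y : ℝ) : ℂ) * Complex.I := by push_cast; ring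
    rw [this, Complex.norm_exp_ofReal_mul_I]
  have hnormexp' : ∀ x y : ℝ, ‖Complex.exp (-(Complex.I * x * y))‖ = 1 := by
    intro x y; rw [Complex.exp_neg, norm_inv, hnormexp, inv_one]
  set F : (Σ r, DirichletCharacter ℂ r) → ℝ → ℂ := fun x t => h t * Complex.exp (Complex.I * t * Real.log N) *
    ((∑ m ∈ Ico U M, cA t m * x.2 (m : ZMod x.1)) * (∑ n ∈ Ico U M, cB t n * x.2 (n : ZMod x.1))) with hF
  have hFexp : ∀ x t, F x t = ∑ m ∈ Ico U M, ∑ n ∈ Ico U M,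
      (((α m : ℂ) * x.2 (m : ZMod x.1)) * ((β n : ℂ) * x.2 (n : ZMod x.1)) * ((m : ℂ)⁻¹ * (n : ℂ)⁻¹)) *
        (h t * Complex.exp (-(Complex.I * t * Real.log (m * n / N)))) := by
    intro x t
    simp only [hF]
    rw [Finset.sum_mul_sum, Finset.mul_sum]
    refine Finset.sum_congr rfl fun m hm => ?_
    rw [Finset.mul_sum]
    refine Finset.sum_congr rfl fun n hn => ?_
    have m0 : (m : ℝ) ≠ 0 := by have := (Finset.mem_Ico.mp hm).1; exact_mod_cast (by omega : m ≠ 0)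
    have n0 : (n : ℝ) ≠ 0 := by have := (Finset.mem_Ico.mp hn).1; exact_mod_cast (by omega : n ≠ 0)
    simp only [hcA, hcB]
    rw [Real.log_div (mul_ne_zero m0 n0) hN.ne', Real.log_mul m0 n0, Complex.ofReal_sub, Complex.ofReal_add,
      show -(Complex.I * t * ((Real.log m : ℂ) + (Real.log n : ℂ) - (Real.log N : ℂ))) =
        -(Complex.I * t * (Real.log m : ℂ)) + (-(Complex.I * t * (Real.log n : ℂ))) + Complex.I * t * (Real.log N : ℂ) by ring,
      Complex.exp_add, Complex.exp_add]
    ring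
  have hint1 : ∀ y : ℝ, MeasureTheory.Integrable (fun t : ℝ => h t * Complex.exp (-(Complex.I * t * y))) := by
    intro y
    refine h.integrable.norm.mono' ?_ ?_
    · have := h.continuous
      exact (by fun_prop : Continuous fun t : ℝ => h t * Complex.exp (-(Complex.I * t * y))).aestronglyMeasurable
    · filter_upwards with t
      rw [norm_mul, hnormexp', mul_one]
  have hFint : ∀ x, MeasureTheory.Integrable (F x) := by
    intro x
    have : F x = fun t => ∑ m ∈ Ico U M, ∑ n ∈ Ico U M,
      (((α m : ℂ) * x.2 (m : ZMod x.1)) * ((β n : ℂ) * x.2 (n : ZMod x.1)) * ((m : ℂ)⁻¹ * (n : ℂ)⁻¹)) *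
        (h t * Complex.exp (-(Complex.I * t * Real.log (m * n / N)))) := funext (hFexp x)
    rw [this]
    exact MeasureTheory.integrable_finsetSum _ fun m _ => MeasureTheory.integrable_finsetSum _ fun n _ =>
      (hint1 _).const_mul _
  have hkey : ∀ x : (Σ r, DirichletCharacter ℂ r), ∑ n ∈ Ico 1 M, (((α * β) n : ℝ) : ℂ) * x.2 (n : ZMod x.1) * (w (n / N) : ℂ) =
      N * ∫ t, F x t := by
    intro x
    rw [rect w a b hw α β x.2 N hN M hM]
    rw [rect_restrict α β U M (by omega) hα hβ (fun n => x.2 (n : ZMod x.1)) (fun n => x.2 (n : ZMod x.1))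
      (fun m n => (w (m * n / N) : ℂ))]
    simp_rw [hFexp x]
    rw [MeasureTheory.integral_finsetSum _ fun m _ => MeasureTheory.integrable_finsetSum _ fun n _ =>
      (hint1 _).const_mul _, Finset.mul_sum]
    refine Finset.sum_congr rfl fun m hm => ?_
    rw [MeasureTheory.integral_finsetSum _ fun n _ => (hint1 _).const_mul _, Finset.mul_sum]
    refine Finset.sum_congr rfl fun n hn => ?_
    rw [MeasureTheory.integral_const_mul]
    have m0 : (0:ℝ) < m := by have := (Finset.mem_Ico.mp hm).1; exact_mod_cast (by omega : 0 < m)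
    have n0 : (0:ℝ) < n := by have := (Finset.mem_Ico.mp hn).1; exact_mod_cast (by omega : 0 < n)
    rw [hh (m * n / N) (by positivity)]
    generalize (∫ t : ℝ, h t * Complex.exp (-(Complex.I * t * Real.log (m * n / N)))) = J
    have m0' : (m:ℂ) ≠ 0 := by exact_mod_cast m0.ne'
    have n0' : (n:ℂ) ≠ 0 := by exact_mod_cast n0.ne'
    have N0' : (N:ℂ) ≠ 0 := by exact_mod_cast hN.ne'
    push_cast
    field_simp
  have hSieve : ∀ t, ∑ x ∈ X, ‖F x t‖ ≤ ‖h t‖ * (D * (1 + Real.log M)^4) := by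
    intro t
    have e1 : ∀ x, ‖F x t‖ = ‖h t‖ * (‖∑ m ∈ Ico U M, cA t m * x.2 (m : ZMod x.1)‖ * ‖∑ n ∈ Ico U M, cB t n * x.2 (n : ZMod x.1)‖) := by
      intro x
      simp only [hF]
      rw [norm_mul, norm_mul, norm_mul, hnormexp, mul_one]
    simp_rw [e1]
    rw [← Finset.mul_sum]
    refine mul_le_mul_of_nonneg_left ?_ (norm_nonneg _)
    have l1 := large_sieve X R hX U M (by omega) hUM (cA t)
    have l2 := large_sieve X R hX U M (by omega) hUM (cB t)
    have nA : ∑ n ∈ Ico U M, (n:ℝ) * ‖cA t n‖^2 ≤ (1 + Real.log M)^4 := by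
      have h1 : ∑ n ∈ Ico U M, (n:ℝ) * ‖cA t n‖^2 ≤ ∑ n ∈ Ico U M, (Real.log M)^2 * (1 / n : ℝ) := by
        refine Finset.sum_le_sum fun n hn => ?_
        rw [Finset.mem_Ico] at hn
        have n0 : (0:ℝ) < n := by exact_mod_cast (by omega : 0 < n)
        simp only [hcA]
        rw [norm_mul, norm_mul, hnormexp', mul_one, norm_inv, Complex.norm_natCast, Complex.norm_real, Real.norm_eq_abs]
        have : |α n| ≤ Real.log M := (hα1 n).trans (Real.log_le_log n0 (by exact_mod_cast hn.2.le))
        calc (n:ℝ) * (|α n| * (n:ℝ)⁻¹)^2 ≤ (n:ℝ) * (Real.log M * (n:ℝ)⁻¹)^2 := by gcongr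
          _ = _ := by field_simp
      have h2 : ∑ n ∈ Ico U M, (Real.log M)^2 * (1 / n : ℝ) ≤ (Real.log M)^2 * (1 + Real.log M) := by
        rw [← Finset.mul_sum]
        gcongr
        refine le_trans ?_ (harmonic_le M hM1)
        exact Finset.sum_le_sum_of_subset_of_nonneg (Finset.Ico_subset_Ico_left (by omega)) fun _ _ _ => by positivity
      refine (h1.trans h2).trans ?_
      calc (Real.log M)^2 * (1 + Real.log M) ≤ (1 + Real.log M)^2 * (1 + Real.log M) := by gcongr; linarith
        _ = (1 + Real.log M)^3 := by ring
        _ ≤ _ := pow_le_pow_right₀ (by linarith) (by norm_num)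
    have nB : ∑ n ∈ Ico U M, (n:ℝ) * ‖cB t n‖^2 ≤ (1 + Real.log M)^4 := by
      have h1 : ∑ n ∈ Ico U M, (n:ℝ) * ‖cB t n‖^2 ≤ ∑ n ∈ Ico U M, (n.divisors.card:ℝ)^2 / n := by
        refine Finset.sum_le_sum fun n hn => ?_
        rw [Finset.mem_Ico] at hn
        have n0 : (0:ℝ) < n := by exact_mod_cast (by omega : 0 < n)
        simp only [hcB]
        rw [norm_mul, norm_mul, hnormexp', mul_one, norm_inv, Complex.norm_natCast, Complex.norm_real, Real.norm_eq_abs]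
        have := hβ1 n
        calc (n:ℝ) * (|β n| * (n:ℝ)⁻¹)^2 ≤ (n:ℝ) * (n.divisors.card * (n:ℝ)⁻¹)^2 := by gcongr
          _ = _ := by field_simp
      refine h1.trans (le_trans ?_ (tau_sq_sum M hM1))
      exact Finset.sum_le_sum_of_subset_of_nonneg (Finset.Ico_subset_Ico_left (by omega)) fun _ _ _ => by positivity
    have l1' := l1.trans (mul_le_mul_of_nonneg_left nA hD0)
    have l2' := l2.trans (mul_le_mul_of_nonneg_left nB hD0)
    have am : ∑ x ∈ X, ‖∑ m ∈ Ico U M, cA t m * x.2 (m : ZMod x.1)‖ * ‖∑ n ∈ Ico U M, cB t n * x.2 (n : ZMod x.1)‖ ≤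
        ∑ x ∈ X, (‖∑ m ∈ Ico U M, cA t m * x.2 (m : ZMod x.1)‖^2 / 2 + ‖∑ n ∈ Ico U M, cB t n * x.2 (n : ZMod x.1)‖^2 / 2) := by
      refine Finset.sum_le_sum fun x _ => ?_
      nlinarith [sq_nonneg (‖∑ m ∈ Ico U M, cA t m * x.2 (m : ZMod x.1)‖ - ‖∑ n ∈ Ico U M, cB t n * x.2 (n : ZMod x.1)‖)]
    refine am.trans ?_
    rw [Finset.sum_add_distrib, ← Finset.sum_div, ← Finset.sum_div]
    linarith
  calc ∑ x ∈ X, ‖∑ n ∈ Ico 1 M, (((α * β) n : ℝ) : ℂ) * x.2 (n : ZMod x.1) * (w (n / N) : ℂ)‖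
      ≤ ∑ x ∈ X, N * ∫ t, ‖F x t‖ := by
        refine Finset.sum_le_sum fun x _ => ?_
        rw [hkey x, norm_mul, Complex.norm_real, Real.norm_of_nonneg hN.le]
        exact mul_le_mul_of_nonneg_left (MeasureTheory.norm_integral_le_integral_norm _) hN.le
    _ = N * ∫ t, ∑ x ∈ X, ‖F x t‖ := by
        rw [← Finset.mul_sum, MeasureTheory.integral_finsetSum _ fun x _ => (hFint x).norm]
    _ ≤ N * ∫ t, ‖h t‖ * (D * (1 + Real.log M)^4) := by
        refine mul_le_mul_of_nonneg_left ?_ hN.le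
        exact MeasureTheory.integral_mono (MeasureTheory.integrable_finsetSum _ fun x _ => (hFint x).norm)
          (h.integrable.norm.mul_const _) hSieve
    _ = _ := by rw [MeasureTheory.integral_mul_const]

end MT

namespace MT
open Finset Filter Topology

lemma large_cond (w : ℝ → ℝ) (a b : ℝ) (hw : Cut w a b) : ∃ C N0 : ℝ, 0 < C ∧ 1 < N0 ∧
    ∀ N : ℝ, N0 ≤ N → ∀ R : ℕ, (R:ℝ)^40 ≤ N → ∀ X : Finset (Σ r, DirichletCharacter ℂ r), Fam X R →
    ∀ M : ℕ, b * N < M → (M:ℝ) ≤ (b+2) * N →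
    ∑ x ∈ X, ‖∑ n ∈ Ico 1 M, (ArithmeticFunction.vonMangoldt n : ℂ) * x.2 (n : ZMod x.1) * (w (n / N) : ℂ)‖ ≤
      C * N * (1 + Real.log N)^5 := by
  have hb0 : 0 < b := hw.ha.trans hw.hab
  obtain ⟨L, hL, hb, hl⟩ := cut_lip w a b hw
  obtain ⟨h, hh⟩ := cut_fourier w a b hw
  set κ := b + 2 with hκ
  set lk := Real.log κ with hlk
  have hlk0 : 0 ≤ lk := Real.log_nonneg (by linarith)
  set I := ∫ t, ‖h t‖ with hI
  have hI0 : 0 ≤ I := MeasureTheory.integral_nonneg fun t => norm_nonneg _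
  refine ⟨80 * (L * (2+κ)) * (1+lk) + I * (5 * (1+lk)^5), max 2 ((4/b)^2), by positivity, by simp, ?_⟩
  intro N hN R hR X hX M hM hMκ
  have hN2 : 2 ≤ N := (le_max_left _ _).trans hN
  have hN4 : (4/b)^2 ≤ N := (le_max_right _ _).trans hN
  set x := N ^ ((1:ℝ)/40) with hx
  have hx40 : x^40 = N := by
    rw [hx, ← Real.rpow_natCast, ← Real.rpow_mul (by linarith)]; norm_num
  have hx1 : 1 < x := Real.one_lt_rpow (by linarith) (by norm_num)
  have hx0 : 0 < x := by linarith
  have hRx : (R:ℝ) ≤ x := le_of_pow_le_pow_left₀ (n := 40) (by norm_num) hx0.le (by rw [hx40]; exact hR)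
  set U := ⌈x^5⌉₊ with hU
  have hx5 : 1 < x^5 := one_lt_pow₀ hx1 (by norm_num)
  have hU5 : x^5 ≤ U := Nat.le_ceil _
  have hU2 : 2 ≤ U := by
    have : (1:ℝ) < U := hx5.trans_le hU5
    exact_mod_cast this
  have hUu : (U:ℝ) ≤ 2 * x^5 := by
    have := Nat.ceil_lt_add_one (by positivity : 0 ≤ x^5)
    linarith
  have hx30 : 4 ≤ b * x^30 := by
    by_contra hc
    push Not at hc
    have h1 : x^30 < 4/b := by rw [lt_div_iff₀ hb0]; linarith
    have h2 : x^60 < (4/b)^2 := by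
      calc x^60 = (x^30)^2 := by ring
        _ < _ := by gcongr
    have h3 : x^40 ≤ x^60 := pow_le_pow_right₀ hx1.le (by norm_num)
    linarith
  have hUM : U^2 ≤ M := by
    have : ((U^2:ℕ):ℝ) ≤ M := by
      push_cast
      calc (U:ℝ)^2 ≤ (2 * x^5)^2 := by gcongr
        _ = 4 * x^10 := by ring
        _ ≤ b * x^30 * x^10 := by gcongr
        _ = b * N := by rw [← hx40]; ring
        _ ≤ M := hM.le
    exact_mod_cast this
  have hUM' : U ≤ M := le_trans (by nlinarith) hUM
  have hM1 : 1 ≤ M := by omega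
  set l := Real.log N with hlN
  have hl0 : 0 ≤ l := Real.log_nonneg (by linarith)
  have hlM : Real.log M ≤ lk + l := by
    rw [hlk, hlN, ← Real.log_mul (by linarith) (by linarith)]
    exact Real.log_le_log (by exact_mod_cast hM1) hMκ
  have hlM0 : 0 ≤ Real.log M := Real.log_natCast_nonneg M
  have hlM1 : 1 + Real.log M ≤ (1+lk) * (1+l) := by nlinarith
  have hcard : (X.card:ℝ) ≤ x^2 := by
    calc (X.card:ℝ) ≤ ((R^2:ℕ):ℝ) := by exact_mod_cast Fam_card X R hX
      _ ≤ x^2 := by push_cast; gcongr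
  have ha1 : ∀ n, n < U → (ArithmeticFunction.vonMangoldt - cutA ArithmeticFunction.vonMangoldt U) n = 0 := by
    intro n hn
    rw [subA_apply, cutA_apply, if_pos hn, sub_self]
  have ha2 : ∀ n : ℕ, |(ArithmeticFunction.vonMangoldt - cutA ArithmeticFunction.vonMangoldt U) n| ≤ Real.log n := by
    intro n
    rw [subA_apply, cutA_apply]
    split_ifs
    · simpa using Real.log_natCast_nonneg n
    · rw [sub_zero, abs_of_nonneg ArithmeticFunction.vonMangoldt_nonneg]
      exact ArithmeticFunction.vonMangoldt_le_log
  have key := typeII w a b hw h hh X R hX N (by linarith) M hM U hU2 hUM'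
    (ArithmeticFunction.vonMangoldt - cutA ArithmeticFunction.vonMangoldt U) (1 - zeR * cutA muR U)
    ha1 (fun n hn => bcoef_zero U n hn) ha2
    (fun n => bcoef_abs U n hU2)
  have hI1 : X.card * (2 * (R:ℝ)^2 / U) ≤ 2 := by
    calc X.card * (2 * (R:ℝ)^2 / U) ≤ x^2 * (2 * x^2 / x^5) := by gcongr
      _ = 2 / x := by field_simp
      _ ≤ 2 := by rw [div_le_iff₀ hx0]; linarith
  have hp1 : 1 ≤ (1+lk) * (1+l) := by nlinarith
  have hII : N * (I * ((1 + Real.log M + X.card * (2 * R^2 / U)) * (1 + Real.log M)^4)) ≤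
      I * (5 * (1+lk)^5) * N * (1+l)^5 := by
    have : (1 + Real.log M + X.card * (2 * (R:ℝ)^2 / U)) ≤ 5 * ((1+lk) * (1+l)) := by linarith
    calc _ ≤ N * (I * (5 * ((1+lk) * (1+l)) * ((1+lk)*(1+l))^4)) := by gcongr
      _ = _ := by ring
  have hTI : X.card * (5 * (R * L * (2 + κ) * U^4 * Real.log M)) ≤ 80 * (L * (2+κ)) * (1+lk) * N * (1+l)^5 := by
    calc X.card * (5 * (R * L * (2 + κ) * U^4 * Real.log M))
        ≤ x^2 * (5 * (x * L * (2+κ) * (2*x^5)^4 * ((1+lk) * (1+l)))) := by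
          gcongr
          linarith
      _ = 80 * (L * (2+κ)) * (1+lk) * x^23 * (1+l)^1 := by ring
      _ ≤ 80 * (L * (2+κ)) * (1+lk) * x^40 * (1+l)^5 := by
          gcongr
          · exact hx1.le
          · norm_num
          · linarith
          · norm_num
      _ = _ := by rw [hx40]
  calc _ ≤ ∑ y ∈ X, (5 * (R * L * (2 + κ) * U^4 * Real.log M) +
    ‖∑ n ∈ Ico 1 M, ((((ArithmeticFunction.vonMangoldt - cutA ArithmeticFunction.vonMangoldt U) * (1 - zeR * cutA muR U)) n : ℝ) : ℂ)
      * y.2 (n : ZMod y.1) * (w (n / N) : ℂ)‖) := by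
        refine sum_le_sum fun y hy => ?_
        obtain ⟨h1, h2, h3, h4⟩ := hX y hy
        haveI : NeZero y.1 := ⟨h1⟩
        exact typeI w a b hw L hL hb hl y.2 h4 R h2 N κ (by linarith) (by linarith) M hM1 hM hMκ U hU2 hUM
    _ ≤ _ := by
        rw [sum_add_distrib, sum_const, nsmul_eq_mul]
        calc _ ≤ _ := add_le_add hTI (key.trans hII)
          _ = _ := by ring
end MT

namespace MT
open Finset Filter Topology

/-- twisted weighted prime power sum -/
noncomputable def psiW (w : ℝ → ℝ) (N : ℝ) (M : ℕ) {r : ℕ} (χ : DirichletCharacter ℂ r) : ℂ :=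
  ∑ n ∈ Ico 1 M, (ArithmeticFunction.vonMangoldt n : ℂ) * χ n * (w (n / N) : ℂ)

/-- weighted primes in a residue class -/
noncomputable def thW (w : ℝ → ℝ) (N : ℝ) (M q a : ℕ) : ℝ :=
  ∑ n ∈ Ico 1 M with Nat.Prime n ∧ ((n : ℕ) : ZMod q) = (a : ZMod q), Real.log n * w (n / N)

/-- weighted primes -/
noncomputable def thX (w : ℝ → ℝ) (N : ℝ) (M : ℕ) : ℝ :=
  ∑ n ∈ Ico 1 M with n.Prime, Real.log n * w (n / N)

lemma noncop_sum (q M : ℕ) (hq : 1 ≤ q) (hM : 1 ≤ M) :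
    ∑ n ∈ Ico 1 M with ¬ n.Coprime q, ArithmeticFunction.vonMangoldt n ≤ (q+1) * (2 * Real.log M + 1) * Real.log M := by
  have hlM : 0 ≤ Real.log M := Real.log_natCast_nonneg M
  set T : Finset ℕ := (range (q+1) ×ˢ range (Nat.log 2 M + 1)).image (fun x => x.1^x.2) with hT
  have h1 : ∑ n ∈ Ico 1 M with ¬ n.Coprime q, ArithmeticFunction.vonMangoldt n =
      ∑ n ∈ (Ico 1 M).filter (fun n => ¬ n.Coprime q ∧ IsPrimePow n), ArithmeticFunction.vonMangoldt n := by
    rw [sum_filter, sum_filter]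
    refine sum_congr rfl fun n _ => ?_
    by_cases hp : IsPrimePow n
    · simp [hp]
    · simp [hp, ArithmeticFunction.vonMangoldt_apply]
  have hsub : (Ico 1 M).filter (fun n => ¬ n.Coprime q ∧ IsPrimePow n) ⊆ T := by
    intro n hn
    rw [mem_filter, mem_Ico] at hn
    obtain ⟨⟨hn1, hn2⟩, hc, hpp⟩ := hn
    obtain ⟨p, k, hp, hk, rfl⟩ := (isPrimePow_nat_iff n).mp hpp
    rw [hT, mem_image]
    refine ⟨(p, k), ?_, rfl⟩
    rw [mem_product, mem_range, mem_range]
    constructor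
    · rw [Nat.coprime_pow_left_iff hk] at hc
      have : p ∣ q := by
        by_contra h
        exact hc ((Nat.Prime.coprime_iff_not_dvd hp).mpr h)
      have := Nat.le_of_dvd hq this
      simp only; omega
    · have : 2^k ≤ M := (Nat.pow_le_pow_left hp.two_le k).trans hn2.le
      have := Nat.le_log_of_pow_le (by norm_num) this
      simp only; omega
  rw [h1]
  have hcard : (((Ico 1 M).filter (fun n => ¬ n.Coprime q ∧ IsPrimePow n)).card : ℝ) ≤ (q+1) * (2 * Real.log M + 1) := by
    have h2 : ((Ico 1 M).filter (fun n => ¬ n.Coprime q ∧ IsPrimePow n)).card ≤ (q+1) * (Nat.log 2 M + 1) := by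
      refine (card_le_card hsub).trans ?_
      refine card_image_le.trans ?_
      simp
    have h3 : ((Nat.log 2 M : ℕ):ℝ) ≤ 2 * Real.log M := by
      have := Real.natLog_le_logb M 2
      refine this.trans ?_
      rw [Real.logb, div_le_iff₀ (Real.log_pos (by norm_num))]
      have : (0.5:ℝ) < Real.log 2 := lt_trans (by norm_num) Real.log_two_gt_d9
      push_cast
      nlinarith
    calc _ ≤ (((q+1) * (Nat.log 2 M + 1) : ℕ) : ℝ) := by exact_mod_cast h2
      _ ≤ _ := by push_cast; gcongr
  calc _ ≤ ∑ n ∈ (Ico 1 M).filter (fun n => ¬ n.Coprime q ∧ IsPrimePow n), Real.log M := by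
        refine sum_le_sum fun n hn => ?_
        rw [mem_filter, mem_Ico] at hn
        refine ArithmeticFunction.vonMangoldt_le_log.trans ?_
        apply Real.log_le_log (by exact_mod_cast hn.1.1)
        exact_mod_cast hn.1.2.le
    _ ≤ _ := by
        rw [sum_const, nsmul_eq_mul]
        gcongr

lemma nonprime_sum (M : ℕ) (hM : 2 ≤ M) :
    ∑ n ∈ Ico 1 M with ¬ n.Prime, ArithmeticFunction.vonMangoldt n ≤ 2 * √M * Real.log M := by
  have h := Chebyshev.psi_sub_theta_le (x := (M:ℝ)) (by exact_mod_cast (by omega : 1 ≤ M))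
  refine le_trans ?_ h
  unfold Chebyshev.psi Chebyshev.theta
  rw [Nat.floor_natCast, ← sum_filter_add_sum_filter_not (Ioc 0 M) Nat.Prime]
  have : ∑ p ∈ Ioc 0 M with Nat.Prime p, Real.log p = ∑ p ∈ Ioc 0 M with Nat.Prime p, ArithmeticFunction.vonMangoldt p := by
    refine sum_congr rfl fun p hp => ?_
    rw [ArithmeticFunction.vonMangoldt_apply_prime (mem_filter.mp hp).2]
  rw [this, add_sub_cancel_left]
  refine sum_le_sum_of_subset_of_nonneg ?_ fun n _ _ => ArithmeticFunction.vonMangoldt_nonneg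
  intro n hn
  rw [mem_filter, mem_Ico] at hn
  rw [mem_filter, mem_Ioc]
  exact ⟨⟨by omega, by omega⟩, hn.2⟩

lemma ortho (w : ℝ → ℝ) (N : ℝ) (M q a : ℕ) [NeZero q] (ha : a.Coprime q) :
    (∑ n ∈ Ico 1 M with ((n : ℕ) : ZMod q) = (a : ZMod q), (ArithmeticFunction.vonMangoldt n : ℂ) * (w (n / N) : ℂ)) * (q.totient : ℂ) =
      ∑ χ : DirichletCharacter ℂ q, χ ((a : ZMod q)⁻¹) * psiW w N M χ := by
  have hu : IsUnit (a : ZMod q) := (ZMod.isUnit_iff_coprime a q).mpr ha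
  simp only [psiW, mul_sum]
  rw [sum_comm, sum_filter, sum_mul]
  refine sum_congr rfl fun n _ => ?_
  have := DirichletCharacter.sum_char_inv_mul_char_eq ℂ hu (n : ZMod q)
  rw [sum_congr rfl (g := fun χ : DirichletCharacter ℂ q => (χ ((a : ZMod q)⁻¹) * χ n) * ((ArithmeticFunction.vonMangoldt n : ℂ) * (w (n / N) : ℂ)))
    (fun χ _ => by ring), ← sum_mul, this]
  by_cases h : (n : ZMod q) = (a : ZMod q)
  · rw [if_pos h, if_pos h.symm]; ring
  · rw [if_neg h, if_neg (fun h' => h h'.symm)]; ring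

lemma psiW_prim (w : ℝ → ℝ) (L : ℝ) (hL : 0 ≤ L) (hb : ∀ x, |w x| ≤ L) (N : ℝ) (M q : ℕ) {r : ℕ} (hr : r ∣ q) (χ : DirichletCharacter ℂ r) :
    ‖psiW w N M (χ.changeLevel hr) - psiW w N M χ‖ ≤ L * ∑ n ∈ Ico 1 M with ¬ n.Coprime q, ArithmeticFunction.vonMangoldt n := by
  unfold psiW
  rw [← sum_sub_distrib, sum_filter, mul_sum]
  refine (norm_sum_le _ _).trans (sum_le_sum fun n _ => ?_)
  by_cases h : n.Coprime q
  · rw [changeLevel_nat χ hr n h]; simp [h]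
  · rw [char_zero_of_not_coprime _ n h, if_pos h]
    have h1 := DirichletCharacter.norm_le_one χ (n : ZMod r)
    have h2 : (0:ℝ) ≤ ArithmeticFunction.vonMangoldt n := ArithmeticFunction.vonMangoldt_nonneg
    rw [mul_zero, zero_mul, zero_sub, norm_neg, norm_mul, norm_mul, Complex.norm_real, Complex.norm_real, Real.norm_eq_abs, Real.norm_eq_abs, abs_of_nonneg h2]
    calc ArithmeticFunction.vonMangoldt n * ‖χ (n : ZMod r)‖ * |w (n / N)| ≤ ArithmeticFunction.vonMangoldt n * 1 * L := by
          gcongr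
          exact hb _
      _ = _ := by ring

lemma psiW_one (w : ℝ → ℝ) (L : ℝ) (hL : 0 ≤ L) (hb : ∀ x, |w x| ≤ L) (N : ℝ) (M q : ℕ) :
    ‖psiW w N M (1 : DirichletCharacter ℂ q) - ∑ n ∈ Ico 1 M, (ArithmeticFunction.vonMangoldt n : ℂ) * (w (n / N) : ℂ)‖ ≤
      L * ∑ n ∈ Ico 1 M with ¬ n.Coprime q, ArithmeticFunction.vonMangoldt n := by
  have := psiW_prim w L hL hb N M q (one_dvd q) 1
  rw [DirichletCharacter.changeLevel_one] at this
  refine le_of_eq_of_le ?_ this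
  congr 2
  unfold psiW
  refine sum_congr rfl fun n _ => ?_
  rw [MulChar.one_apply (isUnit_of_subsingleton _), mul_one]

lemma la_to_th (w : ℝ → ℝ) (L : ℝ) (hL : 0 ≤ L) (hb : ∀ x, |w x| ≤ L) (N : ℝ) (M : ℕ) (P : ℕ → Prop) :
    |∑ n ∈ Ico 1 M with P n, ArithmeticFunction.vonMangoldt n * w (n / N) -
      ∑ n ∈ Ico 1 M with n.Prime ∧ P n, Real.log n * w (n / N)| ≤ L * ∑ n ∈ Ico 1 M with ¬ n.Prime, ArithmeticFunction.vonMangoldt n := by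
  rw [sum_filter, sum_filter, sum_filter, ← sum_sub_distrib, mul_sum]
  refine (abs_sum_le_sum_abs _ _).trans (sum_le_sum fun n _ => ?_)
  have h2 : (0:ℝ) ≤ ArithmeticFunction.vonMangoldt n := ArithmeticFunction.vonMangoldt_nonneg
  by_cases hp : n.Prime
  · simp only [hp, true_and, ArithmeticFunction.vonMangoldt_apply_prime hp, sub_self, abs_zero, not_true, if_false, mul_zero, le_refl]
  · simp only [hp, false_and, if_false, sub_zero, not_false_eq_true, if_true]
    split_ifs
    · rw [abs_mul, abs_of_nonneg h2, mul_comm]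
      gcongr
      exact hb _
    · simp; positivity

set_option maxHeartbeats 800000 in
lemma one_class (w : ℝ → ℝ) (L : ℝ) (hL : 0 ≤ L) (hb : ∀ x, |w x| ≤ L) (N : ℝ) (M q a : ℕ) [NeZero q] (hq : 1 ≤ q) (ha : a.Coprime q) :
    |thW w N M q a - thX w N M / q.totient| ≤
      1 / q.totient * ∑ χ : DirichletCharacter ℂ q with χ ≠ 1, ‖psiW w N M χ.primitiveCharacter‖ +
      2 * L * ((∑ n ∈ Ico 1 M with ¬ n.Prime, ArithmeticFunction.vonMangoldt n) + ∑ n ∈ Ico 1 M with ¬ n.Coprime q, ArithmeticFunction.vonMangoldt n) := by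
  set e1 := ∑ n ∈ Ico 1 M with ¬ n.Prime, ArithmeticFunction.vonMangoldt n
  set e2 := ∑ n ∈ Ico 1 M with ¬ n.Coprime q, ArithmeticFunction.vonMangoldt n
  have he1 : 0 ≤ e1 := sum_nonneg fun _ _ => ArithmeticFunction.vonMangoldt_nonneg
  have he2 : 0 ≤ e2 := sum_nonneg fun _ _ => ArithmeticFunction.vonMangoldt_nonneg
  set φ : ℝ := (q.totient : ℝ) with hφ
  have hφ1 : 1 ≤ φ := by rw [hφ]; exact_mod_cast Nat.totient_pos.mpr hq
  have hφ0 : 0 < φ := by linarith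
  set S := ∑ n ∈ Ico 1 M with ((n : ℕ) : ZMod q) = (a : ZMod q), ArithmeticFunction.vonMangoldt n * w (n / N) with hS
  set Y := ∑ n ∈ Ico 1 M, ArithmeticFunction.vonMangoldt n * w (n / N) with hY
  have h1 : |S - thW w N M q a| ≤ L * e1 := by
    have := la_to_th w L hL hb N M (fun n => ((n : ℕ) : ZMod q) = (a : ZMod q))
    rw [hS, thW]
    convert this
  have h2 : |Y - thX w N M| ≤ L * e1 := by
    have := la_to_th w L hL hb N M (fun _ => True)
    simpa [thX] using this
  have h3 : |S * φ - Y| ≤ ∑ χ : DirichletCharacter ℂ q with χ ≠ 1, ‖psiW w N M χ.primitiveCharacter‖ + φ * (L * e2) := by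
    have ho := ortho w N M q a ha
    have hu : IsUnit (a : ZMod q) := (ZMod.isUnit_iff_coprime a q).mpr ha
    have hu' : IsUnit ((a : ZMod q)⁻¹) := by
      obtain ⟨u, hu⟩ := hu
      rw [← hu, ZMod.inv_coe_unit]; exact Units.isUnit _
    have e : ((S * φ - Y : ℝ) : ℂ) = (psiW w N M (1 : DirichletCharacter ℂ q) - ∑ n ∈ Ico 1 M, (ArithmeticFunction.vonMangoldt n : ℂ) * (w (n / N) : ℂ)) +
        ∑ χ : DirichletCharacter ℂ q with χ ≠ 1, χ ((a : ZMod q)⁻¹) * psiW w N M χ := by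
      have hf : (Finset.univ.filter (fun χ : DirichletCharacter ℂ q => χ ≠ 1)) = Finset.univ.erase 1 := by
        ext χ; simp
      rw [← add_sum_erase univ _ (mem_univ (1 : DirichletCharacter ℂ q)), MulChar.one_apply hu', one_mul] at ho
      rw [hf]
      have : ((S * φ - Y : ℝ) : ℂ) = (∑ n ∈ Ico 1 M with ((n : ℕ) : ZMod q) = (a : ZMod q), (ArithmeticFunction.vonMangoldt n : ℂ) * (w (n / N) : ℂ)) * (q.totient : ℂ)
         - ∑ n ∈ Ico 1 M, (ArithmeticFunction.vonMangoldt n : ℂ) * (w (n / N) : ℂ) := by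
        rw [hS, hY, hφ]; push_cast; rfl
      rw [this, ho]; ring
    have hn : |S * φ - Y| = ‖((S * φ - Y : ℝ) : ℂ)‖ := by rw [Complex.norm_real, Real.norm_eq_abs]
    rw [hn, e]
    have hcard : (((Finset.univ.filter (fun χ : DirichletCharacter ℂ q => χ ≠ 1)).card : ℕ) : ℝ) + 1 = φ := by
      have hf : (Finset.univ.filter (fun χ : DirichletCharacter ℂ q => χ ≠ 1)) = Finset.univ.erase 1 := by
        ext χ; simp
      have hc : Finset.univ.card (α := DirichletCharacter ℂ q) = q.totient := by
        rw [Finset.card_univ, ← Nat.card_eq_fintype_card]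
        exact DirichletCharacter.card_eq_totient_of_hasEnoughRootsOfUnity ℂ q
      rw [hf, hφ, ← hc, ← card_erase_add_one (mem_univ (1 : DirichletCharacter ℂ q))]
      push_cast; rfl
    calc _ ≤ L * e2 + ∑ χ : DirichletCharacter ℂ q with χ ≠ 1, (‖psiW w N M χ.primitiveCharacter‖ + L * e2) := by
          refine (norm_add_le _ _).trans (add_le_add (psiW_one w L hL hb N M q) ?_)
          refine (norm_sum_le _ _).trans (sum_le_sum fun χ _ => ?_)
          rw [norm_mul]
          have hp := psiW_prim w L hL hb N M q χ.conductor_dvd_level χ.primitiveCharacter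
          rw [DirichletCharacter.changeLevel_primitiveCharacter] at hp
          calc _ ≤ 1 * ‖psiW w N M χ‖ := by
                gcongr
                exact DirichletCharacter.norm_le_one _ _
            _ = ‖psiW w N M χ.primitiveCharacter + (psiW w N M χ - psiW w N M χ.primitiveCharacter)‖ := by rw [one_mul]; congr 1; ring
            _ ≤ _ := (norm_add_le _ _).trans (by gcongr)
      _ = _ := by
          rw [sum_add_distrib, sum_const, nsmul_eq_mul, ← hcard]; ring
  set Z := ∑ χ : DirichletCharacter ℂ q with χ ≠ 1, ‖psiW w N M χ.primitiveCharacter‖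
  have h4 : |S - Y / φ| ≤ 1 / φ * Z + L * e2 := by
    have : S - Y / φ = (S * φ - Y) / φ := by field_simp
    rw [this, abs_div, abs_of_pos hφ0, div_le_iff₀ hφ0]
    refine h3.trans (le_of_eq ?_)
    field_simp
  have h5 : |Y / φ - thX w N M / φ| ≤ L * e1 := by
    rw [← sub_div, abs_div, abs_of_pos hφ0, div_le_iff₀ hφ0]
    have : 0 ≤ L * e1 := by positivity
    nlinarith
  have h6 : 0 ≤ L * e2 := by positivity
  rw [abs_le] at h1 h4 h5 ⊢
  constructor <;> linarith [h1.1, h1.2, h4.1, h4.2, h5.1, h5.2]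
end MT

namespace MT
open Finset Filter Topology

lemma sqf_sum (j n : ℕ) (hn : Squarefree n) : ((j:ℝ)+1)^n.primeFactors.card = ∑ d ∈ n.divisors, (j:ℝ)^d.primeFactors.card := by
  have hn0 : n ≠ 0 := hn.ne_zero
  have h := Finset.sum_pow_mul_eq_add_pow (j:ℝ) 1 n.primeFactors
  simp only [one_pow, mul_one] at h
  rw [← h]
  symm
  refine sum_nbij (fun d => d.primeFactors) ?_ ?_ ?_ ?_
  · intro d hd
    rw [mem_powerset]
    exact Nat.primeFactors_mono (Nat.dvd_of_mem_divisors hd) hn0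
  · intro d hd e he hde
    have hd' := Nat.prod_primeFactors_of_squarefree (hn.squarefree_of_dvd (Nat.dvd_of_mem_divisors hd))
    have he' := Nat.prod_primeFactors_of_squarefree (hn.squarefree_of_dvd (Nat.dvd_of_mem_divisors he))
    simp only at hde
    rw [← hd', hde, he']
  · intro t ht
    have ht' : t ⊆ n.primeFactors := by simpa using ht
    refine ⟨∏ p ∈ t, p, ?_, ?_⟩
    · simp only [mem_coe, Nat.mem_divisors]
      refine ⟨?_, hn0⟩
      rw [← Nat.prod_primeFactors_of_squarefree hn]
      exact Finset.prod_dvd_prod_of_subset _ _ _ ht'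
    · exact Nat.primeFactors_prod fun p hp => Nat.prime_of_mem_primeFactors (ht' hp)
  · intro d _; rfl

lemma omega_sum (j M : ℕ) (hM : 1 ≤ M) :
    ∑ n ∈ Ico 1 M with Squarefree n, (j:ℝ)^n.primeFactors.card / n ≤ (1 + Real.log M)^j := by
  induction j with
  | zero =>
    have : ∀ n ∈ (Ico 1 M).filter Squarefree, ((0:ℕ):ℝ)^n.primeFactors.card / n = if n = 1 then 1 else 0 := by
      intro n hn
      rw [mem_filter, mem_Ico] at hn
      split_ifs with h
      · subst h; simp
      · have : n.primeFactors.card ≠ 0 := by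
          rw [Finset.card_ne_zero, Nat.nonempty_primeFactors]; omega
        simp [this]
    rw [sum_congr rfl this, sum_ite_eq']
    split_ifs <;> simp
  | succ j ih =>
    have hlM : 0 ≤ Real.log M := Real.log_natCast_nonneg M
    set G : ℕ × ℕ → ℝ := fun x => (if Squarefree x.1 then (j:ℝ)^x.1.primeFactors.card / x.1 else 0) * (1 / (x.2:ℝ)) with hG
    have h1 : ∑ n ∈ Ico 1 M with Squarefree n, ((j+1:ℕ):ℝ)^n.primeFactors.card / n ≤
        ∑ n ∈ Ico 1 M, ∑ x ∈ n.divisorsAntidiagonal, G x := by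
      rw [sum_filter]
      refine sum_le_sum fun n hn => ?_
      split_ifs with h
      · push_cast
        rw [sqf_sum j n h, ← Nat.sum_divisorsAntidiagonal (fun i _ => (j:ℝ)^i.primeFactors.card), sum_div]
        refine sum_le_sum fun x hx => ?_
        have hx1 := (Nat.mem_divisorsAntidiagonal.mp hx).1
        have : Squarefree x.1 := h.squarefree_of_dvd ⟨x.2, hx1.symm⟩
        simp only [hG, this, if_true]
        rw [← hx1]; push_cast
        rw [div_mul_div_comm, mul_one]
      · exact sum_nonneg fun x _ => by simp only [hG]; positivity
    refine h1.trans ((sum_conv_le G (fun x => by simp only [hG]; positivity) M).trans ?_)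
    simp only [hG]
    rw [← sum_mul_sum, ← sum_filter, pow_succ]
    gcongr
    exact harmonic_le M hM

lemma tot_sqf (D : ℕ) (hD : Squarefree D) : (D.totient:ℝ) = ∏ p ∈ D.primeFactors, ((p:ℝ) - 1) := by
  have h := Nat.totient_mul_prod_primeFactors D
  rw [Nat.prod_primeFactors_of_squarefree hD, mul_comm] at h
  have := Nat.eq_of_mul_eq_mul_left (Nat.pos_of_ne_zero hD.ne_zero) h
  rw [this]; push_cast
  refine prod_congr rfl fun p hp => ?_
  have := (Nat.prime_of_mem_primeFactors hp).one_lt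
  rw [Nat.cast_sub this.le]; simp

lemma tot_sqrt (c D : ℕ) (hD : Squarefree D) (hp : ∀ p ∈ D.primeFactors, 4 * c^2 ≤ p) :
    (c:ℝ)^D.primeFactors.card / D.totient ≤ 1 / √D := by
  have : (√D:ℝ) = ∏ p ∈ D.primeFactors, √(p:ℝ) := by
    conv_lhs => rw [← Nat.prod_primeFactors_of_squarefree hD]
    push_cast
    rw [Real.sqrt_eq_rpow, ← Real.finsetProd_rpow _ _ (fun p _ => by positivity)]
    simp [Real.sqrt_eq_rpow]
  rw [this, tot_sqf D hD, ← prod_const, ← prod_div_distrib, one_div, ← prod_inv_distrib]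
  refine prod_le_prod (fun p hp => ?_) fun p hp' => ?_
  · have : (1:ℝ) ≤ p := by exact_mod_cast (Nat.prime_of_mem_primeFactors hp).one_lt.le
    exact div_nonneg (by positivity) (by linarith)
  · have h2 : (2:ℝ) ≤ p := by exact_mod_cast (Nat.prime_of_mem_primeFactors hp').two_le
    have h4 : (4:ℝ) * c^2 ≤ p := by exact_mod_cast hp p hp'
    have hs : (√(p:ℝ))^2 = p := Real.sq_sqrt (by linarith)
    have hs0 : 0 < √(p:ℝ) := Real.sqrt_pos.mpr (by linarith)
    have hcs : 2 * (c:ℝ) ≤ √(p:ℝ) := Real.le_sqrt_of_sq_le (by linarith)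
    rw [div_le_iff₀ (by linarith), inv_mul_eq_div, le_div_iff₀ hs0]
    nlinarith

lemma tot_two (c D : ℕ) (hD : Squarefree D) :
    (c:ℝ)^D.primeFactors.card / D.totient ≤ ((2*c:ℕ):ℝ)^D.primeFactors.card / D := by
  have : (D:ℝ) = ∏ p ∈ D.primeFactors, (p:ℝ) := by
    conv_lhs => rw [← Nat.prod_primeFactors_of_squarefree hD]
    push_cast; rfl
  rw [tot_sqf D hD]
  conv_rhs => rw [this]
  rw [← prod_const, ← prod_div_distrib, ← prod_const, ← prod_div_distrib]
  refine prod_le_prod (fun p hp => ?_) fun p hp' => ?_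
  · have : (1:ℝ) ≤ p := by exact_mod_cast (Nat.prime_of_mem_primeFactors hp).one_lt.le
    exact div_nonneg (by positivity) (by linarith)
  · have h2 : (2:ℝ) ≤ p := by exact_mod_cast (Nat.prime_of_mem_primeFactors hp').two_le
    rw [div_le_div_iff₀ (by linarith) (by linarith)]
    push_cast
    nlinarith [(Nat.cast_nonneg c : (0:ℝ) ≤ c)]

lemma kappa (c G M r : ℕ) (hG : 1 ≤ G) (hr : 1 ≤ r) (hM : 1 ≤ M) (𝒟 : Finset ℕ)
    (h𝒟 : ∀ D ∈ 𝒟, D < M ∧ Squarefree D ∧ D.Coprime G ∧ ∀ p ∈ D.primeFactors, 4 * c^2 ≤ p) :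
    ∑ D ∈ 𝒟 with r ∣ G * D, (c:ℝ)^D.primeFactors.card / (G * D).totient ≤ √(G/r) * (1 + Real.log M)^(2*c) := by
  have hlM : 0 ≤ Real.log M := Real.log_natCast_nonneg M
  set g := Nat.gcd r G with hg
  have hg1 : 0 < g := Nat.gcd_pos_of_pos_left _ hr
  set r' := r / g with hr'
  have hrr : r = r' * g := (Nat.div_mul_cancel (Nat.gcd_dvd_left r G)).symm
  have hr'1 : 0 < r' := by
    rcases Nat.eq_zero_or_pos r' with h | h
    · rw [h, zero_mul] at hrr; omega
    · exact h
  have hgG : g ≤ G := Nat.le_of_dvd hG (Nat.gcd_dvd_right r G)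
  have hdv : ∀ D ∈ 𝒟.filter (fun D => r ∣ G * D), r' ∣ D := by
    intro D hD
    have h1 := (mem_filter.mp hD).2
    have hc : Nat.Coprime r' (G / g) := Nat.coprime_div_gcd_div_gcd hg1
    refine hc.dvd_of_dvd_mul_left ?_
    have hGg : G = G / g * g := (Nat.div_mul_cancel (Nat.gcd_dvd_right r G)).symm
    rw [hGg, hrr] at h1
    have : r' * g ∣ (G / g * D) * g := by convert h1 using 1; ring
    exact Nat.dvd_of_mul_dvd_mul_right hg1 this
  have hs : 1 / √(r':ℝ) ≤ √(G/r) := by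
    rw [one_div, ← Real.sqrt_inv]
    apply Real.sqrt_le_sqrt
    rw [hrr]; push_cast
    rw [inv_eq_one_div, div_le_div_iff₀ (by exact_mod_cast hr'1) (by positivity)]
    have : (g:ℝ) ≤ G := by exact_mod_cast hgG
    have : (0:ℝ) < r' := by exact_mod_cast hr'1
    nlinarith
  calc _ ≤ ∑ D ∈ 𝒟 with r ∣ G * D, √(G/r) * (((2*c:ℕ):ℝ)^(D/r').primeFactors.card / ((D / r' : ℕ) : ℝ)) := by
        refine sum_le_sum fun D hD => ?_
        have hd := hdv D hD
        obtain ⟨h1, h2, h3, h4⟩ := h𝒟 D (mem_filter.mp hD).1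
        have hDe : D = r' * (D / r') := (Nat.mul_div_cancel' hd).symm
        set e := D / r' with he
        have h2' := h2
        rw [hDe, Nat.squarefree_mul_iff] at h2'
        obtain ⟨hcop, hsr, hse⟩ := h2'
        have hD0 : D ≠ 0 := h2.ne_zero
        calc (c:ℝ)^D.primeFactors.card / (G * D).totient ≤ (c:ℝ)^D.primeFactors.card / D.totient := by
              have : D.totient ≤ (G*D).totient := by
                rw [Nat.totient_mul h3.symm]
                exact Nat.le_mul_of_pos_left _ (Nat.totient_pos.mpr hG)
              have h0 : 0 < D.totient := Nat.totient_pos.mpr (Nat.pos_of_ne_zero hD0)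
              gcongr
          _ = ((c:ℝ)^r'.primeFactors.card / r'.totient) * ((c:ℝ)^e.primeFactors.card / e.totient) := by
              conv_lhs => rw [hDe]
              rw [hcop.primeFactors_mul, card_union_of_disjoint hcop.disjoint_primeFactors, Nat.totient_mul hcop, pow_add]
              push_cast
              rw [div_mul_div_comm]
          _ ≤ _ := by
              refine mul_le_mul ?_ (tot_two c e hse) (by positivity) (by positivity)
              refine (tot_sqrt c r' hsr fun p hp => h4 p ?_).trans hs
              exact Nat.primeFactors_mono hd hD0 hp
    _ = √(G/r) * ∑ e ∈ (𝒟.filter (fun D => r ∣ G * D)).image (fun D => D / r'), (((2*c:ℕ):ℝ)^e.primeFactors.card / (e : ℝ)) := by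
        rw [← mul_sum, sum_image]
        intro D hD E hE hDE
        simp only at hDE
        rw [← Nat.mul_div_cancel' (hdv D hD), ← Nat.mul_div_cancel' (hdv E hE), hDE]
    _ ≤ √(G/r) * ∑ e ∈ Ico 1 M with Squarefree e, (((2*c:ℕ):ℝ)^e.primeFactors.card / (e : ℝ)) := by
        gcongr
        intro e he
        obtain ⟨D, hD, rfl⟩ := mem_image.mp he
        obtain ⟨h1, h2, h3, h4⟩ := h𝒟 D (mem_filter.mp hD).1
        have hd := hdv D hD
        rw [mem_filter, mem_Ico]
        refine ⟨⟨Nat.div_pos (Nat.le_of_dvd (Nat.pos_of_ne_zero h2.ne_zero) hd) hr'1, (Nat.div_le_self _ _).trans_lt h1⟩, ?_⟩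
        exact h2.squarefree_of_dvd (Nat.div_dvd_of_dvd hd)
    _ ≤ _ := by
        gcongr
        exact omega_sum (2*c) M hM
end MT

namespace MT
open Finset Filter Topology

/-- nontrivial primitive characters inducing characters modulo `q` -/
noncomputable def charImg (q : ℕ) : Finset (Σ r, DirichletCharacter ℂ r) :=
  if h : q ≠ 0 then
    have : NeZero q := ⟨h⟩
    (Finset.univ.filter (fun χ : DirichletCharacter ℂ q => χ ≠ 1)).image (fun χ => ⟨χ.conductor, χ.primitiveCharacter⟩)
  else ∅

lemma charImg_prop (q : ℕ) (x : Σ r, DirichletCharacter ℂ r) (hx : x ∈ charImg q) :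
    x.1 ∣ q ∧ q ≠ 0 ∧ x.2.IsPrimitive ∧ x.2 ≠ 1 := by
  unfold charImg at hx
  split_ifs at hx with h
  · have : NeZero q := ⟨h⟩
    obtain ⟨χ, hχ, rfl⟩ := mem_image.mp hx
    refine ⟨χ.conductor_dvd_level, h, χ.primitiveCharacter_isPrimitive, fun h1 => ?_⟩
    have h2 := χ.changeLevel_primitiveCharacter
    simp only at h1
    rw [h1, DirichletCharacter.changeLevel_one] at h2
    exact (mem_filter.mp hχ).2 h2.symm
  · simp at hx

lemma charImg_sum (q : ℕ) [hq : NeZero q] (F : (Σ r, DirichletCharacter ℂ r) → ℝ) :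
    ∑ χ : DirichletCharacter ℂ q with χ ≠ 1, F ⟨χ.conductor, χ.primitiveCharacter⟩ = ∑ x ∈ charImg q, F x := by
  unfold charImg
  rw [dif_pos hq.out]
  rw [sum_image]
  intro χ _ ψ _ h
  have gen : ∀ x y : Σ r, DirichletCharacter ℂ r, x = y → ∀ (h1 : x.1 ∣ q) (h2 : y.1 ∣ q), x.2.changeLevel h1 = y.2.changeLevel h2 := by
    intro x y hxy h1 h2
    subst hxy; rfl
  have := gen _ _ h χ.conductor_dvd_level ψ.conductor_dvd_level
  simpa only [DirichletCharacter.changeLevel_primitiveCharacter] using this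

lemma swap_sum (c G : ℕ) (𝒟 : Finset ℕ) (F : (Σ r, DirichletCharacter ℂ r) → ℝ) (hF : ∀ x, 0 ≤ F x) :
    ∑ D ∈ 𝒟, (c:ℝ)^D.primeFactors.card / (G * D).totient * ∑ x ∈ charImg (G*D), F x ≤
    ∑ x ∈ 𝒟.biUnion (fun D => charImg (G*D)), F x * ∑ D ∈ 𝒟 with x.1 ∣ G * D, (c:ℝ)^D.primeFactors.card / (G * D).totient := by
  set X := 𝒟.biUnion (fun D => charImg (G*D)) with hX
  calc _ ≤ ∑ D ∈ 𝒟, (c:ℝ)^D.primeFactors.card / (G * D).totient * ∑ x ∈ X with x.1 ∣ G * D, F x := by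
        refine sum_le_sum fun D hD => ?_
        gcongr
        · exact fun i _ _ => hF i
        · intro x hx
          rw [mem_filter]
          exact ⟨mem_biUnion.mpr ⟨D, hD, hx⟩, (charImg_prop _ x hx).1⟩
    _ = _ := by
        simp only [sum_filter, mul_sum]
        rw [sum_comm]
        refine sum_congr rfl fun x _ => sum_congr rfl fun D _ => ?_
        split_ifs <;> ring

lemma ev_log (B E : ℕ) : ∀ᶠ l : ℝ in atTop, (2 + B * Real.log l)^E ≤ l := by
  have h := (Real.isLittleO_pow_log_id_atTop (n := E)).bound (c := 1/((2+B:ℕ):ℝ)^E) (by positivity)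
  filter_upwards [h, eventually_ge_atTop (Real.exp 1)] with l hl hl1
  have hl0 : 0 < l := (Real.exp_pos 1).trans_le hl1
  have h1 : 1 ≤ Real.log l := by rw [Real.le_log_iff_exp_le hl0]; exact hl1
  simp only [id, Real.norm_eq_abs] at hl
  rw [abs_of_pos hl0, abs_of_nonneg (by positivity), div_mul_eq_mul_div, one_mul, le_div_iff₀ (by positivity)] at hl
  calc (2 + B * Real.log l)^E ≤ ((2 + B) * Real.log l)^E := by
        apply pow_le_pow_left₀ (by positivity)
        nlinarith
    _ = Real.log l^E * ((2+B:ℕ):ℝ)^E := by push_cast; rw [mul_pow]; ring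
    _ ≤ l := hl

set_option maxHeartbeats 1600000 in
theorem bv (A c : ℕ) : ∃ B : ℕ, 1 ≤ B ∧ ∀ (w : ℝ → ℝ) (a b : ℝ), Cut w a b → ∀ G : ℕ, 1 ≤ G → ∃ N0 : ℝ, ∀ N : ℝ, N0 ≤ N →
    ∀ Q : ℕ, GoodQ Q → (Real.log N)^B ≤ 2 * Q → (Q:ℝ) ≤ (Real.log N)^B → ∀ M : ℕ, b * N < M → (M:ℝ) ≤ (b+2)*N →
    ∀ 𝒟 : Finset ℕ, (∀ D ∈ 𝒟, (D:ℝ)^50 ≤ N ∧ Squarefree D ∧ D.Coprime G ∧ ∀ p ∈ D.primeFactors, 4 * c^2 ≤ p) →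
    ∀ α : ℕ → ℕ, (∀ D ∈ 𝒟, (α D).Coprime (G*D)) →
    ∑ D ∈ 𝒟, (c:ℝ)^D.primeFactors.card * |thW w N M (G*D) (α D) - thX w N M / (G*D).totient| ≤ N / (Real.log N)^A := by
  set B' := 5 + 2*c + A + 1 with hB'
  set K := 2*c + 2*(2*B') + 1 + A + 1 with hK
  refine ⟨2*B', by omega, ?_⟩
  intro w a b hw G hG
  have hb0 : 0 < b := hw.ha.trans hw.hab
  have hG1 : (1:ℝ) ≤ G := by exact_mod_cast hG
  obtain ⟨L, hL, hwb, -⟩ := cut_lip w a b hw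
  obtain ⟨C1, E, hC1, hps⟩ := psi_small w a b hw K
  obtain ⟨C2, N2, hC2, hN21, hlc⟩ := large_cond w a b hw
  set lk := Real.log (b+2) with hlk
  have hlk0 : 0 ≤ lk := Real.log_nonneg (by linarith)
  set K3 := 2 * L * (2 * √(b+2) * (1+lk) + 6 * G * (1+lk)^2) with hK3
  have hK30 : 0 ≤ K3 := by positivity
  set Ctot := C1 * (√G * 3^(2*c)) + C2 * 32 * (√(2*G) * 3^(2*c)) + K3 with hCt
  have ev1 := Real.tendsto_log_atTop.eventually (ev_log (2*B') E)
  have ev2 := Real.tendsto_log_atTop.eventually (eventually_ge_atTop (max 1 Ctot))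
  have ev3 := (Real.isLittleO_pow_log_id_atTop (n := 4*(A+3))).bound (c := 1) (by norm_num)
  obtain ⟨N0, hN0⟩ := Filter.eventually_atTop.mp (ev1.and (ev2.and (ev3.and
    ((eventually_ge_atTop N2).and (eventually_ge_atTop ((G:ℝ)^200))))))
  refine ⟨N0, ?_⟩
  intro N hN Q hQ hQ1 hQ2 M hM hM2 𝒟 h𝒟 α hα
  obtain ⟨e1, e2, e3, e4, e5⟩ := hN0 N hN
  set l := Real.log N with hl
  have hl1 : 1 ≤ l := (le_max_left _ _).trans e2
  have hlC : Ctot ≤ l := (le_max_right _ _).trans e2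
  have hN1 : 1 < N := hN21.trans_le e4
  have hNpos : 0 < N := by linarith
  set t := N ^ ((1:ℝ)/100) with ht
  have ht100 : t^100 = N := by
    rw [ht, ← Real.rpow_natCast, ← Real.rpow_mul (by linarith)]; norm_num
  have ht1 : 1 < t := Real.one_lt_rpow (by linarith) (by norm_num)
  have ht0 : 0 < t := by linarith
  have hlt : l^(A+3) ≤ t^25 := by
    simp only [id, Real.norm_eq_abs, one_mul] at e3
    rw [abs_of_pos hNpos, abs_of_nonneg (by positivity)] at e3
    refine le_of_pow_le_pow_left₀ (n := 4) (by norm_num) (by positivity) ?_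
    calc (l^(A+3))^4 = l^(4*(A+3)) := by rw [← pow_mul]; ring_nf
      _ ≤ N := e3
      _ = (t^25)^4 := by rw [← ht100]; ring
  have hGt : (G:ℝ) ≤ t^(1/2:ℝ) := by
    refine le_of_pow_le_pow_left₀ (n := 200) (by norm_num) (by positivity) ?_
    calc (G:ℝ)^200 ≤ N := e5
      _ = _ := by
        rw [← Real.rpow_natCast (t^(1/2:ℝ)), ← Real.rpow_mul ht0.le, ← ht100, ← Real.rpow_natCast]; norm_num
  have hDt : ∀ D ∈ 𝒟, (D:ℝ) ≤ t^2 := by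
    intro D hD
    refine le_of_pow_le_pow_left₀ (n := 50) (by norm_num) (by positivity) ?_
    calc _ ≤ N := (h𝒟 D hD).1
      _ = _ := by rw [← ht100]; ring
  have hD1 : ∀ D ∈ 𝒟, 1 ≤ D := fun D hD => Nat.pos_of_ne_zero (h𝒟 D hD).2.1.ne_zero
  set R := ⌊(G:ℝ) * t^2⌋₊ with hR
  have hR40 : (R:ℝ)^40 ≤ N := by
    have h1 : (R:ℝ) ≤ G * t^2 := Nat.floor_le (by positivity)
    calc (R:ℝ)^40 ≤ (t^(1/2:ℝ) * t^2)^40 := by gcongr; exact h1.trans (by gcongr)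
      _ = t^100 := by
        rw [mul_pow, ← Real.rpow_natCast (t^(1/2:ℝ)), ← Real.rpow_mul ht0.le]; norm_num
        norm_cast
        ring
      _ = N := ht100
  have hGDR : ∀ D ∈ 𝒟, G * D ≤ R := by
    intro D hD
    apply Nat.le_floor
    push_cast
    have := hDt D hD
    gcongr
  set M' := ⌊t^2⌋₊ + 1 with hM'
  have hDM' : ∀ D ∈ 𝒟, D < M' := by
    intro D hD
    have := Nat.le_floor (hDt D hD)
    omega
  have htN : t^2 ≤ N := by rw [← ht100]; exact pow_le_pow_right₀ ht1.le (by norm_num)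
  have hlM' : 1 + Real.log M' ≤ 3 * l := by
    have h1 : (M':ℝ) ≤ 2 * N := by
      rw [hM']; push_cast
      have := Nat.floor_le (by positivity : 0 ≤ t^2)
      linarith
    have h2 : Real.log M' ≤ Real.log (2 * N) := Real.log_le_log (by rw [hM']; positivity) h1
    rw [Real.log_mul (by norm_num) (by linarith)] at h2
    have := Real.log_two_lt_d9
    linarith
  have hlM'0 : 0 ≤ Real.log M' := Real.log_natCast_nonneg M'
  have hkap : ∀ r : ℕ, 1 ≤ r → ∑ D ∈ 𝒟 with r ∣ G * D, (c:ℝ)^D.primeFactors.card / (G * D).totient ≤ √(G/r) * (3*l)^(2*c) := by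
    intro r hr
    refine (kappa c G M' r hG hr (by omega) 𝒟 (fun D hD => ⟨hDM' D hD, (h𝒟 D hD).2⟩)).trans ?_
    gcongr
  -- the characters
  set X := 𝒟.biUnion (fun D => charImg (G*D)) with hX
  have hFam : Fam X R := by
    intro x hx
    obtain ⟨D, hD, hx⟩ := mem_biUnion.mp hx
    obtain ⟨h1, h2, h3, h4⟩ := charImg_prop _ x hx
    refine ⟨?_, (Nat.le_of_dvd (Nat.pos_of_ne_zero h2) h1).trans (hGDR D hD), h3, h4⟩
    rintro h0
    rw [h0, zero_dvd_iff] at h1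
    exact h2 h1
  have hQpos : (0:ℝ) < Q := by
    have : (1:ℝ) ≤ l^(2*B') := one_le_pow₀ hl1
    linarith
  have hsmall : ∑ x ∈ X with x.1 ≤ Q, ‖psiW w N M x.2‖ * ∑ D ∈ 𝒟 with x.1 ∣ G * D, (c:ℝ)^D.primeFactors.card / (G * D).totient ≤
      C1 * (√G * 3^(2*c)) * (N / l^(A+1)) := by
    have hF : Fam (X.filter (fun x => x.1 ≤ Q)) Q := by
      intro x hx
      obtain ⟨h1, h2⟩ := mem_filter.mp hx
      exact ⟨(hFam x h1).1, h2, (hFam x h1).2.2⟩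
    have hcard := Fam_card _ Q hF
    have hterm : ∀ x ∈ X.filter (fun x => x.1 ≤ Q), ‖psiW w N M x.2‖ * ∑ D ∈ 𝒟 with x.1 ∣ G * D, (c:ℝ)^D.primeFactors.card / (G * D).totient ≤
        (C1 * N * l / l^K) * (√G * (3*l)^(2*c)) := by
      intro x hx
      obtain ⟨h1, h2, h3, h4⟩ := hF x hx
      have hx1 : 1 ≤ x.1 := Nat.pos_of_ne_zero h1
      refine mul_le_mul ?_ ((hkap x.1 hx1).trans ?_) (sum_nonneg fun _ _ => by positivity) (by positivity)
      · have := hps Q hQ x.1 ⟨h1⟩ h2 x.2 h3 h4 N hN1 M hM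
        refine this.trans ?_
        rw [← hl]
        refine div_le_div_of_nonneg_right (mul_le_mul_of_nonneg_left ?_ (by positivity)) (by positivity)
        refine le_trans ?_ e1
        have hlq : Real.log (2 * Q : ℕ) ≤ 1 + (2*B':ℕ) * Real.log l := by
          push_cast
          rw [Real.log_mul (by norm_num) hQpos.ne']
          have h5 : Real.log Q ≤ Real.log (l^(2*B')) := Real.log_le_log hQpos hQ2
          rw [Real.log_pow] at h5
          push_cast at h5
          have := Real.log_two_lt_d9
          linarith
        have : 0 ≤ Real.log (2 * Q : ℕ) := Real.log_natCast_nonneg _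
        exact pow_le_pow_left₀ (by linarith) (by linarith) _
      · exact mul_le_mul_of_nonneg_right (Real.sqrt_le_sqrt (div_le_self (by linarith) (by exact_mod_cast hx1))) (by positivity)
    calc _ ≤ ((X.filter (fun x => x.1 ≤ Q)).card : ℝ) * ((C1 * N * l / l^K) * (√G * (3*l)^(2*c))) := by
          rw [← nsmul_eq_mul]; exact sum_le_card_nsmul _ _ _ hterm
      _ ≤ (l^(2*B'))^2 * ((C1 * N * l / l^K) * (√G * (3*l)^(2*c))) := by
          gcongr
          calc _ ≤ ((Q^2:ℕ):ℝ) := by exact_mod_cast hcard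
            _ ≤ _ := by push_cast; gcongr
      _ = _ := by
          have : l^K = l^(2*c) * (l^(2*B'))^2 * l * l^(A+1) := by
            rw [hK, ← pow_mul]; ring
          rw [this]
          field_simp
          ring
  have hlarge : ∑ x ∈ X with ¬ x.1 ≤ Q, ‖psiW w N M x.2‖ * ∑ D ∈ 𝒟 with x.1 ∣ G * D, (c:ℝ)^D.primeFactors.card / (G * D).totient ≤
      C2 * 32 * (√(2*G) * 3^(2*c)) * (N / l^(A+1)) := by
    have hF : Fam (X.filter (fun x => ¬ x.1 ≤ Q)) R := by
      intro x hx
      exact hFam x (mem_filter.mp hx).1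
    have hk2 : ∀ x ∈ X.filter (fun x => ¬ x.1 ≤ Q), ∑ D ∈ 𝒟 with x.1 ∣ G * D, (c:ℝ)^D.primeFactors.card / (G * D).totient ≤
        √(2*G) / l^B' * (3*l)^(2*c) := by
      intro x hx
      have hxQ := (mem_filter.mp hx).2
      have hx1 : 1 ≤ x.1 := Nat.pos_of_ne_zero (hF x hx).1
      refine (hkap x.1 hx1).trans ?_
      gcongr
      have h1 : (G:ℝ) / x.1 ≤ 2*G / (l^B')^2 := by
        rw [div_le_div_iff₀ (by exact_mod_cast hx1) (by positivity), ← pow_mul]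
        have h2 : l^(B'*2) ≤ 2 * x.1 := by
          rw [mul_comm]
          refine hQ1.trans ?_
          have : (Q:ℝ) ≤ x.1 := by exact_mod_cast (not_le.mp hxQ).le
          linarith
        nlinarith
      calc √((G:ℝ) / x.1) ≤ √(2*G / (l^B')^2) := Real.sqrt_le_sqrt h1
        _ = _ := by rw [Real.sqrt_div (by positivity), Real.sqrt_sq (by positivity)]
    calc _ ≤ ∑ x ∈ X with ¬ x.1 ≤ Q, ‖psiW w N M x.2‖ * (√(2*G) / l^B' * (3*l)^(2*c)) := by
          refine sum_le_sum fun x hx => ?_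
          have := hk2 x hx
          gcongr
      _ = (∑ x ∈ X with ¬ x.1 ≤ Q, ‖psiW w N M x.2‖) * (√(2*G) / l^B' * (3*l)^(2*c)) := by rw [sum_mul]
      _ ≤ (C2 * N * (1 + l)^5) * (√(2*G) / l^B' * (3*l)^(2*c)) := by
          gcongr
          exact hlc N e4 R hR40 _ hF M hM hM2
      _ ≤ (C2 * N * (2 * l)^5) * (√(2*G) / l^B' * (3*l)^(2*c)) := by
          gcongr
          linarith
      _ = _ := by
          have : l^B' = l^5 * l^(2*c) * l^(A+1) := by rw [hB']; ring
          rw [this]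
          field_simp
          ring
  -- error terms
  have hlM : Real.log M ≤ (1 + lk) * l := by
    have h1 : Real.log M ≤ lk + l := by
      rw [hlk, hl, ← Real.log_mul (by linarith) (by linarith)]
      exact Real.log_le_log ((by positivity : 0 < b * N).trans hM) hM2
    nlinarith
  have hM1 : 1 ≤ M := by
    have : (0:ℝ) < M := (by positivity : 0 < b * N).trans hM
    exact_mod_cast this
  have hlM0 : 0 ≤ Real.log M := Real.log_natCast_nonneg M
  have hsN : √N = t^50 := by
    rw [← ht100]
    rw [show t^100 = (t^50)^2 by ring, Real.sqrt_sq (by positivity)]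
  have herr1 : ∑ n ∈ Ico 1 M with ¬ n.Prime, ArithmeticFunction.vonMangoldt n ≤ 2 * √(b+2) * (1+lk) * t^50 * l^2 := by
    by_cases hM2' : 2 ≤ M
    · refine (nonprime_sum M hM2').trans ?_
      have h1 : √(M:ℝ) ≤ √(b+2) * t^50 := by
        rw [← hsN, ← Real.sqrt_mul (by linarith)]
        exact Real.sqrt_le_sqrt hM2
      calc 2 * √(M:ℝ) * Real.log M ≤ 2 * (√(b+2) * t^50) * ((1+lk) * l) := by gcongr
        _ = 2 * √(b+2) * (1+lk) * t^50 * l^1 := by ring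
        _ ≤ _ := by
          gcongr
          norm_num
    · have : M = 1 := by omega
      subst this
      simp; positivity
  have herr2 : ∀ D ∈ 𝒟, ∑ n ∈ Ico 1 M with ¬ n.Coprime (G*D), ArithmeticFunction.vonMangoldt n ≤ 6 * G * (1+lk)^2 * t^50 * l^2 := by
    intro D hD
    refine (noncop_sum (G*D) M (Nat.mul_pos hG (hD1 D hD)) hM1).trans ?_
    have h1 : (((G*D:ℕ):ℝ) + 1) ≤ 2 * G * t^50 := by
      have h2 : ((G*D:ℕ):ℝ) ≤ G * t^50 := by
        push_cast
        gcongr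
        exact (hDt D hD).trans (pow_le_pow_right₀ ht1.le (by norm_num))
      have h3 : (1:ℝ) ≤ G * t^50 := by
        have : 1 ≤ t^50 := one_le_pow₀ ht1.le
        nlinarith
      linarith
    have h4 : 2 * Real.log M + 1 ≤ 3 * ((1+lk) * l) := by nlinarith
    calc _ ≤ (2 * G * t^50) * (3 * ((1+lk) * l)) * ((1+lk) * l) := by gcongr
      _ = _ := by ring
  have hcw : ∀ D ∈ 𝒟, (c:ℝ)^D.primeFactors.card ≤ t^2 := by
    intro D hD
    refine le_trans ?_ (hDt D hD)
    have hsq := (h𝒟 D hD).2.1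
    conv_rhs => rw [← Nat.prod_primeFactors_of_squarefree hsq]
    push_cast
    rw [← prod_const]
    refine prod_le_prod (fun _ _ => by positivity) fun p hp => ?_
    have := (h𝒟 D hD).2.2.2 p hp
    have : c ≤ p := by nlinarith
    exact_mod_cast this
  have hcard : (𝒟.card:ℝ) ≤ t^2 := by
    have h1 : 𝒟 ⊆ Ico 1 M' := fun D hD => mem_Ico.mpr ⟨hD1 D hD, hDM' D hD⟩
    have h2 := card_le_card h1
    rw [Nat.card_Ico, hM', Nat.add_sub_cancel] at h2
    calc (𝒟.card:ℝ) ≤ (⌊t^2⌋₊:ℝ) := by exact_mod_cast h2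
      _ ≤ _ := Nat.floor_le (by positivity)
  have herr : ∑ D ∈ 𝒟, (c:ℝ)^D.primeFactors.card * (2 * L * ((∑ n ∈ Ico 1 M with ¬ n.Prime, ArithmeticFunction.vonMangoldt n) + ∑ n ∈ Ico 1 M with ¬ n.Coprime (G*D), ArithmeticFunction.vonMangoldt n))
      ≤ K3 * (N / l^(A+1)) := by
    calc _ ≤ ∑ D ∈ 𝒟, t^2 * (K3 * t^50 * l^2) := by
          refine sum_le_sum fun D hD => ?_
          have h1 := hcw D hD
          have h2 := herr2 D hD
          have h3 : 0 ≤ ∑ n ∈ Ico 1 M with ¬ n.Coprime (G*D), ArithmeticFunction.vonMangoldt n :=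
            sum_nonneg fun _ _ => ArithmeticFunction.vonMangoldt_nonneg
          have h4 : 0 ≤ ∑ n ∈ Ico 1 M with ¬ n.Prime, ArithmeticFunction.vonMangoldt n :=
            sum_nonneg fun _ _ => ArithmeticFunction.vonMangoldt_nonneg
          calc _ ≤ t^2 * (2 * L * (2 * √(b+2) * (1+lk) * t^50 * l^2 + 6 * G * (1+lk)^2 * t^50 * l^2)) := by gcongr
            _ = _ := by rw [hK3]; ring
      _ = 𝒟.card * (t^2 * (K3 * t^50 * l^2)) := by rw [sum_const, nsmul_eq_mul]
      _ ≤ t^2 * (t^2 * (K3 * t^50 * l^2)) := by gcongr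
      _ = K3 * (t^54 * l^2) := by ring
      _ ≤ _ := by
          gcongr
          rw [le_div_iff₀ (by positivity)]
          calc t^54 * l^2 * l^(A+1) = t^54 * l^(A+3) := by ring
            _ ≤ t^54 * t^25 := by gcongr
            _ = t^79 := by ring
            _ ≤ t^100 := pow_le_pow_right₀ ht1.le (by norm_num)
            _ = N := ht100
  calc _ ≤ ∑ D ∈ 𝒟, ((c:ℝ)^D.primeFactors.card / (G * D).totient * ∑ x ∈ charImg (G*D), ‖psiW w N M x.2‖ +
        (c:ℝ)^D.primeFactors.card * (2 * L * ((∑ n ∈ Ico 1 M with ¬ n.Prime, ArithmeticFunction.vonMangoldt n) + ∑ n ∈ Ico 1 M with ¬ n.Coprime (G*D), ArithmeticFunction.vonMangoldt n))) := by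
        refine sum_le_sum fun D hD => ?_
        have hGD : 1 ≤ G * D := Nat.mul_pos hG (hD1 D hD)
        have : NeZero (G*D) := ⟨by omega⟩
        have h1 := one_class w L hL.le hwb N M (G*D) (α D) hGD (hα D hD)
        have h2 := charImg_sum (G*D) (fun x => ‖psiW w N M x.2‖)
        simp only at h2
        rw [h2] at h1
        refine (mul_le_mul_of_nonneg_left h1 (by positivity)).trans (le_of_eq ?_)
        ring
    _ ≤ ∑ x ∈ X, ‖psiW w N M x.2‖ * (∑ D ∈ 𝒟 with x.1 ∣ G * D, (c:ℝ)^D.primeFactors.card / (G * D).totient) + K3 * (N / l^(A+1)) := by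
        rw [sum_add_distrib]
        exact add_le_add (swap_sum c G 𝒟 (fun x => ‖psiW w N M x.2‖) fun x => norm_nonneg _) herr
    _ ≤ Ctot * (N / l^(A+1)) := by
        rw [← sum_filter_add_sum_filter_not X (fun x => x.1 ≤ Q)]
        calc _ ≤ _ := add_le_add (add_le_add hsmall hlarge) le_rfl
          _ = _ := by rw [hCt]; ring
    _ ≤ l * (N / l^(A+1)) := by gcongr
    _ = _ := by rw [pow_succ]; field_simp
end MT

namespace MT
open Finset Filter Topology

section
variable {ι : Type} [Fintype ι]

/-- all slots containing a common prime belong to the same form -/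
def Val {ι : Type} (A : ι × Bool → Finset ℕ) : Prop := ∀ p j jj, p ∈ A j → p ∈ A jj → j.1 = jj.1

/-- local version -/
def ValS {ι : Type} (S : Finset (ι × Bool)) : Prop := ∀ j ∈ S, ∀ jj ∈ S, j.1 = jj.1

/-- the sieve main term -/
noncomputable def sieveT (P : Finset ℕ) (ω : ℕ → ℝ) (F : ι × Bool → ℝ → ℝ) (lam : ℝ) : ℝ :=
  ∑ A ∈ Fintype.piFinset (fun _ : ι × Bool => P.powerset),
    if Val A then (∏ j, (-1:ℝ)^(A j).card * F j ((∑ p ∈ A j, Real.log p) / lam)) * ∏ p ∈ univ.biUnion A, ω p else 0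

lemma slots_gen (P : Finset ℕ) (Wt : ℕ → Finset (ι × Bool) → ℂ) :
    ∑ A ∈ Fintype.piFinset (fun _ : ι × Bool => P.powerset), ∏ p ∈ P, Wt p (univ.filter (fun j => p ∈ A j)) =
      ∏ p ∈ P, ∑ S : Finset (ι × Bool), Wt p S := by
  rw [Finset.prod_sum]
  refine sum_bij' (fun A _ => fun p _ => univ.filter (fun j => p ∈ A j))
    (fun f _ => fun j => P.filter (fun p => ∃ h : p ∈ P, j ∈ f p h)) ?_ ?_ ?_ ?_ ?_
  · intro A _; simp
  · intro f _; simp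
  · intro A hA
    funext j
    have hA' : A j ⊆ P := by
      have := Fintype.mem_piFinset.mp hA j
      simpa using this
    ext p
    simp only [mem_filter, mem_univ, true_and, exists_prop]
    constructor
    · exact fun h => h.2.2
    · exact fun h => ⟨hA' h, hA' h, h⟩
  · intro f _
    funext p hp
    ext j
    simp [hp]
  · intro A _
    rw [← prod_attach P]

lemma valS_sum (x : ι × Bool → ℂ) (w : ℂ) :
    ∑ S : Finset (ι × Bool), (if ValS S then (if S = ∅ then 1 else w) * ∏ j ∈ S, (-x j) else 0) =
      1 + w * ∑ i, ((1 - x (i, false)) * (1 - x (i, true)) - 1) := by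
  set T : Finset (Finset Bool) := {{false}, {true}, {false, true}} with hT
  set f : Finset (ι × Bool) → ℂ := fun S => (if ValS S then (if S = ∅ then 1 else w) * ∏ j ∈ S, (-x j) else 0) with hf
  have hTne : ∀ U ∈ T, U.Nonempty := by
    intro U hU
    simp only [hT, mem_insert, mem_singleton] at hU
    rcases hU with rfl | rfl | rfl <;> simp
  have key : ∑ S ∈ univ.erase (∅ : Finset (ι × Bool)), f S = ∑ i : ι, ∑ U ∈ T, f ({i} ×ˢ U) := by
    rw [← sum_product']
    symm
    rw [← sum_filter_add_sum_filter_not (univ.erase (∅ : Finset (ι × Bool))) ValS]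
    have h0 : ∑ S ∈ univ.erase (∅ : Finset (ι × Bool)) with ¬ ValS S, f S = 0 :=
      sum_eq_zero fun S hS => by simp only [hf]; rw [if_neg (mem_filter.mp hS).2]
    rw [h0, add_zero]
    refine sum_bij (fun y _ => {y.1} ×ˢ y.2) ?_ ?_ ?_ ?_
    · rintro ⟨i, U⟩ hy
      have hU := hTne U (mem_product.mp hy).2
      rw [mem_filter, mem_erase]
      refine ⟨⟨?_, mem_univ _⟩, ?_⟩
      · rw [← Finset.nonempty_iff_ne_empty]
        exact (singleton_nonempty i).product hU
      · intro j hj j' hj'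
        rw [mem_product, mem_singleton] at hj hj'
        rw [hj.1, hj'.1]
    · rintro ⟨i, U⟩ hy ⟨i', U'⟩ hy' h
      obtain ⟨b, hb⟩ := hTne U (mem_product.mp hy).2
      simp only at h
      have hii : i = i' := by
        have : (i, b) ∈ ({i'} : Finset ι) ×ˢ U' := by rw [← h]; simp [hb]
        simpa using (mem_product.mp this).1
      subst hii
      have : U = U' := by
        ext b
        have : (i, b) ∈ ({i} : Finset ι) ×ˢ U ↔ (i, b) ∈ ({i} : Finset ι) ×ˢ U' := by rw [h]
        simpa using this
      rw [this]
    · intro S hS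
      rw [mem_filter, mem_erase] at hS
      obtain ⟨⟨hne, -⟩, hv⟩ := hS
      obtain ⟨⟨i, b⟩, hib⟩ := Finset.nonempty_iff_ne_empty.mpr hne
      refine ⟨(i, univ.filter (fun b => (i, b) ∈ S)), ?_, ?_⟩
      · rw [mem_product]
        refine ⟨mem_univ _, ?_⟩
        simp only [hT, mem_insert, mem_singleton]
        by_cases h1 : (i, false) ∈ S <;> by_cases h2 : (i, true) ∈ S
        · right; right; ext b; cases b <;> simp [h1, h2]
        · left; ext b; cases b <;> simp [h1, h2]
        · right; left; ext b; cases b <;> simp [h1, h2]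
        · cases b <;> contradiction
      · ext ⟨i', b'⟩
        simp only [mem_product, mem_singleton, mem_filter, mem_univ, true_and]
        constructor
        · rintro ⟨rfl, h⟩; exact h
        · intro h
          have : i' = i := hv _ h _ hib
          subst this
          exact ⟨rfl, h⟩
    · intro y _; rfl
  have hfe : f ∅ = 1 := by simp [hf, ValS]
  rw [← add_sum_erase univ f (mem_univ ∅), key, hfe, mul_sum]
  congr 1
  refine sum_congr rfl fun i _ => ?_
  have hval : ∀ U : Finset Bool, U.Nonempty → f ({i} ×ˢ U) = w * ∏ b ∈ U, (-x (i, b)) := by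
    intro U hU
    simp only [hf]
    rw [if_pos, if_neg, prod_product]
    · simp
    · rw [← ne_eq, ← Finset.nonempty_iff_ne_empty]
      exact (singleton_nonempty i).product hU
    · intro j hj j' hj'
      rw [mem_product, mem_singleton] at hj hj'
      rw [hj.1, hj'.1]
  rw [sum_congr rfl fun U hU => hval U (hTne U hU), hT]
  rw [sum_insert (by decide), sum_insert (by decide), sum_singleton]
  simp
  ring

lemma slots_id (P : Finset ℕ) (ω : ℕ → ℂ) (x : ι × Bool → ℕ → ℂ) :
    ∑ A ∈ Fintype.piFinset (fun _ : ι × Bool => P.powerset),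
      (if Val A then (∏ j, ∏ p ∈ A j, (-x j p)) * ∏ p ∈ univ.biUnion A, ω p else 0) =
    ∏ p ∈ P, (1 + ω p * ∑ i, ((1 - x (i, false) p) * (1 - x (i, true) p) - 1)) := by
  rw [prod_congr rfl fun p _ => (valS_sum (fun j => x j p) (ω p)).symm, ← slots_gen]
  refine sum_congr rfl fun A hA => ?_
  have hA' : ∀ j, A j ⊆ P := by
    intro j
    have := Fintype.mem_piFinset.mp hA j
    simpa using this
  have hv : Val A ↔ ∀ p ∈ P, ValS (univ.filter (fun j => p ∈ A j)) := by
    constructor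
    · intro h p _ j hj j' hj'
      exact h p j j' (mem_filter.mp hj).2 (mem_filter.mp hj').2
    · intro h p j j' hj hj'
      exact h p (hA' j hj) j (by simp [hj]) j' (by simp [hj'])
  by_cases h : Val A
  · rw [if_pos h]
    have h' := hv.mp h
    rw [prod_congr rfl fun p hp => if_pos (h' p hp), prod_mul_distrib, mul_comm]
    congr 1
    · have hsub : univ.biUnion A ⊆ P := by
        intro p hp
        obtain ⟨j, _, hj⟩ := mem_biUnion.mp hp
        exact hA' j hj
      have hone : ∀ p ∈ P, p ∉ univ.biUnion A →
          (if (univ.filter (fun j => p ∈ A j)) = ∅ then (1:ℂ) else ω p) = 1 := by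
        intro p _ hp
        rw [if_pos]
        ext j
        simp only [mem_filter, mem_univ, true_and, notMem_empty, iff_false]
        exact fun hj => hp (mem_biUnion.mpr ⟨j, mem_univ _, hj⟩)
      rw [← prod_subset hsub hone]
      refine prod_congr rfl fun p hp => ?_
      obtain ⟨j, _, hj⟩ := mem_biUnion.mp hp
      rw [if_neg]
      intro he
      have : j ∈ univ.filter (fun j => p ∈ A j) := by simp [hj]
      rw [he] at this
      simp at this
    · simp only [prod_filter]
      rw [Finset.prod_comm]
      refine prod_congr rfl fun j _ => ?_
      rw [← prod_filter]
      refine prod_congr ?_ fun _ _ => rfl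
      ext p
      simp only [mem_filter]
      exact ⟨fun h => ⟨hA' j h, h⟩, fun h => h.2⟩
  · rw [if_neg h]
    rw [hv] at h
    push Not at h
    obtain ⟨p, hp, hp'⟩ := h
    exact (prod_eq_zero hp (if_neg hp')).symm
end
end MT

namespace MT
open Finset Filter Topology MeasureTheory
open scoped SchwartzMap

lemma F_rep (F : ℝ → ℝ) (hF : ContDiff ℝ (⊤:ℕ∞) F) (hc : HasCompactSupport F) :
    ∃ h : 𝓢(ℝ, ℂ), ∀ u : ℝ, (F u : ℂ) = ∫ t : ℝ, h t * Complex.exp (-((1 + Complex.I * t) * u)) := by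
  obtain ⟨h, hh⟩ := fourier_rep (fun u => Real.exp u * F u) (Real.contDiff_exp.mul hF) (hc.mul_left)
  refine ⟨h, fun u => ?_⟩
  have := hh u
  have e : (F u : ℂ) = Complex.exp (-u) * ((Real.exp u * F u : ℝ) : ℂ) := by
    push_cast
    rw [← mul_assoc, ← Complex.exp_add]
    simp
  rw [e, this, ← integral_const_mul]
  congr 1
  funext t
  rw [mul_left_comm, ← Complex.exp_add]
  congr 2
  ring

/-- the number p^{-(1+it)/lam} -/
noncomputable def xx (lam t : ℝ) (p : ℕ) : ℂ := Complex.exp (-((1 + Complex.I * t) * ((Real.log p / lam : ℝ) : ℂ)))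

lemma xx_cont (lam : ℝ) (p : ℕ) : Continuous (fun t => xx lam t p) := by
  unfold xx
  fun_prop

lemma xx_norm (lam t : ℝ) (p : ℕ) : ‖xx lam t p‖ = Real.exp (-(Real.log p / lam)) := by
  unfold xx
  rw [Complex.norm_exp]
  congr 1
  generalize Real.log p / lam = r
  simp [Complex.mul_re]

lemma xx_norm_le (lam t : ℝ) (hl : 0 < lam) (p : ℕ) : ‖xx lam t p‖ ≤ 1 := by
  rw [xx_norm, Real.exp_le_one_iff]
  have := Real.log_natCast_nonneg p
  have : 0 ≤ Real.log p / lam := by positivity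
  linarith

lemma xx_prod (lam t : ℝ) (B : Finset ℕ) : ∏ p ∈ B, (-xx lam t p) =
    (-1)^B.card * Complex.exp (-((1 + Complex.I * t) * (((∑ p ∈ B, Real.log p) / lam : ℝ) : ℂ))) := by
  have : ∏ p ∈ B, (-xx lam t p) = ∏ p ∈ B, ((-1) * xx lam t p) := prod_congr rfl fun p _ => by ring
  rw [this, prod_mul_distrib, prod_const]
  congr 1
  unfold xx
  rw [← Complex.exp_sum]
  congr 1
  rw [sum_neg_distrib, ← mul_sum, sum_div]
  push_cast
  rfl

section
variable {ι : Type} [Fintype ι]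

/-- local factor -/
noncomputable def aP (ω : ℕ → ℝ) (lam : ℝ) (τ : ι → ℝ × ℝ) (p : ℕ) : ℂ :=
  1 + (ω p : ℂ) * ∑ i, ((1 - xx lam (τ i).1 p) * (1 - xx lam (τ i).2 p) - 1)

lemma aP_cont (ω : ℕ → ℝ) (lam : ℝ) (p : ℕ) : Continuous (fun τ : ι → ℝ × ℝ => aP ω lam τ p) := by
  unfold aP
  have := xx_cont lam p
  refine continuous_const.add (continuous_const.mul (continuous_finsetSum _ fun i _ => ?_))
  have h1 : Continuous (fun τ : ι → ℝ × ℝ => xx lam (τ i).1 p) := this.comp (by fun_prop)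
  have h2 : Continuous (fun τ : ι → ℝ × ℝ => xx lam (τ i).2 p) := this.comp (by fun_prop)
  fun_prop

/-- the product of the Fourier weights -/
noncomputable def hh (h : ι × Bool → 𝓢(ℝ, ℂ)) (τ : ι → ℝ × ℝ) : ℂ :=
  ∏ i, (h (i, false) (τ i).1 * h (i, true) (τ i).2)

lemma sieveT_rep (P : Finset ℕ) (ω : ℕ → ℝ) (F : ι × Bool → ℝ → ℝ) (lam : ℝ) (hl : 0 < lam)
    (h : ι × Bool → 𝓢(ℝ, ℂ))
    (hF : ∀ j u, (F j u : ℂ) = ∫ t : ℝ, h j t * Complex.exp (-((1 + Complex.I * t) * u))) :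
    (sieveT P ω F lam : ℂ) = ∫ τ : ι → ℝ × ℝ, hh h τ * ∏ p ∈ P, aP ω lam τ p := by
  set g : (ι × Bool → Finset ℕ) → ι → ℝ × ℝ → ℂ := fun A i t =>
    (h (i, false) t.1 * ∏ p ∈ A (i, false), (-xx lam t.1 p)) *
    (h (i, true) t.2 * ∏ p ∈ A (i, true), (-xx lam t.2 p)) with hg
  have hint1 : ∀ j (B : Finset ℕ), Integrable (fun t : ℝ => h j t * ∏ p ∈ B, (-xx lam t p)) := by
    intro j B
    refine (h j).integrable.norm.mono' ?_ (Eventually.of_forall fun t => ?_)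
    · refine Continuous.aestronglyMeasurable ?_
      refine (h j).continuous.mul (continuous_finsetProd _ fun p _ => (xx_cont lam p).neg)
    · rw [norm_mul, norm_prod]
      refine mul_le_of_le_one_right (norm_nonneg _) (prod_le_one (fun _ _ => norm_nonneg _) fun p _ => ?_)
      rw [norm_neg]
      exact xx_norm_le lam t hl p
  have hintg : ∀ A, Integrable (fun τ : ι → ℝ × ℝ => ∏ i, g A i (τ i)) := by
    intro A
    refine Integrable.fintype_prod (f := fun i t => g A i t) fun i => ?_
    exact (hint1 _ _).mul_prod (hint1 _ _)
  have hF1 : ∀ j (B : Finset ℕ), (((-1:ℝ)^B.card * F j ((∑ p ∈ B, Real.log p) / lam) : ℝ) : ℂ) =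
      ∫ t : ℝ, h j t * ∏ p ∈ B, (-xx lam t p) := by
    intro j B
    rw [Complex.ofReal_mul, hF, ← integral_const_mul]
    congr 1
    funext t
    rw [xx_prod]
    push_cast
    ring
  have hprod : ∀ A : ι × Bool → Finset ℕ,
      ((∏ j, (-1:ℝ)^(A j).card * F j ((∑ p ∈ A j, Real.log p) / lam) : ℝ) : ℂ) =
      ∫ τ : ι → ℝ × ℝ, ∏ i, g A i (τ i) := by
    intro A
    rw [integral_fintype_prod_volume_eq_prod (f := fun i t => g A i t), Complex.ofReal_prod, Fintype.prod_prod_type]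
    refine prod_congr rfl fun i _ => ?_
    rw [Fintype.prod_bool, hF1, hF1, mul_comm]
    exact (integral_prod_mul (fun t : ℝ => h (i, false) t * ∏ p ∈ A (i, false), (-xx lam t p))
      (fun t : ℝ => h (i, true) t * ∏ p ∈ A (i, true), (-xx lam t p))).symm
  have hone : ∀ A : ι × Bool → Finset ℕ,
      (((if Val A then (∏ j, (-1:ℝ)^(A j).card * F j ((∑ p ∈ A j, Real.log p) / lam)) * ∏ p ∈ univ.biUnion A, ω p else 0) : ℝ) : ℂ)
      = ∫ τ : ι → ℝ × ℝ, (∏ i, g A i (τ i)) * (if Val A then ∏ p ∈ univ.biUnion A, (ω p : ℂ) else 0) := by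
    intro A
    rw [integral_mul_const, ← hprod]
    split_ifs
    · push_cast; rfl
    · simp
  unfold sieveT
  rw [Complex.ofReal_sum, sum_congr rfl fun A _ => hone A, ← integral_finsetSum _ fun A _ => (hintg A).mul_const _]
  congr 1
  funext τ
  have := slots_id P (fun p => (ω p : ℂ)) (fun j p => xx lam (if j.2 then (τ j.1).2 else (τ j.1).1) p)
  simp only [Bool.false_eq_true, if_false, if_true] at this
  unfold aP
  rw [← this, mul_sum]
  refine sum_congr rfl fun A _ => ?_
  have e : ∏ i, g A i (τ i) = hh h τ * ∏ j : ι × Bool, ∏ p ∈ A j, (-xx lam (if j.2 then (τ j.1).2 else (τ j.1).1) p) := by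
    rw [hh, Fintype.prod_prod_type, ← prod_mul_distrib]
    refine prod_congr rfl fun i _ => ?_
    rw [Fintype.prod_bool]
    simp only [hg, Bool.false_eq_true, if_false, if_true]
    ring
  rw [e]
  split_ifs
  · ring
  · simp
end
end MT

namespace MT
open Finset Filter Topology MeasureTheory
open scoped SchwartzMap

/-- inverse zeta local factor -/
noncomputable def vv (q : ℝ) (x y : ℂ) : ℂ := (1 - q * x * y) / ((1 - q * x) * (1 - q * y))

lemma one_sub_lower (q : ℝ) (hq : 0 ≤ q) (hq2 : q ≤ 1/2) (x : ℂ) (hx : ‖x‖ ≤ 1) : 1/2 ≤ ‖1 - q * x‖ := by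
  have h1 : ‖(q:ℂ) * x‖ ≤ 1/2 := by
    rw [norm_mul, Complex.norm_real, Real.norm_of_nonneg hq]
    nlinarith [norm_nonneg x]
  have := norm_sub_norm_le (1:ℂ) (q * x)
  simp only [norm_one] at this
  linarith

lemma vv_bound (q : ℝ) (hq : 0 ≤ q) (hq2 : q ≤ 1/2) (x y : ℂ) (hx : ‖x‖ ≤ 1) (hy : ‖y‖ ≤ 1) :
    ‖vv q x y - (1 - q * (x * y - x - y))‖ ≤ 40 * q^2 := by
  have h1 := one_sub_lower q hq hq2 x hx
  have h2 := one_sub_lower q hq hq2 y hy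
  have n1 : 1 - (q:ℂ) * x ≠ 0 := by rw [← norm_pos_iff]; linarith
  have n2 : 1 - (q:ℂ) * y ≠ 0 := by rw [← norm_pos_iff]; linarith
  have e : vv q x y - (1 - q * (x * y - x - y)) =
      (-(q^2 * (x * y + x * y * (x + y) - (x+y)*(x+y) + q * ((x+y) * (x*y) - (x*y)*(x*y))))) / ((1 - q * x) * (1 - q * y)) := by
    unfold vv
    field_simp
    ring
  rw [e, norm_div, norm_neg, norm_mul, norm_mul]
  have hxy : ‖x * y‖ ≤ 1 := by rw [norm_mul]; nlinarith [norm_nonneg x, norm_nonneg y]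
  have hs : ‖x + y‖ ≤ 2 := (norm_add_le _ _).trans (by linarith)
  have h3 : ‖x * y + x * y * (x + y) - (x+y)*(x+y) + q * ((x+y) * (x*y) - (x*y)*(x*y))‖ ≤ 10 := by
    have a1 : ‖x * y * (x + y)‖ ≤ 2 := by rw [norm_mul]; nlinarith [norm_nonneg (x*y), norm_nonneg (x+y)]
    have a2 : ‖(x + y) * (x + y)‖ ≤ 4 := by rw [norm_mul]; nlinarith [norm_nonneg (x+y)]
    have a3 : ‖(x + y) * (x * y)‖ ≤ 2 := by rw [mul_comm]; exact a1
    have a4 : ‖(x * y) * (x * y)‖ ≤ 1 := by rw [norm_mul]; nlinarith [norm_nonneg (x*y)]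
    have a5 : ‖(x+y) * (x*y) - (x*y)*(x*y)‖ ≤ 3 := (norm_sub_le _ _).trans (by linarith)
    have a6 : ‖(q:ℂ) * ((x+y) * (x*y) - (x*y)*(x*y))‖ ≤ 3 := by
      rw [norm_mul, Complex.norm_real, Real.norm_of_nonneg hq]
      nlinarith [norm_nonneg ((x+y) * (x*y) - (x*y)*(x*y))]
    refine (norm_add_le _ _).trans ?_
    refine (add_le_add (norm_sub_le _ _) le_rfl).trans ?_
    have := norm_add_le (x*y) (x * y * (x + y))
    linarith
  have h4 : 1/4 ≤ ‖1 - (q:ℂ) * x‖ * ‖1 - (q:ℂ) * y‖ := by nlinarith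
  have h5 : ‖(q:ℂ)^2‖ = q^2 := by rw [norm_pow, Complex.norm_real, Real.norm_of_nonneg hq]
  rw [h5, div_le_iff₀ (by linarith)]
  have : q^2 * ‖x * y + x * y * (x + y) - (x+y)*(x+y) + q * ((x+y) * (x*y) - (x*y)*(x*y))‖ ≤ q^2 * 10 :=
    mul_le_mul_of_nonneg_left h3 (sq_nonneg q)
  nlinarith [sq_nonneg q]

section
variable {ι : Type} [Fintype ι]

lemma bb_norm (q : ℝ) (hq : 0 ≤ q) (x y : ℂ) (hx : ‖x‖ ≤ 1) (hy : ‖y‖ ≤ 1) : ‖(q:ℂ) * (x * y - x - y)‖ ≤ 3 * q := by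
  rw [norm_mul, Complex.norm_real, Real.norm_of_nonneg hq]
  have hxy : ‖x * y‖ ≤ 1 := by rw [norm_mul]; nlinarith [norm_nonneg x, norm_nonneg y]
  have := norm_sub_le (x*y - x) y
  have := norm_sub_le (x*y) x
  nlinarith

lemma vprod_bound (S : Finset ι) : ∃ C : ℝ, 0 ≤ C ∧ ∀ q : ℝ, 0 ≤ q → q ≤ 1/2 → ∀ x y : ι → ℂ, (∀ i, ‖x i‖ ≤ 1) → (∀ i, ‖y i‖ ≤ 1) →
    ‖∏ i ∈ S, vv q (x i) (y i) - (1 - ∑ i ∈ S, (q:ℂ) * (x i * y i - x i - y i))‖ ≤ C * q^2 := by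
  induction S using Finset.induction_on with
  | empty => exact ⟨0, le_rfl, by intros; simp⟩
  | insert i S hi ih =>
    obtain ⟨C, hC, ih⟩ := ih
    refine ⟨C * 13 + (1 + 2 * S.card) * 40 + 9 * S.card, by positivity, ?_⟩
    intro q hq hq2 x y hx hy
    rw [prod_insert hi, sum_insert hi]
    have h0 := ih q hq hq2 x y hx hy
    set V := ∏ i ∈ S, vv q (x i) (y i)
    set b := ∑ i ∈ S, (q:ℂ) * (x i * y i - x i - y i) with hb
    have h1 := vv_bound q hq hq2 (x i) (y i) (hx i) (hy i)
    have hbi := bb_norm q hq (x i) (y i) (hx i) (hy i)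
    set c := (q:ℂ) * (x i * y i - x i - y i)
    set v := vv q (x i) (y i)
    have hbn : ‖b‖ ≤ 3 * q * S.card := by
      refine (norm_sum_le _ _).trans ?_
      refine (sum_le_sum fun j _ => bb_norm q hq (x j) (y j) (hx j) (hy j)).trans ?_
      rw [sum_const, nsmul_eq_mul]; linarith
    have hv : ‖v‖ ≤ 13 := by
      have : v = (v - (1 - c)) + 1 - c := by ring
      rw [this]
      refine (norm_sub_le _ _).trans ((add_le_add (norm_add_le _ _) le_rfl).trans ?_)
      simp only [norm_one]
      nlinarith
    have e : v * V - (1 - (c + b)) = (V - (1 - b)) * v + (1 - b) * (v - (1 - c)) + b * c := by ring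
    rw [e]
    have t1 : ‖(V - (1 - b)) * v‖ ≤ C * q^2 * 13 := by
      rw [norm_mul]; exact mul_le_mul h0 hv (norm_nonneg _) (by positivity)
    have hcard : (0:ℝ) ≤ S.card := by positivity
    have t2 : ‖(1 - b) * (v - (1 - c))‖ ≤ (1 + 2 * S.card) * (40 * q^2) := by
      rw [norm_mul]; refine mul_le_mul ?_ h1 (norm_nonneg _) (by positivity)
      refine (norm_sub_le _ _).trans ?_
      rw [norm_one]
      nlinarith
    have t3 : ‖b * c‖ ≤ (3 * q * S.card) * (3 * q) := by
      rw [norm_mul]; exact mul_le_mul hbn hbi (norm_nonneg _) (by positivity)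
    refine (norm_add_le _ _).trans ((add_le_add (norm_add_le _ _) le_rfl).trans ?_)
    linarith

lemma e_bound : ∃ C : ℝ, 0 ≤ C ∧ ∀ q : ℝ, 0 ≤ q → q ≤ 1/2 → ∀ x y : ι → ℂ, (∀ i, ‖x i‖ ≤ 1) → (∀ i, ‖y i‖ ≤ 1) →
    ‖∏ i, vv q (x i) (y i) - 1‖ ≤ C ∧ ∀ w : ℝ, |w - q| ≤ 2 * q^2 →
    ‖(1 + (w:ℂ) * ∑ i, ((1 - x i) * (1 - y i) - 1)) * ∏ i, vv q (x i) (y i) - 1‖ ≤ C * q^2 := by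
  obtain ⟨C, hC, h⟩ := vprod_bound (univ : Finset ι)
  obtain ⟨n, hn⟩ : ∃ n : ℝ, n = ((univ : Finset ι).card : ℝ) := ⟨_, rfl⟩
  have hn0 : 0 ≤ n := by rw [hn]; positivity
  refine ⟨C + 3 * n + 9 * n^2 + (1 + 3 * n) * C + 6 * n * (1 + 3 * n + C), by positivity, ?_⟩
  intro q hq hq2 x y hx hy
  have h0 := h q hq hq2 x y hx hy
  set V := ∏ i, vv q (x i) (y i)
  have hb' : ∑ i, (q:ℂ) * (x i * y i - x i - y i) = q * ∑ i, (x i * y i - x i - y i) := by rw [mul_sum]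
  rw [hb'] at h0
  have hs : ∑ i, ((1 - x i) * (1 - y i) - 1) = ∑ i, (x i * y i - x i - y i) := sum_congr rfl fun i _ => by ring
  rw [hs]
  set B := ∑ i, (x i * y i - x i - y i) with hB
  have hBn : ‖B‖ ≤ 3 * n := by
    refine (norm_sum_le _ _).trans ?_
    refine (sum_le_sum (g := fun _ => (3:ℝ)) fun j _ => ?_).trans ?_
    · have := bb_norm 1 (by norm_num) (x j) (y j) (hx j) (hy j)
      simpa using this
    · rw [sum_const, nsmul_eq_mul, ← hn]; linarith
  set ε := V - (1 - q * B) with hε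
  have hVe : V = 1 - q * B + ε := by rw [hε]; ring
  have hq1 : q^2 ≤ 1 := by nlinarith
  have hqB : ‖(q:ℂ) * B‖ ≤ 3 * n * q := by
    rw [norm_mul, Complex.norm_real, Real.norm_of_nonneg hq]; nlinarith
  have hqB' : ‖(q:ℂ) * B‖ ≤ 3 * n := by nlinarith
  have hε1 : ‖ε‖ ≤ C := by nlinarith
  have hnC : 0 ≤ 9 * n^2 + (1 + 3 * n) * C + 6 * n * (1 + 3 * n + C) := by positivity
  constructor
  · rw [hVe]
    have : 1 - (q:ℂ) * B + ε - 1 = ε - q * B := by ring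
    rw [this]
    refine (norm_sub_le _ _).trans ?_
    linarith
  · intro w hw
    set δ : ℂ := ((w - q : ℝ) : ℂ) * B with hδ
    have hδn : ‖δ‖ ≤ 2 * q^2 * (3 * n) := by
      rw [hδ, norm_mul, Complex.norm_real]
      exact mul_le_mul hw hBn (norm_nonneg _) (by positivity)
    have hwe : (1 + (w:ℂ) * B) = 1 + q * B + δ := by rw [hδ]; push_cast; ring
    rw [hwe, hVe]
    have e : (1 + q * B + δ) * (1 - q * B + ε) - 1 = -((q * B) * (q * B)) + (1 + q * B) * ε + δ * (1 - q * B + ε) := by ring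
    rw [e]
    have t1 : ‖((q:ℂ) * B) * (q * B)‖ ≤ (3 * n * q) * (3 * n * q) := by
      rw [norm_mul]; exact mul_le_mul hqB hqB (norm_nonneg _) (by positivity)
    have t2 : ‖(1 + q * B) * ε‖ ≤ (1 + 3 * n) * (C * q^2) := by
      rw [norm_mul]; refine mul_le_mul ((norm_add_le _ _).trans ?_) h0 (norm_nonneg _) (by positivity)
      rw [norm_one]; linarith
    have t3 : ‖δ * (1 - q * B + ε)‖ ≤ (2 * q^2 * (3 * n)) * (1 + 3 * n + C) := by
      rw [norm_mul]; refine mul_le_mul hδn ?_ (norm_nonneg _) (by positivity)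
      refine (norm_add_le _ _).trans (add_le_add ((norm_sub_le _ _).trans ?_) hε1)
      rw [norm_one]; linarith
    refine (norm_add_le _ _).trans ((add_le_add (norm_add_le _ _) le_rfl).trans ?_)
    rw [norm_neg]
    have : 0 ≤ (C + 3 * n) * q^2 := by positivity
    linarith

/-- convergent local factor -/
noncomputable def eP (ω : ℕ → ℝ) (D0 : ℕ) (lam : ℝ) (τ : ι → ℝ × ℝ) (p : ℕ) : ℂ :=
  if p.Prime then (if D0 < p then aP ω lam τ p else 1) * ∏ i, vv (1/p) (xx lam (τ i).1 p) (xx lam (τ i).2 p) else 1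

lemma eP_bound (ω : ℕ → ℝ) (D0 : ℕ) (hω : ∀ p : ℕ, p.Prime → |ω p - 1/p| ≤ 2 * (1/(p:ℝ))^2) :
    ∃ C : ℝ, 0 ≤ C ∧ ∀ lam : ℝ, 0 < lam → ∀ τ : ι → ℝ × ℝ, ∀ p : ℕ, ‖eP ω D0 lam τ p - 1‖ ≤ C * (1/(p:ℝ)^2) := by
  obtain ⟨C, hC, h⟩ := e_bound (ι := ι)
  refine ⟨C * (D0 + 1)^2, by positivity, ?_⟩
  intro lam hl τ p
  unfold eP
  by_cases hp : p.Prime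
  · rw [if_pos hp]
    have hp2 : (2:ℝ) ≤ p := by exact_mod_cast hp.two_le
    have h0 := h (1/p) (by positivity) (by rw [div_le_div_iff₀ (by linarith) (by norm_num)]; linarith)
      (fun i => xx lam (τ i).1 p) (fun i => xx lam (τ i).2 p)
      (fun i => xx_norm_le lam _ hl p) (fun i => xx_norm_le lam _ hl p)
    by_cases hD : D0 < p
    · rw [if_pos hD]
      refine (h0.2 (ω p) (hω p hp)).trans ?_
      rw [div_pow, one_pow]
      refine mul_le_mul_of_nonneg_right ?_ (by positivity)
      have : (1:ℝ) ≤ (D0 + 1)^2 := by nlinarith [(Nat.cast_nonneg D0 : (0:ℝ) ≤ D0)]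
      nlinarith
    · rw [if_neg hD, one_mul]
      refine h0.1.trans ?_
      rw [mul_assoc]
      refine le_mul_of_one_le_right hC ?_
      rw [mul_one_div, le_div_iff₀ (by positivity), one_mul]
      have : (p:ℝ) ≤ D0 := by exact_mod_cast not_lt.mp hD
      nlinarith
  · rw [if_neg hp]
    simp
    positivity
end
end MT

namespace MT
open Finset Filter Topology MeasureTheory
open scoped SchwartzMap

/-- the complex shift -/
noncomputable def ss (lam t : ℝ) : ℂ := (1 + Complex.I * t) / lam

/-- the zeta ratio -/
noncomputable def Zr (lam : ℝ) (t : ℝ × ℝ) : ℂ :=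
  riemannZeta (1 + (ss lam t.1 + ss lam t.2)) / (riemannZeta (1 + ss lam t.1) * riemannZeta (1 + ss lam t.2))

/-- sieving primes -/
def PP (D0 n : ℕ) : Finset ℕ := (Nat.primesBelow n).filter (fun p => D0 < p)

lemma ss_re (lam t : ℝ) : (ss lam t).re = 1 / lam := by
  unfold ss
  simp [Complex.div_ofReal_re]

lemma xx_eq (lam t : ℝ) (p : ℕ) (hp : p ≠ 0) : xx lam t p = (p:ℂ)^(-ss lam t) := by
  rw [Complex.cpow_def_of_ne_zero (by exact_mod_cast hp), ← Complex.natCast_log]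
  unfold xx ss
  congr 1
  rw [Complex.ofReal_div]
  ring

lemma xx_cpow (lam t : ℝ) (p : ℕ) (hp : p ≠ 0) : ((1/p : ℝ) : ℂ) * xx lam t p = (p:ℂ)^(-(1 + ss lam t)) := by
  have hp' : (p:ℂ) ≠ 0 := by exact_mod_cast hp
  rw [xx_eq lam t p hp, neg_add, Complex.cpow_add _ _ hp', Complex.cpow_neg_one]
  push_cast
  rw [one_div]

lemma xx_cpow2 (lam t t' : ℝ) (p : ℕ) (hp : p ≠ 0) :
    ((1/p : ℝ) : ℂ) * xx lam t p * xx lam t' p = (p:ℂ)^(-(1 + (ss lam t + ss lam t'))) := by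
  have hp' : (p:ℂ) ≠ 0 := by exact_mod_cast hp
  rw [xx_cpow lam t p hp, xx_eq lam t' p hp, ← Complex.cpow_add _ _ hp']
  congr 1; ring

lemma vv_lim (lam : ℝ) (hl : 0 < lam) (t : ℝ × ℝ) :
    Tendsto (fun n : ℕ => ∏ p ∈ Nat.primesBelow n, vv (1/p) (xx lam t.1 p) (xx lam t.2 p)) atTop (𝓝 (Zr lam t)⁻¹) := by
  have r0 : 0 < 1 / lam := by positivity
  have r1 : 1 < (1 + ss lam t.1).re := by simp [ss_re]; positivity
  have r2 : 1 < (1 + ss lam t.2).re := by simp [ss_re]; positivity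
  have r3 : 1 < (1 + (ss lam t.1 + ss lam t.2)).re := by simp [ss_re]; positivity
  have h := ((riemannZeta_eulerProduct r1).mul (riemannZeta_eulerProduct r2)).div (riemannZeta_eulerProduct r3)
    (riemannZeta_ne_zero_of_one_le_re r3.le)
  have e : (Zr lam t)⁻¹ = riemannZeta (1 + ss lam t.1) * riemannZeta (1 + ss lam t.2) / riemannZeta (1 + (ss lam t.1 + ss lam t.2)) := by
    unfold Zr; rw [inv_div]
  rw [e]
  refine h.congr fun n => ?_
  rw [Pi.div_apply, ← prod_mul_distrib, ← prod_div_distrib]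
  refine prod_congr rfl fun p hp => ?_
  have hp0 : p ≠ 0 := (Nat.prime_of_mem_primesBelow hp).ne_zero
  unfold vv
  rw [← xx_cpow2 _ _ _ _ hp0, ← xx_cpow _ _ _ hp0, ← xx_cpow _ _ _ hp0]
  rw [div_inv_eq_mul, ← mul_inv, mul_comm, ← div_eq_mul_inv]

lemma Zr_ne (lam : ℝ) (hl : 0 < lam) (t : ℝ × ℝ) : Zr lam t ≠ 0 := by
  have r0 : 0 < 1 / lam := by positivity
  have r1 : 1 < (1 + ss lam t.1).re := by simp [ss_re]; positivity
  have r2 : 1 < (1 + ss lam t.2).re := by simp [ss_re]; positivity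
  have r3 : 1 < (1 + (ss lam t.1 + ss lam t.2)).re := by simp [ss_re]; positivity
  exact div_ne_zero (riemannZeta_ne_zero_of_one_le_re r3.le)
    (mul_ne_zero (riemannZeta_ne_zero_of_one_le_re r1.le) (riemannZeta_ne_zero_of_one_le_re r2.le))

section
variable {ι : Type} [Fintype ι]

lemma eP_lim (ω : ℕ → ℝ) (D0 : ℕ) (hω : ∀ p : ℕ, p.Prime → |ω p - 1/p| ≤ 2 * (1/(p:ℝ))^2) (lam : ℝ) (hl : 0 < lam)
    (τ : ι → ℝ × ℝ) :
    Tendsto (fun n : ℕ => ∏ p ∈ range n, eP ω D0 lam τ p) atTop (𝓝 (∏' p, eP ω D0 lam τ p)) := by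
  obtain ⟨C, hC, h⟩ := eP_bound (ι := ι) ω D0 hω
  have hs : Summable (fun p : ℕ => ‖eP ω D0 lam τ p - 1‖) := by
    refine Summable.of_nonneg_of_le (fun _ => norm_nonneg _) (fun p => h lam hl τ p) ?_
    exact (Real.summable_one_div_nat_pow.mpr (by norm_num)).mul_left C
  have hm := multipliable_one_add_of_summable hs
  simp only [add_sub_cancel] at hm
  exact hm.hasProd.tendsto_prod_nat

lemma aP_lim (ω : ℕ → ℝ) (D0 : ℕ) (hω : ∀ p : ℕ, p.Prime → |ω p - 1/p| ≤ 2 * (1/(p:ℝ))^2) (lam : ℝ) (hl : 0 < lam)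
    (τ : ι → ℝ × ℝ) :
    Tendsto (fun n : ℕ => ∏ p ∈ PP D0 n, aP ω lam τ p) atTop (𝓝 ((∏' p, eP ω D0 lam τ p) * ∏ i, Zr lam (τ i))) := by
  have h1 := eP_lim ω D0 hω lam hl τ
  have h2 : Tendsto (fun n : ℕ => ∏ i, ∏ p ∈ Nat.primesBelow n, vv (1/p) (xx lam (τ i).1 p) (xx lam (τ i).2 p)) atTop
      (𝓝 (∏ i, (Zr lam (τ i))⁻¹)) := tendsto_finsetProd _ fun i _ => vv_lim lam hl (τ i)
  have hne : ∏ i, (Zr lam (τ i))⁻¹ ≠ 0 := prod_ne_zero_iff.mpr fun i _ => inv_ne_zero (Zr_ne lam hl _)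
  have h3 := h1.div h2 hne
  rw [prod_inv_distrib, div_inv_eq_mul] at h3
  refine h3.congr' ?_
  filter_upwards [h2.eventually_ne hne] with n hn
  rw [Pi.div_apply, div_eq_iff hn, Finset.prod_comm, PP, prod_filter, ← prod_mul_distrib, Nat.primesBelow, prod_filter]
  refine prod_congr rfl fun p _ => ?_
  unfold eP
  rfl

lemma omega_le (ω : ℕ → ℝ) (hω : ∀ p : ℕ, p.Prime → |ω p - 1/p| ≤ 2 * (1/(p:ℝ))^2) (p : ℕ) (hp : p.Prime) :
    |ω p| ≤ 2 * (1 / (p:ℝ)) := by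
  have h := hω p hp
  have hp2 : (2:ℝ) ≤ p := by exact_mod_cast hp.two_le
  have h1 : 1/(p:ℝ) ≤ 1/2 := by rw [div_le_div_iff₀ (by linarith) (by norm_num)]; linarith
  have h0 : 0 ≤ 1/(p:ℝ) := by positivity
  rw [abs_le] at *
  constructor <;> nlinarith

lemma prod_dom (ω : ℕ → ℝ) (D0 : ℕ) (hω : ∀ p : ℕ, p.Prime → |ω p - 1/p| ≤ 2 * (1/(p:ℝ))^2) (lam : ℝ) (hl : 0 < lam) :
    ∃ C : ℝ, ∀ (n : ℕ) (τ : ι → ℝ × ℝ), ‖∏ p ∈ PP D0 n, aP ω lam τ p‖ ≤ C := by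
  have hsum : Summable (fun p : ℕ => 1 / (p:ℝ)^(1 + 1/lam)) := by
    rw [Real.summable_one_div_nat_rpow]
    have : 0 < 1/lam := by positivity
    linarith
  refine ⟨Real.exp (6 * Fintype.card ι * ∑' p : ℕ, 1 / (p:ℝ)^(1 + 1/lam)), fun n τ => ?_⟩
  rw [norm_prod]
  have hb : ∀ p ∈ PP D0 n, ‖aP ω lam τ p‖ ≤ Real.exp (6 * Fintype.card ι * (1 / (p:ℝ)^(1 + 1/lam))) := by
    intro p hp
    have hpp := Nat.prime_of_mem_primesBelow (mem_filter.mp hp).1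
    have hp0 : (0:ℝ) < p := by exact_mod_cast hpp.pos
    have hx : ∀ t, ‖xx lam t p‖ = 1 / (p:ℝ)^(1/lam) := by
      intro t
      rw [xx_norm, one_div, ← Real.rpow_neg hp0.le, Real.rpow_def_of_pos hp0]
      congr 1; ring
    have hx1 : (1:ℝ) / (p:ℝ)^(1/lam) ≤ 1 := by rw [← hx 0]; exact xx_norm_le lam 0 hl p
    have hx0 : 0 ≤ (1:ℝ) / (p:ℝ)^(1/lam) := by positivity
    unfold aP
    refine (norm_add_le _ _).trans ?_
    rw [norm_one, add_comm]
    refine le_trans ?_ (Real.add_one_le_exp _)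
    rw [add_le_add_iff_right, norm_mul, Complex.norm_real, Real.norm_eq_abs]
    have h1 := omega_le ω hω p hpp
    have h2 : ‖∑ i, ((1 - xx lam (τ i).1 p) * (1 - xx lam (τ i).2 p) - 1)‖ ≤ Fintype.card ι * (3 * (1 / (p:ℝ)^(1/lam))) := by
      refine (norm_sum_le _ _).trans ?_
      refine (sum_le_sum (g := fun _ => 3 * ((1:ℝ) / (p:ℝ)^(1/lam))) fun i _ => ?_).trans ?_
      · have e : (1 - xx lam (τ i).1 p) * (1 - xx lam (τ i).2 p) - 1 = xx lam (τ i).1 p * xx lam (τ i).2 p - xx lam (τ i).1 p - xx lam (τ i).2 p := by ring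
        rw [e]
        refine (norm_sub_le _ _).trans ((add_le_add (norm_sub_le _ _) le_rfl).trans ?_)
        rw [norm_mul, hx, hx]
        nlinarith
      · rw [sum_const, nsmul_eq_mul, card_univ]
    calc |ω p| * ‖∑ i, ((1 - xx lam (τ i).1 p) * (1 - xx lam (τ i).2 p) - 1)‖
        ≤ (2 * (1 / (p:ℝ))) * (Fintype.card ι * (3 * (1 / (p:ℝ)^(1/lam)))) :=
          mul_le_mul h1 h2 (norm_nonneg _) (by positivity)
      _ = 6 * Fintype.card ι * (1 / (p:ℝ)^(1 + 1/lam)) := by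
          rw [Real.rpow_add hp0, Real.rpow_one]
          field_simp
          ring
  refine (prod_le_prod (fun _ _ => norm_nonneg _) hb).trans ?_
  rw [← Real.exp_sum, Real.exp_le_exp, ← mul_sum]
  refine mul_le_mul_of_nonneg_left ?_ (by positivity)
  exact hsum.sum_le_tsum _ fun p _ => by positivity

lemma sieveT_stable (ω : ℕ → ℝ) (D0 : ℕ) (F : ι × Bool → ℝ → ℝ) (lam R : ℝ) (hl : 0 < lam)
    (hR : ∀ j u, R ≤ u → F j u = 0) (n0 n : ℕ) (hn0 : Real.exp (lam * R) ≤ n0) (hn : n0 ≤ n) :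
    sieveT (PP D0 n) ω F lam = sieveT (PP D0 n0) ω F lam := by
  unfold sieveT
  symm
  refine sum_subset ?_ ?_
  · intro A hA
    rw [Fintype.mem_piFinset] at *
    intro j
    have := hA j
    rw [mem_powerset] at *
    refine this.trans ?_
    intro p hp
    simp only [PP, Nat.mem_primesBelow, mem_filter] at *
    exact ⟨⟨by omega, hp.1.2⟩, hp.2⟩
  · intro A hA hA'
    rw [Fintype.mem_piFinset] at hA hA'
    push Not at hA'
    obtain ⟨j, hj⟩ := hA'
    rw [mem_powerset, Finset.not_subset] at hj
    obtain ⟨p, hp, hpn⟩ := hj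
    have hp' := mem_powerset.mp (hA j) hp
    simp only [PP, Nat.mem_primesBelow, mem_filter] at hp' hpn
    have hge : n0 ≤ p := by
      by_contra hlt
      exact hpn ⟨⟨by omega, hp'.1.2⟩, hp'.2⟩
    have hlog : lam * R ≤ Real.log p := by
      rw [Real.le_log_iff_exp_le (by exact_mod_cast hp'.1.2.pos)]
      exact hn0.trans (by exact_mod_cast hge)
    have hF : F j ((∑ p ∈ A j, Real.log p) / lam) = 0 := by
      apply hR
      rw [le_div_iff₀ hl, mul_comm]
      exact hlog.trans (single_le_sum (f := fun p : ℕ => Real.log p) (fun q _ => Real.log_natCast_nonneg q) hp)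
    split_ifs
    · rw [prod_eq_zero (mem_univ j) (by rw [hF, mul_zero]), zero_mul]
    · rfl

lemma hh_int (h : ι × Bool → 𝓢(ℝ, ℂ)) : Integrable (fun τ : ι → ℝ × ℝ => hh h τ) := by
  unfold hh
  refine Integrable.fintype_prod (f := fun i (t : ℝ × ℝ) => h (i, false) t.1 * h (i, true) t.2) fun i => ?_
  exact (h (i, false)).integrable.mul_prod (h (i, true)).integrable

lemma sieveT_int (ω : ℕ → ℝ) (D0 : ℕ) (hω : ∀ p : ℕ, p.Prime → |ω p - 1/p| ≤ 2 * (1/(p:ℝ))^2)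
    (F : ι × Bool → ℝ → ℝ) (lam R : ℝ) (hl : 0 < lam)
    (h : ι × Bool → 𝓢(ℝ, ℂ))
    (hF : ∀ j u, (F j u : ℂ) = ∫ t : ℝ, h j t * Complex.exp (-((1 + Complex.I * t) * u)))
    (hR : ∀ j u, R ≤ u → F j u = 0) (n0 : ℕ) (hn0 : Real.exp (lam * R) ≤ n0) :
    (sieveT (PP D0 n0) ω F lam : ℂ) = ∫ τ : ι → ℝ × ℝ, hh h τ * ((∏' p, eP ω D0 lam τ p) * ∏ i, Zr lam (τ i)) := by
  obtain ⟨C, hC⟩ := prod_dom (ι := ι) ω D0 hω lam hl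
  have hlim : Tendsto (fun n : ℕ => ∫ τ : ι → ℝ × ℝ, hh h τ * ∏ p ∈ PP D0 n, aP ω lam τ p) atTop
      (𝓝 (∫ τ : ι → ℝ × ℝ, hh h τ * ((∏' p, eP ω D0 lam τ p) * ∏ i, Zr lam (τ i)))) := by
    refine tendsto_integral_of_dominated_convergence (fun τ => ‖hh h τ‖ * C) ?_ ((hh_int h).norm.mul_const C) ?_ ?_
    · intro n
      refine (hh_int h).aestronglyMeasurable.mul (Continuous.aestronglyMeasurable ?_)
      exact continuous_finsetProd _ fun p _ => aP_cont ω lam p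
    · intro n
      refine Eventually.of_forall fun τ => ?_
      rw [norm_mul]
      exact mul_le_mul_of_nonneg_left (hC n τ) (norm_nonneg _)
    · refine Eventually.of_forall fun τ => ?_
      exact (aP_lim ω D0 hω lam hl τ).const_mul _
  refine tendsto_nhds_unique ?_ hlim
  refine tendsto_const_nhds.congr' ?_
  filter_upwards [eventually_ge_atTop n0] with n hn
  rw [← sieveT_stable ω D0 F lam R hl hR n0 n hn0 hn, sieveT_rep _ ω F lam hl h hF]

lemma phi_meas (ω : ℕ → ℝ) (D0 : ℕ) (hω : ∀ p : ℕ, p.Prime → |ω p - 1/p| ≤ 2 * (1/(p:ℝ))^2) (lam : ℝ) (hl : 0 < lam) :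
    AEStronglyMeasurable (fun τ : ι → ℝ × ℝ => (∏' p, eP ω D0 lam τ p) * ∏ i, Zr lam (τ i)) := by
  refine aestronglyMeasurable_of_tendsto_ae atTop (f := fun (n : ℕ) τ => ∏ p ∈ PP D0 n, aP ω lam τ p) (fun n => ?_) ?_
  · exact Continuous.aestronglyMeasurable (continuous_finsetProd _ fun p _ => aP_cont ω lam p)
  · exact Eventually.of_forall fun τ => aP_lim ω D0 hω lam hl τ
end
end MT

namespace MT
open Finset Filter Topology MeasureTheory
open scoped SchwartzMap

/-- limiting kernel -/
noncomputable def KK (t : ℝ × ℝ) : ℂ :=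
  (1 + Complex.I * t.1) * (1 + Complex.I * t.2) / ((1 + Complex.I * t.1) + (1 + Complex.I * t.2))

lemma zz_norm (t : ℝ) : ‖1 + Complex.I * t‖ ≤ 1 + |t| := by
  refine (norm_add_le _ _).trans ?_
  simp

lemma exp_norm (t u : ℝ) : ‖Complex.exp (-((1 + Complex.I * t) * u))‖ = Real.exp (-u) := by
  rw [Complex.norm_exp]; congr 1; simp

lemma F_deriv (F : ℝ → ℝ) (hF : ContDiff ℝ (⊤:ℕ∞) F) (h : 𝓢(ℝ, ℂ))
    (hr : ∀ u : ℝ, (F u : ℂ) = ∫ t : ℝ, h t * Complex.exp (-((1 + Complex.I * t) * u))) (u : ℝ) :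
    ((deriv F u : ℝ) : ℂ) = ∫ t : ℝ, h t * (1 + Complex.I * t) * (-Complex.exp (-((1 + Complex.I * t) * u))) := by
  have hd : HasDerivAt (fun u : ℝ => ∫ t : ℝ, h t * Complex.exp (-((1 + Complex.I * t) * u)))
      (∫ t : ℝ, h t * (1 + Complex.I * t) * (-Complex.exp (-((1 + Complex.I * t) * u)))) u := by
    refine (hasDerivAt_integral_of_dominated_loc_of_deriv_le (s := Metric.ball u 1)
      (bound := fun t => (1 + |t|)^1 * ‖h t‖ * Real.exp (1 - u)) (F' := fun u t => h t * (1 + Complex.I * t) * (-Complex.exp (-((1 + Complex.I * t) * u))))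
      (Metric.ball_mem_nhds u one_pos) ?_ ?_ ?_ ?_ ?_ ?_).2
    · refine Eventually.of_forall fun x => Continuous.aestronglyMeasurable ?_
      exact h.continuous.mul (by fun_prop)
    · refine (h.integrable.norm.mul_const (Real.exp (-u))).mono' (Continuous.aestronglyMeasurable ?_) (Eventually.of_forall fun t => ?_)
      · exact h.continuous.mul (by fun_prop)
      · rw [norm_mul, exp_norm]
    · refine Continuous.aestronglyMeasurable ?_
      exact (h.continuous.mul (by fun_prop)).mul (by fun_prop)
    · refine Eventually.of_forall fun t x hx => ?_
      rw [norm_mul, norm_mul, norm_neg, exp_norm, pow_one, mul_comm ‖h t‖]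
      have hx' : u - 1 < x := by
        rw [Metric.mem_ball, Real.dist_eq, abs_lt] at hx; linarith
      have : Real.exp (-x) ≤ Real.exp (1 - u) := Real.exp_le_exp.mpr (by linarith)
      have hz := zz_norm t
      gcongr
    · exact (schwartz_integrable_poly h 1).mul_const _
    · refine Eventually.of_forall fun t x _ => ?_
      have h1 : HasDerivAt (fun x : ℝ => -((1 + Complex.I * t) * (x:ℂ))) (-((1 + Complex.I * t) * 1)) x :=
        ((Complex.ofRealCLM.hasDerivAt (x := x)).const_mul _).neg
      have := (h1.cexp).const_mul (h t)
      refine this.congr_deriv ?_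
      beta_reduce
      ring
  have hd2 : HasDerivAt (fun u : ℝ => (F u : ℂ)) ((deriv F u : ℝ) : ℂ) u :=
    ((hF.differentiable (by simp)).differentiableAt.hasDerivAt).ofReal_comp
  have : (fun u : ℝ => (F u : ℂ)) = (fun u : ℝ => ∫ t : ℝ, h t * Complex.exp (-((1 + Complex.I * t) * u))) := funext hr
  rw [this] at hd2
  exact hd2.unique hd

lemma hz_int (h : 𝓢(ℝ, ℂ)) : Integrable (fun t : ℝ => h t * (1 + Complex.I * t)) := by
  refine (schwartz_integrable_poly h 1).mono' (Continuous.aestronglyMeasurable ?_) (Eventually.of_forall fun t => ?_)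
  · exact h.continuous.mul (by fun_prop)
  · rw [norm_mul, pow_one, mul_comm]
    exact mul_le_mul_of_nonneg_right (zz_norm t) (norm_nonneg _)

lemma K_int (F G : ℝ → ℝ) (hF : ContDiff ℝ (⊤:ℕ∞) F) (hG : ContDiff ℝ (⊤:ℕ∞) G) (h h' : 𝓢(ℝ, ℂ))
    (hr : ∀ u : ℝ, (F u : ℂ) = ∫ t : ℝ, h t * Complex.exp (-((1 + Complex.I * t) * u)))
    (hr' : ∀ u : ℝ, (G u : ℂ) = ∫ t : ℝ, h' t * Complex.exp (-((1 + Complex.I * t) * u))) :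
    ∫ t : ℝ × ℝ, h t.1 * h' t.2 * KK t = ((∫ u in Set.Ioi (0:ℝ), deriv F u * deriv G u : ℝ) : ℂ) := by
  set m : ℝ → ℝ × ℝ → ℂ := fun u t => (h t.1 * (1 + Complex.I * t.1)) * (h' t.2 * (1 + Complex.I * t.2)) *
      Complex.exp (-((1 + Complex.I * t.1) + (1 + Complex.I * t.2)) * u) with hm
  have h1 : ((∫ u in Set.Ioi (0:ℝ), deriv F u * deriv G u : ℝ) : ℂ) = ∫ u in Set.Ioi (0:ℝ), ∫ t : ℝ × ℝ, m u t := by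
    rw [← integral_complex_ofReal]
    refine setIntegral_congr_fun measurableSet_Ioi fun u _ => ?_
    beta_reduce
    rw [Complex.ofReal_mul, F_deriv F hF h hr, F_deriv G hG h' hr', ← integral_prod_mul]
    refine integral_congr_ae (Eventually.of_forall fun t => ?_)
    simp only [hm]
    have e : Complex.exp (-((1 + Complex.I * t.1) + (1 + Complex.I * t.2)) * u) =
        Complex.exp (-((1 + Complex.I * t.1) * u)) * Complex.exp (-((1 + Complex.I * t.2) * u)) := by
      rw [← Complex.exp_add]; congr 1; ring
    rw [e]
    ring
  have hintg : Integrable (Function.uncurry m) ((volume.restrict (Set.Ioi (0:ℝ))).prod volume) := by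
    have a1 : Integrable (fun u : ℝ => Real.exp (-2 * u)) (volume.restrict (Set.Ioi (0:ℝ))) :=
      integrableOn_exp_mul_Ioi (by norm_num) 0
    have a2 : Integrable (fun t : ℝ × ℝ => ‖(h t.1 * (1 + Complex.I * t.1)) * (h' t.2 * (1 + Complex.I * t.2))‖) :=
      ((hz_int h).mul_prod (hz_int h')).norm
    refine (a1.mul_prod a2).mono' (Continuous.aestronglyMeasurable ?_) (Eventually.of_forall fun ⟨u, t⟩ => ?_)
    · have c1 := h.continuous
      have c2 := h'.continuous
      have c3 : Continuous (fun z : ℝ × ℝ × ℝ => h z.2.1) := c1.comp (by fun_prop)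
      have c4 : Continuous (fun z : ℝ × ℝ × ℝ => h' z.2.2) := c2.comp (by fun_prop)
      simp only [hm, Function.uncurry_def]
      fun_prop
    · simp only [Function.uncurry, hm]
      rw [norm_mul, mul_comm, Complex.norm_exp]
      refine mul_le_mul_of_nonneg_right (Real.exp_le_exp.mpr (le_of_eq ?_)) (norm_nonneg _)
      simp
      ring
  rw [h1, integral_integral_swap hintg]
  refine integral_congr_ae (Eventually.of_forall fun t => ?_)
  simp only [hm]
  have hre : (-((1 + Complex.I * t.1) + (1 + Complex.I * t.2))).re < 0 := by simp
  rw [integral_const_mul, integral_exp_mul_complex_Ioi hre]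
  unfold KK
  simp only [Complex.ofReal_zero, mul_zero, Complex.exp_zero]
  rw [neg_div_neg_eq]
  ring

lemma K_norm (t : ℝ × ℝ) : ‖KK t‖ ≤ (1 + |t.1|) * (1 + |t.2|) := by
  unfold KK
  rw [norm_div, norm_mul]
  have h1 : 1 ≤ ‖(1 + Complex.I * t.1) + (1 + Complex.I * t.2)‖ := by
    have := Complex.re_le_norm ((1 + Complex.I * t.1) + (1 + Complex.I * t.2))
    simp at this
    linarith
  refine (div_le_self (by positivity) h1).trans ?_
  exact mul_le_mul (zz_norm _) (zz_norm _) (norm_nonneg _) (by positivity)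
end MT

namespace MT
open Finset Filter Topology MeasureTheory
open scoped SchwartzMap

lemma ss_norm_le (lam t : ℝ) (hl : 0 < lam) : ‖ss lam t‖ ≤ (1 + |t|) / lam := by
  unfold ss
  rw [norm_div, Complex.norm_real, Real.norm_of_nonneg hl.le]
  exact div_le_div_of_nonneg_right (zz_norm t) hl.le

lemma zeta_inv_bound (lam t : ℝ) (hl : 2 ≤ lam) : ‖(riemannZeta (1 + ss lam t))⁻¹‖ ≤ 48 * (1 + |t|)^2 / lam := by
  have hl0 : 0 < lam := by linarith
  have h1l : 1 / lam ≤ 1 / 2 := by rw [div_le_div_iff₀ hl0 (by norm_num)]; linarith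
  have h0l : 0 < 1 / lam := by positivity
  have hre : (1 + ss lam t).re = 1 + 1 / lam := by simp [ss_re]
  have r1 : 1 < (1 + ss lam t).re := by rw [hre]; linarith
  have hs := ss_norm_le lam t hl0
  rw [← LSeries_one_eq_riemannZeta r1]
  set s := ss lam t with hsdef
  have hs0 : s ≠ 0 := by
    intro h
    have := ss_re lam t
    rw [← hsdef, h] at this
    simp at this
    linarith
  have hsp : 0 < ‖s‖ := norm_pos_iff.mpr hs0
  have ht : 1 ≤ 1 + |t| := by linarith [abs_nonneg t]
  rw [norm_inv]
  by_cases hc : ‖s‖ ≤ 1/4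
  · have h := zeta_sub (1 + s) r1
    rw [add_sub_cancel_left] at h
    have h2 : ‖1 + s‖ ≤ 5/4 := (norm_add_le _ _).trans (by rw [norm_one]; linarith)
    have h3 : ‖(1:ℂ)/s‖ = 1 / ‖s‖ := by rw [norm_div, norm_one]
    have h4 := norm_sub_norm_le ((1:ℂ)/s) ((1:ℂ)/s - LSeries 1 (1+s))
    rw [sub_sub_cancel, norm_sub_rev ((1:ℂ)/s) (LSeries 1 (1+s)), h3] at h4
    have h5 : 4 ≤ 1 / ‖s‖ := by rw [le_div_iff₀ hsp]; linarith
    have h6 : (1 / ‖s‖) / 2 ≤ ‖LSeries 1 (1+s)‖ := by linarith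
    have h7 : ‖LSeries 1 (1+s)‖⁻¹ ≤ ((1 / ‖s‖) / 2)⁻¹ := inv_anti₀ (by positivity) h6
    refine h7.trans ?_
    have : ((1 / ‖s‖) / 2)⁻¹ = 2 * ‖s‖ := by field_simp
    rw [this]
    refine (mul_le_mul_of_nonneg_left hs (by norm_num)).trans ?_
    rw [← mul_div_assoc]
    refine div_le_div_of_nonneg_right ?_ hl0.le
    nlinarith
  · push Not at hc
    have h := L_lower_trivial (1 : DirichletCharacter ℂ 1) (1 + s) r1 (by rw [hre]; linarith)
    have e : (fun n : ℕ => (1 : DirichletCharacter ℂ 1) n) = (1 : ℕ → ℂ) := by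
      funext n
      have : (n : ZMod 1) = 1 := Subsingleton.elim _ _
      rw [this]
      simp
    rw [e, hre] at h
    have h2 : 1 / (3 * lam) ≤ ‖LSeries 1 (1+s)‖ := by
      refine le_trans (le_of_eq ?_) h
      field_simp
      ring
    have h7 : ‖LSeries 1 (1+s)‖⁻¹ ≤ (1 / (3 * lam))⁻¹ := inv_anti₀ (by positivity) h2
    refine h7.trans ?_
    rw [one_div, inv_inv, le_div_iff₀ hl0]
    have h8 : 1/4 < (1 + |t|) / lam := hc.trans_le hs
    rw [lt_div_iff₀ hl0] at h8
    nlinarith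

lemma Zr_bound (lam : ℝ) (hl : 2 ≤ lam) (t : ℝ × ℝ) : ‖lam * Zr lam t‖ ≤ 3456 * ((1 + |t.1|)^2 * (1 + |t.2|)^2) := by
  have hl0 : 0 < lam := by linarith
  have h1l : 1 / lam ≤ 1 / 2 := by rw [div_le_div_iff₀ hl0 (by norm_num)]; linarith
  have h0l : 0 < 1 / lam := by positivity
  have hre : (1 + (ss lam t.1 + ss lam t.2)).re = 1 + 2 / lam := by simp [ss_re]; ring
  have e2 : 2 / lam = 2 * (1 / lam) := by ring
  have r1 : 1 < (1 + (ss lam t.1 + ss lam t.2)).re := by rw [hre, e2]; linarith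
  have h1 : ‖riemannZeta (1 + (ss lam t.1 + ss lam t.2))‖ ≤ 3 / (2 / lam) := by
    rw [← LSeries_one_eq_riemannZeta r1]
    have := norm_L_le 1 (fun n => by simp) _ r1 (by rw [hre, e2]; linarith)
    rw [hre] at this
    simpa using this
  have h2 := zeta_inv_bound lam t.1 hl
  have h3 := zeta_inv_bound lam t.2 hl
  unfold Zr
  rw [div_eq_mul_inv, mul_inv, norm_mul, norm_mul, norm_mul, Complex.norm_real, Real.norm_of_nonneg hl0.le]
  calc lam * (‖riemannZeta (1 + (ss lam t.1 + ss lam t.2))‖ * (‖(riemannZeta (1 + ss lam t.1))⁻¹‖ * ‖(riemannZeta (1 + ss lam t.2))⁻¹‖))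
      ≤ lam * ((3 / (2 / lam)) * ((48 * (1 + |t.1|)^2 / lam) * (48 * (1 + |t.2|)^2 / lam))) := by
        refine mul_le_mul_of_nonneg_left ?_ hl0.le
        refine mul_le_mul h1 ?_ (by positivity) (by positivity)
        exact mul_le_mul h2 h3 (by positivity) (by positivity)
    _ = 3456 * ((1 + |t.1|)^2 * (1 + |t.2|)^2) := by field_simp; ring

lemma zz_ne (t : ℝ) : (1 + Complex.I * t) ≠ 0 := by
  intro h
  have := congrArg Complex.re h
  simp at this

lemma ss_zeta_lim (z : ℂ) (hz : z ≠ 0) :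
    Tendsto (fun lam : ℝ => (z / lam) * riemannZeta (1 + z / lam)) atTop (𝓝 1) := by
  have h1 : Tendsto (fun lam : ℝ => 1 + z / (lam:ℂ)) atTop (𝓝[≠] 1) := by
    rw [tendsto_nhdsWithin_iff]
    constructor
    · have : Tendsto (fun lam : ℝ => z / (lam:ℂ)) atTop (𝓝 0) := by
        rw [tendsto_zero_iff_norm_tendsto_zero]
        have h := (tendsto_inv_atTop_zero (𝕜 := ℝ)).const_mul ‖z‖
        rw [mul_zero] at h
        refine h.congr' ?_
        filter_upwards [eventually_gt_atTop 0] with x hx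
        rw [norm_div, Complex.norm_real, Real.norm_of_nonneg hx.le, div_eq_mul_inv]
      have h := this.const_add 1
      rwa [add_zero] at h
    · filter_upwards [eventually_gt_atTop 0] with x hx
      have : z / (x:ℂ) ≠ 0 := div_ne_zero hz (by exact_mod_cast hx.ne')
      simpa using this
  have h2 := riemannZeta_residue_one.comp h1
  refine h2.congr fun x => ?_
  simp

lemma Zr_lim (t : ℝ × ℝ) : Tendsto (fun lam : ℝ => lam * Zr lam t) atTop (𝓝 (KK t)) := by
  set z := 1 + Complex.I * t.1 with hz
  set z' := 1 + Complex.I * t.2 with hz'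
  have hz0 : z ≠ 0 := zz_ne _
  have hz0' : z' ≠ 0 := zz_ne _
  have hzz : z + z' ≠ 0 := by
    intro h
    have := congrArg Complex.re h
    simp [hz, hz'] at this
  have h := ((ss_zeta_lim (z + z') hzz).div ((ss_zeta_lim z hz0).mul (ss_zeta_lim z' hz0')) (by simp)).const_mul (KK t)
  simp only [mul_one, div_one] at h
  refine h.congr' ?_
  filter_upwards [eventually_gt_atTop 0] with x hx
  have hx0 : (x:ℂ) ≠ 0 := by exact_mod_cast hx.ne'
  simp only [Pi.div_apply]
  unfold Zr ss KK
  rw [← hz, ← hz', ← add_div]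
  have r1 : 1 ≤ (1 + z / (x:ℂ)).re := by
    have := ss_re x t.1
    unfold ss at this
    rw [← hz] at this
    rw [Complex.add_re, this]; simp; positivity
  have r2 : 1 ≤ (1 + z' / (x:ℂ)).re := by
    have := ss_re x t.2
    unfold ss at this
    rw [← hz'] at this
    rw [Complex.add_re, this]; simp; positivity
  have n1 := riemannZeta_ne_zero_of_one_le_re r1
  have n2 := riemannZeta_ne_zero_of_one_le_re r2
  generalize riemannZeta (1 + z / x) = A at *
  generalize riemannZeta (1 + z' / x) = B at *
  generalize riemannZeta (1 + (z+z') / x) = C at *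
  field_simp

/-- limiting local factor -/
noncomputable def eI (ω : ℕ → ℝ) (D0 k : ℕ) (p : ℕ) : ℝ :=
  if p.Prime then (if D0 < p then 1 - k * ω p else 1) * (1/(1 - 1/p))^k else 1

/-- singular series -/
noncomputable def SS (ω : ℕ → ℝ) (D0 k : ℕ) : ℝ := ∏' p, eI ω D0 k p

section
variable {ι : Type} [Fintype ι]

lemma xx_lim (t : ℝ) (p : ℕ) : Tendsto (fun lam : ℝ => xx lam t p) atTop (𝓝 1) := by
  unfold xx
  have h1 : Tendsto (fun lam : ℝ => Real.log p / lam) atTop (𝓝 0) := tendsto_const_nhds.div_atTop tendsto_id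
  have h2 : Tendsto (fun lam : ℝ => ((Real.log p / lam : ℝ) : ℂ)) atTop (𝓝 ((0:ℝ):ℂ)) :=
    (Complex.continuous_ofReal.tendsto 0).comp h1
  have h3 := ((h2.const_mul (1 + Complex.I * t)).neg).cexp
  simpa using h3

lemma eP_to (ω : ℕ → ℝ) (D0 : ℕ) (τ : ι → ℝ × ℝ) (p : ℕ) :
    Tendsto (fun lam : ℝ => eP ω D0 lam τ p) atTop (𝓝 ((eI ω D0 (Fintype.card ι) p : ℝ) : ℂ)) := by
  unfold eP eI
  by_cases hp : p.Prime
  · simp only [if_pos hp]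
    rw [Complex.ofReal_mul]
    refine Tendsto.mul ?_ ?_
    · by_cases hD : D0 < p
      · simp only [if_pos hD]
        unfold aP
        have : ((1 - (Fintype.card ι : ℝ) * ω p : ℝ) : ℂ) = 1 + (ω p : ℂ) * ∑ i : ι, ((1 - 1) * (1 - 1) - 1) := by
          push_cast
          simp
          ring
        rw [this]
        refine tendsto_const_nhds.add (tendsto_const_nhds.mul (tendsto_finsetSum _ fun i _ => ?_))
        exact ((tendsto_const_nhds.sub (xx_lim _ p)).mul (tendsto_const_nhds.sub (xx_lim _ p))).sub tendsto_const_nhds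
      · simp only [if_neg hD]
        simp
    · have hp2 : (2:ℝ) ≤ p := by exact_mod_cast hp.two_le
      have hq : (1:ℝ) - 1/p ≠ 0 := by
        have : (1:ℝ)/p ≤ 1/2 := by rw [div_le_div_iff₀ (by linarith) (by norm_num)]; linarith
        linarith
      have hq' : (1:ℂ) - ((1/p : ℝ) : ℂ) * 1 ≠ 0 := by
        rw [mul_one]; exact_mod_cast hq
      have : (((1/(1 - 1/p))^(Fintype.card ι) : ℝ) : ℂ) = ∏ i : ι, vv (1/p) 1 1 := by
        rw [prod_const, card_univ]
        unfold vv
        push_cast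
        congr 1
        have hq'' : (1:ℂ) - 1/p ≠ 0 := by
          have := Complex.ofReal_ne_zero.mpr hq
          push_cast at this
          exact this
        simp only [mul_one]
        rw [div_mul_eq_div_div, div_self hq'']
      rw [this]
      refine tendsto_finsetProd _ fun i _ => ?_
      unfold vv
      refine Tendsto.div ?_ ?_ (mul_ne_zero hq' hq')
      · exact tendsto_const_nhds.sub ((tendsto_const_nhds.mul (xx_lim _ p)).mul (xx_lim _ p))
      · exact (tendsto_const_nhds.sub (tendsto_const_nhds.mul (xx_lim _ p))).mul (tendsto_const_nhds.sub (tendsto_const_nhds.mul (xx_lim _ p)))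
  · simp only [if_neg hp]
    simp

lemma eI_bound (k : ℕ) (ω : ℕ → ℝ) (D0 : ℕ) (hω : ∀ p : ℕ, p.Prime → |ω p - 1/p| ≤ 2 * (1/(p:ℝ))^2) :
    ∃ C : ℝ, 0 ≤ C ∧ ∀ p : ℕ, ‖eI ω D0 k p - 1‖ ≤ C * (1/(p:ℝ)^2) := by
  obtain ⟨C, hC, h⟩ := eP_bound (ι := Fin k) ω D0 hω
  refine ⟨C, hC, fun p => ?_⟩
  have h1 := ((eP_to ω D0 (fun _ : Fin k => (0, 0)) p).sub_const 1).norm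
  rw [Fintype.card_fin] at h1
  have h2 : ‖((eI ω D0 k p : ℝ) : ℂ) - 1‖ = ‖eI ω D0 k p - 1‖ := by
    rw [← Complex.ofReal_one, ← Complex.ofReal_sub, Complex.norm_real]
  rw [← h2]
  refine le_of_tendsto h1 ?_
  filter_upwards [eventually_gt_atTop 0] with lam hl
  exact h lam hl _ p

lemma eI_summable (k : ℕ) (ω : ℕ → ℝ) (D0 : ℕ) (hω : ∀ p : ℕ, p.Prime → |ω p - 1/p| ≤ 2 * (1/(p:ℝ))^2) :
    Summable (fun p => ‖eI ω D0 k p - 1‖) := by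
  obtain ⟨C, hC, h⟩ := eI_bound k ω D0 hω
  refine Summable.of_nonneg_of_le (fun _ => norm_nonneg _) h ?_
  exact (Real.summable_one_div_nat_pow.mpr (by norm_num)).mul_left C

lemma eI_mult (k : ℕ) (ω : ℕ → ℝ) (D0 : ℕ) (hω : ∀ p : ℕ, p.Prime → |ω p - 1/p| ≤ 2 * (1/(p:ℝ))^2) :
    Multipliable (fun p => eI ω D0 k p) := by
  have := multipliable_one_add_of_summable (eI_summable k ω D0 hω)
  simpa only [add_sub_cancel] using this

lemma SS_pos (k : ℕ) (ω : ℕ → ℝ) (D0 : ℕ) (hω : ∀ p : ℕ, p.Prime → |ω p - 1/p| ≤ 2 * (1/(p:ℝ))^2)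
    (hpos : ∀ p : ℕ, p.Prime → D0 < p → k * ω p < 1) : 0 < SS ω D0 k := by
  have hp : ∀ p, 0 < eI ω D0 k p := by
    intro p
    unfold eI
    split_ifs with h1 h2
    · have hp2 : (2:ℝ) ≤ p := by exact_mod_cast h1.two_le
      have : (1:ℝ)/p ≤ 1/2 := by rw [div_le_div_iff₀ (by linarith) (by norm_num)]; linarith
      have h3 := hpos p h1 h2
      have h4 : (0:ℝ) < 1 - 1/p := by linarith
      have h5 : 0 < 1 - k * ω p := by linarith
      positivity
    · have hp2 : (2:ℝ) ≤ p := by exact_mod_cast h1.two_le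
      have : (1:ℝ)/p ≤ 1/2 := by rw [div_le_div_iff₀ (by linarith) (by norm_num)]; linarith
      have h4 : (0:ℝ) < 1 - 1/p := by linarith
      positivity
    · norm_num
  have hl : Summable (fun p => Real.log (eI ω D0 k p)) := by
    have := Real.summable_log_one_add_of_summable ((eI_summable k ω D0 hω).of_norm)
    simpa only [add_sub_cancel] using this
  unfold SS
  rw [← Real.rexp_tsum_eq_tprod hp hl]
  exact Real.exp_pos _

lemma tprod_eP_lim (ω : ℕ → ℝ) (D0 : ℕ) (hω : ∀ p : ℕ, p.Prime → |ω p - 1/p| ≤ 2 * (1/(p:ℝ))^2) (τ : ι → ℝ × ℝ) :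
    Tendsto (fun lam : ℝ => ∏' p, eP ω D0 lam τ p) atTop (𝓝 ((SS ω D0 (Fintype.card ι) : ℝ) : ℂ)) := by
  obtain ⟨C, hC, h⟩ := eP_bound (ι := ι) ω D0 hω
  have h1 := tendsto_tprod_one_add_of_dominated_convergence (𝓕 := atTop)
    (f := fun (lam : ℝ) p => eP ω D0 lam τ p - 1) (g := fun p => ((eI ω D0 (Fintype.card ι) p : ℝ) : ℂ) - 1)
    (bound := fun p : ℕ => C * (1/(p:ℝ)^2))
    ((Real.summable_one_div_nat_pow.mpr (by norm_num)).mul_left C)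
    (fun p => (eP_to ω D0 τ p).sub_const 1) (by
      filter_upwards [eventually_gt_atTop 0] with lam hl
      intro p
      exact h lam hl τ p)
  simp only [add_sub_cancel] at h1
  have e : ∏' p, ((eI ω D0 (Fintype.card ι) p : ℝ) : ℂ) = ((SS ω D0 (Fintype.card ι) : ℝ) : ℂ) := by
    have := (eI_mult (Fintype.card ι) ω D0 hω).map_tprod Complex.ofRealHom Complex.continuous_ofReal
    unfold SS
    exact this.symm
  rwa [e] at h1

lemma tprod_eP_bound (ω : ℕ → ℝ) (D0 : ℕ) (hω : ∀ p : ℕ, p.Prime → |ω p - 1/p| ≤ 2 * (1/(p:ℝ))^2) :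
    ∃ C : ℝ, 0 ≤ C ∧ ∀ lam : ℝ, 0 < lam → ∀ τ : ι → ℝ × ℝ, ‖∏' p, eP ω D0 lam τ p‖ ≤ C := by
  obtain ⟨C, hC, h⟩ := eP_bound (ι := ι) ω D0 hω
  have hsum : Summable (fun p : ℕ => 1/(p:ℝ)^2) := Real.summable_one_div_nat_pow.mpr (by norm_num)
  refine ⟨Real.exp (C * ∑' p : ℕ, 1/(p:ℝ)^2), (Real.exp_pos _).le, fun lam hl τ => ?_⟩
  refine le_of_tendsto (eP_lim ω D0 hω lam hl τ).norm (Eventually.of_forall fun n => ?_)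
  rw [norm_prod]
  refine (prod_le_prod (g := fun p : ℕ => Real.exp (C * (1/(p:ℝ)^2))) (fun _ _ => norm_nonneg _) fun p _ => ?_).trans ?_
  · have e : eP ω D0 lam τ p = 1 + (eP ω D0 lam τ p - 1) := by ring
    rw [e]
    refine (norm_add_le _ _).trans ?_
    rw [norm_one, add_comm]
    refine le_trans ?_ (Real.add_one_le_exp _)
    linarith [h lam hl τ p]
  · rw [← Real.exp_sum, Real.exp_le_exp, ← mul_sum]
    exact mul_le_mul_of_nonneg_left (hsum.sum_le_tsum _ fun p _ => by positivity) hC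

theorem main_lim (ω : ℕ → ℝ) (D0 : ℕ) (hω : ∀ p : ℕ, p.Prime → |ω p - 1/p| ≤ 2 * (1/(p:ℝ))^2)
    (F : ι × Bool → ℝ → ℝ) (hF : ∀ j, ContDiff ℝ (⊤:ℕ∞) (F j)) (hc : ∀ j, HasCompactSupport (F j)) (R : ℝ)
    (hR : ∀ j u, R ≤ u → F j u = 0) :
    Tendsto (fun lam : ℝ => lam^(Fintype.card ι) * sieveT (PP D0 ⌈Real.exp (lam * R)⌉₊) ω F lam) atTop
      (𝓝 (SS ω D0 (Fintype.card ι) * ∏ i, ∫ u in Set.Ioi (0:ℝ), deriv (F (i, false)) u * deriv (F (i, true)) u)) := by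
  choose h hr using fun j => F_rep (F j) (hF j) (hc j)
  obtain ⟨C, hC, hE⟩ := tprod_eP_bound (ι := ι) ω D0 hω
  have hlim : Tendsto (fun lam : ℝ => ∫ τ : ι → ℝ × ℝ, (lam:ℂ)^(Fintype.card ι) * (hh h τ * ((∏' p, eP ω D0 lam τ p) * ∏ i, Zr lam (τ i)))) atTop
      (𝓝 (∫ τ : ι → ℝ × ℝ, hh h τ * ((SS ω D0 (Fintype.card ι) : ℝ) * ∏ i, KK (τ i)))) := by
    refine tendsto_integral_filter_of_dominated_convergence
      (fun τ => C * ∏ i, (((1 + |(τ i).1|)^2 * ‖h (i, false) (τ i).1‖) * ((1 + |(τ i).2|)^2 * ‖h (i, true) (τ i).2‖) * 3456)) ?_ ?_ ?_ ?_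
    · filter_upwards [eventually_gt_atTop 0] with lam hl
      exact ((hh_int h).aestronglyMeasurable.mul (phi_meas ω D0 hω lam hl)).const_mul _
    · filter_upwards [eventually_ge_atTop 2] with lam hl
      refine Eventually.of_forall fun τ => ?_
      have hl0 : 0 < lam := by linarith
      have e : (lam:ℂ)^(Fintype.card ι) * (hh h τ * ((∏' p, eP ω D0 lam τ p) * ∏ i, Zr lam (τ i))) =
          (∏' p, eP ω D0 lam τ p) * ∏ i, (h (i, false) (τ i).1 * h (i, true) (τ i).2 * (lam * Zr lam (τ i))) := by
        rw [prod_mul_distrib, prod_mul_distrib (f := fun _ => (lam:ℂ)), prod_const, card_univ, hh]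
        ring
      rw [e, norm_mul, norm_prod]
      refine mul_le_mul (hE lam hl0 τ) (prod_le_prod (fun _ _ => norm_nonneg _) fun i _ => ?_)
        (prod_nonneg fun _ _ => norm_nonneg _) hC
      rw [norm_mul, norm_mul]
      refine (mul_le_mul_of_nonneg_left (Zr_bound lam hl (τ i)) (by positivity)).trans (le_of_eq ?_)
      ring
    · refine Integrable.const_mul ?_ C
      refine Integrable.fintype_prod (f := fun i (t : ℝ × ℝ) => (((1 + |t.1|)^2 * ‖h (i, false) t.1‖) * ((1 + |t.2|)^2 * ‖h (i, true) t.2‖) * 3456)) fun i => ?_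
      exact ((schwartz_integrable_poly _ 2).mul_prod (schwartz_integrable_poly _ 2)).mul_const _
    · refine Eventually.of_forall fun τ => ?_
      have h1 := ((tprod_eP_lim ω D0 hω τ).mul (tendsto_finsetProd univ fun i _ => Zr_lim (τ i))).const_mul (hh h τ)
      refine h1.congr fun lam => ?_
      rw [prod_mul_distrib, prod_const, card_univ]
      ring
  have hval : ∫ τ : ι → ℝ × ℝ, hh h τ * ((SS ω D0 (Fintype.card ι) : ℝ) * ∏ i, KK (τ i)) =
      ((SS ω D0 (Fintype.card ι) * ∏ i, ∫ u in Set.Ioi (0:ℝ), deriv (F (i, false)) u * deriv (F (i, true)) u : ℝ) : ℂ) := by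
    have e : ∀ τ : ι → ℝ × ℝ, hh h τ * ((SS ω D0 (Fintype.card ι) : ℝ) * ∏ i, KK (τ i)) =
        ((SS ω D0 (Fintype.card ι) : ℝ) : ℂ) * ∏ i, (h (i, false) (τ i).1 * h (i, true) (τ i).2 * KK (τ i)) := by
      intro τ
      rw [prod_mul_distrib, hh]
      ring
    simp_rw [e]
    rw [integral_const_mul, integral_fintype_prod_volume_eq_prod (f := fun i (t : ℝ × ℝ) => h (i, false) t.1 * h (i, true) t.2 * KK t)]
    rw [Complex.ofReal_mul, Complex.ofReal_prod]
    congr 1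
    exact prod_congr rfl fun i _ => K_int _ _ (hF _) (hF _) _ _ (hr _) (hr _)
  rw [hval] at hlim
  have hre := (Complex.continuous_re.tendsto _).comp hlim
  rw [Complex.ofReal_re] at hre
  refine hre.congr' ?_
  filter_upwards [eventually_gt_atTop 0] with lam hl
  rw [Function.comp_apply, integral_const_mul, ← sieveT_int ω D0 hω F lam R hl h hr hR _ (Nat.le_ceil _),
    ← Complex.ofReal_pow, ← Complex.ofReal_mul, Complex.ofReal_re]
end
end MT

namespace MT
open Finset Filter Topology MeasureTheory

section
variable {k : ℕ}

/-- harmonic weights -/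
noncomputable def bw (c : Fin k → Fin k) : ℝ := ∏ j, (1/(1 + (c j : ℝ)))^2

noncomputable def Hk (k : ℕ) : ℝ := ∑ x : Fin k, 1/(1 + (x:ℝ))
noncomputable def qk (k : ℕ) : ℝ := ∑ x : Fin k, (1/(1 + (x:ℝ)))^2

lemma bw_sum (S : Finset (Fin k)) : ∑ c : Fin k → Fin k, bw c * ∏ l ∈ S, (1 + (c l : ℝ)) = Hk k^S.card * qk k^(k - S.card) := by
  have e : ∀ c : Fin k → Fin k, bw c * ∏ l ∈ S, (1 + (c l : ℝ)) =
      ∏ l, (if l ∈ S then 1/(1 + (c l : ℝ)) else (1/(1 + (c l:ℝ)))^2) := by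
    intro c
    have : ∏ l ∈ S, (1 + (c l : ℝ)) = ∏ l, (if l ∈ S then (1 + (c l : ℝ)) else 1) := by
      rw [← prod_filter]; congr 1; ext; simp
    rw [bw, this, ← prod_mul_distrib]
    refine prod_congr rfl fun l _ => ?_
    have : (1 + (c l : ℝ)) ≠ 0 := by positivity
    split_ifs
    · field_simp
    · ring
  simp_rw [e]
  have h := Finset.prod_univ_sum (fun _ : Fin k => (univ : Finset (Fin k)))
    (fun l x => if l ∈ S then 1/(1 + (x : ℝ)) else (1/(1 + (x:ℝ)))^2)
  rw [Fintype.piFinset_univ] at h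
  rw [← h]
  have h2 : ∀ l : Fin k, ∑ x : Fin k, (if l ∈ S then 1/(1 + (x : ℝ)) else (1/(1 + (x:ℝ)))^2) = if l ∈ S then Hk k else qk k := by
    intro l; split_ifs <;> rfl
  simp_rw [h2]
  rw [prod_ite, prod_const, prod_const]
  congr 2
  · congr 1; ext; simp
  · have : univ.filter (fun l => l ∉ S) = Sᶜ := by ext; simp
    rw [this, card_compl, Fintype.card_fin]

lemma qk_le (k : ℕ) : qk k ≤ 2 := by
  unfold qk
  rw [Fin.sum_univ_eq_sum_range (fun x => (1/(1 + (x:ℝ)))^2)]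
  have : ∀ n : ℕ, ∑ x ∈ range (n+1), (1/(1 + (x:ℝ)))^2 ≤ (2:ℝ) - 1 / ((n:ℝ) + 1) := by
    intro n
    induction n with
    | zero => norm_num
    | succ n ih =>
      rw [sum_range_succ]
      have : (1/(1 + ((n+1:ℕ):ℝ)))^2 ≤ 1/((n:ℝ)+1) - 1/(((n+1:ℕ):ℝ) + 1) := by
        push_cast
        rw [div_sub_div _ _ (by positivity) (by positivity), div_pow, div_le_div_iff₀ (by positivity) (by positivity)]
        nlinarith [(Nat.cast_nonneg n : (0:ℝ) ≤ n)]
      linarith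
  rcases k with _ | k
  · norm_num
  have h := this k
  have : (0:ℝ) ≤ 1/((k:ℝ)+1) := by positivity
  linarith

lemma qk_ge (hk : 0 < k) : 1 ≤ qk k := by
  unfold qk
  have := single_le_sum (f := fun x : Fin k => (1/(1 + (x:ℝ)))^2) (fun x _ => by positivity) (mem_univ ⟨0, hk⟩)
  simpa using this

lemma Hk_ge (hk : 0 < k) : 1 ≤ Hk k := by
  unfold Hk
  have := single_le_sum (f := fun x : Fin k => (1/(1 + (x:ℝ)))) (fun x _ => by positivity) (mem_univ ⟨0, hk⟩)
  simpa using this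

/-- truncated coefficients -/
noncomputable def ac (M : ℕ) (c : Fin k → Fin k) : ℝ :=
  if ∑ j, ((c j : ℕ) + 1) ≤ M then ∏ j, (1/(1 + (c j : ℝ))) else 0

lemma ac_nonneg (M : ℕ) (c : Fin k → Fin k) : 0 ≤ ac M c := by
  unfold ac
  split_ifs
  · exact prod_nonneg fun _ _ => by positivity
  · exact le_rfl

noncomputable def Ja (M : ℕ) (i : Fin k) : ℝ :=
  ∑ c : Fin k → Fin k, ∑ c' : Fin k → Fin k, if ∀ j, j ≠ i → c j = c' j then ac M c * ac M c' else 0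

lemma Ja_ge1 (M : ℕ) (i : Fin k) : ∑ c : Fin k → Fin k, ∑ x : Fin k, ac M c * ac M (Function.update c i x) ≤ Ja M i := by
  unfold Ja
  refine sum_le_sum fun c _ => ?_
  have hinj : Function.Injective (fun x => Function.update c i x) := Function.update_injective c i
  rw [← sum_image (s := univ) (g := fun x => Function.update c i x) (f := fun c' => ac M c * ac M c') (fun x _ y _ h => hinj h)]
  rw [← sum_filter]
  refine sum_le_sum_of_subset_of_nonneg ?_ fun c' _ _ => mul_nonneg (ac_nonneg _ _) (ac_nonneg _ _)
  intro c' hc'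
  obtain ⟨x, _, rfl⟩ := mem_image.mp hc'
  rw [mem_filter]
  refine ⟨mem_univ _, fun j hj => ?_⟩
  simp [Function.update_of_ne hj]

lemma ac_pair (M' : ℕ) (hM' : 0 < M') (i : Fin k) (c : Fin k → Fin k) (x : Fin k) :
    bw c * (1 + (c i : ℝ)) * (1/(1 + (x:ℝ))) * (1 - (∑ j ∈ univ.erase i, (1 + (c j : ℝ))) / M') ≤
      ac (M' + k) c * ac (M' + k) (Function.update c i x) := by
  have hb : 0 ≤ bw c * (1 + (c i : ℝ)) * (1/(1 + (x:ℝ))) := by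
    have : 0 ≤ bw c := prod_nonneg fun _ _ => by positivity
    positivity
  have hM0 : (0:ℝ) < M' := by exact_mod_cast hM'
  by_cases hY : ∑ j ∈ univ.erase i, ((c j : ℕ) + 1) ≤ M'
  · have h1 : ∀ d : Fin k → Fin k, (∀ j, j ≠ i → d j = c j) → ∑ j, ((d j : ℕ) + 1) ≤ M' + k := by
      intro d hd
      rw [← add_sum_erase univ _ (mem_univ i)]
      have : ∑ j ∈ univ.erase i, ((d j : ℕ) + 1) = ∑ j ∈ univ.erase i, ((c j : ℕ) + 1) :=
        sum_congr rfl fun j hj => by rw [hd j (ne_of_mem_erase hj)]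
      rw [this]
      have := (d i).isLt
      omega
    unfold ac
    rw [if_pos (h1 c fun _ _ => rfl), if_pos (h1 _ fun j hj => Function.update_of_ne hj _ _)]
    have e : (∏ j, (1/(1 + (c j : ℝ)))) * ∏ j, (1/(1 + (Function.update c i x j : ℝ))) = bw c * (1 + (c i : ℝ)) * (1/(1 + (x:ℝ))) := by
      unfold bw
      rw [← mul_prod_erase univ _ (mem_univ i), ← mul_prod_erase univ (fun j => 1/(1 + (Function.update c i x j : ℝ))) (mem_univ i),
        ← mul_prod_erase univ (fun j => (1/(1 + (c j : ℝ)))^2) (mem_univ i)]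
      have e2 : ∏ j ∈ univ.erase i, (1/(1 + (Function.update c i x j : ℝ))) = ∏ j ∈ univ.erase i, (1/(1 + (c j : ℝ))) :=
        prod_congr rfl fun j hj => by rw [Function.update_of_ne (ne_of_mem_erase hj)]
      rw [e2, Function.update_self, prod_pow]
      have : (1 + (c i : ℝ)) ≠ 0 := by positivity
      have : (1 + (x : ℝ)) ≠ 0 := by positivity
      field_simp
    rw [e]
    refine mul_le_of_le_one_right hb ?_
    have : 0 ≤ (∑ j ∈ univ.erase i, (1 + (c j : ℝ))) / M' := div_nonneg (sum_nonneg fun _ _ => by positivity) hM0.le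
    linarith
  · refine le_trans ?_ (mul_nonneg (ac_nonneg _ _) (ac_nonneg _ _))
    refine mul_nonpos_of_nonneg_of_nonpos hb ?_
    have : (M':ℝ) ≤ ∑ j ∈ univ.erase i, (1 + (c j : ℝ)) := by
      push Not at hY
      have := hY.le
      have h2 : (M':ℝ) ≤ ((∑ j ∈ univ.erase i, ((c j : ℕ) + 1) : ℕ) : ℝ) := by exact_mod_cast this
      refine h2.trans (le_of_eq ?_)
      push_cast
      exact sum_congr rfl fun j _ => by ring
    rw [sub_nonpos, le_div_iff₀ hM0]
    linarith

lemma Ja_ge2 (hk : 0 < k) (M' : ℕ) (hM' : 2 * k * Hk k ≤ M') (i : Fin k) : Hk k^2 * qk k^(k-1) / 2 ≤ Ja (M' + k) i := by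
  have hH := Hk_ge hk
  have hq := qk_ge hk
  have hk1 : (1:ℝ) ≤ k := by exact_mod_cast hk
  have hM0 : (0:ℝ) < M' := lt_of_lt_of_le (by positivity) hM'
  refine le_trans ?_ (Ja_ge1 _ i)
  refine le_trans ?_ (sum_le_sum fun c _ => sum_le_sum fun x _ => ac_pair M' (by exact_mod_cast hM0) i c x)
  have e1 : ∀ c : Fin k → Fin k, ∑ x : Fin k, bw c * (1 + (c i : ℝ)) * (1/(1 + (x:ℝ))) * (1 - (∑ j ∈ univ.erase i, (1 + (c j : ℝ))) / M')
      = Hk k * (bw c * ∏ l ∈ {i}, (1 + (c l : ℝ)) - (∑ j ∈ univ.erase i, bw c * ∏ l ∈ {i, j}, (1 + (c l : ℝ))) / M') := by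
    intro c
    rw [← sum_mul, ← mul_sum]
    have : ∀ j ∈ univ.erase i, bw c * ∏ l ∈ ({i, j} : Finset (Fin k)), (1 + (c l : ℝ)) = bw c * (1 + (c i : ℝ)) * (1 + (c j : ℝ)) := by
      intro j hj
      rw [prod_pair (ne_of_mem_erase hj).symm]
      ring
    rw [sum_congr rfl this, ← mul_sum, prod_singleton]
    unfold Hk
    ring
  simp_rw [e1]
  rw [← mul_sum, sum_sub_distrib, bw_sum, ← sum_div, Finset.sum_comm]
  have e2 : ∑ j ∈ univ.erase i, ∑ c : Fin k → Fin k, bw c * ∏ l ∈ {i, j}, (1 + (c l : ℝ)) ≤ k * (Hk k^2 * qk k^(k-1)) := by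
    refine (sum_le_sum (g := fun _ => Hk k^2 * qk k^(k-1)) fun j hj => ?_).trans ?_
    · rw [bw_sum, card_pair (ne_of_mem_erase hj).symm]
      refine mul_le_mul_of_nonneg_left (pow_le_pow_right₀ hq (by omega)) (by positivity)
    · rw [sum_const, nsmul_eq_mul]
      refine mul_le_mul_of_nonneg_right ?_ (by positivity)
      have := card_le_univ (univ.erase i)
      rw [Fintype.card_fin] at this
      exact_mod_cast this
  have e3 : (∑ j ∈ univ.erase i, ∑ c : Fin k → Fin k, bw c * ∏ l ∈ {i, j}, (1 + (c l : ℝ))) / M' ≤ Hk k * qk k^(k-1) / 2 := by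
    rw [div_le_iff₀ hM0]
    refine e2.trans ?_
    have : 0 ≤ Hk k * qk k^(k-1) / 2 := by positivity
    calc k * (Hk k^2 * qk k^(k-1)) = Hk k * qk k^(k-1) / 2 * (2 * k * Hk k) := by ring
      _ ≤ _ := mul_le_mul_of_nonneg_left hM' this
  rw [card_singleton, pow_one]
  have : Hk k^2 * qk k^(k-1) / 2 = Hk k * (Hk k * qk k^(k-1) - Hk k * qk k^(k-1) / 2) := by ring
  rw [this]
  exact mul_le_mul_of_nonneg_left (by linarith) (by linarith)

lemma Ia_le (M : ℕ) : ∑ c : Fin k → Fin k, ac M c^2 ≤ qk k^k := by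
  have h := bw_sum (k := k) ∅
  simp only [prod_empty, mul_one, card_empty, pow_zero, one_mul, Nat.sub_zero] at h
  rw [← h]
  refine sum_le_sum fun c _ => ?_
  unfold ac bw
  split_ifs
  · rw [prod_pow]
  · rw [zero_pow (by norm_num)]
    exact prod_nonneg fun _ _ => by positivity

theorem variational (T : ℝ) : ∃ k : ℕ, 2 ≤ k ∧ ∃ M : ℕ, 1 ≤ M ∧ T * M * ∑ c : Fin k → Fin k, ac M c^2 < ∑ i, Ja (k := k) M i := by
  have hH : Tendsto Hk atTop atTop := by
    have := Real.tendsto_sum_range_one_div_nat_succ_atTop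
    refine this.congr fun n => ?_
    unfold Hk
    rw [Fin.sum_univ_eq_sum_range (fun x => 1/(1 + (x:ℝ)))]
    exact sum_congr rfl fun j _ => by rw [add_comm]
  obtain ⟨k, hk2, hkT⟩ := ((eventually_ge_atTop 2).and (hH.eventually_gt_atTop (16 * max T 0))).exists
  have hk : 0 < k := by omega
  have hHk := Hk_ge hk
  have hq := qk_ge hk
  have hq2 := qk_le k
  have hk1 : (1:ℝ) ≤ k := by exact_mod_cast hk
  set M' := ⌈2 * k * Hk k⌉₊ with hM'
  have h1 : 2 * k * Hk k ≤ M' := Nat.le_ceil _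
  have h2 : (M':ℝ) < 2 * k * Hk k + 1 := Nat.ceil_lt_add_one (by positivity)
  refine ⟨k, hk2, M' + k, by omega, ?_⟩
  have hJ : (k:ℝ) * (Hk k^2 * qk k^(k-1) / 2) ≤ ∑ i, Ja (k := k) (M' + k) i := by
    have := card_nsmul_le_sum univ (fun i => Ja (k := k) (M' + k) i) _ fun i _ => Ja_ge2 hk M' h1 i
    rwa [card_univ, Fintype.card_fin, nsmul_eq_mul] at this
  refine lt_of_lt_of_le ?_ hJ
  have hI := Ia_le (k := k) (M' + k)
  have hI0 : 0 ≤ ∑ c : Fin k → Fin k, ac (M' + k) c^2 := sum_nonneg fun _ _ => sq_nonneg _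
  have hT0 : 0 ≤ max T 0 := le_max_right _ _
  have hkH : (k:ℝ) ≤ k * Hk k := le_mul_of_one_le_right (by linarith) hHk
  have hM4 : ((M' + k : ℕ) : ℝ) ≤ 4 * k * Hk k := by
    push_cast
    nlinarith
  have hqk : qk k^k = qk k^(k-1) * qk k := by rw [← pow_succ]; congr 1; omega
  set Q := qk k^(k-1) with hQ
  have hQ1 : 1 ≤ Q := one_le_pow₀ hq
  calc T * ((M' + k : ℕ) : ℝ) * ∑ c : Fin k → Fin k, ac (M' + k) c^2
      ≤ max T 0 * ((M' + k : ℕ) : ℝ) * ∑ c : Fin k → Fin k, ac (M' + k) c^2 := by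
        gcongr; exact le_max_left _ _
    _ ≤ max T 0 * (4 * k * Hk k) * (Q * 2) := by
        refine mul_le_mul (mul_le_mul_of_nonneg_left hM4 hT0) ?_ hI0 (by positivity)
        rw [hqk] at hI
        exact hI.trans (mul_le_mul_of_nonneg_left hq2 (by linarith))
    _ = (16 * max T 0) * (k * Hk k * Q / 2) := by ring
    _ < Hk k * (k * Hk k * Q / 2) := mul_lt_mul_of_pos_right hkT (by positivity)
    _ = _ := by ring
end

/-- test functions -/
noncomputable def fc (c : ℕ) (u : ℝ) : ℝ := Real.smoothTransition (c + 1 - u) * Real.smoothTransition (u + 1)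

lemma fc_smooth (c : ℕ) : ContDiff ℝ (⊤:ℕ∞) (fc c) := by
  unfold fc
  exact (Real.smoothTransition.contDiff.comp (by fun_prop)).mul (Real.smoothTransition.contDiff.comp (by fun_prop))

lemma fc_zero_right (c : ℕ) (u : ℝ) (hu : (c:ℝ) + 1 ≤ u) : fc c u = 0 := by
  unfold fc
  rw [Real.smoothTransition.zero_of_nonpos (by linarith), zero_mul]

lemma fc_compact (c : ℕ) : HasCompactSupport (fc c) := by
  refine HasCompactSupport.intro (K := Set.Icc (-1) (c+1)) isCompact_Icc fun u hu => ?_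
  rw [Set.mem_Icc, not_and_or] at hu
  rcases hu with hu | hu
  · unfold fc
    rw [Real.smoothTransition.zero_of_nonpos (x := u + 1) (by linarith), mul_zero]
  · exact fc_zero_right c u (by linarith)

lemma fc_zero (c : ℕ) : fc c 0 = 1 := by
  unfold fc
  rw [Real.smoothTransition.one_of_one_le, Real.smoothTransition.one_of_one_le] <;> simp

lemma fc_nonneg_le (c : ℕ) (u : ℝ) : |fc c u| ≤ 1 := by
  unfold fc
  rw [abs_of_nonneg (mul_nonneg (Real.smoothTransition.nonneg _) (Real.smoothTransition.nonneg _))]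
  exact mul_le_one₀ (Real.smoothTransition.le_one _) (Real.smoothTransition.nonneg _) (Real.smoothTransition.le_one _)

lemma st_deriv_zero (x : ℝ) (hx : x < 0 ∨ 1 < x) : deriv Real.smoothTransition x = 0 := by
  rcases hx with hx | hx
  · have : Real.smoothTransition =ᶠ[𝓝 x] fun _ => 0 := by
      filter_upwards [eventually_lt_nhds hx] with y hy
      exact Real.smoothTransition.zero_of_nonpos hy.le
    rw [this.deriv_eq]; simp
  · have : Real.smoothTransition =ᶠ[𝓝 x] fun _ => 1 := by
      filter_upwards [eventually_gt_nhds hx] with y hy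
      exact Real.smoothTransition.one_of_one_le hy.le
    rw [this.deriv_eq]; simp

lemma fc_deriv (c : ℕ) (u : ℝ) (hu : 0 < u) : deriv (fc c) u = -deriv Real.smoothTransition (c + 1 - u) := by
  have : fc c =ᶠ[𝓝 u] fun u => Real.smoothTransition (c + 1 - u) := by
    filter_upwards [eventually_gt_nhds hu] with y hy
    unfold fc
    rw [Real.smoothTransition.one_of_one_le (x := y + 1) (by linarith), mul_one]
  rw [this.deriv_eq, deriv_comp_const_sub]

/-- energy of the test function -/
noncomputable def A2 : ℝ := ∫ x in (0:ℝ)..1, (deriv Real.smoothTransition x)^2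

lemma st_cont : Continuous (deriv Real.smoothTransition) :=
  (Real.smoothTransition.contDiff (n := 1)).continuous_deriv le_rfl

lemma A2_pos : 1 ≤ A2 := by
  have h0 : ∫ x in (0:ℝ)..1, deriv Real.smoothTransition x = 1 := by
    rw [intervalIntegral.integral_deriv_eq_sub]
    · simp
    · intro x _
      exact (Real.smoothTransition.contDiff (n := 1)).differentiable (by norm_num) x
    · exact st_cont.intervalIntegrable _ _
  have h1 : 0 ≤ ∫ x in (0:ℝ)..1, (deriv Real.smoothTransition x - 1)^2 :=
    intervalIntegral.integral_nonneg (by norm_num) fun _ _ => sq_nonneg _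
  have h2 : ∫ x in (0:ℝ)..1, (deriv Real.smoothTransition x - 1)^2 = A2 - 2 * 1 + 1 := by
    have c := st_cont
    have : ∀ x, (deriv Real.smoothTransition x - 1)^2 = (deriv Real.smoothTransition x)^2 - 2 * deriv Real.smoothTransition x + 1 := fun x => by ring
    simp_rw [this]
    rw [intervalIntegral.integral_add, intervalIntegral.integral_sub, intervalIntegral.integral_const_mul, h0, A2]
    · simp
    all_goals exact Continuous.intervalIntegrable (by fun_prop) _ _
  linarith

lemma fc_orth (c c' : ℕ) : ∫ u in Set.Ioi (0:ℝ), deriv (fc c) u * deriv (fc c') u = if c = c' then A2 else 0 := by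
  have e1 : ∫ u in Set.Ioi (0:ℝ), deriv (fc c) u * deriv (fc c') u =
      ∫ u in Set.Ioi (0:ℝ), deriv Real.smoothTransition (c + 1 - u) * deriv Real.smoothTransition (c' + 1 - u) := by
    refine setIntegral_congr_fun measurableSet_Ioi fun u hu => ?_
    beta_reduce
    rw [fc_deriv c u hu, fc_deriv c' u hu]; ring
  rw [e1]
  split_ifs with h
  · subst h
    have e2 : ∫ u in Set.Ioi (0:ℝ), deriv Real.smoothTransition (c + 1 - u) * deriv Real.smoothTransition (c + 1 - u) =
        ∫ u in Set.Ioc (c:ℝ) (c+1), deriv Real.smoothTransition (c + 1 - u) * deriv Real.smoothTransition (c + 1 - u) := by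
      refine setIntegral_eq_of_subset_of_forall_sdiff_eq_zero measurableSet_Ioi ?_ ?_
      · intro u hu
        have : (0:ℝ) ≤ c := by positivity
        exact lt_of_le_of_lt this hu.1
      · rintro u ⟨hu, hu'⟩
        have h3 : ¬ ((c:ℝ) < u ∧ u ≤ c + 1) := hu'
        by_cases h4 : (c:ℝ) < u
        · have h5 : (c:ℝ) + 1 < u := by
            by_contra h6
            exact h3 ⟨h4, not_lt.mp h6⟩
          rw [st_deriv_zero _ (Or.inl (by linarith))]; ring
        · have h6 : deriv Real.smoothTransition (c + 1 - u) = 0 := by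
            rcases (not_lt.mp h4).lt_or_eq with h7 | h7
            · exact st_deriv_zero _ (Or.inr (by linarith))
            · rw [h7]
              have h8 : (c:ℝ) + 1 - c = 1 := by ring
              rw [h8]
              have : IsLocalMax Real.smoothTransition 1 := Eventually.of_forall fun x => by
                rw [Real.smoothTransition.one]; exact Real.smoothTransition.le_one x
              exact this.deriv_eq_zero
          rw [h6]; ring
    rw [e2, ← intervalIntegral.integral_of_le (by linarith)]
    rw [intervalIntegral.integral_comp_sub_left (fun x => deriv Real.smoothTransition x * deriv Real.smoothTransition x)]
    unfold A2
    simp only [sub_self, add_sub_cancel_left]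
    congr 1
    funext x; ring
  · refine (integral_congr_ae (g := fun _ => (0:ℝ)) ?_).trans (by simp)
    have hfin : ∀ᵐ u ∂(volume.restrict (Set.Ioi (0:ℝ))), u ≠ (c:ℝ) ∧ u ≠ c + 1 := by
      refine ae_restrict_of_ae ?_
      have h1 : ∀ᵐ u : ℝ, u ≠ (c:ℝ) := by simp [ae_iff]
      have h2 : ∀ᵐ u : ℝ, u ≠ (c:ℝ) + 1 := by simp [ae_iff]
      filter_upwards [h1, h2] with u a b using ⟨a, b⟩
    filter_upwards [hfin] with u hu
    simp only [Pi.zero_apply, mul_eq_zero]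
    rcases lt_or_gt_of_ne hu.1 with h1 | h1
    · left; exact st_deriv_zero _ (Or.inr (by linarith))
    · rcases lt_or_gt_of_ne hu.2 with h2 | h2
      · right
        rcases lt_or_gt_of_ne h with h3 | h3
        · have : (c:ℝ) + 1 ≤ c' := by exact_mod_cast h3
          exact st_deriv_zero _ (Or.inr (by linarith))
        · have : (c':ℝ) + 1 ≤ c := by exact_mod_cast h3
          exact st_deriv_zero _ (Or.inl (by linarith))
      · left; exact st_deriv_zero _ (Or.inl (by linarith))
end MT

namespace MT
open Finset Filter Topology

section
variable {ι : Type} [Fintype ι]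

/-- truncated divisor sum -/
noncomputable def Lam (P : Finset ℕ) (f : ℝ → ℝ) (lam : ℝ) (n : ℕ) : ℝ :=
  ∑ A ∈ P.powerset, if ∀ p ∈ A, p ∣ n then (-1:ℝ)^A.card * f ((∑ p ∈ A, Real.log p) / lam) else 0

/-- the divisibility condition -/
def DC (L : ι → ℕ → ℕ) (A : ι × Bool → Finset ℕ) (l : ℕ) : Prop := ∀ j, ∀ p ∈ A j, p ∣ L j.1 l

/-- relevant tuples -/
noncomputable def AA (P : Finset ℕ) (F : ι × Bool → ℝ → ℝ) (lam : ℝ) : Finset (ι × Bool → Finset ℕ) :=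
  (Fintype.piFinset (fun _ : ι × Bool => P.powerset)).filter
    (fun A => Val A ∧ ∀ j, F j ((∑ p ∈ A j, Real.log p) / lam) ≠ 0)

lemma prod_Lam (P : Finset ℕ) (F : ι × Bool → ℝ → ℝ) (lam : ℝ) (L : ι → ℕ → ℕ) (l : ℕ) :
    ∏ j, Lam P (F j) lam (L j.1 l) = ∑ A ∈ Fintype.piFinset (fun _ : ι × Bool => P.powerset),
      if DC L A l then ∏ j, (-1:ℝ)^(A j).card * F j ((∑ p ∈ A j, Real.log p) / lam) else 0 := by
  unfold Lam
  rw [Finset.prod_univ_sum]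
  refine sum_congr rfl fun A _ => ?_
  split_ifs with h
  · exact prod_congr rfl fun j _ => if_pos (h j)
  · unfold DC at h
    push Not at h
    obtain ⟨j, p, hp, hd⟩ := h
    refine prod_eq_zero (mem_univ j) (if_neg fun h => hd (h p hp))

lemma sieve_expand (P : Finset ℕ) (F : ι × Bool → ℝ → ℝ) (hF : ∀ j u, |F j u| ≤ 1) (lam : ℝ) (L : ι → ℕ → ℕ)
    (I : Finset ℕ) (u : ℕ → ℝ) (X : ℝ) (ω : ℕ → ℝ) (E : (ι × Bool → Finset ℕ) → ℝ)
    (hinv : ∀ A ∈ Fintype.piFinset (fun _ : ι × Bool => P.powerset), ¬ Val A → ∀ l, ¬ DC L A l)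
    (hval : ∀ A ∈ AA P F lam, |∑ l ∈ I with DC L A l, u l - X * ∏ p ∈ univ.biUnion A, ω p| ≤ E A) :
    |∑ l ∈ I, u l * ∏ j, Lam P (F j) lam (L j.1 l) - X * sieveT P ω F lam| ≤ ∑ A ∈ AA P F lam, E A := by
  have e1 : ∑ l ∈ I, u l * ∏ j, Lam P (F j) lam (L j.1 l) =
      ∑ A ∈ Fintype.piFinset (fun _ : ι × Bool => P.powerset),
        (∏ j, (-1:ℝ)^(A j).card * F j ((∑ p ∈ A j, Real.log p) / lam)) * ∑ l ∈ I with DC L A l, u l := by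
    simp_rw [prod_Lam, mul_sum]
    rw [Finset.sum_comm]
    refine sum_congr rfl fun A _ => ?_
    rw [sum_filter]
    refine sum_congr rfl fun l _ => ?_
    split_ifs <;> ring
  have e2 : ∑ l ∈ I, u l * ∏ j, Lam P (F j) lam (L j.1 l) - X * sieveT P ω F lam =
      ∑ A ∈ AA P F lam, (∏ j, (-1:ℝ)^(A j).card * F j ((∑ p ∈ A j, Real.log p) / lam)) *
        (∑ l ∈ I with DC L A l, u l - X * ∏ p ∈ univ.biUnion A, ω p) := by
    rw [e1]
    unfold sieveT AA
    rw [mul_sum, ← sum_sub_distrib, sum_filter]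
    refine sum_congr rfl fun A hA => ?_
    by_cases hv : Val A
    · by_cases hn : ∀ j, F j ((∑ p ∈ A j, Real.log p) / lam) ≠ 0
      · rw [if_pos hv, if_pos ⟨hv, hn⟩]; ring
      · rw [if_pos hv, if_neg (fun h => hn h.2)]
        push Not at hn
        obtain ⟨j, hj⟩ := hn
        rw [prod_eq_zero (mem_univ j) (by rw [hj]; ring)]; ring
    · rw [if_neg hv, if_neg (fun h => hv h.1)]
      have : I.filter (fun l => DC L A l) = ∅ := filter_eq_empty_iff.mpr fun l _ => hinv A hA hv l
      rw [this]; simp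
  rw [e2]
  refine (abs_sum_le_sum_abs _ _).trans (sum_le_sum fun A hA => ?_)
  rw [abs_mul]
  have h1 : |∏ j, (-1:ℝ)^(A j).card * F j ((∑ p ∈ A j, Real.log p) / lam)| ≤ 1 := by
    rw [abs_prod]
    refine prod_le_one (fun _ _ => abs_nonneg _) fun j _ => ?_
    rw [abs_mul, abs_pow, abs_neg, abs_one, one_pow, one_mul]
    exact hF j _
  calc _ ≤ 1 * |∑ l ∈ I with DC L A l, u l - X * ∏ p ∈ univ.biUnion A, ω p| := by gcongr
    _ ≤ _ := by rw [one_mul]; exact hval A hA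

/-- the modulus of a tuple -/
noncomputable def DD (A : ι × Bool → Finset ℕ) : ℕ := ∏ p ∈ univ.biUnion A, p

lemma AA_mem {P : Finset ℕ} {F : ι × Bool → ℝ → ℝ} {lam : ℝ} {A : ι × Bool → Finset ℕ} (hA : A ∈ AA P F lam) :
    (∀ j, A j ⊆ P) ∧ Val A ∧ ∀ j, F j ((∑ p ∈ A j, Real.log p) / lam) ≠ 0 := by
  have := mem_filter.mp hA
  refine ⟨fun j => ?_, this.2⟩
  have h := Fintype.mem_piFinset.mp this.1 j
  exact mem_powerset.mp h

lemma DD_pf {P : Finset ℕ} (hP : ∀ p ∈ P, p.Prime) {A : ι × Bool → Finset ℕ} (hA : ∀ j, A j ⊆ P) :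
    (DD A).primeFactors = univ.biUnion A := by
  unfold DD
  refine Nat.primeFactors_prod fun p hp => ?_
  obtain ⟨j, -, hj⟩ := mem_biUnion.mp hp
  exact hP p (hA j hj)

lemma fiber_sum (P : Finset ℕ) (hP : ∀ p ∈ P, p.Prime) (F : ι × Bool → ℝ → ℝ) (lam : ℝ)
    (E : (ι × Bool → Finset ℕ) → ℝ) (hE : ∀ A, 0 ≤ E A) :
    ∃ s : ℕ → (ι × Bool → Finset ℕ), (∀ D ∈ (AA P F lam).image DD, s D ∈ AA P F lam ∧ DD (s D) = D) ∧
      ∑ A ∈ AA P F lam, E A ≤ ∑ D ∈ (AA P F lam).image DD, ((4^Fintype.card ι : ℕ):ℝ)^D.primeFactors.card * E (s D) := by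
  have hex : ∀ D, ∃ B : ι × Bool → Finset ℕ, D ∈ (AA P F lam).image DD →
      (B ∈ AA P F lam ∧ DD B = D) ∧ ∀ A ∈ AA P F lam, DD A = D → E A ≤ E B := by
    intro D
    by_cases hD : D ∈ (AA P F lam).image DD
    · obtain ⟨A, hA, hAD⟩ := mem_image.mp hD
      obtain ⟨B, hB, hmax⟩ := Finset.exists_max_image ((AA P F lam).filter (fun A => DD A = D)) E ⟨A, mem_filter.mpr ⟨hA, hAD⟩⟩
      exact ⟨B, fun _ => ⟨mem_filter.mp hB, fun A h1 h2 => hmax A (mem_filter.mpr ⟨h1, h2⟩)⟩⟩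
    · exact ⟨fun _ => ∅, fun h => absurd h hD⟩
  choose s hs using hex
  refine ⟨s, fun D hD => (hs D hD).1, ?_⟩
  rw [← Finset.sum_fiberwise_of_maps_to (g := DD) (t := (AA P F lam).image DD) (fun A hA => mem_image_of_mem _ hA)]
  refine sum_le_sum fun D hD => ?_
  have hcard : ((AA P F lam).filter (fun A => DD A = D)).card ≤ (4^Fintype.card ι)^D.primeFactors.card := by
    have hsub : (AA P F lam).filter (fun A => DD A = D) ⊆ Fintype.piFinset (fun _ : ι × Bool => D.primeFactors.powerset) := by
      intro A hA
      obtain ⟨hA1, hA2⟩ := mem_filter.mp hA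
      rw [Fintype.mem_piFinset]
      intro j
      rw [mem_powerset, ← hA2, DD_pf hP (AA_mem hA1).1]
      exact subset_biUnion_of_mem A (mem_univ j)
    refine (card_le_card hsub).trans (le_of_eq ?_)
    rw [Fintype.card_piFinset, prod_const, card_powerset, card_univ, Fintype.card_prod, Fintype.card_bool]
    rw [show (4:ℕ) = 2^2 by norm_num, ← pow_mul, ← pow_mul, ← pow_mul]
    congr 1; ring
  calc _ ≤ ∑ A ∈ (AA P F lam).filter (fun A => DD A = D), E (s D) :=
        sum_le_sum fun A hA => (hs D hD).2 A (mem_filter.mp hA).1 (mem_filter.mp hA).2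
    _ = ((AA P F lam).filter (fun A => DD A = D)).card * E (s D) := by rw [sum_const, nsmul_eq_mul]
    _ ≤ _ := by
      have := hE (s D)
      gcongr
      exact_mod_cast hcard

/-- size of the modulus -/
lemma DD_le {P : Finset ℕ} (hP : ∀ p ∈ P, p.Prime) {F : ι × Bool → ℝ → ℝ} {lam : ℝ} (hl : 0 < lam) (τ : ι × Bool → ℝ)
    (hτ : ∀ j u, τ j ≤ u → F j u = 0) {A : ι × Bool → Finset ℕ} (hA : A ∈ AA P F lam) :
    (DD A : ℝ) ≤ Real.exp (lam * ∑ j, τ j) := by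
  obtain ⟨h1, -, h3⟩ := AA_mem hA
  have hpos : ∀ j, ∀ p ∈ A j, (0:ℝ) < p := fun j p hp => by exact_mod_cast (hP p (h1 j hp)).pos
  have h4 : DD A ≤ ∏ j, ∏ p ∈ A j, p := by
    refine Nat.le_of_dvd ?_ ?_
    · refine prod_pos fun j _ => prod_pos fun p hp => by exact_mod_cast hpos j p hp
    · refine Finset.prod_primes_dvd _ (fun p hp => ?_) (fun p hp => ?_)
      · obtain ⟨j, -, hj⟩ := mem_biUnion.mp hp
        exact (hP p (h1 j hj)).prime
      · obtain ⟨j, -, hj⟩ := mem_biUnion.mp hp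
        exact (dvd_prod_of_mem (fun p => p) hj).trans (dvd_prod_of_mem (fun j => ∏ p ∈ A j, p) (mem_univ j))
  calc (DD A : ℝ) ≤ ((∏ j, ∏ p ∈ A j, p : ℕ):ℝ) := by exact_mod_cast h4
    _ = ∏ j, ∏ p ∈ A j, (p:ℝ) := by push_cast; rfl
    _ ≤ ∏ j, Real.exp (lam * τ j) := by
      refine prod_le_prod (fun j _ => (prod_pos (hpos j)).le) fun j _ => ?_
      have h5 : (∑ p ∈ A j, Real.log p) / lam < τ j := by
        by_contra h
        exact h3 j (hτ j _ (not_lt.mp h))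
      rw [div_lt_iff₀ hl] at h5
      rw [← Real.exp_log (prod_pos (hpos j)), Real.log_prod (fun p hp => (hpos j p hp).ne')]
      exact Real.exp_le_exp.mpr (by linarith)
    _ = _ := by rw [← Real.exp_sum, mul_sum]

/-- reduced system of linear forms -/
structure Sys {ι : Type} (G H : ι → ℕ) (D0 : ℕ) : Prop where
  big : ∀ i p, p.Prime → D0 < p → ¬ p ∣ G i
  diff : ∀ i j, i ≠ j → ∀ p : ℕ, p.Prime → D0 < p → ¬ ((p:ℤ) ∣ (G i:ℤ) * H j - G j * H i)

lemma Sys_inv {G H : ι → ℕ} {D0 : ℕ} (hS : Sys G H D0) (P : Finset ℕ) (hP : ∀ p ∈ P, p.Prime ∧ D0 < p) :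
    ∀ A ∈ Fintype.piFinset (fun _ : ι × Bool => P.powerset), ¬ Val A → ∀ l, ¬ DC (fun i l => G i * l + H i) A l := by
  intro A hA hv l hd
  unfold Val at hv
  push Not at hv
  obtain ⟨p, j, j', hj, hj', hne⟩ := hv
  have hp := hP p (mem_powerset.mp (Fintype.mem_piFinset.mp hA j) hj)
  refine hS.diff _ _ hne p hp.1 hp.2 ?_
  have a1 : (p:ℤ) ∣ G j.1 * l + H j.1 := by exact_mod_cast hd j p hj
  have a2 : (p:ℤ) ∣ G j'.1 * l + H j'.1 := by exact_mod_cast hd j' p hj'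
  have := (a2.mul_left (G j.1)).sub (a1.mul_left (G j'.1))
  rwa [show (G j.1:ℤ) * (G j'.1 * l + H j'.1) - G j'.1 * (G j.1 * l + H j.1) = G j.1 * H j'.1 - G j'.1 * H j.1 by ring] at this

lemma Sys_crt {G H : ι → ℕ} {D0 : ℕ} (hS : Sys G H D0) (P : Finset ℕ) (hP : ∀ p ∈ P, p.Prime ∧ D0 < p)
    (A : ι × Bool → Finset ℕ) (hA : ∀ j, A j ⊆ P) (hv : Val A) :
    ∃ a : ℕ, ∀ l, DC (fun i l => G i * l + H i) A l ↔ l ≡ a [MOD DD A] := by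
  have hU : ∀ p ∈ univ.biUnion A, p.Prime ∧ D0 < p := fun p hp => by
    obtain ⟨j, -, hj⟩ := mem_biUnion.mp hp
    exact hP p (hA j hj)
  have hex : ∀ p, ∃ x : ℕ, p ∈ univ.biUnion A → ∀ j, p ∈ A j → p ∣ G j.1 * x + H j.1 := by
    intro p
    by_cases hp : p ∈ univ.biUnion A
    · obtain ⟨j, -, hj⟩ := mem_biUnion.mp hp
      have := Fact.mk (hU p hp).1
      have hG : (G j.1 : ZMod p) ≠ 0 := by
        rw [Ne, ZMod.natCast_eq_zero_iff]
        exact hS.big _ p (hU p hp).1 (hU p hp).2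
      refine ⟨(-(H j.1 : ZMod p) / G j.1).val, fun _ j' hj' => ?_⟩
      rw [hv p j' j hj' hj, ← ZMod.natCast_eq_zero_iff]
      push_cast
      rw [ZMod.natCast_zmod_val]
      field_simp; ring
    · exact ⟨0, fun h => absurd h hp⟩
  choose x hx using hex
  obtain ⟨a, ha⟩ := Nat.chineseRemainderOfFinset x (fun p => p) (univ.biUnion A) (fun p hp => (hU p hp).1.ne_zero)
    (fun p hp q hq hne => (Nat.coprime_primes (hU p hp).1 (hU q hq).1).mpr hne)
  have hxa : ∀ j, ∀ p ∈ A j, (p:ℤ) ∣ G j.1 * a + H j.1 := by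
    intro j p hp
    have hpU : p ∈ univ.biUnion A := mem_biUnion.mpr ⟨j, mem_univ _, hp⟩
    have h1 : p ∣ G j.1 * a + H j.1 := by
      have h2 := hx p hpU j hp
      rw [← ZMod.natCast_eq_zero_iff] at h2 ⊢
      have h3 := (ZMod.natCast_eq_natCast_iff _ _ _).mpr (ha p hpU)
      push_cast at h2 ⊢
      rw [h3]; exact h2
    exact_mod_cast h1
  refine ⟨a, fun l => ⟨fun h => ?_, fun h => ?_⟩⟩
  · refine Nat.ModEq.symm ((Nat.modEq_iff_dvd).mpr ?_)
    unfold DD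
    push_cast
    refine Finset.prod_dvd_of_coprime (s := fun p : ℕ => (p:ℤ)) ?_ fun p hp => ?_
    · intro p hp q hq hne
      exact Nat.isCoprime_iff_coprime.mpr ((Nat.coprime_primes (hU p hp).1 (hU q hq).1).mpr hne)
    · obtain ⟨j, -, hj⟩ := mem_biUnion.mp hp
      have a1 : (p:ℤ) ∣ G j.1 * l + H j.1 := by exact_mod_cast h j p hj
      have a2 := a1.sub (hxa j p hj)
      have a3 : (p:ℤ) ∣ G j.1 * (l - a) := by
        rwa [show (G j.1 * l + H j.1 : ℤ) - (G j.1 * a + H j.1) = G j.1 * (l - a) by ring] at a2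
      rcases (Nat.prime_iff_prime_int.mp (hU p hp).1).dvd_or_dvd a3 with h5 | h5
      · exact absurd (by exact_mod_cast h5) (hS.big j.1 p (hU p hp).1 (hU p hp).2)
      · exact h5
  · intro j p hp
    have hpU : p ∈ univ.biUnion A := mem_biUnion.mpr ⟨j, mem_univ _, hp⟩
    have h1 : (DD A : ℤ) ∣ (l:ℤ) - a := (Nat.modEq_iff_dvd).mp h.symm
    have h2 : (p:ℤ) ∣ DD A := by exact_mod_cast dvd_prod_of_mem (fun p => p) hpU
    have h3 := ((h2.trans h1).mul_left (G j.1:ℤ)).add (hxa j p hp)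
    have h4 : (p:ℤ) ∣ G j.1 * l + H j.1 := by
      rwa [show (G j.1:ℤ) * (l - a) + (G j.1 * a + H j.1) = G j.1 * l + H j.1 by ring] at h3
    show p ∣ G j.1 * l + H j.1
    exact_mod_cast h4
end
end MT

namespace MT
open Finset Filter Topology

section
variable {ι : Type} [Fintype ι]

/-- sieve scale -/
noncomputable def lamN (M : ℕ) (N : ℝ) : ℝ := Real.log N / (100 * M)

lemma lamN_tendsto (M : ℕ) (hM : 1 ≤ M) : Tendsto (lamN M) atTop atTop := by
  have : (0:ℝ) < 100 * M := by positivity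
  exact Real.tendsto_log_atTop.atTop_div_const this

lemma exp_lamN (M : ℕ) (hM : 1 ≤ M) (N : ℝ) (hN : 0 < N) : Real.exp (100 * M * lamN M N) = N := by
  have : (0:ℝ) < M := by positivity
  unfold lamN
  rw [show 100 * (M:ℝ) * (Real.log N / (100 * M)) = Real.log N by field_simp, Real.exp_log hN]

lemma PP_mem {D0 n p : ℕ} (h : p ∈ PP D0 n) : p.Prime ∧ D0 < p ∧ p < n := by
  have := mem_filter.mp h
  have h2 := Nat.mem_primesBelow.mp this.1
  exact ⟨h2.2, this.2, h2.1⟩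

/-- the sieving set -/
noncomputable def PN (D0 M R : ℕ) (N : ℝ) : Finset ℕ := PP D0 ⌈Real.exp (lamN M N * R)⌉₊

/-- hypotheses on the test functions -/
structure Tst (F : ι × Bool → ℝ → ℝ) (M R : ℕ) : Prop where
  smooth : ∀ j, ContDiff ℝ (⊤:ℕ∞) (F j)
  cpt : ∀ j, HasCompactSupport (F j)
  bd : ∀ j u, |F j u| ≤ 1
  tau : ∃ τ : ι × Bool → ℝ, (∀ j u, τ j ≤ u → F j u = 0) ∧ (∀ j, τ j ≤ R) ∧ ∑ j, τ j ≤ 2 * M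

lemma Tst_lim {F : ι × Bool → ℝ → ℝ} {M R : ℕ} (hT : Tst F M R) (hM : 1 ≤ M) (ω : ℕ → ℝ) (D0 : ℕ)
    (hω : ∀ p:ℕ, p.Prime → |ω p - 1/p| ≤ 2 * (1/(p:ℝ))^2) :
    Tendsto (fun N => lamN M N^(Fintype.card ι) * sieveT (PN D0 M R N) ω F (lamN M N)) atTop
      (𝓝 (SS ω D0 (Fintype.card ι) * ∏ i, ∫ u in Set.Ioi (0:ℝ), deriv (F (i,false)) u * deriv (F (i,true)) u)) := by
  obtain ⟨τ, h1, h2, -⟩ := hT.tau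
  exact (main_lim ω D0 hω F hT.smooth hT.cpt R (fun j u hu => h1 j u ((h2 j).trans hu))).comp (lamN_tendsto M hM)

lemma Tst_D {F : ι × Bool → ℝ → ℝ} {M R : ℕ} (hT : Tst F M R) {D0 : ℕ} {N : ℝ} (hl : 0 < lamN M N)
    {A : ι × Bool → Finset ℕ} (hA : A ∈ AA (PN D0 M R N) F (lamN M N)) :
    (DD A : ℝ) ≤ Real.exp (2 * M * lamN M N) := by
  obtain ⟨τ, h1, -, h3⟩ := hT.tau
  refine (DD_le (fun p hp => (PP_mem hp).1) hl τ h1 hA).trans (Real.exp_le_exp.mpr ?_)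
  nlinarith

lemma DD_pos {D0 M R : ℕ} {N : ℝ} {F : ι × Bool → ℝ → ℝ} {lam : ℝ}
    {A : ι × Bool → Finset ℕ} (hA : A ∈ AA (PN D0 M R N) F lam) : 0 < DD A := by
  refine prod_pos fun p hp => ?_
  obtain ⟨j, -, hj⟩ := mem_biUnion.mp hp
  exact (PP_mem ((AA_mem hA).1 j hj)).1.pos

lemma DD_pf' {D0 M R : ℕ} {N : ℝ} {F : ι × Bool → ℝ → ℝ} {lam : ℝ}
    {A : ι × Bool → Finset ℕ} (hA : A ∈ AA (PN D0 M R N) F lam) : (DD A).primeFactors = univ.biUnion A :=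
  DD_pf (fun p hp => (PP_mem hp).1) (AA_mem hA).1

lemma DD_big {D0 M R : ℕ} {N : ℝ} {F : ι × Bool → ℝ → ℝ} {lam : ℝ}
    {A : ι × Bool → Finset ℕ} (hA : A ∈ AA (PN D0 M R N) F lam) : ∀ p ∈ (DD A).primeFactors, p.Prime ∧ D0 < p := by
  rw [DD_pf' hA]
  intro p hp
  obtain ⟨j, -, hj⟩ := mem_biUnion.mp hp
  have := PP_mem ((AA_mem hA).1 j hj)
  exact ⟨this.1, this.2.1⟩

lemma AA_count {F : ι × Bool → ℝ → ℝ} {M R : ℕ} (hT : Tst F M R) {D0 : ℕ} (hD0 : 4 * (4^Fintype.card ι)^2 ≤ D0) {N : ℝ} (hl : 0 < lamN M N) :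
    ((AA (PN D0 M R N) F (lamN M N)).card : ℝ) ≤ Real.exp (4 * M * lamN M N) := by
  obtain ⟨s, hs, hsum⟩ := fiber_sum (PN D0 M R N) (fun p hp => (PP_mem hp).1) F (lamN M N) (fun _ => 1) (fun _ => zero_le_one)
  rw [sum_const, nsmul_eq_mul, mul_one] at hsum
  refine hsum.trans ?_
  set 𝒟 := (AA (PN D0 M R N) F (lamN M N)).image DD with h𝒟
  set Y := Real.exp (2 * M * lamN M N) with hY
  have hDY : ∀ D ∈ 𝒟, 0 < D ∧ (D:ℝ) ≤ Y := by
    intro D hD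
    obtain ⟨h1, h2⟩ := hs D hD
    rw [← h2]
    exact ⟨DD_pos h1, Tst_D hT hl h1⟩
  have hcard : (𝒟.card : ℝ) ≤ Y := by
    have : 𝒟 ⊆ Icc 1 ⌊Y⌋₊ := fun D hD => mem_Icc.mpr ⟨(hDY D hD).1, Nat.le_floor (hDY D hD).2⟩
    have h2 := card_le_card this
    rw [Nat.card_Icc, Nat.add_sub_cancel] at h2
    exact (by exact_mod_cast h2 : (𝒟.card:ℝ) ≤ ⌊Y⌋₊).trans (Nat.floor_le (Real.exp_pos _).le)
  have hterm : ∀ D ∈ 𝒟, ((4^Fintype.card ι : ℕ):ℝ)^D.primeFactors.card * 1 ≤ Y := by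
    intro D hD
    refine le_trans ?_ (hDY D hD).2
    rw [mul_one]
    have h1 : (4^Fintype.card ι)^D.primeFactors.card ≤ ∏ p ∈ D.primeFactors, p := by
      rw [← prod_const]
      refine prod_le_prod' fun p hp => ?_
      obtain ⟨h1, h2⟩ := hs D hD
      rw [← h2] at hp
      have := (DD_big h1 p hp).2
      have h3 : 4^Fintype.card ι ≤ 4 * (4^Fintype.card ι)^2 := by
        have : 1 ≤ 4^Fintype.card ι := Nat.one_le_pow _ _ (by norm_num)
        nlinarith
      omega
    have h2 := h1.trans (Nat.le_of_dvd (hDY D hD).1 (Nat.prod_primeFactors_dvd D))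
    exact_mod_cast h2
  calc _ ≤ ∑ D ∈ 𝒟, Y := sum_le_sum hterm
    _ = 𝒟.card * Y := by rw [sum_const, nsmul_eq_mul]
    _ ≤ Y * Y := by have : 0 ≤ Y := (Real.exp_pos _).le; gcongr
    _ = _ := by rw [hY, ← Real.exp_add]; congr 1; ring

lemma count_class (n0 a D : ℕ) (hD : 0 < D) :
    |(((Ico n0 (10*n0)).filter (fun l => l ≡ a [MOD D])).card : ℝ) - 9 * n0 * (1/D)| ≤ 1 := by
  have h := Nat.Ico_filter_modEq_card n0 (10*n0) hD a
  have hD' : (0:ℚ) < D := by exact_mod_cast hD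
  have hle : ((n0:ℚ) - a)/D ≤ (((10*n0:ℕ):ℚ) - a)/D := by
    push_cast
    have : (0:ℚ) ≤ n0 := by positivity
    gcongr; linarith
  rw [max_eq_left (by have := Int.ceil_le_ceil hle; omega)] at h
  have h1 := Int.ceil_lt_add_one (((n0:ℚ) - a)/D)
  have h2 := Int.le_ceil (((n0:ℚ) - a)/D)
  have h3 := Int.ceil_lt_add_one ((((10*n0:ℕ):ℚ) - a)/D)
  have h4 := Int.le_ceil ((((10*n0:ℕ):ℚ) - a)/D)
  have h5 : (((Ico n0 (10*n0)).filter (fun l => l ≡ a [MOD D])).card : ℚ) =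
      (⌈(((10*n0:ℕ):ℚ) - a)/D⌉ : ℚ) - ⌈((n0:ℚ) - a)/D⌉ := by exact_mod_cast h
  have h6 : (((10*n0:ℕ):ℚ) - a)/D - ((n0:ℚ) - a)/D = 9 * n0 * (1/D) := by push_cast; field_simp; ring
  have h7 : |(((Ico n0 (10*n0)).filter (fun l => l ≡ a [MOD D])).card : ℚ) - 9 * n0 * (1/D)| ≤ 1 := by
    rw [abs_le, h5]
    constructor <;> linarith
  have h8 : ((|(((Ico n0 (10*n0)).filter (fun l => l ≡ a [MOD D])).card : ℚ) - 9 * n0 * (1/D)| : ℚ) : ℝ) ≤ ((1:ℚ):ℝ) := Rat.cast_le.mpr h7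
  push_cast at h8
  exact h8

/-- density for the first sum -/
noncomputable def om1 (p : ℕ) : ℝ := 1/p

lemma om1_ok : ∀ p:ℕ, p.Prime → |om1 p - 1/p| ≤ 2 * (1/(p:ℝ))^2 := by
  intro p _
  unfold om1
  rw [sub_self, abs_zero]; positivity

lemma ceil_lim : Tendsto (fun N : ℝ => (⌈N⌉₊ : ℝ) / N) atTop (𝓝 1) := tendsto_nat_ceil_div_atTop

theorem S1_lim (G H : ι → ℕ) (D0 : ℕ) (hS : Sys G H D0) (hD0 : 4 * (4^Fintype.card ι)^2 ≤ D0) (F : ι × Bool → ℝ → ℝ) (M R : ℕ)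
    (hM : 1 ≤ M) (hT : Tst F M R) :
    Tendsto (fun N : ℝ => lamN M N^(Fintype.card ι) / N * ∑ l ∈ Ico ⌈N⌉₊ (10*⌈N⌉₊), ∏ j, Lam (PN D0 M R N) (F j) (lamN M N) (G j.1 * l + H j.1))
      atTop (𝓝 (9 * (SS om1 D0 (Fintype.card ι) * ∏ i, ∫ u in Set.Ioi (0:ℝ), deriv (F (i,false)) u * deriv (F (i,true)) u))) := by
  have h1 := ((ceil_lim.const_mul 9).mul (Tst_lim hT hM om1 D0 om1_ok))
  rw [mul_one] at h1
  refine (tendsto_iff_of_dist ?_).mp h1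
  have h2 : Tendsto (fun N => lamN M N^(Fintype.card ι) * Real.exp (-lamN M N)) atTop (𝓝 0) :=
    (Real.tendsto_pow_mul_exp_neg_atTop_nhds_zero _).comp (lamN_tendsto M hM)
  refine squeeze_zero' (Eventually.of_forall fun _ => dist_nonneg) ?_ h2
  filter_upwards [eventually_gt_atTop 0, (lamN_tendsto M hM).eventually_gt_atTop 0] with N hN hl
  have hmain := sieve_expand (PN D0 M R N) F hT.bd (lamN M N) (fun i l => G i * l + H i) (Ico ⌈N⌉₊ (10*⌈N⌉₊)) (fun _ => 1) (9 * ⌈N⌉₊) om1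
    (fun _ => 1) (Sys_inv hS _ fun p hp => ⟨(PP_mem hp).1, (PP_mem hp).2.1⟩) (by
      intro A hA
      obtain ⟨a, ha⟩ := Sys_crt hS (PN D0 M R N) (fun p hp => ⟨(PP_mem hp).1, (PP_mem hp).2.1⟩) A (AA_mem hA).1 (AA_mem hA).2.1
      simp_rw [ha]
      have h5 : ∏ p ∈ univ.biUnion A, om1 p = 1 / (DD A : ℝ) := by
        unfold om1 DD
        push_cast
        rw [prod_div_distrib, prod_const_one]
      rw [h5, sum_const, nsmul_eq_mul, mul_one]
      exact count_class _ _ _ (DD_pos hA))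
  rw [sum_const, nsmul_eq_mul, mul_one] at hmain
  simp only [one_mul] at hmain
  have h3 := hmain.trans (AA_count hT hD0 hl)
  rw [Real.dist_eq, abs_sub_comm]
  set S := ∑ l ∈ Ico ⌈N⌉₊ (10*⌈N⌉₊), ∏ j, Lam (PN D0 M R N) (F j) (lamN M N) (G j.1 * l + H j.1)
  set T := sieveT (PN D0 M R N) om1 F (lamN M N)
  set lam := lamN M N with hlam
  have e : lam^(Fintype.card ι) / N * S - 9 * (⌈N⌉₊ / N) * (lam^(Fintype.card ι) * T) = lam^(Fintype.card ι) * ((S - 9 * ⌈N⌉₊ * T) / N) := by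
    field_simp
  rw [e, abs_mul, abs_div, abs_of_pos hN, abs_of_nonneg (by positivity)]
  have h4 : |S - 9 * ⌈N⌉₊ * T| / N ≤ Real.exp (-lam) := by
    rw [div_le_iff₀ hN]
    refine h3.trans ?_
    have h6 : Real.exp (100 * M * lam) = N := exp_lamN M hM N hN
    rw [← h6, ← Real.exp_add]
    refine Real.exp_le_exp.mpr ?_
    have : (1:ℝ) ≤ M := by exact_mod_cast hM
    nlinarith
  gcongr
end
end MT

namespace MT
open Finset Filter Topology

/-- cutoff for the prime sums -/
noncomputable def vc (x : ℝ) : ℝ := Real.smoothTransition (x - 2) * Real.smoothTransition (9 - x)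

lemma vc_cut : Cut vc 2 9 where
  smooth := by
    unfold vc
    exact (Real.smoothTransition.contDiff.comp (by fun_prop)).mul (Real.smoothTransition.contDiff.comp (by fun_prop))
  ha := by norm_num
  hab := by norm_num
  supp := by
    intro x hx
    unfold vc at hx
    constructor
    · by_contra h
      exact hx (by rw [Real.smoothTransition.zero_of_nonpos (by linarith)]; ring)
    · by_contra h
      exact hx (by rw [Real.smoothTransition.zero_of_nonpos (x := 9 - x) (by linarith)]; ring)

lemma vc_nonneg (x : ℝ) : 0 ≤ vc x := mul_nonneg (Real.smoothTransition.nonneg _) (Real.smoothTransition.nonneg _)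

lemma vc_le (x : ℝ) : vc x ≤ 1 :=
  mul_le_one₀ (Real.smoothTransition.le_one _) (Real.smoothTransition.nonneg _) (Real.smoothTransition.le_one _)

lemma vc_one (x : ℝ) (h : 3 ≤ x) (h' : x ≤ 8) : vc x = 1 := by
  unfold vc
  rw [Real.smoothTransition.one_of_one_le (by linarith), Real.smoothTransition.one_of_one_le (by linarith), one_mul]

lemma theta_diff : ∀ᶠ x : ℝ in atTop, x ≤ Chebyshev.theta (8*x) - Chebyshev.theta (3*x) := by
  have h1 := (isLittleO_log_rpow_atTop (r := 1/2) (by norm_num)).bound (show (0:ℝ) < 1/200 by norm_num)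
  have h2 : Tendsto (fun x : ℝ => 8 * x) atTop atTop := tendsto_id.const_mul_atTop (by norm_num)
  filter_upwards [h2.eventually h1, eventually_ge_atTop 100] with x hx hx1
  obtain ⟨y, hy⟩ : ∃ y, y = 8 * x := ⟨_, rfl⟩
  rw [← hy] at hx ⊢
  have hy1 : 800 ≤ y := by linarith
  have a1 := Chebyshev.theta_ge' (x := y) (by linarith)
  have a2 := Chebyshev.theta_le_log4_mul_x (x := 3*x) (by linarith)
  have l4 : Real.log 4 = 2 * Real.log 2 := by
    rw [show (4:ℝ) = 2^2 by norm_num, Real.log_pow]; norm_num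
  rw [l4] at a2
  have lg := Real.log_two_gt_d9
  have lg2 := Real.log_two_lt_d9
  rw [Real.norm_of_nonneg (Real.log_nonneg (by linarith)), Real.norm_of_nonneg (by positivity), ← Real.sqrt_eq_rpow] at hx
  have hs : √y * √y = y := Real.mul_self_sqrt (by linarith)
  have hs1 : 1 ≤ √y := by rw [Real.one_le_sqrt]; linarith
  have b1 : 2 * √y * Real.log y ≤ y / 100 := by nlinarith
  have b2 : Real.log (y+2) ≤ y/100 := by
    calc Real.log (y+2) ≤ Real.log (y^2) := Real.log_le_log (by linarith) (by nlinarith)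
      _ = 2 * Real.log y := by rw [Real.log_pow]; norm_num
      _ ≤ y/100 := by nlinarith
  nlinarith

lemma thX_ge : ∀ᶠ x : ℝ in atTop, x ≤ thX vc x ⌈10*x⌉₊ := by
  filter_upwards [theta_diff, eventually_gt_atTop 0] with x hx hx0
  refine hx.trans ?_
  rw [Chebyshev.theta_eq_sum_Icc, Chebyshev.theta_eq_sum_Icc, sub_le_iff_le_add]
  unfold thX
  have hn : ∀ n : ℕ, 0 ≤ Real.log n := fun n => Real.log_natCast_nonneg n
  calc ∑ p ∈ Icc 0 ⌊8*x⌋₊ with p.Prime, Real.log (p:ℕ)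
      ≤ ∑ p ∈ (((Ico 1 ⌈10*x⌉₊).filter (fun n : ℕ => n.Prime ∧ vc (n/x) = 1)) ∪ (Icc 0 ⌊3*x⌋₊).filter (fun n : ℕ => n.Prime)), Real.log (p:ℕ) := by
        refine sum_le_sum_of_subset_of_nonneg ?_ fun n _ _ => hn n
        intro n hn
        obtain ⟨h1, h2⟩ := mem_filter.mp hn
        have h3 := (Nat.le_floor_iff (by linarith)).mp (mem_Icc.mp h1).2
        by_cases h4 : n ≤ ⌊3*x⌋₊
        · exact mem_union_right _ (mem_filter.mpr ⟨mem_Icc.mpr ⟨by omega, h4⟩, h2⟩)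
        · have h5 := Nat.lt_of_floor_lt (not_le.mp h4)
          refine mem_union_left _ (mem_filter.mpr ⟨mem_Ico.mpr ⟨h2.pos, ?_⟩, h2, ?_⟩)
          · rw [Nat.lt_ceil]; linarith
          · refine vc_one _ ?_ ?_
            · rw [le_div_iff₀ hx0]; exact h5.le
            · rw [div_le_iff₀ hx0]; exact h3
    _ ≤ ∑ p ∈ ((Ico 1 ⌈10*x⌉₊).filter (fun n : ℕ => n.Prime ∧ vc (n/x) = 1)), Real.log (p:ℕ) + ∑ p ∈ (Icc 0 ⌊3*x⌋₊).filter (fun n : ℕ => n.Prime), Real.log (p:ℕ) := by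
        rw [← sum_union_inter]
        have := sum_nonneg (s := ((Ico 1 ⌈10*x⌉₊).filter (fun n : ℕ => n.Prime ∧ vc (n/x) = 1)) ∩ (Icc 0 ⌊3*x⌋₊).filter (fun n : ℕ => n.Prime)) (fun n _ => hn n)
        linarith
    _ ≤ _ := by
        gcongr
        have e : ∑ p ∈ ((Ico 1 ⌈10*x⌉₊).filter (fun n : ℕ => n.Prime ∧ vc (n/x) = 1)), Real.log (p:ℕ) =
            ∑ p ∈ ((Ico 1 ⌈10*x⌉₊).filter (fun n : ℕ => n.Prime ∧ vc (n/x) = 1)), Real.log (p:ℕ) * vc (p/x) :=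
          sum_congr rfl fun n hn => by rw [(mem_filter.mp hn).2.2, mul_one]
        rw [e]
        refine sum_le_sum_of_subset_of_nonneg (fun n h => ?_) fun n _ _ => mul_nonneg (hn n) (vc_nonneg _)
        obtain ⟨h1, h2⟩ := mem_filter.mp h
        exact mem_filter.mpr ⟨h1, h2.1⟩

/-- equidistribution of primes along a sequence -/
def BVs (N : ℕ → ℝ) (A c : ℕ) : Prop := ∀ G : ℕ, 1 ≤ G → ∀ᶠ n in atTop, ∀ 𝒟 : Finset ℕ,
    (∀ D ∈ 𝒟, (D:ℝ)^50 ≤ G * N n ∧ Squarefree D ∧ D.Coprime G ∧ ∀ p ∈ D.primeFactors, 4 * c^2 ≤ p) →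
    ∀ α : ℕ → ℕ, (∀ D ∈ 𝒟, (α D).Coprime (G*D)) →
    ∑ D ∈ 𝒟, (c:ℝ)^D.primeFactors.card * |thW vc (G * N n) ⌈10 * (G * N n)⌉₊ (G*D) (α D) -
      thX vc (G * N n) ⌈10 * (G * N n)⌉₊ / (G*D).totient| ≤ G * N n / (Real.log (G * N n))^A

lemma exists_BVs (A c : ℕ) : ∃ N : ℕ → ℝ, Tendsto N atTop atTop ∧ BVs N A c := by
  obtain ⟨B, hB, hbv⟩ := bv A c
  choose Q hQ hg using exists_good
  have hB' : (0:ℝ) < 1/B := by positivity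
  have hQt : Tendsto (fun n => ((Q n : ℕ):ℝ)) atTop atTop :=
    tendsto_natCast_atTop_atTop.comp (tendsto_atTop_mono hQ tendsto_id)
  have hx : Tendsto (fun n => ((Q n : ℕ):ℝ)^((1:ℝ)/B)) atTop atTop := (tendsto_rpow_atTop hB').comp hQt
  refine ⟨fun n => Real.exp (((Q n : ℕ):ℝ)^((1:ℝ)/B)), Real.tendsto_exp_atTop.comp hx, ?_⟩
  intro G hG
  obtain ⟨N0, hN0⟩ := hbv vc 2 9 vc_cut G hG
  have hG0 : (1:ℝ) ≤ G := by exact_mod_cast hG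
  have hlim : Tendsto (fun n => (Real.log G / ((Q n : ℕ):ℝ)^((1:ℝ)/B) + 1)^B) atTop (𝓝 ((0+1)^B)) :=
    ((hx.const_div_atTop (Real.log G)).add_const 1).pow B
  rw [zero_add, one_pow] at hlim
  have hNt : Tendsto (fun n => G * Real.exp (((Q n : ℕ):ℝ)^((1:ℝ)/B))) atTop atTop :=
    (Real.tendsto_exp_atTop.comp hx).const_mul_atTop (by linarith)
  filter_upwards [hNt.eventually_ge_atTop N0, hNt.eventually_ge_atTop 1, hlim.eventually_le_const (show (1:ℝ) < 2 by norm_num), hx.eventually_gt_atTop 0] with n h1 h1' h2 h3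
  obtain ⟨x, hxd⟩ : ∃ x, x = ((Q n : ℕ):ℝ)^((1:ℝ)/B) := ⟨_, rfl⟩
  have hxB : x^B = Q n := by
    rw [hxd, ← Real.rpow_natCast, ← Real.rpow_mul (by positivity), one_div, inv_mul_cancel₀ (by positivity), Real.rpow_one]
  rw [← hxd] at h1 h1' h2 h3
  simp only [← hxd]
  have hlog : Real.log (G * Real.exp x) = Real.log G + x := by
    rw [Real.log_mul (by positivity) (by positivity), Real.log_exp]
  have hlG : 0 ≤ Real.log G := Real.log_nonneg hG0
  intro 𝒟 hD α hα
  refine hN0 _ h1 (Q n) (hg n) ?_ ?_ _ ?_ ?_ 𝒟 hD α hα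
  · rw [hlog, ← hxB, show Real.log G + x = (Real.log G / x + 1) * x by field_simp, mul_pow]
    have : 0 ≤ x^B := by positivity
    nlinarith
  · rw [hlog, ← hxB]
    gcongr; linarith
  · refine lt_of_lt_of_le ?_ (Nat.le_ceil _)
    linarith
  · have := Nat.ceil_lt_add_one (a := 10 * (G * Real.exp x)) (by linarith)
    linarith

/-- prime weight -/
noncomputable def th (n : ℕ) : ℝ := if n.Prime then Real.log n else 0

lemma th_nonneg (n : ℕ) : 0 ≤ th n := by
  unfold th; split_ifs
  · exact Real.log_natCast_nonneg n
  · exact le_rfl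

lemma class_sum (G0 H0 D a : ℕ) (hG0 : 0 < G0) (hD : 0 < D) (N : ℝ) (hN : (H0:ℝ) + 2 ≤ N) :
    ∑ l ∈ Ico ⌈N⌉₊ (10*⌈N⌉₊) with l ≡ a [MOD D], vc (((G0 * l + H0 : ℕ):ℝ) / (G0 * N)) * th (G0 * l + H0) =
      thW vc (G0 * N) ⌈10 * (G0 * N)⌉₊ (G0 * D) (G0 * a + H0) := by
  unfold thW
  have hG1 : (1:ℝ) ≤ G0 := by exact_mod_cast hG0
  have hH : (0:ℝ) ≤ H0 := by positivity
  have hN0 : 0 < N := by linarith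
  have hGN : 0 < (G0:ℝ) * N := by positivity
  refine Finset.sum_bij_ne_zero (fun l _ _ => G0 * l + H0) ?_ ?_ ?_ ?_
  · intro l hl hne
    have hl2 := (mem_filter.mp hl).2
    have hp : (G0 * l + H0).Prime := by
      by_contra h
      exact hne (by unfold th; rw [if_neg h, mul_zero])
    have hv := (vc_cut.supp _ (left_ne_zero_of_mul hne)).2
    rw [div_le_iff₀ hGN] at hv
    refine mem_filter.mpr ⟨mem_Ico.mpr ⟨hp.pos, ?_⟩, hp, ?_⟩
    · rw [Nat.lt_ceil]; linarith
    · rw [ZMod.natCast_eq_natCast_iff]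
      exact (hl2.mul_left' G0).add_right H0
  · intro l _ _ l' _ _ h
    exact Nat.eq_of_mul_eq_mul_left hG0 (Nat.add_right_cancel h)
  · intro n hn hne
    obtain ⟨h1, hp, h2⟩ := mem_filter.mp hn
    rw [ZMod.natCast_eq_natCast_iff] at h2
    have hv := vc_cut.supp _ (right_ne_zero_of_mul hne)
    rw [div_le_iff₀ hGN, le_div_iff₀ hGN] at hv
    have hnH : H0 ≤ n := by
      have : (H0:ℝ) ≤ n := by nlinarith
      exact_mod_cast this
    have h3 : n ≡ H0 [MOD G0] := by
      have h4 := h2.of_mul_right D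
      refine h4.trans ?_
      unfold Nat.ModEq
      simp
    obtain ⟨l, hl⟩ := (Nat.modEq_iff_dvd' hnH).mp h3.symm
    have hnl : n = G0 * l + H0 := by omega
    have hla : l ≡ a [MOD D] := by
      rw [hnl] at h2
      exact Nat.ModEq.mul_left_cancel' hG0.ne' (Nat.ModEq.add_right_cancel' H0 h2)
    have hnr : (n:ℝ) = G0 * l + H0 := by exact_mod_cast hnl
    have hl1 : N + 1 ≤ l := by
      by_contra hc
      push Not at hc
      nlinarith
    have hl2 : (l:ℝ) ≤ 9 * N := by
      by_contra hc
      push Not at hc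
      nlinarith
    have hc1 := Nat.ceil_lt_add_one hN0.le
    have hc2 := Nat.le_ceil N
    refine ⟨l, mem_filter.mpr ⟨mem_Ico.mpr ⟨?_, ?_⟩, hla⟩, ?_, hnl.symm⟩
    · have : (⌈N⌉₊:ℝ) ≤ l := by linarith
      exact_mod_cast this
    · have : (l:ℝ) < 10 * ⌈N⌉₊ := by linarith
      exact_mod_cast this
    · rw [← hnl]
      unfold th
      rw [if_pos hp, mul_comm]; exact hne
  · intro l hl hne
    have hp : (G0 * l + H0).Prime := by
      by_contra h
      exact hne (by unfold th; rw [if_neg h, mul_zero])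
    unfold th
    rw [if_pos hp, mul_comm]
end MT

namespace MT
open Finset Filter Topology

section
variable {ι : Type} [Fintype ι]

/-- density for the second sum -/
noncomputable def om2 (p : ℕ) : ℝ := 1/((p:ℝ)-1)

lemma om2_ok : ∀ p:ℕ, p.Prime → |om2 p - 1/p| ≤ 2 * (1/(p:ℝ))^2 := by
  intro p hp
  unfold om2
  have h2 : (2:ℝ) ≤ p := by exact_mod_cast hp.two_le
  have e : 1/((p:ℝ)-1) - 1/p = 1/(((p:ℝ)-1)*p) := by
    have : (p:ℝ) - 1 ≠ 0 := by linarith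
    field_simp; ring
  have h1 : 0 < ((p:ℝ)-1)*p := by nlinarith
  rw [e, abs_of_pos (by positivity), div_pow, one_pow, mul_one_div, div_le_div_iff₀ h1 (by positivity)]
  nlinarith

/-- the weight in the second sum -/
noncomputable def u2 (G0 H0 : ℕ) (N : ℝ) (l : ℕ) : ℝ := vc (((G0 * l + H0 : ℕ):ℝ) / (G0 * N)) * th (G0 * l + H0)

/-- total mass -/
noncomputable def X2 (G0 : ℕ) (N : ℝ) : ℝ := thX vc (G0 * N) ⌈10 * (G0 * N)⌉₊

lemma S2_err (G H : ι → ℕ) (D0 G0 H0 : ℕ) (hS : Sys G H D0) (hD0 : 4 * (4^Fintype.card ι)^2 ≤ D0) (hG0 : 1 ≤ G0)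
    (hcop : G0.Coprime H0) (hbig : ∀ p, p.Prime → D0 < p → ¬ p ∣ G0)
    (hdiff : ∀ j, ∀ p : ℕ, p.Prime → D0 < p → ¬ ((p:ℤ) ∣ (G0:ℤ) * H j - G j * H0))
    (F : ι × Bool → ℝ → ℝ) (M R : ℕ) (hM : 1 ≤ M) (hT : Tst F M R) (N : ℕ → ℝ) (hN : Tendsto N atTop atTop) (K : ℕ)
    (hbv : BVs N K (4^Fintype.card ι)) :
    ∀ᶠ n in atTop, |∑ l ∈ Ico ⌈N n⌉₊ (10*⌈N n⌉₊), u2 G0 H0 (N n) l * ∏ j, Lam (PN D0 M R (N n)) (F j) (lamN M (N n)) (G j.1 * l + H j.1)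
      - X2 G0 (N n) / G0.totient * sieveT (PN D0 M R (N n)) om2 F (lamN M (N n))| ≤ G0 * N n / (Real.log (G0 * N n))^K := by
  filter_upwards [hbv G0 hG0, hN.eventually_ge_atTop ((H0:ℝ)+2), ((lamN_tendsto M hM).comp hN).eventually_gt_atTop 0] with n hb hNH hl
  have hl : 0 < lamN M (N n) := hl
  have hH : (0:ℝ) ≤ H0 := by positivity
  have hN0 : 0 < N n := by linarith
  have hP : ∀ p ∈ PN D0 M R (N n), p.Prime ∧ D0 < p := fun p hp => ⟨(PP_mem hp).1, (PP_mem hp).2.1⟩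
  have h1 := sieve_expand (PN D0 M R (N n)) F hT.bd (lamN M (N n)) (fun i l => G i * l + H i) (Ico ⌈N n⌉₊ (10*⌈N n⌉₊))
    (u2 G0 H0 (N n)) (X2 G0 (N n) / G0.totient) om2 _ (Sys_inv hS _ hP) (fun A _ => le_refl _)
  refine h1.trans ?_
  obtain ⟨s, hs, hsum⟩ := fiber_sum (PN D0 M R (N n)) (fun p hp => (PP_mem hp).1) F (lamN M (N n))
    (fun A => |∑ l ∈ Ico ⌈N n⌉₊ (10*⌈N n⌉₊) with DC (fun i l => G i * l + H i) A l, u2 G0 H0 (N n) l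
      - X2 G0 (N n) / G0.totient * ∏ p ∈ univ.biUnion A, om2 p|) (fun _ => abs_nonneg _)
  refine hsum.trans ?_
  have hex : ∀ D, ∃ a : ℕ, D ∈ (AA (PN D0 M R (N n)) F (lamN M (N n))).image DD →
      ∀ l, DC (fun i l => G i * l + H i) (s D) l ↔ l ≡ a [MOD D] := by
    intro D
    by_cases hD : D ∈ (AA (PN D0 M R (N n)) F (lamN M (N n))).image DD
    · obtain ⟨h2, h3⟩ := hs D hD
      obtain ⟨a, ha⟩ := Sys_crt hS (PN D0 M R (N n)) hP (s D) (AA_mem h2).1 (AA_mem h2).2.1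
      rw [h3] at ha
      exact ⟨a, fun _ => ha⟩
    · exact ⟨0, fun h => absurd h hD⟩
  choose a ha using hex
  set 𝒟 := (AA (PN D0 M R (N n)) F (lamN M (N n))).image DD with h𝒟
  have hsq : ∀ D ∈ 𝒟, Squarefree D := by
    intro D hD
    obtain ⟨h2, h3⟩ := hs D hD
    rw [← h3]
    unfold DD
    have hpr : ∀ p ∈ univ.biUnion (s D), p.Prime := by
      rw [← DD_pf' h2]; exact fun p hp => (DD_big h2 p hp).1
    refine Finset.squarefree_prod_of_pairwise_isCoprime (fun p hp q hq hne => ?_) (fun p hp => (hpr p hp).prime.squarefree)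
    exact Nat.coprime_iff_isRelPrime.mp ((Nat.coprime_primes (hpr p hp) (hpr q hq)).mpr hne)
  have hcopD : ∀ D ∈ 𝒟, G0.Coprime D := by
    intro D hD
    obtain ⟨h2, h3⟩ := hs D hD
    refine Nat.Coprime.symm (Nat.Coprime.symm (Nat.coprime_of_dvd fun p hp h4 h5 => ?_))
    have hpD : p ∈ (DD (s D)).primeFactors := by
      rw [h3]; exact Nat.mem_primeFactors.mpr ⟨hp, h5, by rw [← h3]; exact (DD_pos h2).ne'⟩
    exact hbig p hp (DD_big h2 p hpD).2 h4
  have hbb := hb 𝒟 (fun D hD => by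
    obtain ⟨h2, h3⟩ := hs D hD
    refine ⟨?_, hsq D hD, (hcopD D hD).symm, fun p hp => ?_⟩
    · have h4 := Tst_D hT hl h2
      rw [h3] at h4
      calc (D:ℝ)^50 ≤ (Real.exp (2 * M * lamN M (N n)))^50 := by gcongr
        _ = Real.exp (100 * M * lamN M (N n)) := by rw [← Real.exp_nat_mul]; congr 1; push_cast; ring
        _ = N n := exp_lamN M hM _ hN0
        _ ≤ G0 * N n := by
          have : (1:ℝ) ≤ G0 := by exact_mod_cast hG0
          nlinarith
    · rw [← h3] at hp
      exact hD0.trans (DD_big h2 p hp).2.le) (fun D => G0 * a D + H0) (fun D hD => by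
    obtain ⟨h2, h3⟩ := hs D hD
    refine Nat.Coprime.mul_right ?_ ?_
    · rw [mul_comm, Nat.coprime_mul_right_add_left]; exact hcop.symm
    · refine Nat.coprime_of_dvd fun p hp h4 h5 => ?_
      have hpD : p ∈ (DD (s D)).primeFactors := by
        rw [h3]; exact Nat.mem_primeFactors.mpr ⟨hp, h5, by rw [← h3]; exact (DD_pos h2).ne'⟩
      have hp2 := (DD_big h2 p hpD).2
      rw [DD_pf' h2] at hpD
      obtain ⟨j, -, hj⟩ := mem_biUnion.mp hpD
      have h6 := (ha D hD (a D)).mpr rfl j p hj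
      have a1 : (p:ℤ) ∣ G j.1 * a D + H j.1 := by exact_mod_cast h6
      have a2 : (p:ℤ) ∣ G0 * a D + H0 := by exact_mod_cast h4
      have a3 := (a1.mul_left (G0:ℤ)).sub (a2.mul_left (G j.1:ℤ))
      rw [show (G0:ℤ) * (G j.1 * a D + H j.1) - G j.1 * (G0 * a D + H0) = G0 * H j.1 - G j.1 * H0 by ring] at a3
      exact hdiff j.1 p hp hp2 a3)
  refine le_trans (le_of_eq (sum_congr rfl fun D hD => ?_)) hbb
  obtain ⟨h2, h3⟩ := hs D hD
  congr 2
  have e1 : ∑ l ∈ Ico ⌈N n⌉₊ (10*⌈N n⌉₊) with DC (fun i l => G i * l + H i) (s D) l, u2 G0 H0 (N n) l =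
      thW vc (G0 * N n) ⌈10 * (G0 * N n)⌉₊ (G0 * D) (G0 * a D + H0) := by
    simp_rw [ha D hD]
    exact class_sum G0 H0 D (a D) hG0 (by rw [← h3]; exact DD_pos h2) (N n) hNH
  rw [e1]
  congr 1
  rw [Nat.totient_mul (hcopD D hD), ← DD_pf' h2, h3]
  push_cast
  rw [tot_sqf D (hsq D hD)]
  unfold om2 X2
  rw [prod_div_distrib, prod_const_one]
  field_simp

theorem S2_lim (G H : ι → ℕ) (D0 G0 H0 : ℕ) (hS : Sys G H D0) (hD0 : 4 * (4^Fintype.card ι)^2 ≤ D0) (hG0 : 1 ≤ G0)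
    (hcop : G0.Coprime H0) (hbig : ∀ p, p.Prime → D0 < p → ¬ p ∣ G0)
    (hdiff : ∀ j, ∀ p : ℕ, p.Prime → D0 < p → ¬ ((p:ℤ) ∣ (G0:ℤ) * H j - G j * H0))
    (F : ι × Bool → ℝ → ℝ) (M R : ℕ) (hM : 1 ≤ M) (hT : Tst F M R) (N : ℕ → ℝ) (hN : Tendsto N atTop atTop)
    (hbv : BVs N (Fintype.card ι + 1) (4^Fintype.card ι)) :
    Tendsto (fun n => lamN M (N n)^(Fintype.card ι) / X2 G0 (N n) *
      ∑ l ∈ Ico ⌈N n⌉₊ (10*⌈N n⌉₊), u2 G0 H0 (N n) l * ∏ j, Lam (PN D0 M R (N n)) (F j) (lamN M (N n)) (G j.1 * l + H j.1))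
      atTop (𝓝 (1 / G0.totient * (SS om2 D0 (Fintype.card ι) * ∏ i, ∫ u in Set.Ioi (0:ℝ), deriv (F (i,false)) u * deriv (F (i,true)) u))) := by
  have h1 := ((Tst_lim hT hM om2 D0 om2_ok).comp hN).const_mul (1 / (G0.totient:ℝ))
  refine (tendsto_iff_of_dist ?_).mp h1
  have hG1 : (1:ℝ) ≤ G0 := by exact_mod_cast hG0
  have hGN : Tendsto (fun n => (G0:ℝ) * N n) atTop atTop := hN.const_mul_atTop (by linarith)
  have h2 : Tendsto (fun n => 1 / Real.log (G0 * N n)) atTop (𝓝 0) :=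
    (Real.tendsto_log_atTop.comp hGN).const_div_atTop 1
  refine squeeze_zero' (Eventually.of_forall fun _ => dist_nonneg) ?_ h2
  filter_upwards [hGN.eventually thX_ge, S2_err G H D0 G0 H0 hS hD0 hG0 hcop hbig hdiff F M R hM hT N hN _ hbv,
    ((lamN_tendsto M hM).comp hN).eventually_gt_atTop 0, hN.eventually_gt_atTop 1] with n hX he hl hN1
  have hl : 0 < lamN M (N n) := hl
  have hX : G0 * N n ≤ X2 G0 (N n) := hX
  have hX0 : 0 < X2 G0 (N n) := by nlinarith
  set S := ∑ l ∈ Ico ⌈N n⌉₊ (10*⌈N n⌉₊), u2 G0 H0 (N n) l * ∏ j, Lam (PN D0 M R (N n)) (F j) (lamN M (N n)) (G j.1 * l + H j.1)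
  rw [Real.dist_eq, abs_sub_comm]
  simp only [Function.comp]
  set T := sieveT (PN D0 M R (N n)) om2 F (lamN M (N n))
  set lam := lamN M (N n) with hlam
  set X := X2 G0 (N n)
  have e : lam^(Fintype.card ι) / X * S - 1 / (G0.totient:ℝ) * (lam^(Fintype.card ι) * T) = lam^(Fintype.card ι) * ((S - X / G0.totient * T) / X) := by
    field_simp
  rw [e, abs_mul, abs_div, abs_of_pos hX0, abs_of_nonneg (by positivity)]
  have hM' : (1:ℝ) ≤ M := by exact_mod_cast hM
  have hlogN : 0 < Real.log (N n) := Real.log_pos hN1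
  have hlogle : Real.log (N n) ≤ Real.log (G0 * N n) := Real.log_le_log (by linarith) (by nlinarith)
  have hll : lam ≤ Real.log (G0 * N n) := by
    refine le_trans ?_ hlogle
    rw [hlam]; unfold lamN
    exact div_le_self hlogN.le (by linarith)
  obtain ⟨y, hy⟩ : ∃ y, y = Real.log (G0 * N n) := ⟨_, rfl⟩
  rw [← hy] at he hll ⊢
  have hy0 : 0 < y := by linarith
  calc lam^(Fintype.card ι) * (|S - X / G0.totient * T| / X)
      ≤ y^(Fintype.card ι) * (G0 * N n / y^(Fintype.card ι + 1) / (G0 * N n)) := by gcongr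
    _ = 1 / y := by
      have : (0:ℝ) < N n := by linarith
      rw [pow_succ]
      field_simp
end
end MT

namespace MT
open Finset Filter Topology

section
variable {ι : Type} [Fintype ι] {k : ℕ}

/-- test functions attached to a pair of tuples -/
noncomputable def FF (e : ι → Fin k) (c c' : Fin k → Fin k) : ι × Bool → ℝ → ℝ :=
  fun j => fc (if j.2 then (c' (e j.1) : ℕ) else (c (e j.1) : ℕ))

lemma ac_le {M : ℕ} {c : Fin k → Fin k} (h : ac M c ≠ 0) : ∑ j, ((c j : ℕ) + 1) ≤ M := by
  by_contra h1
  exact h (by unfold ac; rw [if_neg h1])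

lemma sum_emb (e : ι → Fin k) (he : Function.Injective e) (f : Fin k → ℕ) : ∑ i, f (e i) ≤ ∑ j, f j := by
  rw [← sum_image (s := univ) (g := e) (f := f) (fun x _ y _ h => he h)]
  exact sum_le_sum_of_subset (subset_univ _)

lemma FF_tst (e : ι → Fin k) (he : Function.Injective e) (M : ℕ) (c c' : Fin k → Fin k) (h : ac M c ≠ 0) (h' : ac M c' ≠ 0) :
    Tst (FF e c c') M k where
  smooth := fun j => fc_smooth _
  cpt := fun j => fc_compact _
  bd := fun j u => fc_nonneg_le _ _
  tau := by
    refine ⟨fun j => ((if j.2 then (c' (e j.1) : ℕ) else (c (e j.1) : ℕ) : ℕ) : ℝ) + 1, fun j u hu => fc_zero_right _ _ hu, ?_, ?_⟩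
    · intro j
      have : (if j.2 then (c' (e j.1) : ℕ) else (c (e j.1) : ℕ)) + 1 ≤ k := by
        split_ifs
        · exact (c' _).2
        · exact (c _).2
      beta_reduce
      exact_mod_cast this
    · rw [Fintype.sum_prod_type]
      simp only [Fintype.sum_bool, if_true, Bool.false_eq_true, if_false]
      have h1 := (sum_emb e he (fun j => (c j : ℕ) + 1)).trans (ac_le h)
      have h2 := (sum_emb e he (fun j => (c' j : ℕ) + 1)).trans (ac_le h')
      rw [sum_add_distrib]
      have h3 : ∑ i, (((c (e i) : ℕ):ℝ) + 1) ≤ M := by exact_mod_cast h1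
      have h4 : ∑ i, (((c' (e i) : ℕ):ℝ) + 1) ≤ M := by exact_mod_cast h2
      linarith

lemma FF_int (e : ι → Fin k) (c c' : Fin k → Fin k) :
    ∏ i, ∫ u in Set.Ioi (0:ℝ), deriv (FF e c c' (i,false)) u * deriv (FF e c c' (i,true)) u =
      if ∀ i, c (e i) = c' (e i) then A2^Fintype.card ι else 0 := by
  unfold FF
  simp only [if_true, Bool.false_eq_true, if_false, fc_orth]
  split_ifs with h
  · rw [prod_congr rfl (g := fun _ => A2) (fun i _ => if_pos (by rw [h i])), prod_const, card_univ]
  · push Not at h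
    obtain ⟨i, hi⟩ := h
    exact prod_eq_zero (mem_univ i) (if_neg fun h => hi (Fin.ext h))

/-- the square root of the sieve weight -/
noncomputable def wr (G H : ι → ℕ) (e : ι → Fin k) (D0 M : ℕ) (N : ℝ) (l : ℕ) : ℝ :=
  ∑ c : Fin k → Fin k, ac M c * ∏ i, Lam (PN D0 M k N) (fc (c (e i))) (lamN M N) (G i * l + H i)

lemma wr_sq (G H : ι → ℕ) (e : ι → Fin k) (D0 M : ℕ) (N : ℝ) (I : Finset ℕ) (u : ℕ → ℝ) :
    ∑ l ∈ I, u l * wr G H e D0 M N l^2 = ∑ c : Fin k → Fin k, ∑ c' : Fin k → Fin k, ac M c * ac M c' *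
      ∑ l ∈ I, u l * ∏ j, Lam (PN D0 M k N) (FF e c c' j) (lamN M N) (G j.1 * l + H j.1) := by
  have h1 : ∀ l, wr G H e D0 M N l^2 = ∑ c : Fin k → Fin k, ∑ c' : Fin k → Fin k, ac M c * ac M c' *
      ∏ j, Lam (PN D0 M k N) (FF e c c' j) (lamN M N) (G j.1 * l + H j.1) := by
    intro l
    unfold wr
    rw [sq, sum_mul_sum]
    refine sum_congr rfl fun c _ => sum_congr rfl fun c' _ => ?_
    rw [Fintype.prod_prod_type]
    unfold FF
    simp only [Fintype.prod_bool, if_true, Bool.false_eq_true, if_false]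
    rw [prod_mul_distrib]; ring
  simp_rw [h1, mul_sum]
  rw [Finset.sum_comm]
  refine sum_congr rfl fun c _ => ?_
  rw [Finset.sum_comm]
  refine sum_congr rfl fun c' _ => sum_congr rfl fun l _ => by ring

lemma W1_lim (G H : ι → ℕ) (e : ι → Fin k) (he : Function.Injective e) (D0 : ℕ) (hS : Sys G H D0)
    (hD0 : 4 * (4^Fintype.card ι)^2 ≤ D0) (M : ℕ) (hM : 1 ≤ M) :
    Tendsto (fun N : ℝ => lamN M N^(Fintype.card ι) / N * ∑ l ∈ Ico ⌈N⌉₊ (10*⌈N⌉₊), wr G H e D0 M N l^2)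
      atTop (𝓝 (9 * (SS om1 D0 (Fintype.card ι) * A2^Fintype.card ι * ∑ c : Fin k → Fin k, ∑ c' : Fin k → Fin k,
        if ∀ i, c (e i) = c' (e i) then ac M c * ac M c' else 0))) := by
  have h1 : ∀ N : ℝ, lamN M N^(Fintype.card ι) / N * ∑ l ∈ Ico ⌈N⌉₊ (10*⌈N⌉₊), wr G H e D0 M N l^2 =
      ∑ c : Fin k → Fin k, ∑ c' : Fin k → Fin k, ac M c * ac M c' * (lamN M N^(Fintype.card ι) / N *
        ∑ l ∈ Ico ⌈N⌉₊ (10*⌈N⌉₊), ∏ j, Lam (PN D0 M k N) (FF e c c' j) (lamN M N) (G j.1 * l + H j.1)) := by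
    intro N
    have := wr_sq G H e D0 M N (Ico ⌈N⌉₊ (10*⌈N⌉₊)) (fun _ => 1)
    simp only [one_mul] at this
    rw [this, mul_sum]
    refine sum_congr rfl fun c _ => ?_
    rw [mul_sum]
    exact sum_congr rfl fun c' _ => by ring
  simp_rw [h1]
  simp_rw [mul_sum (s := (univ : Finset (Fin k → Fin k)))]
  refine tendsto_finsetSum _ fun c _ => tendsto_finsetSum _ fun c' _ => ?_
  by_cases h : ac M c = 0
  · simp [h]
  by_cases h' : ac M c' = 0
  · simp [h']
  have h2 := (S1_lim G H D0 hS hD0 (FF e c c') M k hM (FF_tst e he M c c' h h')).const_mul (ac M c * ac M c')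
  rw [FF_int] at h2
  convert h2 using 2
  split_ifs <;> ring

lemma W2_lim (G H : ι → ℕ) (e : ι → Fin k) (he : Function.Injective e) (D0 G0 H0 : ℕ) (hS : Sys G H D0)
    (hD0 : 4 * (4^Fintype.card ι)^2 ≤ D0) (hG0 : 1 ≤ G0)
    (hcop : G0.Coprime H0) (hbig : ∀ p, p.Prime → D0 < p → ¬ p ∣ G0)
    (hdiff : ∀ j, ∀ p : ℕ, p.Prime → D0 < p → ¬ ((p:ℤ) ∣ (G0:ℤ) * H j - G j * H0)) (M : ℕ) (hM : 1 ≤ M)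
    (N : ℕ → ℝ) (hN : Tendsto N atTop atTop) (hbv : BVs N (Fintype.card ι + 1) (4^Fintype.card ι)) :
    Tendsto (fun n => lamN M (N n)^(Fintype.card ι) / X2 G0 (N n) *
        ∑ l ∈ Ico ⌈N n⌉₊ (10*⌈N n⌉₊), u2 G0 H0 (N n) l * wr G H e D0 M (N n) l^2)
      atTop (𝓝 (1 / G0.totient * (SS om2 D0 (Fintype.card ι) * A2^Fintype.card ι * ∑ c : Fin k → Fin k, ∑ c' : Fin k → Fin k,
        if ∀ i, c (e i) = c' (e i) then ac M c * ac M c' else 0))) := by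
  have h1 : ∀ n, lamN M (N n)^(Fintype.card ι) / X2 G0 (N n) * ∑ l ∈ Ico ⌈N n⌉₊ (10*⌈N n⌉₊), u2 G0 H0 (N n) l * wr G H e D0 M (N n) l^2 =
      ∑ c : Fin k → Fin k, ∑ c' : Fin k → Fin k, ac M c * ac M c' * (lamN M (N n)^(Fintype.card ι) / X2 G0 (N n) *
        ∑ l ∈ Ico ⌈N n⌉₊ (10*⌈N n⌉₊), u2 G0 H0 (N n) l * ∏ j, Lam (PN D0 M k (N n)) (FF e c c' j) (lamN M (N n)) (G j.1 * l + H j.1)) := by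
    intro n
    rw [wr_sq, mul_sum]
    refine sum_congr rfl fun c _ => ?_
    rw [mul_sum]
    exact sum_congr rfl fun c' _ => by ring
  simp_rw [h1]
  simp_rw [mul_sum (s := (univ : Finset (Fin k → Fin k)))]
  refine tendsto_finsetSum _ fun c _ => tendsto_finsetSum _ fun c' _ => ?_
  by_cases h : ac M c = 0
  · simp [h]
  by_cases h' : ac M c' = 0
  · simp [h']
  have h2 := (S2_lim G H D0 G0 H0 hS hD0 hG0 hcop hbig hdiff (FF e c c') M k hM (FF_tst e he M c c' h h') N hN hbv).const_mul (ac M c * ac M c')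
  rw [FF_int] at h2
  convert h2 using 2
  split_ifs <;> ring

lemma Lam_prime (D0 M R q : ℕ) (N : ℝ) (hq : q.Prime) (c : ℕ) (hN : Real.exp (lamN M N * R) ≤ q) :
    Lam (PN D0 M R N) (fc c) (lamN M N) q = 1 := by
  unfold Lam
  rw [sum_eq_single ∅]
  · simp [fc_zero]
  · intro A hA hne
    obtain ⟨p, hp⟩ := nonempty_iff_ne_empty.mpr hne
    refine if_neg fun h => ?_
    have hpp := PP_mem (mem_powerset.mp hA hp)
    have := (Nat.prime_dvd_prime_iff_eq hpp.1 hq).mp (h p hp)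
    have h3 := Nat.lt_ceil.mp hpp.2.2
    rw [this] at h3
    linarith
  · intro h; exact absurd (empty_mem_powerset _) h

lemma wr_drop (G H : Fin k → ℕ) (i : Fin k) (D0 M : ℕ) (N : ℝ) (l : ℕ) (hq : (G i * l + H i).Prime)
    (hN : Real.exp (lamN M N * k) ≤ (G i * l + H i : ℕ)) :
    wr G H id D0 M N l = wr (fun j : {j // j ≠ i} => G j.1) (fun j : {j // j ≠ i} => H j.1) (fun j => j.1) D0 M N l := by
  unfold wr
  refine sum_congr rfl fun c _ => ?_
  congr 1
  rw [Fintype.prod_eq_mul_prod_subtype_ne _ i]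
  simp only [id]
  rw [Lam_prime D0 M k _ N hq _ hN, one_mul]

lemma SS_id (k D0 : ℕ) (hk : k + 1 ≤ D0) (G : ℕ) (hG : 1 ≤ G) (hGp : ∀ p : ℕ, p.Prime → (p ∣ G ↔ p ≤ D0)) :
    SS om1 D0 (k+1) * G.totient = SS om2 D0 k * G := by
  have h1 : ∀ p, eI om1 D0 (k+1) p = eI om2 D0 k p * (if p.Prime ∧ p ≤ D0 then 1/(1 - 1/(p:ℝ)) else 1) := by
    intro p
    unfold eI
    by_cases hp : p.Prime
    · have h2 : (2:ℝ) ≤ p := by exact_mod_cast hp.two_le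
      have h3 : (p:ℝ) - 1 ≠ 0 := by linarith
      by_cases hD : p ≤ D0
      · rw [if_pos hp, if_pos hp, if_neg (not_lt.mpr hD), if_neg (not_lt.mpr hD), if_pos ⟨hp, hD⟩, pow_succ]; ring
      · rw [if_pos hp, if_pos hp, if_pos (not_le.mp hD), if_pos (not_le.mp hD), if_neg (fun h => hD h.2), mul_one, pow_succ]
        unfold om1 om2
        push_cast
        have : (1 - ((k:ℝ)+1) * (1/p)) * (1/(1 - 1/(p:ℝ))) = 1 - k * (1/((p:ℝ)-1)) := by
          have : 1 - 1/(p:ℝ) ≠ 0 := by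
            have : 1/(p:ℝ) ≤ 1/2 := by gcongr
            linarith
          field_simp; ring
        rw [← this]; ring
    · rw [if_neg hp, if_neg hp, if_neg (fun h => hp h.1), mul_one]
  have h2 : ∀ p ∉ G.primeFactors, (if p.Prime ∧ p ≤ D0 then 1/(1 - 1/(p:ℝ)) else 1) = 1 := by
    intro p hp
    refine if_neg fun h => hp (Nat.mem_primeFactors.mpr ⟨h.1, (hGp p h.1).mpr h.2, by omega⟩)
  have h3 : SS om1 D0 (k+1) = SS om2 D0 k * ∏ p ∈ G.primeFactors, (if p.Prime ∧ p ≤ D0 then 1/(1 - 1/(p:ℝ)) else 1) := by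
    unfold SS
    simp_rw [h1]
    rw [Multipliable.tprod_mul (eI_mult k om2 D0 om2_ok) (multipliable_of_ne_finset_one h2), tprod_eq_prod h2]
  have h4 : (G.totient:ℝ) = G * ∏ p ∈ G.primeFactors, (1 - 1/(p:ℝ)) := by
    have := Nat.totient_eq_mul_prod_factors G
    have h5 : ((G.totient:ℚ):ℝ) = ((G * ∏ p ∈ G.primeFactors, (1 - (p:ℚ)⁻¹) : ℚ):ℝ) := by rw [this]
    push_cast at h5
    simpa only [one_div] using h5
  rw [h3, h4]
  have h5 : (∏ p ∈ G.primeFactors, (if p.Prime ∧ p ≤ D0 then 1/(1 - 1/(p:ℝ)) else 1)) * ∏ p ∈ G.primeFactors, (1 - 1/(p:ℝ)) = 1 := by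
    rw [← prod_mul_distrib]
    refine prod_eq_one fun p hp => ?_
    have hpp := Nat.mem_primeFactors.mp hp
    rw [if_pos ⟨hpp.1, (hGp p hpp.1).mp hpp.2.1⟩]
    have h2 : (2:ℝ) ≤ p := by exact_mod_cast hpp.1.two_le
    have : 1/(p:ℝ) ≤ 1/2 := by gcongr
    have : 1 - 1/(p:ℝ) ≠ 0 := by linarith
    exact one_div_mul_cancel this
  linear_combination (SS om2 D0 k * G) * h5
end
end MT

namespace MT
open Finset Filter Topology

section
variable {k : ℕ}

lemma Ja_nonneg (M : ℕ) (i : Fin k) : 0 ≤ Ja M i := by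
  unfold Ja
  refine sum_nonneg fun c _ => sum_nonneg fun c' _ => ?_
  split_ifs
  · exact mul_nonneg (ac_nonneg _ _) (ac_nonneg _ _)
  · exact le_rfl

lemma u2_nonneg (G0 H0 : ℕ) (N : ℝ) (l : ℕ) : 0 ≤ u2 G0 H0 N l := mul_nonneg (vc_nonneg _) (th_nonneg _)

lemma diag_sum (M : ℕ) : (∑ c : Fin k → Fin k, ∑ c' : Fin k → Fin k,
    if ∀ i, c (id i) = c' (id i) then ac M c * ac M c' else 0) = ∑ c : Fin k → Fin k, ac M c^2 := by
  refine sum_congr rfl fun c _ => ?_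
  rw [sum_eq_single c]
  · simp [sq]
  · intro b _ hb
    exact if_neg fun h => hb (funext fun i => (h i).symm)
  · intro h; exact absurd (mem_univ _) h

/-- conditions on the tuple after the `W`-trick -/
structure Good (G H : Fin k → ℕ) (D0 : ℕ) : Prop where
  sys : Sys G H D0
  one : ∀ i, 1 ≤ G i
  cop : ∀ i, (G i).Coprime (H i)
  pr : ∀ i, ∀ p : ℕ, p.Prime → (p ∣ G i ↔ p ≤ D0)

lemma SS1_pos (k D0 : ℕ) (h : k ≤ D0) : 0 < SS om1 D0 k := by
  refine SS_pos k om1 D0 om1_ok fun p hp hD => ?_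
  unfold om1
  have : (k:ℝ) < p := by exact_mod_cast lt_of_le_of_lt h hD
  rw [mul_one_div, div_lt_one (lt_of_le_of_lt (Nat.cast_nonneg k) this)]
  exact this

lemma S2_lower (G H : Fin (k+1) → ℕ) (D0 : ℕ) (hg : Good G H D0) (hD0 : 4 * (4^(k+1))^2 ≤ D0) (M : ℕ) (hM : 1 ≤ M)
    (hkM : k + 1 ≤ M) (hk : k + 1 ≤ D0)
    (N : ℕ → ℝ) (hN : Tendsto N atTop atTop) (hbv : BVs N (k + 1) (4^k)) (i : Fin (k+1)) :
    ∀ᶠ n : ℕ in atTop, N n / 2 * (SS om1 D0 (k+1) * A2^k * Ja M i) ≤ lamN M (N n)^k *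
      ∑ l ∈ Ico ⌈N n⌉₊ (10*⌈N n⌉₊), u2 (G i) (H i) (N n) l * wr G H id D0 M (N n) l^2 := by
  have hcard : Fintype.card {j : Fin (k+1) // j ≠ i} = k := by
    rw [Fintype.card_subtype_compl, Fintype.card_fin, Fintype.card_subtype_eq]; rfl
  have hlp : ∀ᶠ n : ℕ in atTop, 0 < lamN M (N n) := ((lamN_tendsto M hM).comp hN).eventually_gt_atTop 0
  have hG0 : (0:ℝ) < G i := by exact_mod_cast hg.one i
  rcases (Ja_nonneg M i).eq_or_lt with h0 | h0
  · filter_upwards [hlp] with n hn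
    rw [← h0, mul_zero, mul_zero]
    exact mul_nonneg (pow_nonneg hn.le _) (sum_nonneg fun l _ => mul_nonneg (u2_nonneg _ _ _ _) (sq_nonneg _))
  have hsub : Sys (fun j : {j : Fin (k+1) // j ≠ i} => G j.1) (fun j : {j : Fin (k+1) // j ≠ i} => H j.1) D0 :=
    ⟨fun j => hg.sys.big j.1, fun a b hab => hg.sys.diff a.1 b.1 (fun h => hab (Subtype.ext h))⟩
  have hD0' : 4 * (4^k)^2 ≤ D0 := by
    refine le_trans ?_ hD0
    have : 4^k ≤ 4^(k+1) := Nat.pow_le_pow_right (by norm_num) (by omega)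
    gcongr <;> norm_num
  have hlim := W2_lim (fun j : {j : Fin (k+1) // j ≠ i} => G j.1) (fun j : {j : Fin (k+1) // j ≠ i} => H j.1)
    (fun j => j.1) Subtype.val_injective D0 (G i) (H i) hsub (by rw [hcard]; exact hD0') (hg.one i) (hg.cop i)
    (hg.sys.big i) (fun j => hg.sys.diff i j.1 (Ne.symm j.2)) M hM N hN (by rw [hcard]; exact hbv)
  rw [hcard] at hlim
  have hJ : (∑ c : Fin (k+1) → Fin (k+1), ∑ c' : Fin (k+1) → Fin (k+1),
      if ∀ j : {j : Fin (k+1) // j ≠ i}, c j.1 = c' j.1 then ac M c * ac M c' else 0) = Ja M i := by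
    unfold Ja
    refine sum_congr rfl fun c _ => sum_congr rfl fun c' _ => ?_
    simp only [Subtype.forall]
  rw [hJ] at hlim
  have hφ : (0:ℝ) < (G i).totient := by exact_mod_cast Nat.totient_pos.mpr (hg.one i)
  have hV : 1 / ((G i).totient:ℝ) * (SS om2 D0 k * A2^k * Ja M i) = SS om1 D0 (k+1) * A2^k * Ja M i / G i := by
    have := SS_id k D0 hk (G i) (hg.one i) (hg.pr i)
    rw [one_div, inv_mul_eq_div, div_eq_div_iff hφ.ne' hG0.ne']
    linear_combination (-(A2^k * Ja M i)) * this
  rw [hV] at hlim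
  have hA : 0 < A2 := lt_of_lt_of_le one_pos A2_pos
  have hVpos : 0 < SS om1 D0 (k+1) * A2^k * Ja M i := mul_pos (mul_pos (SS1_pos _ _ hk) (pow_pos hA _)) h0
  have hVp : 0 < SS om1 D0 (k+1) * A2^k * Ja M i / G i := div_pos hVpos hG0
  have hGN : Tendsto (fun n => (G i:ℝ) * N n) atTop atTop := hN.const_mul_atTop hG0
  filter_upwards [hlim.eventually_const_le (half_lt_self hVp), hlp, hGN.eventually thX_ge, hN.eventually_gt_atTop 1] with n h1 h2 hX hN1
  have hX : G i * N n ≤ X2 (G i) (N n) := hX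
  have hX0 : 0 < X2 (G i) (N n) := lt_of_lt_of_le (by positivity) hX
  have hS : ∑ l ∈ Ico ⌈N n⌉₊ (10*⌈N n⌉₊), u2 (G i) (H i) (N n) l * wr G H id D0 M (N n) l^2 =
      ∑ l ∈ Ico ⌈N n⌉₊ (10*⌈N n⌉₊), u2 (G i) (H i) (N n) l *
        wr (fun j : {j : Fin (k+1) // j ≠ i} => G j.1) (fun j : {j : Fin (k+1) // j ≠ i} => H j.1) (fun j => j.1) D0 M (N n) l^2 := by
    refine sum_congr rfl fun l hl => ?_
    by_cases hp : (G i * l + H i).Prime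
    · rw [wr_drop G H i D0 M (N n) l hp]
      have hl1 : N n ≤ (l:ℝ) := Nat.ceil_le.mp (mem_Ico.mp hl).1
      have hl2 : (l:ℝ) ≤ (G i * l + H i : ℕ) := by
        have := hg.one i
        have : l ≤ G i * l + H i := by nlinarith
        exact_mod_cast this
      refine le_trans ?_ (hl1.trans hl2)
      conv_rhs => rw [← exp_lamN M hM (N n) (by linarith)]
      refine Real.exp_le_exp.mpr ?_
      have : ((k+1:ℕ):ℝ) ≤ M := by exact_mod_cast hkM
      have hM0 : (0:ℝ) ≤ M := Nat.cast_nonneg M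
      nlinarith
    · unfold u2 th
      rw [if_neg hp]; simp
  rw [hS]
  rw [div_mul_eq_mul_div, le_div_iff₀ hX0] at h1
  refine le_trans ?_ h1
  calc N n / 2 * (SS om1 D0 (k+1) * A2^k * Ja M i) = SS om1 D0 (k+1) * A2^k * Ja M i / G i / 2 * (G i * N n) := by
        field_simp
    _ ≤ _ := by gcongr

lemma primes_le (G H : Fin k → ℕ) (m : ℕ) (N : ℝ) (hN : 1 ≤ N) (hb : ∀ i, 20 * (G i:ℝ) + H i ≤ N)
    (l : ℕ) (hl : l < 10*⌈N⌉₊)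
    (hm : (univ.filter fun i => (G i * l + H i).Prime).card ≤ m) :
    ∑ i, u2 (G i) (H i) N l ≤ 2 * m * Real.log N := by
  have hlog : 0 ≤ Real.log N := Real.log_nonneg hN
  have h1 : ∀ i, u2 (G i) (H i) N l ≤ if (G i * l + H i).Prime then 2 * Real.log N else 0 := by
    intro i
    have h2 : u2 (G i) (H i) N l ≤ th (G i * l + H i) := mul_le_of_le_one_left (th_nonneg _) (vc_le _)
    refine h2.trans ?_
    unfold th
    split_ifs with hp
    · have h3 : ((G i * l + H i : ℕ):ℝ) ≤ N^2 := by
        push_cast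
        have h4 : (l:ℝ) ≤ 10 * (N+1) := by
          have h5 : (l:ℝ) ≤ 10 * ⌈N⌉₊ := by exact_mod_cast hl.le
          have h6 := (Nat.ceil_lt_add_one (by linarith : 0 ≤ N)).le
          linarith
        have hG : (0:ℝ) ≤ G i := Nat.cast_nonneg _
        have hH : (0:ℝ) ≤ H i := Nat.cast_nonneg _
        have h7 : (G i:ℝ) * l ≤ G i * (20 * N) := by gcongr; linarith
        have h8 : (H i:ℝ) ≤ H i * N := le_mul_of_one_le_right hH hN
        have h9 : (20 * (G i:ℝ) + H i) * N ≤ N * N := by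
          have := hb i
          gcongr
        nlinarith
      have h4 := Real.log_le_log (by exact_mod_cast hp.pos) h3
      rw [Real.log_pow] at h4
      exact_mod_cast h4
    · exact le_rfl
  refine (sum_le_sum fun i _ => h1 i).trans ?_
  rw [← sum_filter, sum_const, nsmul_eq_mul]
  have : ((univ.filter fun i => (G i * l + H i).Prime).card:ℝ) ≤ m := by exact_mod_cast hm
  nlinarith

theorem sieve_final (m : ℕ) : ∃ k : ℕ, ∃ Dmin : ℕ, ∀ D0 ≥ Dmin, ∀ G H : Fin k → ℕ, Good G H D0 → ∀ N0 : ℕ,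
    ∃ l ≥ N0, m ≤ (univ.filter fun i => (G i * l + H i).Prime).card := by
  have hA : 0 < A2 := lt_of_lt_of_le one_pos A2_pos
  obtain ⟨k1, hk1, M, hM, hv⟩ := variational (8000 * m * A2)
  obtain ⟨k, rfl⟩ : ∃ k, k1 = k + 1 := ⟨k1 - 1, by omega⟩
  have hne : ∃ c : Fin (k+1) → Fin (k+1), ac M c ≠ 0 := by
    by_contra! h
    unfold Ja at hv
    simp [h] at hv
  obtain ⟨c0, hc0⟩ := hne
  have hkM : k + 1 ≤ M := by
    refine le_trans ?_ (ac_le hc0)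
    have : ∑ j : Fin (k+1), 1 ≤ ∑ j : Fin (k+1), ((c0 j : ℕ) + 1) := sum_le_sum fun j _ => by omega
    simpa using this
  have hac : 0 < ∑ c : Fin (k+1) → Fin (k+1), ac M c^2 :=
    sum_pos' (fun c _ => sq_nonneg _) ⟨c0, mem_univ _, by positivity⟩
  obtain ⟨N, hN, hbv⟩ := exists_BVs (k+1) (4^k)
  refine ⟨k+1, 4 * (4^(k+1))^2, fun D0 hD0 G H hg N0 => ?_⟩
  have hk : k + 1 ≤ D0 := by
    refine le_trans ?_ hD0
    have : k + 1 < 4^(k+1) := Nat.lt_pow_self (by norm_num)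
    nlinarith
  have hSS := SS1_pos (k+1) D0 hk
  have hcard : Fintype.card (Fin (k+1)) = k + 1 := Fintype.card_fin _
  have hw1 := W1_lim G H id Function.injective_id D0 hg.sys (by rw [hcard]; exact hD0) M hM
  rw [hcard] at hw1
  set Q : ℝ := SS om1 D0 (k+1) * A2^(k+1) * ∑ c : Fin (k+1) → Fin (k+1), ac M c^2 with hQ
  have hQ0 : 0 < Q := by positivity
  have hw2 : Tendsto (fun N : ℝ => lamN M N^(k+1) / N * ∑ l ∈ Ico ⌈N⌉₊ (10*⌈N⌉₊), wr G H id D0 M N l^2)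
      atTop (𝓝 (9 * Q)) := by
    rw [hQ, ← diag_sum M]
    convert hw1
  have e1 := (hw2.comp hN).eventually_le_const (show 9 * Q < 18 * Q by linarith)
  have e2 := eventually_all.mpr fun i => S2_lower G H D0 hg hD0 M hM hkM hk N hN hbv i
  have e3 := eventually_all.mpr fun i => hN.eventually_ge_atTop (20 * (G i:ℝ) + H i)
  have e4 : ∀ᶠ n : ℕ in atTop, 0 < lamN M (N n) := ((lamN_tendsto M hM).comp hN).eventually_gt_atTop 0
  obtain ⟨n, h1, h2, h3, h4, h5, h6⟩ := (e1.and (e2.and (e3.and (e4.and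
    ((hN.eventually_gt_atTop 1).and (hN.eventually_ge_atTop (N0:ℝ))))))).exists
  by_contra! hcon
  have hlow : ∀ l ∈ Ico ⌈N n⌉₊ (10*⌈N n⌉₊), ∑ i, u2 (G i) (H i) (N n) l ≤ 2 * m * Real.log (N n) := by
    intro l hl
    refine primes_le G H m (N n) h5.le h3 l (mem_Ico.mp hl).2 (hcon l ?_).le
    have : (N0:ℝ) ≤ l := h6.trans (Nat.ceil_le.mp (mem_Ico.mp hl).1)
    exact_mod_cast this
  have hN0 : 0 < N n := by linarith
  have hlogN : Real.log (N n) = 100 * M * lamN M (N n) := by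
    conv_lhs => rw [← exp_lamN M hM (N n) hN0]
    rw [Real.log_exp]
  set S1 : ℝ := ∑ l ∈ Ico ⌈N n⌉₊ (10*⌈N n⌉₊), wr G H id D0 M (N n) l^2 with hS1
  have h7 : ∑ i, ∑ l ∈ Ico ⌈N n⌉₊ (10*⌈N n⌉₊), u2 (G i) (H i) (N n) l * wr G H id D0 M (N n) l^2 ≤
      2 * m * Real.log (N n) * S1 := by
    rw [Finset.sum_comm, hS1, mul_sum]
    refine sum_le_sum fun l hl => ?_
    rw [← sum_mul]
    exact mul_le_mul_of_nonneg_right (hlow l hl) (sq_nonneg _)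
  have h8 := sum_le_sum fun i (_ : i ∈ (univ : Finset (Fin (k+1)))) => h2 i
  rw [← mul_sum, ← mul_sum, ← mul_sum] at h8
  have h9 : lamN M (N n)^(k+1) * S1 ≤ 18 * Q * N n := by
    have h1' : lamN M (N n)^(k+1) / N n * S1 ≤ 18 * Q := h1
    rw [div_mul_eq_mul_div, div_le_iff₀ hN0] at h1'
    exact h1'
  have h10 : N n / 2 * (SS om1 D0 (k+1) * A2^k * ∑ i, Ja (k := k+1) M i) ≤ 200 * m * M * (18 * Q * N n) := by
    refine h8.trans ?_
    refine (mul_le_mul_of_nonneg_left h7 (pow_nonneg h4.le k)).trans ?_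
    rw [hlogN]
    calc _ = 200 * m * M * (lamN M (N n)^(k+1) * S1) := by rw [pow_succ]; ring
      _ ≤ _ := by gcongr
  have h11 : N n / 2 * (SS om1 D0 (k+1) * A2^k * (8000 * m * A2 * M * ∑ c : Fin (k+1) → Fin (k+1), ac M c^2)) <
      N n / 2 * (SS om1 D0 (k+1) * A2^k * ∑ i, Ja (k := k+1) M i) := by gcongr
  have h12 : N n / 2 * (SS om1 D0 (k+1) * A2^k * (8000 * m * A2 * M * ∑ c : Fin (k+1) → Fin (k+1), ac M c^2)) =
      4000 * (m * M * Q * N n) := by rw [hQ, pow_succ]; ring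
  have h13 : 0 ≤ m * M * Q * N n := by positivity
  nlinarith
end
end MT

namespace MT
open Finset Filter Topology

section
variable {k : ℕ}

lemma adm_res {g : Fin k → ℕ} {h : Fin k → ℤ} (ha : AdmissibleTuple g h) (p : ℕ) (hp : p.Prime) :
    ∃ n : ℕ, ∀ i, ¬ ((p:ℤ) ∣ (g i:ℤ) * n + h i) := by
  have h1 := ha p hp
  by_contra! hc
  have : ((Finset.range p).filter (fun n : ℕ => (∏ i, ((g i : ℤ) * n + h i)) % (p : ℤ) = 0)) = Finset.range p := by
    refine Finset.filter_true_of_mem fun n _ => ?_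
    obtain ⟨i, hi⟩ := hc n
    exact Int.emod_eq_zero_of_dvd (hi.trans (dvd_prod_of_mem _ (mem_univ i)))
  rw [this, card_range] at h1
  exact lt_irrefl _ h1

lemma adm_cop {g : Fin k → ℕ} {h : Fin k → ℤ} (ha : AdmissibleTuple g h) (i : Fin k) :
    IsCoprime (g i : ℤ) (h i) := by
  rw [Int.isCoprime_iff_gcd_eq_one]
  by_contra hc
  obtain ⟨p, hp, hd⟩ := Nat.exists_prime_and_dvd hc
  obtain ⟨n, hn⟩ := adm_res ha p hp
  have hd' : (p:ℤ) ∣ (Int.gcd (g i) (h i) : ℤ) := by exact_mod_cast hd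
  exact hn i (dvd_add ((hd'.trans (Int.gcd_dvd_left _ _)).mul_right _) (hd'.trans (Int.gcd_dvd_right _ _)))

lemma adm_diff {g : Fin k → ℕ} {h : Fin k → ℤ} (hg : ∀ i, 0 < g i) (hinj : Function.Injective fun i => ((g i : ℤ), h i))
    (ha : AdmissibleTuple g h) (i j : Fin k) (hij : i ≠ j) : (g i:ℤ) * h j - g j * h i ≠ 0 := by
  intro h0
  have h1 : (g i:ℤ) * h j = g j * h i := by linarith
  have h2 : (g i:ℤ) ∣ g j := (adm_cop ha i).dvd_of_dvd_mul_right (Dvd.intro _ h1)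
  have h3 : (g j:ℤ) ∣ g i := (adm_cop ha j).dvd_of_dvd_mul_right (Dvd.intro _ h1.symm)
  have h4 : g i = g j := Nat.dvd_antisymm (by exact_mod_cast h2) (by exact_mod_cast h3)
  have h5 : (g j:ℤ) ≠ 0 := by exact_mod_cast (hg j).ne'
  rw [h4] at h1
  have h6 := mul_left_cancel₀ h5 h1
  exact hij (hinj (Prod.ext (show (g i:ℤ) = g j by exact_mod_cast h4) h6.symm))

/-- product of the primes up to `D` -/
def Wp (D : ℕ) : ℕ := ∏ p ∈ (range (D+1)).filter Nat.Prime, p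

lemma Wp_dvd (D p : ℕ) (hp : p.Prime) : p ∣ Wp D ↔ p ≤ D := by
  unfold Wp
  constructor
  · intro h
    obtain ⟨q, hq, hd⟩ := (hp.prime.dvd_finsetProd_iff _).mp h
    have hq := mem_filter.mp hq
    have := (Nat.prime_dvd_prime_iff_eq hp hq.2).mp hd
    have := mem_range.mp hq.1
    omega
  · intro h
    exact dvd_prod_of_mem (fun p => p) (mem_filter.mpr ⟨mem_range.mpr (by omega), hp⟩)

lemma Wp_pos (D : ℕ) : 0 < Wp D := prod_pos fun p hp => (mem_filter.mp hp).2.pos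

lemma adm_crt {g : Fin k → ℕ} {h : Fin k → ℤ} (hg : ∀ i, 0 < g i) (ha : AdmissibleTuple g h) (D : ℕ) :
    ∃ ν : ℕ, (∀ p : ℕ, p.Prime → p ≤ D → ∀ i, ¬ ((p:ℤ) ∣ (g i:ℤ) * ν + h i)) ∧ ∀ i, 0 ≤ (g i:ℤ) * ν + h i := by
  have hres : ∀ p : ℕ, ∃ n : ℕ, p.Prime → ∀ i, ¬ ((p:ℤ) ∣ (g i:ℤ) * n + h i) := by
    intro p
    by_cases hp : p.Prime
    · obtain ⟨n, hn⟩ := adm_res ha p hp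
      exact ⟨n, fun _ => hn⟩
    · exact ⟨0, fun h => absurd h hp⟩
  choose a haa using hres
  obtain ⟨ν, hν⟩ := Nat.chineseRemainderOfFinset a (fun p => p) ((range (D+1)).filter Nat.Prime)
    (fun p hp => (mem_filter.mp hp).2.ne_zero)
    (fun p hp q hq hpq => (Nat.coprime_primes (mem_filter.mp hp).2 (mem_filter.mp hq).2).mpr hpq)
  refine ⟨ν + Wp D * ∑ i, (h i).natAbs, ?_, ?_⟩
  · intro p hp hD i hd
    have h1 := hν p (mem_filter.mpr ⟨mem_range.mpr (by omega), hp⟩)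
    have h2 : ((ν:ℤ) - a p) ≡ 0 [ZMOD p] := by
      have := (Int.natCast_modEq_iff.mpr h1).sub_right (a p:ℤ)
      simpa using this
    have h2 := Int.modEq_zero_iff_dvd.mp h2
    have h3 : (p:ℤ) ∣ (Wp D:ℤ) := by exact_mod_cast (Wp_dvd D p hp).mpr hD
    refine haa p hp i ?_
    have h4 := (hd.sub (h2.mul_left (g i:ℤ))).sub (h3.mul_left ((g i:ℤ) * (∑ i, (h i).natAbs : ℕ)))
    rwa [show (g i:ℤ) * ((ν + Wp D * ∑ i, (h i).natAbs : ℕ):ℤ) + h i - g i * ((ν:ℤ) - a p) -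
      (g i:ℤ) * (∑ i, (h i).natAbs : ℕ) * Wp D = g i * a p + h i by push_cast; ring] at h4
  · intro i
    have h1 : (h i).natAbs ≤ ∑ i, (h i).natAbs := single_le_sum (f := fun i => (h i).natAbs) (fun _ _ => Nat.zero_le _) (mem_univ i)
    have h2 := hg i
    have h3 := Wp_pos D
    have h4 : ∑ i, (h i).natAbs ≤ g i * (ν + Wp D * ∑ i, (h i).natAbs) := by
      calc ∑ i, (h i).natAbs = 1 * (1 * ∑ i, (h i).natAbs) := by ring
        _ ≤ g i * (Wp D * ∑ i, (h i).natAbs) := by gcongr <;> omega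
        _ ≤ _ := by gcongr; omega
    have h5 : ((h i).natAbs:ℤ) ≤ g i * ((ν + Wp D * ∑ i, (h i).natAbs : ℕ):ℤ) := by exact_mod_cast h1.trans h4
    have h6 : -(h i) ≤ ((h i).natAbs:ℤ) := by omega
    linarith

theorem final (m k Dmin : ℕ) (hs : ∀ D0 ≥ Dmin, ∀ G H : Fin k → ℕ, Good G H D0 → ∀ N0 : ℕ,
    ∃ l ≥ N0, m ≤ (univ.filter fun i => (G i * l + H i).Prime).card)
    (g : Fin k → ℕ) (h : Fin k → ℤ) (hg : ∀ i, 0 < g i) (hinj : Function.Injective fun i => ((g i : ℤ), h i))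
    (ha : AdmissibleTuple g h) :
    {n : ℕ | 0 < n ∧ m ≤ (Finset.univ.filter (fun i : Fin k => Prime ((g i : ℤ) * n + h i))).card}.Infinite := by
  set D0 : ℕ := Dmin + ∑ i, g i + ∑ i, ∑ j, ((g i:ℤ) * h j - g j * h i).natAbs with hD0
  have hD1 : ∀ i, g i ≤ D0 := by
    intro i
    have : g i ≤ ∑ i, g i := single_le_sum (f := g) (fun _ _ => Nat.zero_le _) (mem_univ i)
    omega
  have hD2 : ∀ i j, ((g i:ℤ) * h j - g j * h i).natAbs ≤ D0 := by
    intro i j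
    have h1 : ((g i:ℤ) * h j - g j * h i).natAbs ≤ ∑ j, ((g i:ℤ) * h j - g j * h i).natAbs :=
      single_le_sum (f := fun j => ((g i:ℤ) * h j - g j * h i).natAbs) (fun _ _ => Nat.zero_le _) (mem_univ j)
    have h2 : ∑ j, ((g i:ℤ) * h j - g j * h i).natAbs ≤ ∑ i, ∑ j, ((g i:ℤ) * h j - g j * h i).natAbs :=
      single_le_sum (f := fun i => ∑ j, ((g i:ℤ) * h j - g j * h i).natAbs) (fun _ _ => Nat.zero_le _) (mem_univ i)
    omega
  obtain ⟨ν, hν, hν0⟩ := adm_crt hg ha D0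
  have hH : ∀ i, (((g i:ℤ) * ν + h i).toNat : ℤ) = (g i:ℤ) * ν + h i := fun i => Int.toNat_of_nonneg (hν0 i)
  have hpr : ∀ i, ∀ p : ℕ, p.Prime → (p ∣ g i * Wp D0 ↔ p ≤ D0) := by
    intro i p hp
    rw [hp.dvd_mul, Wp_dvd D0 p hp]
    exact ⟨fun h => h.elim (fun h => (Nat.le_of_dvd (hg i) h).trans (hD1 i)) id, Or.inr⟩
  have hgood : Good (fun i => g i * Wp D0) (fun i => ((g i:ℤ) * ν + h i).toNat) D0 := by
    refine ⟨⟨fun i p hp hD hd => ?_, fun i j hij p hp hD hd => ?_⟩, fun i => ?_, fun i => ?_, hpr⟩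
    · exact absurd ((hpr i p hp).mp hd) (by omega)
    · simp only [hH] at hd
      push_cast at hd
      rw [show (g i:ℤ) * Wp D0 * (g j * ν + h j) - g j * Wp D0 * (g i * ν + h i) =
        Wp D0 * ((g i:ℤ) * h j - g j * h i) by ring] at hd
      rcases (Nat.prime_iff_prime_int.mp hp).dvd_or_dvd hd with hd | hd
      · have hd : p ∣ Wp D0 := by exact_mod_cast hd
        exact absurd ((Wp_dvd D0 p hp).mp hd) (by omega)
      · have h1 := Int.natAbs_dvd_natAbs.mpr hd
        rw [Int.natAbs_natCast] at h1
        have h2 := Nat.le_of_dvd (Int.natAbs_pos.mpr (adm_diff hg hinj ha i j hij)) h1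
        have := hD2 i j
        omega
    · exact Nat.mul_pos (hg i) (Wp_pos D0)
    · refine Nat.Coprime.symm (Nat.coprime_of_dvd fun p hp hd hd' => ?_)
      refine hν p hp ((hpr i p hp).mp hd') i ?_
      rw [← hH i]
      exact_mod_cast hd
  refine Set.infinite_of_forall_exists_gt fun a => ?_
  obtain ⟨l, hl, hm⟩ := hs D0 (by omega) _ _ hgood (a+1)
  have hWl : l ≤ Wp D0 * l := Nat.le_mul_of_pos_left l (Wp_pos D0)
  refine ⟨ν + Wp D0 * l, ⟨by omega, hm.trans (card_le_card ?_)⟩, by omega⟩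
  intro i hi
  rw [mem_filter] at hi ⊢
  refine ⟨mem_univ _, ?_⟩
  have h1 := Nat.prime_iff_prime_int.mp hi.2
  have h2 : ((g i * Wp D0 * l + ((g i:ℤ) * ν + h i).toNat : ℕ):ℤ) = (g i:ℤ) * ((ν + Wp D0 * l : ℕ):ℤ) + h i := by
    rw [Nat.cast_add, hH i]; push_cast; ring
  rwa [h2] at h1
end
end MT

/-- **Maynard–Tao.** For every integer `m ≥ 2` there exists `k = k(m)` such that:
if `g₁ x + h₁, …, g_k x + h_k` is an admissible `k`-tuple of pairwise distinct linear
forms with positive leading coefficients, then for infinitely many positive integers `n`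
there are at least `m` primes among `g₁ n + h₁, …, g_k n + h_k`. -/
theorem maynard_tao :
    ∀ m : ℕ, 2 ≤ m → ∃ k : ℕ,
      ∀ (g : Fin k → ℕ) (h : Fin k → ℤ),
        (∀ i, 0 < g i) →
        (Function.Injective fun i => ((g i : ℤ), h i)) →
        AdmissibleTuple g h →
        {n : ℕ | 0 < n ∧
          m ≤ (Finset.univ.filter
                 (fun i : Fin k => Prime ((g i : ℤ) * n + h i))).card}.Infinite := by
  intro m _
  obtain ⟨k, Dmin, hs⟩ := MT.sieve_final m
  exact ⟨k, fun g h hg hinj ha => MT.final m k Dmin hs g h hg hinj ha⟩
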